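/- Let (p,u,U) be a smooth solution of the incompressible Navier-Stokes equations on [0,T_0]×T^3 with T_0 < ∞, and let (p^{ε,δ},u^{ε,δ},U^{ε,δ}) solve the two-parameter relaxation system with smooth initial data. Assume there exists C_0 > 0 independent of ε and δ such that: ‖u_0^{ε,δ} − u_0‖²_{L²(T³)} ≤ C_0 δ^{1/2}; ‖curl(u_0^{ε,δ} − u_0)‖²_{L²(T³)} + δ‖curl(u_0^{ε,δ} − u_0)‖²_{H¹(T³)} ≤ C_0 δ^{1/2}; ‖div u_0^{ε,δ}‖²_{L²(T³)} + δ‖div u_0^{ε,δ}‖²_{H¹(T³)} ≤ C_0 δ^{−1/2} ε; ‖p_0^{ε,δ}‖²_{H¹(T³)} + δ‖p_0^{ε,δ}‖²_{H²(T³)} ≤ C_0 δ^{−1/2}; and ‖U_0^{ε,δ}‖²_{H¹(T³)} + δ‖div U_0^{ε,δ}‖²_{H¹(T³)} ≤ C_0 δ^{−1/2}. Then there exists a positive constant μ_* ≪ 1, depending only on C_0, T_0 and u, such that for all sufficiently small ε and δ satisfying ε ≤ μ_* δ, the solution (u^{ε,δ},p^{ε,δ},U^{ε,δ}) exists on [0,T_0],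 and for all t ∈ [0,T_0]: ‖u^{ε,δ}(t,·) − u(t,·)‖²_{L²(T³)} ≤ C δ^{1/2}; ‖curl(u^{ε,δ} − u)(t,·)‖²_{L²(T³)} + δ‖curl(u^{ε,δ} − u)(t,·)‖²_{H¹(T³)} ≤ C δ^{1/2}; and ‖div u^{ε,δ}(t,·)‖²_{L²(T³)} + δ‖div u^{ε,δ}(t,·)‖²_{H¹(T³)} ≤ C δ^{−1/2} ε, where C depends only on C_0, T_0 and u. -/

import Mathlib

/-!
Common setup: fields on the torus `𝕋^d = ℝ^d/ℤ^d` are modelled as `ℤ^d`-periodic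
functions on `ℝ^d`; all integrals are taken over the fundamental cell `[0,1]^d`.
-/

noncomputable section
open MeasureTheory Real
open scoped ENNReal

namespace NSRelax

/-- Spatial variable; fields on the torus are `ℤ^d`-periodic functions on `ℝ^d`. -/
abbrev Spc (d : ℕ) := Fin d → ℝ

/-- Vectors in `ℝ^m`. -/
abbrev Vec (m : ℕ) := Fin m → ℝ

/-- Fundamental cell `[0,1]^d` of the torus. -/
def cube (d : ℕ) : Set (Spc d) := Set.pi Set.univ fun _ => Set.Icc (0 : ℝ) 1

/-- `ℤ^d`-periodicity. -/
def Per {d : ℕ} {E : Type*} (f : Spc d → E) : Prop :=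
  ∀ (x : Spc d) (k : Fin d → ℤ), f (fun i => x i + (k i : ℝ)) = f x

/-- `i`-th spatial partial derivative of a scalar field. -/
def pd {d : ℕ} (i : Fin d) (f : Spc d → ℝ) (x : Spc d) : ℝ :=
  fderiv ℝ f x (Pi.single i 1)

/-- Time derivative of a time-dependent scalar field. -/
def dtS {d : ℕ} (p : ℝ → Spc d → ℝ) (t : ℝ) (x : Spc d) : ℝ :=
  deriv (fun s => p s x) t

/-- Time derivative of a time-dependent vector field. -/
def dtV {d m : ℕ} (u : ℝ → Spc d → Vec m) (t : ℝ) (x : Spc d) : Vec m :=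
  fun a => deriv (fun s => u s x a) t

/-- Time derivative of a time-dependent matrix field. -/
def dtM {d m : ℕ} (U : ℝ → Spc d → Fin m → Fin m → ℝ) (t : ℝ) (x : Spc d) :
    Fin m → Fin m → ℝ :=
  fun i j => deriv (fun s => U s x i j) t

section Norms

variable {d : ℕ} {ι : Type*} [Fintype ι]

/-- Pointwise squared Euclidean magnitude of an `ι`-indexed field. -/
def ptsq (v : Spc d → ι → ℝ) (x : Spc d) : ℝ := ∑ a, v x a ^ 2

/-- Pointwise squared magnitude of the first derivatives. -/
def ptsqD1 (v : Spc d → ι → ℝ) (x : Spc d) : ℝ :=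
  ∑ a, ∑ i, pd i (fun y => v y a) x ^ 2

/-- Pointwise squared magnitude of the second derivatives. -/
def ptsqD2 (v : Spc d → ι → ℝ) (x : Spc d) : ℝ :=
  ∑ a, ∑ i, ∑ j, pd i (pd j (fun y => v y a)) x ^ 2

/-- Pointwise squared magnitude of the third derivatives. -/
def ptsqD3 (v : Spc d → ι → ℝ) (x : Spc d) : ℝ :=
  ∑ a, ∑ i, ∑ j, ∑ k, pd i (pd j (pd k (fun y => v y a))) x ^ 2

/-- Squared `L²(𝕋^d)` norm. -/
def L2sq (v : Spc d → ι → ℝ) : ℝ := ∫ x in cube d, ptsq v x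

/-- Squared `L²(𝕋^d)` norm of the gradient. -/
def D1L2sq (v : Spc d → ι → ℝ) : ℝ := ∫ x in cube d, ptsqD1 v x

/-- Squared `L²(𝕋^d)` norm of the second derivatives. -/
def D2L2sq (v : Spc d → ι → ℝ) : ℝ := ∫ x in cube d, ptsqD2 v x

/-- Squared `L²(𝕋^d)` norm of the third derivatives. -/
def D3L2sq (v : Spc d → ι → ℝ) : ℝ := ∫ x in cube d, ptsqD3 v x

/-- Squared `H¹(𝕋^d)` norm. -/
def H1sq (v : Spc d → ι → ℝ) : ℝ := L2sq v + D1L2sq v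

/-- Squared `H²(𝕋^d)` norm. -/
def H2sq (v : Spc d → ι → ℝ) : ℝ := L2sq v + D1L2sq v + D2L2sq v

/-- Squared `H³(𝕋^d)` norm. -/
def H3sq (v : Spc d → ι → ℝ) : ℝ := L2sq v + D1L2sq v + D2L2sq v + D3L2sq v

/-- `L^p(𝕋^d)` norm. -/
def LpN (p : ℝ) (v : Spc d → ι → ℝ) : ℝ :=
  (∫ x in cube d, Real.sqrt (ptsq v x) ^ p) ^ (1 / p)

/-- `L^∞(𝕋^d)` norm (for continuous periodic fields). -/
def LinfN (v : Spc d → ι → ℝ) : ℝ := ⨆ x : Spc d, Real.sqrt (ptsq v x)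

end Norms

/-- View a scalar field as a one-component indexed field. -/
def sc {d : ℕ} (f : Spc d → ℝ) : Spc d → Vec 1 := fun x _ => f x

/-- View a matrix field as an indexed field. -/
def mtx {d m : ℕ} (U : Spc d → Fin m → Fin m → ℝ) : Spc d → Fin m × Fin m → ℝ :=
  fun x ij => U x ij.1 ij.2

/-- Divergence of a vector field. -/
def divv {d : ℕ} (v : Spc d → Vec d) (x : Spc d) : ℝ := ∑ i, pd i (fun y => v y i) x

/-- Row-wise divergence of a matrix field. -/
def divM {d : ℕ} (U : Spc d → Fin d → Fin d → ℝ) (x : Spc d) : Vec d :=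
  fun i => ∑ j, pd j (fun y => U y i j) x

/-- Laplacian of a scalar field. -/
def lapS {d : ℕ} (f : Spc d → ℝ) (x : Spc d) : ℝ := ∑ i, pd i (pd i f) x

/-- Componentwise Laplacian of a vector field. -/
def lapV {d m : ℕ} (v : Spc d → Vec m) (x : Spc d) : Vec m :=
  fun a => lapS (fun y => v y a) x

/-- Tensor product `u ⊗ v` of vector fields. -/
def tens {d : ℕ} (u v : Spc d → Vec d) (x : Spc d) : Fin d → Fin d → ℝ :=
  fun i j => u x i * v x j

/-- Curl of a three-dimensional vector field. -/
def curl3 (v : Spc 3 → Vec 3) (x : Spc 3) : Vec 3 :=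
  ![pd 1 (fun y => v y 2) x - pd 2 (fun y => v y 1) x,
    pd 2 (fun y => v y 0) x - pd 0 (fun y => v y 2) x,
    pd 0 (fun y => v y 1) x - pd 1 (fun y => v y 0) x]

/-- Scalar curl of a planar vector field. -/
def curl2 (v : Spc 2 → Vec 2) (x : Spc 2) : ℝ :=
  pd 0 (fun y => v y 1) x - pd 1 (fun y => v y 0) x

/-- Smoothness (jointly in time and space) of a scalar field. -/
def SmoothS {d : ℕ} (p : ℝ → Spc d → ℝ) : Prop :=
  ContDiff ℝ (⊤ : ℕ∞) fun q : ℝ × Spc d => p q.1 q.2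

/-- Smoothness (jointly in time and space) of a vector field. -/
def SmoothV {d m : ℕ} (u : ℝ → Spc d → Vec m) : Prop :=
  ContDiff ℝ (⊤ : ℕ∞) fun q : ℝ × Spc d => u q.1 q.2

/-- Smoothness (jointly in time and space) of a matrix field. -/
def SmoothM {d m : ℕ} (U : ℝ → Spc d → Fin m → Fin m → ℝ) : Prop :=
  ContDiff ℝ (⊤ : ℕ∞) fun q : ℝ × Spc d => U q.1 q.2

/-- Stress tensor `U = u ⊗ u − ∇u` of a Navier–Stokes solution. -/
def stress {d : ℕ} (u : ℝ → Spc d → Vec d) (t : ℝ) (x : Spc d) : Fin d → Fin d → ℝ :=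
  fun i j => u t x i * u t x j - pd j (fun y => u t y i) x

/-- Smooth solution of the incompressible Navier–Stokes equations on the time set `I`. -/
structure IsNS (d : ℕ) (I : Set ℝ) (p : ℝ → Spc d → ℝ) (u : ℝ → Spc d → Vec d) :
    Prop where
  smooth_p : SmoothS p
  smooth_u : SmoothV u
  per_p : ∀ t, Per (p t)
  per_u : ∀ t, Per (u t)
  div_free : ∀ t ∈ I, ∀ x, divv (u t) x = 0
  momentum : ∀ t ∈ I, ∀ x a,
    dtV u t x a + divM (tens (u t) (u t)) x a = -pd a (p t) x + lapV (u t) x a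
  mean_zero : ∀ t ∈ I, ∫ x in cube d, p t x = 0

/-- The time interval `[0, Tl)`. -/
def Itv (Tl : ℝ≥0∞) : Set ℝ := {t : ℝ | 0 ≤ t ∧ ENNReal.ofReal t < Tl}

/-- Solution of the two-parameter relaxation system on the time interval `[0, Tl)`,
with smooth initial data. -/
structure IsRelax (d : ℕ) (ε δ : ℝ) (Tl : ℝ≥0∞) (p : ℝ → Spc d → ℝ)
    (u : ℝ → Spc d → Vec d) (U : ℝ → Spc d → Fin d → Fin d → ℝ) : Prop where
  pos : 0 < Tl
  init_smooth : ContDiff ℝ (⊤ : ℕ∞) fun x : Spc d => (p 0 x, u 0 x, U 0 x)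
  per_p : ∀ t ∈ Itv Tl, Per (p t)
  per_u : ∀ t ∈ Itv Tl, Per (u t)
  per_U : ∀ t ∈ Itv Tl, Per (U t)
  cont : ContinuousOn (fun q : ℝ × Spc d => (p q.1 q.2, u q.1 q.2, U q.1 q.2))
    (Itv Tl ×ˢ (Set.univ : Set (Spc d)))
  smooth : ∀ t ∈ Itv Tl, 0 < t → ∀ x : Spc d,
    ContDiffAt ℝ (⊤ : ℕ∞) (fun q : ℝ × Spc d => (p q.1 q.2, u q.1 q.2, U q.1 q.2)) (t, x)
  mass : ∀ t ∈ Itv Tl, 0 < t → ∀ x, ε * dtS p t x + divv (u t) x = 0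
  momentum : ∀ t ∈ Itv Tl, 0 < t → ∀ x a,
    dtV u t x a + divM (U t) x a + pd a (p t) x = 0
  stress_eq : ∀ t ∈ Itv Tl, 0 < t → ∀ x i j,
    δ * dtM U t x i j + pd j (fun y => u t y i) x = u t x i * u t x j - U t x i j

/-- Relaxation solution whose lifespan `Tl` is maximal (among solutions with the
same initial data). -/
def IsMaxRelax (d : ℕ) (ε δ : ℝ) (Tl : ℝ≥0∞) (p : ℝ → Spc d → ℝ)
    (u : ℝ → Spc d → Vec d) (U : ℝ → Spc d → Fin d → Fin d → ℝ) : Prop :=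
  IsRelax d ε δ Tl p u U ∧
    ∀ (Tl' : ℝ≥0∞) (p' : ℝ → Spc d → ℝ) (u' : ℝ → Spc d → Vec d)
      (U' : ℝ → Spc d → Fin d → Fin d → ℝ),
      IsRelax d ε δ Tl' p' u' U' → p' 0 = p 0 → u' 0 = u 0 → U' 0 = U 0 → Tl' ≤ Tl

/-- Smooth solution of the intermediate affine system on `[0,T]`. -/
structure IsAffine (ε δ T : ℝ) (u : ℝ → Spc 3 → Vec 3) (p' : ℝ → Spc 3 → ℝ)
    (u' : ℝ → Spc 3 → Vec 3) (U' : ℝ → Spc 3 → Fin 3 → Fin 3 → ℝ) : Prop where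
  smooth_p : SmoothS p'
  smooth_u : SmoothV u'
  smooth_U : SmoothM U'
  per_p : ∀ t, Per (p' t)
  per_u : ∀ t, Per (u' t)
  per_U : ∀ t, Per (U' t)
  mass : ∀ t ∈ Set.Icc (0 : ℝ) T, ∀ x, ε * dtS p' t x + divv (u' t) x = 0
  momentum : ∀ t ∈ Set.Icc (0 : ℝ) T, ∀ x a,
    dtV u' t x a + divM (U' t) x a + pd a (p' t) x = 0
  stress_eq : ∀ t ∈ Set.Icc (0 : ℝ) T, ∀ x i j,
    δ * dtM U' t x i j + pd j (fun y => u' t y i) x = u t x i * u t x j - U' t x i j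

/-- `A = curl ∇·(v ⊗ v)`. -/
def Af (v : Spc 3 → Vec 3) (x : Spc 3) : Vec 3 :=
  curl3 (fun y => divM (tens v v) y) x

/-- `K = 1 + ‖(p,u,U)‖²_{C⁰H³}`. -/
def Kc (T0 : ℝ) (p : ℝ → Spc 3 → ℝ) (u : ℝ → Spc 3 → Vec 3) : ℝ :=
  1 + ⨆ t ∈ Set.Icc (0 : ℝ) T0, (H3sq (sc (p t)) + H3sq (u t) + H3sq (mtx (stress u t)))

/-- `K = 1 + ‖u‖²_{C⁰H³}`. -/
def Ku (T0 : ℝ) (u : ℝ → Spc 3 → Vec 3) : ℝ :=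
  1 + ⨆ t ∈ Set.Icc (0 : ℝ) T0, H3sq (u t)

/-- Fourier modes of the three-dimensional torus. -/
abbrev Mode := Fin 3 → ℤ

/-- Frequency vector of a mode. -/
def xi (k : Mode) (a : Fin 3) : ℝ := 2 * π * k a

/-- Eigenvalue of `-Δ` on a mode. -/
def lam (k : Mode) : ℝ := ∑ a, xi k a ^ 2

/-- Sobolev weight of a mode. -/
def W (k : Mode) : ℝ := 1 + lam k

lemma lam_nonneg (k : Mode) : 0 ≤ lam k := Finset.sum_nonneg fun _ _ => sq_nonneg _

lemma one_le_W (k : Mode) : 1 ≤ W k := by have := lam_nonneg k; unfold W; linarith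

lemma W_pos (k : Mode) : 0 < W k := lt_of_lt_of_le one_pos (one_le_W k)

lemma xi_sq_le_lam (k : Mode) (a : Fin 3) : xi k a ^ 2 ≤ lam k :=
  Finset.single_le_sum (f := fun a => xi k a ^ 2) (fun _ _ => sq_nonneg _) (Finset.mem_univ a)

lemma lam_zero : lam 0 = 0 := by simp [lam, xi]

lemma xi_zero (a : Fin 3) : xi 0 a = 0 := by simp [xi]

lemma xi_neg (k : Mode) (a : Fin 3) : xi (-k) a = -xi k a := by simp [xi]

lemma xi_add (k l : Mode) (a : Fin 3) : xi (k + l) a = xi k a + xi l a := by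
  simp [xi]; ring

lemma xi_sub (k l : Mode) (a : Fin 3) : xi (k - l) a = xi k a - xi l a := by
  simp [xi]; ring

lemma two_le_two_pi : (2 : ℝ) ≤ 2 * π := by have := Real.pi_gt_three; linarith

lemma int_sq_le_xi_sq (k : Mode) (a : Fin 3) : (k a : ℝ) ^ 2 ≤ xi k a ^ 2 := by
  have h := two_le_two_pi
  unfold xi
  rw [mul_pow]
  nlinarith [sq_nonneg (k a : ℝ), mul_nonneg (sub_nonneg.2 h) (sq_nonneg (k a : ℝ))]

lemma one_le_lam {k : Mode} (hk : k ≠ 0) : 1 ≤ lam k := by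
  obtain ⟨a, ha⟩ := Function.ne_iff.1 hk
  refine le_trans ?_ ((int_sq_le_xi_sq k a).trans (xi_sq_le_lam k a))
  have : (1 : ℤ) ≤ (k a) ^ 2 := Int.one_le_abs (pow_ne_zero 2 ha) |>.trans (by simp)
  exact_mod_cast this

lemma lam_pos {k : Mode} (hk : k ≠ 0) : 0 < lam k := one_pos.trans_le (one_le_lam hk)

lemma W_le_two_lam {k : Mode} (hk : k ≠ 0) : W k ≤ 2 * lam k := by
  have := one_le_lam hk; unfold W; linarith

lemma W_le_add (k j : Mode) : W k ≤ 2 * (W (k - j) + W j) := by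
  have h : lam k ≤ 2 * (lam (k - j) + lam j) := by
    unfold lam
    rw [← Finset.sum_add_distrib, Finset.mul_sum]
    refine Finset.sum_le_sum fun a _ => ?_
    rw [xi_sub]
    nlinarith [sq_nonneg (xi k a - 2 * xi j a)]
  unfold W; linarith

lemma W_pow_le_add (m : ℕ) (k j : Mode) : W k ^ m ≤ 4 ^ m * (W (k - j) ^ m + W j ^ m) := by
  have h := W_le_add k j
  have h1 := W_pos (k - j); have h2 := W_pos j; have h0 := W_pos k
  have hmax : W k ≤ 4 * max (W (k - j)) (W j) := by
    have := le_max_left (W (k - j)) (W j); have := le_max_right (W (k - j)) (W j); linarith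
  calc W k ^ m ≤ (4 * max (W (k - j)) (W j)) ^ m := pow_le_pow_left₀ h0.le hmax m
    _ = 4 ^ m * max (W (k - j)) (W j) ^ m := mul_pow _ _ _
    _ ≤ _ := by
      gcongr
      rcases max_choice (W (k - j)) (W j) with e | e <;> rw [e]
      · have := pow_pos h2 m; linarith
      · have := pow_pos h1 m; linarith

lemma summable_int_weight : Summable fun n : ℤ => ((1 : ℝ) + (n : ℝ) ^ 2) ^ (-(2 / 3) : ℝ) := by
  refine Summable.of_norm_bounded_eventually (g := fun n : ℤ => |(n : ℝ)| ^ (-(4 / 3) : ℝ))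
    (Real.summable_abs_int_rpow (by norm_num)) ?_
  have : ({0} : Set ℤ)ᶜ ∈ (Filter.cofinite : Filter ℤ) := (Set.finite_singleton 0).compl_mem_cofinite
  filter_upwards [this] with n hn
  have hn' : 0 < |(n : ℝ)| := abs_pos.2 (by exact_mod_cast hn)
  rw [Real.norm_of_nonneg (by positivity)]
  have : |(n : ℝ)| ^ (-(4 / 3) : ℝ) = ((n : ℝ) ^ 2) ^ (-(2 / 3) : ℝ) := by
    rw [← sq_abs, ← Real.rpow_natCast, ← Real.rpow_mul hn'.le]; norm_num
  rw [this]
  refine Real.rpow_le_rpow_of_nonpos (by rw [← sq_abs]; positivity) (by linarith) (by norm_num)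

lemma summable_W : Summable fun k : Mode => (W k ^ 2)⁻¹ := by
  set g := fun n : ℤ => ((1 : ℝ) + (n : ℝ) ^ 2) ^ (-(2 / 3) : ℝ) with hg
  have g0 : ∀ n, 0 ≤ g n := fun n => by positivity
  refine summable_of_sum_le (c := ∏ _a : Fin 3, ∑' n, g n) (fun k => by positivity) fun F => ?_
  have hle : ∀ k : Mode, (W k ^ 2)⁻¹ ≤ ∏ a, g (k a) := by
    intro k
    have hW := W_pos k
    have : (W k ^ 2)⁻¹ = ∏ _a : Fin 3, (W k) ^ (-(2 / 3) : ℝ) := by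
      have e : ((W k) ^ (-(2 / 3) : ℝ)) ^ 3 = (W k) ^ (-2 : ℝ) := by
        rw [← Real.rpow_natCast, ← Real.rpow_mul hW.le]; norm_num
      rw [Finset.prod_const, Finset.card_univ, Fintype.card_fin, e, Real.rpow_neg hW.le]
      norm_num
    rw [this]
    refine Finset.prod_le_prod (fun a _ => by positivity) fun a _ => ?_
    refine Real.rpow_le_rpow_of_nonpos (by positivity) ?_ (by norm_num)
    have := (int_sq_le_xi_sq k a).trans (xi_sq_le_lam k a)
    unfold W; linarith
  classical
  calc ∑ k ∈ F, (W k ^ 2)⁻¹ ≤ ∑ k ∈ F, ∏ a, g (k a) := Finset.sum_le_sum fun k _ => hle k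
    _ ≤ ∑ k ∈ Fintype.piFinset fun a => F.image (fun k => k a), ∏ a, g (k a) := by
      refine Finset.sum_le_sum_of_subset_of_nonneg ?_ fun k _ _ =>
        Finset.prod_nonneg fun a _ => g0 _
      intro k hk
      exact Fintype.mem_piFinset.2 fun a => Finset.mem_image_of_mem (fun k : Mode => k a) hk
    _ = ∏ a, ∑ n ∈ F.image (fun k => k a), g n := (Finset.prod_univ_sum _ _).symm
    _ ≤ _ := Finset.prod_le_prod (fun a _ => Finset.sum_nonneg fun _ _ => g0 _) fun a _ =>
        summable_int_weight.sum_le_tsum _ fun _ _ => g0 _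

/-- The lattice constant `1 + ∑ W⁻²`. -/
def Slat : ℝ := 1 + ∑' k : Mode, (W k ^ 2)⁻¹

lemma one_le_Slat : 1 ≤ Slat := by
  have : 0 ≤ ∑' k : Mode, (W k ^ 2)⁻¹ := tsum_nonneg fun k => by positivity
  unfold Slat; linarith

lemma sum_W_le (F : Finset Mode) : ∑ k ∈ F, (W k ^ 2)⁻¹ ≤ Slat := by
  have := summable_W.sum_le_tsum F fun _ _ => by positivity
  unfold Slat; linarith

lemma sum_W_sub_le (F : Finset Mode) (k : Mode) : ∑ j ∈ F, (W (k - j) ^ 2)⁻¹ ≤ Slat := by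
  classical
  have := sum_W_le (F.image fun j => k - j)
  rwa [Finset.sum_image fun _ _ _ _ h => by simpa using h] at this

/-- Convolution over a finite set of modes. -/
def cv {R : Type*} [Semiring R] (N : Finset Mode) (A b : Mode → R) (k : Mode) : R :=
  ∑ j ∈ N, A (k - j) * b j

lemma cv_nonneg (N : Finset Mode) {A b : Mode → ℝ} (hA : ∀ k, 0 ≤ A k) (hb : ∀ k, 0 ≤ b k)
    (k : Mode) : 0 ≤ cv N A b k := Finset.sum_nonneg fun _ _ => mul_nonneg (hA _) (hb _)

lemma sum_sum_sub_le (N F : Finset Mode) {A b : Mode → ℝ} {P : ℝ} (hb : ∀ j, 0 ≤ b j)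
    (hA : ∀ F : Finset Mode, ∑ k ∈ F, A k ≤ P) :
    ∑ k ∈ F, ∑ j ∈ N, A (k - j) * b j ≤ P * ∑ j ∈ N, b j := by
  classical
  rw [Finset.sum_comm, Finset.mul_sum]
  refine Finset.sum_le_sum fun j _ => ?_
  rw [← Finset.sum_mul]
  refine mul_le_mul_of_nonneg_right ?_ (hb j)
  have := hA (F.image fun k => k - j)
  rwa [Finset.sum_image fun _ _ _ _ h => by simpa using h] at this

/-- Weighted Young-type inequality for convolutions, by Cauchy-Schwarz. -/
lemma cv_kernel (N F : Finset Mode) {A b α β M : Mode → ℝ} {C P : ℝ}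
    (hα : ∀ k, 0 < α k) (hβ : ∀ k, 0 < β k) (hM : ∀ k, 0 ≤ M k)
    (hk : ∀ k, M k * ∑ j ∈ N, (α (k - j) * β j)⁻¹ ≤ C)
    (hA : ∀ F : Finset Mode, ∑ k ∈ F, α k * A k ^ 2 ≤ P) :
    ∑ k ∈ F, M k * cv N A b k ^ 2 ≤ C * P * ∑ j ∈ N, β j * b j ^ 2 := by
  have hC : 0 ≤ C := le_trans (mul_nonneg (hM 0) (Finset.sum_nonneg fun j _ =>
    (inv_pos.2 (mul_pos (hα _) (hβ _))).le)) (hk 0)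
  have key : ∀ k, M k * cv N A b k ^ 2 ≤
      C * ∑ j ∈ N, (α (k - j) * A (k - j) ^ 2) * (β j * b j ^ 2) := by
    intro k
    have cs := Finset.sum_sq_le_sum_mul_sum_of_sq_le_mul N
      (r := fun j => A (k - j) * b j)
      (f := fun j => (α (k - j) * β j)⁻¹)
      (g := fun j => (α (k - j) * A (k - j) ^ 2) * (β j * b j ^ 2))
      (fun j _ => (inv_pos.2 (mul_pos (hα _) (hβ _))).le)
      (fun j _ => mul_nonneg (mul_nonneg (hα _).le (sq_nonneg _))
        (mul_nonneg (hβ _).le (sq_nonneg _)))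
      (fun j _ => by
        have h1 := (hα (k - j)).ne'; have h2 := (hβ j).ne'
        apply le_of_eq; field_simp)
    calc M k * cv N A b k ^ 2 ≤ M k * _ := mul_le_mul_of_nonneg_left cs (hM k)
      _ = (M k * ∑ j ∈ N, (α (k - j) * β j)⁻¹) * _ := (mul_assoc _ _ _).symm
      _ ≤ _ := mul_le_mul_of_nonneg_right (hk k) (Finset.sum_nonneg fun j _ =>
        mul_nonneg (mul_nonneg (hα _).le (sq_nonneg _)) (mul_nonneg (hβ _).le (sq_nonneg _)))
  calc _ ≤ ∑ k ∈ F, C * ∑ j ∈ N, (α (k - j) * A (k - j) ^ 2) * (β j * b j ^ 2) :=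
        Finset.sum_le_sum fun k _ => key k
    _ = C * ∑ k ∈ F, ∑ j ∈ N, (α (k - j) * A (k - j) ^ 2) * (β j * b j ^ 2) := by
        rw [Finset.mul_sum]
    _ ≤ C * (P * ∑ j ∈ N, β j * b j ^ 2) := mul_le_mul_of_nonneg_left
        (sum_sum_sub_le N F (A := fun k => α k * A k ^ 2) (b := fun j => β j * b j ^ 2)
          (fun j => mul_nonneg (hβ j).le (sq_nonneg _)) hA) hC
    _ = _ := by ring

lemma cv_l2_left (N F : Finset Mode) {A b : Mode → ℝ} {P : ℝ}
    (hA : ∀ F : Finset Mode, ∑ k ∈ F, W k ^ 2 * A k ^ 2 ≤ P) :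
    ∑ k ∈ F, cv N A b k ^ 2 ≤ Slat * P * ∑ j ∈ N, b j ^ 2 := by
  have := cv_kernel N F (A := A) (b := b) (α := fun k => W k ^ 2) (β := fun _ => 1)
    (M := fun _ => 1) (C := Slat) (fun k => pow_pos (W_pos k) 2) (fun _ => one_pos)
    (fun _ => zero_le_one) (fun k => by simpa using sum_W_sub_le N k) hA
  simpa using this

lemma cv_l2_right (N F : Finset Mode) {A b : Mode → ℝ} {P : ℝ}
    (hA : ∀ F : Finset Mode, ∑ k ∈ F, A k ^ 2 ≤ P) :
    ∑ k ∈ F, cv N A b k ^ 2 ≤ Slat * P * ∑ j ∈ N, W j ^ 2 * b j ^ 2 := by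
  have := cv_kernel N F (A := A) (b := b) (α := fun _ => 1) (β := fun k => W k ^ 2)
    (M := fun _ => 1) (C := Slat) (P := P) (fun _ => one_pos) (fun k => pow_pos (W_pos k) 2)
    (fun _ => zero_le_one) (fun k => by simpa using sum_W_le N) (by simpa using hA)
  simpa using this

/-- Tame product estimate. -/
lemma cv_tame (m : ℕ) (N F : Finset Mode) {A b : Mode → ℝ} {P Q : ℝ}
    (hA0 : ∀ k, 0 ≤ A k) (hb0 : ∀ k, 0 ≤ b k)
    (hA : ∀ F : Finset Mode, ∑ k ∈ F, W k ^ 2 * A k ^ 2 ≤ P)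
    (hA' : ∀ F : Finset Mode, ∑ k ∈ F, (W k ^ m * A k) ^ 2 ≤ Q) :
    ∑ k ∈ F, (W k ^ m * cv N A b k) ^ 2 ≤ 2 * 16 ^ m * Slat *
      (Q * ∑ j ∈ N, W j ^ 2 * b j ^ 2 + P * ∑ j ∈ N, (W j ^ m * b j) ^ 2) := by
  have h1 := cv_l2_right N F (A := fun k => W k ^ m * A k) (b := b) hA'
  have h2 := cv_l2_left N F (A := A) (b := fun k => W k ^ m * b k) hA
  have key : ∀ k, (W k ^ m * cv N A b k) ^ 2 ≤ 2 * 16 ^ m *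
      (cv N (fun k => W k ^ m * A k) b k ^ 2 + cv N A (fun k => W k ^ m * b k) k ^ 2) := by
    intro k
    have hw : ∀ k, 0 ≤ W k ^ m := fun k => pow_nonneg (W_pos k).le m
    have e : W k ^ m * cv N A b k ≤
        4 ^ m * (cv N (fun k => W k ^ m * A k) b k + cv N A (fun k => W k ^ m * b k) k) := by
      unfold cv
      rw [← Finset.sum_add_distrib, Finset.mul_sum, Finset.mul_sum]
      refine Finset.sum_le_sum fun j _ => ?_
      have := mul_le_mul_of_nonneg_right (W_pow_le_add m k j) (mul_nonneg (hA0 (k - j)) (hb0 j))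
      linarith
    have h0 : 0 ≤ W k ^ m * cv N A b k := mul_nonneg (hw k) (cv_nonneg N hA0 hb0 k)
    have := pow_le_pow_left₀ h0 e 2
    have e16 : ((4 : ℝ) ^ m) ^ 2 = 16 ^ m := by rw [← pow_mul, mul_comm, pow_mul]; norm_num
    rw [mul_pow (4 ^ m), e16] at this
    refine this.trans ?_
    rw [mul_comm (2 : ℝ), mul_assoc]
    gcongr
    exact add_sq_le
  calc _ ≤ _ := Finset.sum_le_sum fun k _ => key k
    _ = 2 * 16 ^ m * (∑ k ∈ F, cv N (fun k => W k ^ m * A k) b k ^ 2 +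
        ∑ k ∈ F, cv N A (fun k => W k ^ m * b k) k ^ 2) := by
      rw [← Finset.mul_sum, Finset.sum_add_distrib]
    _ ≤ 2 * 16 ^ m * _ := mul_le_mul_of_nonneg_left (add_le_add h1 h2) (by positivity)
    _ = _ := by ring

/-- `H²` is an algebra. -/
lemma cv_h2 (N F : Finset Mode) {A b : Mode → ℝ} {P : ℝ}
    (hA0 : ∀ k, 0 ≤ A k) (hb0 : ∀ k, 0 ≤ b k)
    (hA : ∀ F : Finset Mode, ∑ k ∈ F, W k ^ 2 * A k ^ 2 ≤ P) :
    ∑ k ∈ F, W k ^ 2 * cv N A b k ^ 2 ≤ 64 * Slat * P * ∑ j ∈ N, W j ^ 2 * b j ^ 2 := by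
  have := cv_tame 1 N F hA0 hb0 hA (by simpa [mul_pow] using hA)
  simp only [pow_one, mul_pow] at this
  linarith

lemma inv_mul_le_half (x y : ℝ) :
    (x * y)⁻¹ ≤ ((x ^ 2)⁻¹ + (y ^ 2)⁻¹) / 2 := by
  rw [mul_inv, ← inv_pow, ← inv_pow]
  nlinarith [sq_nonneg (x⁻¹ - y⁻¹)]

lemma sum_W_mul_le (N : Finset Mode) (k : Mode) :
    ∑ j ∈ N, (W (k - j) * W j)⁻¹ ≤ Slat := by
  calc _ ≤ ∑ j ∈ N, ((W (k - j) ^ 2)⁻¹ + (W j ^ 2)⁻¹) / 2 :=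
        Finset.sum_le_sum fun j _ => inv_mul_le_half _ _
    _ ≤ _ := by
      rw [← Finset.sum_div, Finset.sum_add_distrib]
      have := sum_W_sub_le N k; have := sum_W_le N; linarith

lemma cv_h1_left (N F : Finset Mode) {A b : Mode → ℝ} {P : ℝ}
    (hA : ∀ F : Finset Mode, ∑ k ∈ F, W k ^ 2 * A k ^ 2 ≤ P) :
    ∑ k ∈ F, W k * cv N A b k ^ 2 ≤ 4 * Slat * P * ∑ j ∈ N, W j * b j ^ 2 := by
  refine cv_kernel N F (α := fun k => W k ^ 2) (β := W)
    (fun k => pow_pos (W_pos k) 2) W_pos (fun k => (W_pos k).le) (fun k => ?_) hA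
  rw [Finset.mul_sum]
  calc _ ≤ ∑ j ∈ N, (2 * (W (k - j) * W j)⁻¹ + 2 * (W (k - j) ^ 2)⁻¹) := by
        refine Finset.sum_le_sum fun j _ => ?_
        have h1 := W_pos (k - j); have h2 := W_pos j
        have h := mul_le_mul_of_nonneg_right (W_le_add k j)
          (inv_pos.2 (mul_pos (pow_pos h1 2) h2)).le
        refine h.trans (le_of_eq ?_)
        field_simp
    _ ≤ _ := by
      rw [Finset.sum_add_distrib, ← Finset.mul_sum, ← Finset.mul_sum]
      have := sum_W_sub_le N k; have := sum_W_mul_le N k; linarith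

lemma cv_h1_right (N F : Finset Mode) {A b : Mode → ℝ} {P : ℝ}
    (hA : ∀ F : Finset Mode, ∑ k ∈ F, W k * A k ^ 2 ≤ P) :
    ∑ k ∈ F, W k * cv N A b k ^ 2 ≤ 4 * Slat * P * ∑ j ∈ N, W j ^ 2 * b j ^ 2 := by
  refine cv_kernel N F (α := W) (β := fun k => W k ^ 2)
    W_pos (fun k => pow_pos (W_pos k) 2) (fun k => (W_pos k).le) (fun k => ?_) hA
  rw [Finset.mul_sum]
  calc _ ≤ ∑ j ∈ N, (2 * (W (k - j) * W j)⁻¹ + 2 * (W j ^ 2)⁻¹) := by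
        refine Finset.sum_le_sum fun j _ => ?_
        have h1 := W_pos (k - j); have h2 := W_pos j
        have h := mul_le_mul_of_nonneg_right (W_le_add k j)
          (inv_pos.2 (mul_pos h1 (pow_pos h2 2))).le
        refine h.trans (le_of_eq ?_)
        field_simp
        ring
    _ ≤ _ := by
      rw [Finset.sum_add_distrib, ← Finset.mul_sum, ← Finset.mul_sum]
      have := sum_W_le N; have := sum_W_mul_le N k; linarith

lemma le_of_hasDerivAt_nonpos {a b : ℝ} {f f' : ℝ → ℝ}
    (hc : ContinuousOn f (Set.Icc a b))
    (h : ∀ t ∈ Set.Ioo a b, HasDerivAt f (f' t) t) (h' : ∀ t ∈ Set.Ioo a b, f' t ≤ 0)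
    {t : ℝ} (ht : t ∈ Set.Icc a b) : f t ≤ f a := by
  refine antitoneOn_of_deriv_nonpos (convex_Icc a b) hc ?_ ?_ ⟨le_refl a, ht.1.trans ht.2⟩ ht ht.1
  · rw [interior_Icc]
    exact fun t ht => (h t ht).differentiableAt.differentiableWithinAt
  · rw [interior_Icc]
    exact fun t ht => (h t ht).deriv ▸ h' t ht

lemma gronwall_linear {a b A B e0 : ℝ} {e e' : ℝ → ℝ} (hA : 0 ≤ A) (hB : 0 ≤ B)
    (hc : ContinuousOn e (Set.Icc a b))
    (h : ∀ t ∈ Set.Ioo a b, HasDerivAt e (e' t) t)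
    (h' : ∀ t ∈ Set.Ioo a b, e' t ≤ A * e t + B) (h0 : e a ≤ e0)
    {t : ℝ} (ht : t ∈ Set.Icc a b) : e t ≤ (e0 + B * (t - a)) * exp (A * (t - a)) := by
  have key := le_of_hasDerivAt_nonpos (a := a) (b := b)
    (f := fun s => e s * exp (-(A * (s - a))) - B * (s - a))
    (f' := fun s => (e' s * exp (-(A * (s - a))) + e s * (exp (-(A * (s - a))) * -A)) - B)
    ((hc.mul (by fun_prop)).sub (by fun_prop)) (fun s hs => ?_) (fun s hs => ?_) ht
  · simp only [sub_self, mul_zero, neg_zero, exp_zero, mul_one, sub_zero] at key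
    rw [exp_neg] at key
    have hp := exp_pos (A * (t - a))
    have : e t * (exp (A * (t - a)))⁻¹ ≤ e0 + B * (t - a) := by linarith
    calc e t = e t * (exp (A * (t - a)))⁻¹ * exp (A * (t - a)) := by field_simp
      _ ≤ _ := mul_le_mul_of_nonneg_right this hp.le
  · have h1 : HasDerivAt (fun s => exp (-(A * (s - a)))) (exp (-(A * (s - a))) * -A) s := by
      have := ((((hasDerivAt_id s).sub_const a).const_mul A).neg).exp
      simpa using this
    have h2 : HasDerivAt (fun s => B * (s - a)) B s := by
      simpa using ((hasDerivAt_id s).sub_const a).const_mul B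
    exact ((h s hs).mul h1).sub h2
  · have h1 : exp (-(A * (s - a))) ≤ 1 := exp_le_one_iff.2 (by nlinarith [hs.1])
    have h2 := exp_pos (-(A * (s - a)))
    have h3 := h' s hs
    nlinarith [mul_le_mul_of_nonneg_right h3 h2.le]

/-- Continuity argument. -/
lemma bootstrap {a b c : ℝ} {e : ℝ → ℝ} (hc : ContinuousOn e (Set.Icc a b)) (h0 : e a < c)
    (h : ∀ s ∈ Set.Icc a b, (∀ t ∈ Set.Icc a s, e t ≤ c) → e s < c)
    {t : ℝ} (ht : t ∈ Set.Icc a b) : e t < c := by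
  by_contra! hcon
  set S := Set.Icc a t ∩ e ⁻¹' Set.Ici c with hS
  have hcl : IsClosed S := (hc.mono (Set.Icc_subset_Icc le_rfl ht.2)).preimage_isClosed_of_isClosed
    isClosed_Icc isClosed_Ici
  have hne : S.Nonempty := ⟨t, ⟨ht.1, le_rfl⟩, hcon⟩
  have hbd : BddBelow S := ⟨a, fun s hs => hs.1.1⟩
  have hm : sInf S ∈ S := hcl.csInf_mem hne hbd
  set s := sInf S with hs
  have hlt : ∀ r ∈ Set.Icc a s, r < s → e r < c := by
    intro r hr hrs
    by_contra! hh
    exact absurd (csInf_le hbd ⟨⟨hr.1, hrs.le.trans hm.1.2⟩, hh⟩) (not_le.2 hrs)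
  have hsle : e s ≤ c := by
    by_contra! hh
    obtain ⟨r, hr, hrc⟩ := intermediate_value_Icc hm.1.1
      (hc.mono (Set.Icc_subset_Icc le_rfl (hm.1.2.trans ht.2))) ⟨h0.le, hh.le⟩
    rcases hr.2.lt_or_eq with h1 | h1
    · exact absurd (hlt r hr h1) (by rw [hrc]; exact lt_irrefl c)
    · rw [h1] at hrc; linarith
  refine absurd (h s ⟨hm.1.1, hm.1.2.trans ht.2⟩ fun r hr => ?_) (not_lt.2 hm.2)
  rcases hr.2.lt_or_eq with h1 | h1
  · exact (hlt r hr h1).le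
  · rw [h1]; exact hsle

section ODE
variable {E : Type*} [NormedAddCommGroup E] [NormedSpace ℝ E] [FiniteDimensional ℝ E]

lemma lipschitzOnWith_of_contDiff {f : ℝ → E → E} (hf : ContDiff ℝ 1 (Function.uncurry f))
    (a b R : ℝ) : ∃ K : NNReal, ∀ t ∈ Set.Icc a b,
      LipschitzOnWith K (f t) (Metric.closedBall 0 R) := by
  have hc : Continuous fun q : ℝ × E => fderiv ℝ (Function.uncurry f) q :=
    hf.continuous_fderiv one_ne_zero
  have hK : IsCompact (Set.Icc a b ×ˢ Metric.closedBall (0 : E) R) :=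
    isCompact_Icc.prod (isCompact_closedBall 0 R)
  obtain ⟨C, hC⟩ := hK.exists_bound_of_continuousOn hc.continuousOn
  refine ⟨C.toNNReal, fun t ht => ?_⟩
  refine (convex_closedBall (0 : E) R).lipschitzOnWith_of_nnnorm_hasFDerivWithin_le
    (f' := fun x => (fderiv ℝ (Function.uncurry f) (t, x)).comp (ContinuousLinearMap.inr ℝ ℝ E))
    (fun x hx => ?_) fun x hx => ?_
  · have h1 : HasFDerivAt (Function.uncurry f) (fderiv ℝ (Function.uncurry f) (t, x)) (t, x) :=
      ((hf.differentiable one_ne_zero) (t, x)).hasFDerivAt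
    exact (h1.comp x (hasFDerivAt_prodMk_right t x)).hasFDerivWithinAt
  · rw [← NNReal.coe_le_coe, coe_nnnorm]
    refine le_trans ?_ (Real.le_coe_toNNReal C)
    refine (ContinuousLinearMap.opNorm_comp_le _ _).trans ?_
    refine (mul_le_of_le_one_right (norm_nonneg _) ?_).trans (hC (t, x) ⟨ht, hx⟩)
    exact ContinuousLinearMap.opNorm_le_bound _ zero_le_one fun y => by simp

lemma ode_unique {f : ℝ → E → E} (hf : ContDiff ℝ 1 (Function.uncurry f)) {T : ℝ}
    {z w : ℝ → E} (h0 : z 0 = w 0) (hz : ∀ t ∈ Set.Icc 0 T, HasDerivAt z (f t (z t)) t)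
    (hw : ∀ t ∈ Set.Icc 0 T, HasDerivAt w (f t (w t)) t) : Set.EqOn z w (Set.Icc 0 T) := by
  have cz : ContinuousOn z (Set.Icc 0 T) := fun t ht => (hz t ht).continuousAt.continuousWithinAt
  have cw : ContinuousOn w (Set.Icc 0 T) := fun t ht => (hw t ht).continuousAt.continuousWithinAt
  obtain ⟨R1, h1⟩ := isCompact_Icc.exists_bound_of_continuousOn cz
  obtain ⟨R2, h2⟩ := isCompact_Icc.exists_bound_of_continuousOn cw
  obtain ⟨K, hK⟩ := lipschitzOnWith_of_contDiff hf 0 T (max R1 R2)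
  refine ODE_solution_unique_of_mem_Icc_right (v := f) (s := fun _ => Metric.closedBall 0 (max R1 R2))
    (K := K) (fun t ht => hK t ⟨ht.1, ht.2.le⟩) cz
    (fun t ht => (hz t ⟨ht.1, ht.2.le⟩).hasDerivWithinAt) (fun t ht => ?_) cw
    (fun t ht => (hw t ⟨ht.1, ht.2.le⟩).hasDerivWithinAt) (fun t ht => ?_) h0
  · simpa using (h1 t ⟨ht.1, ht.2.le⟩).trans (le_max_left _ _)
  · simpa using (h2 t ⟨ht.1, ht.2.le⟩).trans (le_max_right _ _)

/-- Global existence for an ordinary differential equation with an a priori bound. -/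
lemma ode_global {f : ℝ → E → E} (hf : ContDiff ℝ 1 (Function.uncurry f)) {T R : ℝ} (hT : 0 ≤ T)
    (z0 : E) (hz0 : ‖z0‖ < R)
    (hap : ∀ t₁ ∈ Set.Icc 0 T, ∀ z : ℝ → E, z 0 = z0 →
      (∀ t ∈ Set.Icc 0 t₁, HasDerivAt z (f t (z t)) t) → ‖z t₁‖ < R) :
    ∃ z : ℝ → E, z 0 = z0 ∧ ∀ t ∈ Set.Icc 0 T, HasDerivAt z (f t (z t)) t := by
  have hR : 0 < R := (norm_nonneg z0).trans_lt hz0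
  let χ : ContDiffBump (0 : E) := ⟨R, R + 1, hR, by linarith⟩
  set g : ℝ → E → E := fun t z => χ z • f t z with hg
  have hgc : ContDiff ℝ 1 (Function.uncurry g) := by
    have h1 : ContDiff ℝ 1 fun q : ℝ × E => χ q.2 := χ.contDiff.comp contDiff_snd
    exact h1.smul hf
  have hK : IsCompact (Set.Icc (-1) (T + 1) ×ˢ Metric.closedBall (0 : E) (R + 1)) :=
    isCompact_Icc.prod (isCompact_closedBall 0 (R + 1))
  obtain ⟨L, hL⟩ := hK.exists_bound_of_continuousOn hgc.continuous.continuousOn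
  have hbd : ∀ t ∈ Set.Icc (-1) (T + 1), ∀ z, ‖g t z‖ ≤ L.toNNReal := by
    intro t ht z
    by_cases hz : z ∈ Metric.closedBall (0 : E) (R + 1)
    · exact (hL (t, z) ⟨ht, hz⟩).trans (Real.le_coe_toNNReal L)
    · have : χ z = 0 := χ.zero_of_le_dist (by simpa using (not_le.1 (by simpa using hz)).le)
      simp [hg, this]
  set a : NNReal := L.toNNReal * (T + 2).toNNReal with ha
  obtain ⟨K, hKl⟩ := lipschitzOnWith_of_contDiff hgc (-1) (T + 1) (‖z0‖ + a)
  have hsub : Metric.closedBall z0 a ⊆ Metric.closedBall (0 : E) (‖z0‖ + a) :=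
    Metric.closedBall_subset_closedBall' (by rw [dist_zero_right]; linarith)
  have hpl : IsPicardLindelof g (⟨0, by constructor <;> linarith⟩ : Set.Icc (-1 : ℝ) (T + 1)) z0 a 0
      L.toNNReal K := by
    refine ⟨fun t ht => (hKl t ht).mono hsub, fun x _ => ?_, fun t ht x _ => hbd t ht x, ?_⟩
    · exact (hgc.continuous.comp (Continuous.prodMk_left x)).continuousOn
    · have : max (T + 1 - 0) (0 - -1) ≤ T + 2 := max_le (by linarith) (by linarith)
      simp only [ha, NNReal.coe_mul, NNReal.coe_zero, sub_zero] at this ⊢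
      rw [Real.coe_toNNReal (T + 2) (by linarith)]
      exact mul_le_mul_of_nonneg_left this L.toNNReal.coe_nonneg
  obtain ⟨z, h0, hz⟩ := hpl.exists_eq_forall_mem_Icc_hasDerivWithinAt₀
  simp only at h0
  have hz' : ∀ t ∈ Set.Icc 0 T, HasDerivAt z (g t (z t)) t := fun t ht =>
    (hz t ⟨by linarith [ht.1], by linarith [ht.2]⟩).hasDerivAt
      (Icc_mem_nhds (by linarith [ht.1]) (by linarith [ht.2]))
  have hone : ∀ t x, ‖x‖ ≤ R → g t x = f t x := fun t x hx => by
    have : χ x = 1 := χ.one_of_mem_closedBall (by simpa using hx)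
    simp [hg, this]
  have hlt : ∀ t ∈ Set.Icc 0 T, ‖z t‖ < R := fun t ht => by
    refine bootstrap (e := fun t => ‖z t‖) (a := 0) (b := T)
      (fun s hs => (hz' s hs).continuousAt.norm.continuousWithinAt) (by simpa [h0] using hz0)
      (fun s hs hle => ?_) ht
    refine hap s hs z h0 fun r hr => ?_
    rw [← hone r _ (hle r hr)]
    exact hz' r ⟨hr.1, hr.2.trans hs.2⟩
  exact ⟨z, h0, fun t ht => hone t _ (hlt t ht).le ▸ hz' t ht⟩

end ODE

section InnerEnergy
variable {F : Type*} [NormedAddCommGroup F] [InnerProductSpace ℝ F]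

/-- Energy of the damped wave `δω'' + ω' + λω = Φ`, with `θ = ω'`. -/
def eW (δ l : ℝ) (w θ : F) : ℝ :=
  ‖w‖ ^ 2 / 2 + δ * inner ℝ w θ + δ ^ 2 * ‖θ‖ ^ 2 + δ * l * ‖w‖ ^ 2

lemma eW_hasDerivAt {δ l t : ℝ} (hδ : δ ≠ 0) {w θ : ℝ → F} {Φ : F}
    (hw : HasDerivAt w (θ t) t) (hθ : HasDerivAt θ (δ⁻¹ • (-θ t - l • w t + Φ)) t) :
    HasDerivAt (fun t => eW δ l (w t) (θ t))
      (-(l * ‖w t‖ ^ 2) - δ * ‖θ t‖ ^ 2 + inner ℝ (w t + (2 * δ) • θ t) Φ) t := by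
  have h1 := hw.norm_sq
  have h2 := hθ.norm_sq
  have h3 := hw.inner ℝ hθ
  have := (((h1.div_const 2).add (h3.const_mul δ)).add (h2.const_mul (δ ^ 2))).add
    (h1.const_mul (δ * l))
  refine this.congr_deriv ?_
  simp only [inner_smul_right, inner_add_right, inner_sub_right, inner_neg_right, inner_add_left,
    inner_smul_left, real_inner_self_eq_norm_sq, RCLike.conj_to_real]
  rw [real_inner_comm (θ t) (w t)]
  field_simp
  ring

lemma eW_sq (δ l : ℝ) (w θ : F) :
    eW δ l w θ = ‖w + (2 * δ) • θ‖ ^ 2 / 4 + ‖w‖ ^ 2 / 4 + δ * l * ‖w‖ ^ 2 := by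
  rw [eW, norm_add_sq_real, norm_smul, inner_smul_right, mul_pow, Real.norm_eq_abs, sq_abs]
  ring

/-- Energy of the acoustic part. -/
def eA (ε δ l : ℝ) (s y g : F) : ℝ :=
  ‖s - δ • g - (δ * l) • y‖ ^ 2 / 2 + ε * l / 2 * ‖y + (δ / ε) • s‖ ^ 2 + δ * l / 2 * ‖s‖ ^ 2

lemma eA_hasDerivAt {ε δ l t : ℝ} (hε : ε ≠ 0) (hδ : δ ≠ 0) {s y g : ℝ → F} {η β : F}
    (hs : HasDerivAt s (-g t - l • y t) t) (hy : HasDerivAt y (ε⁻¹ • (s t + η)) t)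
    (hg : HasDerivAt g (δ⁻¹ • (-g t + l • s t + β)) t) :
    HasDerivAt (fun t => eA ε δ l (s t) (y t) (g t))
      (-(l * ‖s t‖ ^ 2) - inner ℝ (s t - δ • g t - (δ * l) • y t) (β + (δ * l / ε) • η)
        + l * inner ℝ (y t + (δ / ε) • s t) η) t := by
  have h1 := ((hs.sub (hg.const_smul δ)).sub (hy.const_smul (δ * l))).norm_sq
  have h2 := (hy.add (hs.const_smul (δ / ε))).norm_sq
  have h3 := hs.norm_sq
  have := ((h1.div_const 2).add (h2.const_mul (ε * l / 2))).add (h3.const_mul (δ * l / 2))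
  refine this.congr_deriv ?_
  simp only [Pi.sub_apply, Pi.add_apply, Pi.smul_apply, inner_smul_right, inner_add_right,
    inner_sub_right, inner_neg_right, inner_add_left, inner_sub_left,
    inner_smul_left, real_inner_self_eq_norm_sq, RCLike.conj_to_real]
  rw [real_inner_comm (g t) (s t), real_inner_comm (y t) (s t), real_inner_comm (g t) (y t)]
  field_simp
  ring

end InnerEnergy

/-- Wedge `ξ ∧ v` (Fourier side of the curl). -/
def om (v : Mode → Fin 3 → ℂ) (k : Mode) (a b : Fin 3) : ℂ := xi k a * v k b - xi k b * v k a

/-- `ξ · v` (Fourier side of the divergence). -/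
def sg (v : Mode → Fin 3 → ℂ) (k : Mode) : ℂ := ∑ a, xi k a * v k a

/-- Fourier side of the row-wise divergence. -/
def HH (V : Mode → Fin 3 → Fin 3 → ℂ) (k : Mode) (b : Fin 3) : ℂ :=
  ∑ j, Complex.I * xi k j * V k b j

/-- Sum of squared components of a vector. -/
def sv (v : Mode → Fin 3 → ℂ) (k : Mode) : ℝ := ∑ a, ‖v k a‖ ^ 2

/-- Sum of squared components of an antisymmetric or general matrix. -/
def sM (V : Mode → Fin 3 → Fin 3 → ℂ) (k : Mode) : ℝ := ∑ a, ∑ b, ‖V k a b‖ ^ 2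

lemma sv_nonneg (v : Mode → Fin 3 → ℂ) (k : Mode) : 0 ≤ sv v k :=
  Finset.sum_nonneg fun _ _ => sq_nonneg _

lemma sM_nonneg (V : Mode → Fin 3 → Fin 3 → ℂ) (k : Mode) : 0 ≤ sM V k :=
  Finset.sum_nonneg fun _ _ => Finset.sum_nonneg fun _ _ => sq_nonneg _

lemma norm_sq_reim (z : ℂ) : ‖z‖ ^ 2 = z.re ^ 2 + z.im ^ 2 := by
  rw [Complex.sq_norm, Complex.normSq_apply]; ring

lemma sM_om_add (v : Mode → Fin 3 → ℂ) (k : Mode) :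
    sM (om v) k / 2 + ‖sg v k‖ ^ 2 = lam k * sv v k := by
  simp only [sM, sv, sg, om, lam, Fin.sum_univ_three, norm_sq_reim, Complex.add_re, Complex.add_im,
    Complex.sub_re, Complex.sub_im, Complex.mul_re, Complex.mul_im, Complex.ofReal_re,
    Complex.ofReal_im]
  ring

lemma sM_om_le (v : Mode → Fin 3 → ℂ) (k : Mode) : sM (om v) k ≤ 2 * (lam k * sv v k) := by
  have := sM_om_add v k; have := sq_nonneg ‖sg v k‖; linarith

lemma sg_sq_le (v : Mode → Fin 3 → ℂ) (k : Mode) : ‖sg v k‖ ^ 2 ≤ lam k * sv v k := by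
  have := sM_om_add v k; have := sM_nonneg (om v) k; linarith

lemma sv_HH_le (V : Mode → Fin 3 → Fin 3 → ℂ) (k : Mode) : sv (HH V) k ≤ lam k * sM V k := by
  unfold sv sM
  rw [Finset.mul_sum]
  refine Finset.sum_le_sum fun b _ => ?_
  have h : ‖HH V k b‖ ^ 2 = ‖sg (fun k j => V k b j) k‖ ^ 2 := by
    have : HH V k b = Complex.I * sg (fun k j => V k b j) k := by
      unfold HH sg; rw [Finset.mul_sum]; exact Finset.sum_congr rfl fun j _ => by ring
    rw [this, norm_mul, Complex.norm_I, one_mul]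
  rw [h]
  exact sg_sq_le _ _

lemma norm_sq_le_sv (v : Mode → Fin 3 → ℂ) (k : Mode) : ‖v k‖ ^ 2 ≤ sv v k := by
  have h : ‖v k‖ ≤ √(sv v k) := (pi_norm_le_iff_of_nonneg (Real.sqrt_nonneg _)).2 fun a =>
    Real.le_sqrt_of_sq_le (Finset.single_le_sum (f := fun a => ‖v k a‖ ^ 2)
      (fun _ _ => sq_nonneg _) (Finset.mem_univ a))
  calc ‖v k‖ ^ 2 ≤ √(sv v k) ^ 2 := pow_le_pow_left₀ (norm_nonneg _) h 2
    _ = _ := Real.sq_sqrt (sv_nonneg v k)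

lemma sv_le_norm_sq (v : Mode → Fin 3 → ℂ) (k : Mode) : sv v k ≤ 3 * ‖v k‖ ^ 2 := by
  calc sv v k ≤ ∑ _a : Fin 3, ‖v k‖ ^ 2 := Finset.sum_le_sum fun a _ =>
        pow_le_pow_left₀ (norm_nonneg _) (norm_le_pi_norm (v k) a) 2
    _ = _ := by simp

/-- The quadratic and bilinear interaction terms. -/
def Bq (N : Finset Mode) (u v : Mode → Fin 3 → ℂ) (k : Mode) (a b : Fin 3) : ℂ :=
  cv N (fun k => v k a) (fun k => v k b) k + cv N (fun k => u k a) (fun k => v k b) k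
    + cv N (fun k => u k b) (fun k => v k a) k

lemma norm_cv_le (N : Finset Mode) (A b : Mode → Fin 3 → ℂ) (k : Mode) (i j : Fin 3) :
    ‖cv N (fun k => A k i) (fun k => b k j) k‖ ≤ cv N (fun k => ‖A k‖) (fun k => ‖b k‖) k := by
  unfold cv
  refine (norm_sum_le _ _).trans (Finset.sum_le_sum fun l _ => ?_)
  rw [norm_mul]
  exact mul_le_mul (norm_le_pi_norm _ _) (norm_le_pi_norm _ _) (norm_nonneg _) (norm_nonneg _)

lemma norm_Bq_le (N : Finset Mode) (u v : Mode → Fin 3 → ℂ) (k : Mode) (a b : Fin 3) :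
    ‖Bq N u v k a b‖ ≤ cv N (fun k => ‖v k‖) (fun k => ‖v k‖) k
      + 2 * cv N (fun k => ‖u k‖) (fun k => ‖v k‖) k := by
  have h1 := norm_cv_le N v v k a b
  have h2 := norm_cv_le N u v k a b
  have h3 := norm_cv_le N u v k b a
  have := norm_add₃_le (a := cv N (fun k => v k a) (fun k => v k b) k)
    (b := cv N (fun k => u k a) (fun k => v k b) k) (c := cv N (fun k => u k b) (fun k => v k a) k)
  unfold Bq; linarith

/-- Galerkin truncation of the perturbation system. -/
structure Gal (N : Finset Mode) (ε δ T : ℝ) (u : ℝ → Mode → Fin 3 → ℂ) (f1 : ℝ → Mode → ℂ)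
    (f2 : ℝ → Mode → Fin 3 → ℂ) (f3 : ℝ → Mode → Fin 3 → Fin 3 → ℂ)
    (q : ℝ → Mode → ℂ) (v : ℝ → Mode → Fin 3 → ℂ) (V : ℝ → Mode → Fin 3 → Fin 3 → ℂ) : Prop where
  sq : ∀ t, ∀ k ∉ N, q t k = 0
  sv : ∀ t, ∀ k ∉ N, v t k = 0
  sV : ∀ t, ∀ k ∉ N, V t k = 0
  dq : ∀ t ∈ Set.Icc 0 T, ∀ k ∈ N,
    HasDerivAt (fun t => q t k) (ε⁻¹ • (-(Complex.I * sg (v t) k) + f1 t k)) t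
  dv : ∀ t ∈ Set.Icc 0 T, ∀ k ∈ N, ∀ a,
    HasDerivAt (fun t => v t k a) (-HH (V t) k a - xi k a * (Complex.I * q t k) + f2 t k a) t
  dV : ∀ t ∈ Set.Icc 0 T, ∀ k ∈ N, ∀ a b,
    HasDerivAt (fun t => V t k a b) (δ⁻¹ • (-V t k a b - Complex.I * xi k b * v t k a
      + (Bq N (u t) (v t) k a b + f3 t k a b))) t

section
variable {N : Finset Mode} {ε δ T : ℝ} {u : ℝ → Mode → Fin 3 → ℂ} {f1 : ℝ → Mode → ℂ}
    {f2 : ℝ → Mode → Fin 3 → ℂ} {f3 : ℝ → Mode → Fin 3 → Fin 3 → ℂ}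
    {q : ℝ → Mode → ℂ} {v : ℝ → Mode → Fin 3 → ℂ} {V : ℝ → Mode → Fin 3 → Fin 3 → ℂ}

/-- Total source of the stress equation. -/
def Src (N : Finset Mode) (u : ℝ → Mode → Fin 3 → ℂ) (f3 : ℝ → Mode → Fin 3 → Fin 3 → ℂ)
    (v : ℝ → Mode → Fin 3 → ℂ) (t : ℝ) (k : Mode) (a b : Fin 3) : ℂ :=
  Bq N (u t) (v t) k a b + f3 t k a b

lemma Gal.dHH (h : Gal N ε δ T u f1 f2 f3 q v V) {t : ℝ} (ht : t ∈ Set.Icc 0 T) {k : Mode}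
    (hk : k ∈ N) (b : Fin 3) : HasDerivAt (fun t => HH (V t) k b)
      (δ⁻¹ • (-HH (V t) k b + lam k * v t k b + HH (Src N u f3 v t) k b)) t := by
  have := HasDerivAt.fun_sum (u := Finset.univ) fun j (_ : j ∈ Finset.univ) =>
    (h.dV t ht k hk b j).const_mul (Complex.I * xi k j)
  refine this.congr_deriv ?_
  simp only [HH, Src, lam, Fin.sum_univ_three, Complex.real_smul]
  push_cast
  linear_combination (-(δ : ℂ)⁻¹ * v t k b * (xi k 0 ^ 2 + xi k 1 ^ 2 + xi k 2 ^ 2)) * Complex.I_sq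

lemma hasDerivAt_sg {w : ℝ → Mode → Fin 3 → ℂ} {w' : Mode → Fin 3 → ℂ} {t : ℝ} {k : Mode}
    (h : ∀ a, HasDerivAt (fun t => w t k a) (w' k a) t) :
    HasDerivAt (fun t => sg (w t) k) (sg w' k) t :=
  HasDerivAt.fun_sum fun a _ => (h a).const_mul _

lemma hasDerivAt_om {w : ℝ → Mode → Fin 3 → ℂ} {w' : Mode → Fin 3 → ℂ} {t : ℝ} {k : Mode}
    (h : ∀ a, HasDerivAt (fun t => w t k a) (w' k a) t) (a b : Fin 3) :
    HasDerivAt (fun t => om (w t) k a b) (om w' k a b) t :=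
  ((h b).const_mul _).sub ((h a).const_mul _)

lemma Gal.dom (hf2 : ∀ t ∈ Set.Icc 0 T, ∀ k a, f2 t k a = 0)
    (h : Gal N ε δ T u f1 f2 f3 q v V) {t : ℝ} (ht : t ∈ Set.Icc 0 T) {k : Mode}
    (hk : k ∈ N) (a b : Fin 3) :
    HasDerivAt (fun t => om (v t) k a b) (-om (HH (V t)) k a b) t := by
  refine (hasDerivAt_om (w' := fun k a => -HH (V t) k a - xi k a * (Complex.I * q t k) + f2 t k a)
    (fun a => h.dv t ht k hk a) a b).congr_deriv ?_
  simp only [om, hf2 t ht]; ring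

lemma Gal.dsg (hf2 : ∀ t ∈ Set.Icc 0 T, ∀ k a, f2 t k a = 0)
    (h : Gal N ε δ T u f1 f2 f3 q v V) {t : ℝ} (ht : t ∈ Set.Icc 0 T) {k : Mode}
    (hk : k ∈ N) :
    HasDerivAt (fun t => sg (v t) k) (-sg (HH (V t)) k - lam k • (Complex.I * q t k)) t := by
  refine (hasDerivAt_sg (w' := fun k a => -HH (V t) k a - xi k a * (Complex.I * q t k) + f2 t k a)
    (fun a => h.dv t ht k hk a)).congr_deriv ?_
  simp only [sg, hf2 t ht, lam, Fin.sum_univ_three, Complex.real_smul]; push_cast; ring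

lemma Gal.dth (h : Gal N ε δ T u f1 f2 f3 q v V) {t : ℝ} (ht : t ∈ Set.Icc 0 T) {k : Mode}
    (hk : k ∈ N) (a b : Fin 3) :
    HasDerivAt (fun t => -om (HH (V t)) k a b) (δ⁻¹ • (-(-om (HH (V t)) k a b)
      - lam k • om (v t) k a b + -om (HH (Src N u f3 v t)) k a b)) t := by
  refine (hasDerivAt_om (w' := fun k b => δ⁻¹ • (-HH (V t) k b + lam k * v t k b
    + HH (Src N u f3 v t) k b)) (fun a => h.dHH ht hk a) a b).neg.congr_deriv ?_
  simp only [om, Complex.real_smul]; ring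

lemma Gal.dga (h : Gal N ε δ T u f1 f2 f3 q v V) {t : ℝ} (ht : t ∈ Set.Icc 0 T) {k : Mode}
    (hk : k ∈ N) :
    HasDerivAt (fun t => sg (HH (V t)) k) (δ⁻¹ • (-sg (HH (V t)) k
      + lam k • sg (v t) k + sg (HH (Src N u f3 v t)) k)) t := by
  refine (hasDerivAt_sg (w' := fun k b => δ⁻¹ • (-HH (V t) k b + lam k * v t k b
    + HH (Src N u f3 v t) k b)) (fun a => h.dHH ht hk a)).congr_deriv ?_
  simp only [sg, Fin.sum_univ_three, Complex.real_smul]; ring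

lemma Gal.dy (h : Gal N ε δ T u f1 f2 f3 q v V) {t : ℝ} (ht : t ∈ Set.Icc 0 T) {k : Mode}
    (hk : k ∈ N) :
    HasDerivAt (fun t => Complex.I * q t k) (ε⁻¹ • (sg (v t) k + Complex.I * f1 t k)) t := by
  refine ((h.dq t ht k hk).const_mul Complex.I).congr_deriv ?_
  simp only [Complex.real_smul, Complex.ofReal_inv]
  linear_combination (-(ε : ℂ)⁻¹ * sg (v t) k) * Complex.I_sq

/-- First energy functional. -/
def En (N : Finset Mode) (ε δ : ℝ) (q : Mode → ℂ) (v : Mode → Fin 3 → ℂ)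
    (V : Mode → Fin 3 → Fin 3 → ℂ) : ℝ :=
  ∑ k ∈ N, ((∑ a, ∑ b, eW δ (lam k) (om v k a b) (-om (HH V) k a b))
    + eA ε δ (lam k) (sg v k) (Complex.I * q k) (sg (HH V) k))

/-- Time derivative of the first energy functional. -/
def dEn (N : Finset Mode) (ε δ : ℝ) (q : Mode → ℂ) (v : Mode → Fin 3 → ℂ)
    (V : Mode → Fin 3 → Fin 3 → ℂ) (f1 : Mode → ℂ) (B : Mode → Fin 3 → Fin 3 → ℂ) : ℝ :=
  ∑ k ∈ N, ((∑ a, ∑ b, (-(lam k * ‖om v k a b‖ ^ 2) - δ * ‖-om (HH V) k a b‖ ^ 2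
      + inner ℝ (om v k a b + (2 * δ) • -om (HH V) k a b) (-om (HH B) k a b)))
    + (-(lam k * ‖sg v k‖ ^ 2) - inner ℝ (sg v k - δ • sg (HH V) k
        - (δ * lam k) • (Complex.I * q k)) (sg (HH B) k + (δ * lam k / ε) • (Complex.I * f1 k))
        + lam k * inner ℝ (Complex.I * q k + (δ / ε) • sg v k) (Complex.I * f1 k)))

lemma Gal.hasDerivAt_En (hf2 : ∀ t ∈ Set.Icc 0 T, ∀ k a, f2 t k a = 0)
    (h : Gal N ε δ T u f1 f2 f3 q v V) (hε : ε ≠ 0) (hδ : δ ≠ 0) {t : ℝ}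
    (ht : t ∈ Set.Icc 0 T) : HasDerivAt (fun t => En N ε δ (q t) (v t) (V t))
      (dEn N ε δ (q t) (v t) (V t) (f1 t) (Src N u f3 v t)) t := by
  refine HasDerivAt.fun_sum fun k hk => HasDerivAt.add ?_ ?_
  · exact HasDerivAt.fun_sum fun a _ => HasDerivAt.fun_sum fun b _ =>
      eW_hasDerivAt hδ (w := fun t => om (v t) k a b) (θ := fun t => -om (HH (V t)) k a b)
      (h.dom hf2 ht hk a b) (h.dth ht hk a b)
  · exact eA_hasDerivAt hε hδ (s := fun t => sg (v t) k) (y := fun t => Complex.I * q t k)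
      (g := fun t => sg (HH (V t)) k) (h.dsg hf2 ht hk) (h.dy ht hk) (h.dga ht hk)

end

lemma sum_le_sqrt_mul_sqrt {ι : Type*} (s : Finset ι) {f P R : ι → ℝ} (hP : ∀ i, 0 ≤ P i)
    (hR : ∀ i, 0 ≤ R i) (h : ∀ i ∈ s, f i ≤ √(P i) * √(R i)) :
    ∑ i ∈ s, f i ≤ √(∑ i ∈ s, P i) * √(∑ i ∈ s, R i) :=
  (Finset.sum_le_sum h).trans (Real.sum_sqrt_mul_sqrt_le s hP hR)

lemma inner_le_sqrt (x y : ℂ) : inner ℝ x y ≤ √(‖x‖ ^ 2) * √(‖y‖ ^ 2) := by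
  rw [Real.sqrt_sq (norm_nonneg _), Real.sqrt_sq (norm_nonneg _)]
  exact real_inner_le_norm x y

lemma neg_inner_le_sqrt (x y : ℂ) : -inner ℝ x y ≤ √(‖x‖ ^ 2) * √(‖y‖ ^ 2) := by
  have := inner_le_sqrt (-x) y
  rwa [inner_neg_left, norm_neg] at this

/-- Dissipation. -/
def Dn (N : Finset Mode) (v : Mode → Fin 3 → ℂ) : ℝ :=
  ∑ k ∈ N, lam k * (sM (om v) k + ‖sg v k‖ ^ 2)

/-- Squared `L²` norm of the time derivative of the vorticity. -/
def Th (N : Finset Mode) (V : Mode → Fin 3 → Fin 3 → ℂ) : ℝ := ∑ k ∈ N, sM (om (HH V)) k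

/-- Squared `H²`-type norm. -/
def H2n (N : Finset Mode) (v : Mode → Fin 3 → ℂ) : ℝ := ∑ k ∈ N, W k ^ 2 * ‖v k‖ ^ 2

lemma Dn_nonneg (N : Finset Mode) (v : Mode → Fin 3 → ℂ) : 0 ≤ Dn N v :=
  Finset.sum_nonneg fun k _ => mul_nonneg (lam_nonneg k) (add_nonneg (sM_nonneg _ _) (sq_nonneg _))

lemma Th_nonneg (N : Finset Mode) (V : Mode → Fin 3 → Fin 3 → ℂ) : 0 ≤ Th N V :=
  Finset.sum_nonneg fun _ _ => sM_nonneg _ _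

lemma H2n_nonneg (N : Finset Mode) (v : Mode → Fin 3 → ℂ) : 0 ≤ H2n N v :=
  Finset.sum_nonneg fun _ _ => mul_nonneg (sq_nonneg _) (sq_nonneg _)

lemma eA_nonneg {ε δ l : ℝ} (hε : 0 ≤ ε) (hδ : 0 ≤ δ) (hl : 0 ≤ l) (s y g : ℂ) :
    0 ≤ eA ε δ l s y g := by unfold eA; positivity

lemma eW_nonneg {δ l : ℝ} (hδ : 0 ≤ δ) (hl : 0 ≤ l) (w θ : ℂ) : 0 ≤ eW δ l w θ := by
  rw [eW_sq]; positivity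

variable {N : Finset Mode} {ε δ : ℝ} {q : Mode → ℂ} {v : Mode → Fin 3 → ℂ}
  {V : Mode → Fin 3 → Fin 3 → ℂ}

lemma sum_eW_le_En (hε : 0 ≤ ε) (hδ : 0 ≤ δ) :
    ∑ k ∈ N, ∑ a, ∑ b, eW δ (lam k) (om v k a b) (-om (HH V) k a b) ≤ En N ε δ q v V :=
  Finset.sum_le_sum fun k _ => le_add_of_nonneg_right (eA_nonneg hε hδ (lam_nonneg k) _ _ _)

lemma sum_eA_le_En (hδ : 0 ≤ δ) :
    ∑ k ∈ N, eA ε δ (lam k) (sg v k) (Complex.I * q k) (sg (HH V) k) ≤ En N ε δ q v V :=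
  Finset.sum_le_sum fun k _ => le_add_of_nonneg_left (Finset.sum_nonneg fun _ _ =>
    Finset.sum_nonneg fun _ _ => eW_nonneg hδ (lam_nonneg k) _ _)

lemma En_nonneg (hε : 0 ≤ ε) (hδ : 0 ≤ δ) : 0 ≤ En N ε δ q v V :=
  (Finset.sum_nonneg fun k _ => eA_nonneg hε hδ (lam_nonneg k) _ _ _).trans (sum_eA_le_En hδ)

lemma lam_le_W (k : Mode) : lam k ≤ W k := by unfold W; linarith

lemma lam_sq_le_W_sq (k : Mode) : lam k ^ 2 ≤ W k ^ 2 :=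
  pow_le_pow_left₀ (lam_nonneg k) (lam_le_W k) 2

lemma H2n_le : H2n N v ≤ ‖v 0‖ ^ 2 + 4 * Dn N v := by
  classical
  have key : ∀ k, W k ^ 2 * ‖v k‖ ^ 2 ≤
      (if k = 0 then ‖v 0‖ ^ 2 else 0) + 4 * (lam k * (sM (om v) k + ‖sg v k‖ ^ 2)) := by
    intro k
    split_ifs with hk
    · subst hk; simp [W, lam_zero]
    · have h1 := W_le_two_lam hk
      have h2 := norm_sq_le_sv v k
      have h3 := sM_om_add v k
      have h4 := sM_nonneg (om v) k
      have h5 := lam_nonneg k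
      have h6 : W k ^ 2 ≤ (2 * lam k) ^ 2 := pow_le_pow_left₀ (W_pos k).le h1 2
      calc W k ^ 2 * ‖v k‖ ^ 2 ≤ (2 * lam k) ^ 2 * sv v k :=
            mul_le_mul h6 h2 (sq_nonneg _) (sq_nonneg _)
        _ = 4 * (lam k * (sM (om v) k / 2 + ‖sg v k‖ ^ 2)) := by rw [h3]; ring
        _ ≤ _ := by
          rw [zero_add]; gcongr; linarith
  calc H2n N v ≤ _ := Finset.sum_le_sum fun k _ => key k
    _ = (∑ k ∈ N, if k = 0 then ‖v 0‖ ^ 2 else 0) + 4 * Dn N v := by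
      rw [Finset.sum_add_distrib, ← Finset.mul_sum, Dn]
    _ ≤ _ := by
      gcongr
      rw [Finset.sum_ite_eq']
      split_ifs
      · exact le_rfl
      · exact sq_nonneg _

lemma sum_W_sM_Bq_le {u : Mode → Fin 3 → ℂ} {A : ℝ} (hs : ∀ k ∉ N, v k = 0)
    (hu : ∀ F : Finset Mode, ∑ k ∈ F, W k ^ 2 * ‖u k‖ ^ 2 ≤ A ^ 2) (F : Finset Mode) :
    ∑ k ∈ F, W k ^ 2 * sM (Bq N u v) k ≤
      4608 * Slat * (H2n N v ^ 2 + A ^ 2 * H2n N v) := by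
  classical
  have hv : ∀ F : Finset Mode, ∑ k ∈ F, W k ^ 2 * ‖v k‖ ^ 2 ≤ H2n N v := by
    intro F
    calc _ ≤ ∑ k ∈ F ∪ N, W k ^ 2 * ‖v k‖ ^ 2 := Finset.sum_le_sum_of_subset_of_nonneg
          Finset.subset_union_left fun k _ _ => by positivity
      _ = H2n N v := (Finset.sum_subset Finset.subset_union_right
          fun k _ hk => by simp [hs k hk]).symm
  have h1 := cv_h2 N F (A := fun k => ‖v k‖) (b := fun k => ‖v k‖) (fun _ => norm_nonneg _)
    (fun _ => norm_nonneg _) hv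
  have h2 := cv_h2 N F (A := fun k => ‖u k‖) (b := fun k => ‖v k‖) (fun _ => norm_nonneg _)
    (fun _ => norm_nonneg _) hu
  have key : ∀ k, W k ^ 2 * sM (Bq N u v) k ≤
      18 * (W k ^ 2 * cv N (fun k => ‖v k‖) (fun k => ‖v k‖) k ^ 2)
      + 72 * (W k ^ 2 * cv N (fun k => ‖u k‖) (fun k => ‖v k‖) k ^ 2) := by
    intro k
    set x := cv N (fun k => ‖v k‖) (fun k => ‖v k‖) k
    set y := cv N (fun k => ‖u k‖) (fun k => ‖v k‖) k
    have : sM (Bq N u v) k ≤ 18 * x ^ 2 + 72 * y ^ 2 := by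
      calc sM (Bq N u v) k ≤ ∑ _a : Fin 3, ∑ _b : Fin 3, (x + 2 * y) ^ 2 :=
            Finset.sum_le_sum fun a _ => Finset.sum_le_sum fun b _ =>
              pow_le_pow_left₀ (norm_nonneg _) (norm_Bq_le N u v k a b) 2
        _ = 9 * (x + 2 * y) ^ 2 := by simp; ring
        _ ≤ _ := by nlinarith [sq_nonneg (x - 2 * y)]
    nlinarith [mul_le_mul_of_nonneg_left this (sq_nonneg (W k))]
  calc _ ≤ _ := Finset.sum_le_sum fun k _ => key k
    _ ≤ 18 * (64 * Slat * H2n N v * H2n N v) + 72 * (64 * Slat * A ^ 2 * H2n N v) := by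
      rw [Finset.sum_add_distrib, ← Finset.mul_sum, ← Finset.mul_sum]
      exact add_le_add (mul_le_mul_of_nonneg_left h1 (by norm_num))
        (mul_le_mul_of_nonneg_left h2 (by norm_num))
    _ ≤ _ := by
      have := one_le_Slat
      have : 0 ≤ Slat * H2n N v ^ 2 := by positivity
      nlinarith

lemma sum_W_sM_add_le (F : Finset Mode) (B f : Mode → Fin 3 → Fin 3 → ℂ) :
    ∑ k ∈ F, W k ^ 2 * sM (fun k a b => B k a b + f k a b) k ≤
      2 * ∑ k ∈ F, W k ^ 2 * sM B k + 2 * ∑ k ∈ F, W k ^ 2 * sM f k := by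
  rw [Finset.mul_sum, Finset.mul_sum, ← Finset.sum_add_distrib]
  refine Finset.sum_le_sum fun k _ => ?_
  have : sM (fun k a b => B k a b + f k a b) k ≤ 2 * sM B k + 2 * sM f k := by
    unfold sM
    simp_rw [Finset.mul_sum]
    rw [← Finset.sum_add_distrib]
    refine Finset.sum_le_sum fun a _ => ?_
    rw [← Finset.sum_add_distrib]
    refine Finset.sum_le_sum fun b _ => ?_
    have := norm_add_le (B k a b) (f k a b)
    nlinarith [norm_nonneg (B k a b + f k a b), sq_nonneg (‖B k a b‖ - ‖f k a b‖)]
  nlinarith [mul_le_mul_of_nonneg_left this (sq_nonneg (W k))]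

lemma sum_om_HH_le (B : Mode → Fin 3 → Fin 3 → ℂ) :
    ∑ k ∈ N, sM (om (HH B)) k ≤ 2 * ∑ k ∈ N, W k ^ 2 * sM B k := by
  rw [Finset.mul_sum]
  refine Finset.sum_le_sum fun k _ => (sM_om_le _ k).trans ?_
  have h1 := sv_HH_le B k
  have h2 := lam_sq_le_W_sq k
  have := mul_le_mul_of_nonneg_left h1 (lam_nonneg k)
  nlinarith [mul_le_mul_of_nonneg_right h2 (sM_nonneg B k)]

lemma sg_HH_sq_le (B : Mode → Fin 3 → Fin 3 → ℂ) (k : Mode) :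
    ‖sg (HH B) k‖ ^ 2 ≤ lam k ^ 2 * sM B k := by
  have h0 := sg_sq_le (HH B) k
  have h1 := sv_HH_le B k
  have := mul_le_mul_of_nonneg_left h1 (lam_nonneg k)
  nlinarith

lemma dEn_le {f1 : Mode → ℂ} {B : Mode → Fin 3 → Fin 3 → ℂ} {A : ℝ} (hA : 0 ≤ A)
    (hε : 0 < ε) (hδ : 0 < δ) (hf1 : ∑ k ∈ N, W k ^ 2 * ‖f1 k‖ ^ 2 ≤ (ε * A) ^ 2) :
    dEn N ε δ q v V f1 B ≤ -Dn N v - δ * Th N V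
      + 5 * √(En N ε δ q v V) * √(∑ k ∈ N, W k ^ 2 * sM B k)
      + 2 * √(En N ε δ q v V) * (δ * A) + En N ε δ q v V + ε * A ^ 2 := by
  set E := En N ε δ q v V with hE
  set X := ∑ k ∈ N, W k ^ 2 * sM B k with hX
  have hX0 : 0 ≤ X := Finset.sum_nonneg fun k _ => mul_nonneg (sq_nonneg _) (sM_nonneg _ _)
  have hE0 : 0 ≤ E := En_nonneg hε.le hδ.le
  have hl := lam_nonneg
  have t1 : ∑ k ∈ N, ∑ a, ∑ b, inner ℝ (om v k a b + (2 * δ) • -om (HH V) k a b)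
      (-om (HH B) k a b) ≤ 3 * √E * √X := by
    have h1 : ∑ k ∈ N, ∑ a, ∑ b, ‖om v k a b + (2 * δ) • -om (HH V) k a b‖ ^ 2 ≤ 4 * E := by
      refine le_trans ?_ (mul_le_mul_of_nonneg_left (sum_eW_le_En hε.le hδ.le) (by norm_num))
      simp_rw [Finset.mul_sum]
      refine Finset.sum_le_sum fun k _ => Finset.sum_le_sum fun a _ => Finset.sum_le_sum fun b _ => ?_
      rw [eW_sq]
      have : 0 ≤ δ * lam k * ‖om v k a b‖ ^ 2 :=
        mul_nonneg (mul_nonneg hδ.le (hl k)) (sq_nonneg _)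
      nlinarith [sq_nonneg ‖om v k a b‖]
    have h2 : ∑ k ∈ N, ∑ a, ∑ b, ‖-om (HH B) k a b‖ ^ 2 ≤ 2 * X := by
      simp_rw [norm_neg]; exact sum_om_HH_le B
    have h3 : ∑ k ∈ N, ∑ a, ∑ b, inner ℝ (om v k a b + (2 * δ) • -om (HH V) k a b)
        (-om (HH B) k a b) ≤ √(4 * E) * √(2 * X) := by
      refine le_trans ?_ (mul_le_mul (Real.sqrt_le_sqrt h1) (Real.sqrt_le_sqrt h2)
        (Real.sqrt_nonneg _) (Real.sqrt_nonneg _))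
      refine sum_le_sqrt_mul_sqrt N (fun k => by positivity) (fun k => by positivity) fun k _ => ?_
      refine sum_le_sqrt_mul_sqrt _ (fun k => by positivity) (fun k => by positivity) fun a _ => ?_
      exact sum_le_sqrt_mul_sqrt _ (fun k => by positivity) (fun k => by positivity)
        fun b _ => inner_le_sqrt _ _
    refine h3.trans ?_
    rw [Real.sqrt_mul (by norm_num), Real.sqrt_mul (by norm_num)]
    have e1 : √(4 : ℝ) * √2 ≤ 3 := by
      rw [← Real.sqrt_mul (by norm_num), Real.sqrt_le_left (by norm_num)]; norm_num
    calc _ = (√4 * √2) * (√E * √X) := by ring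
      _ ≤ 3 * (√E * √X) := mul_le_mul_of_nonneg_right e1 (by positivity)
      _ = _ := by ring
  have hEA := sum_eA_le_En (ε := ε) (N := N) (q := q) (v := v) (V := V) hδ.le
  rw [← hE] at hEA
  have t2 : ∑ k ∈ N, -inner ℝ (sg v k - δ • sg (HH V) k - (δ * lam k) • (Complex.I * q k))
      (sg (HH B) k + (δ * lam k / ε) • (Complex.I * f1 k)) ≤ 2 * √E * (√X + δ * A) := by
    have h1 : ∑ k ∈ N, ‖sg v k - δ • sg (HH V) k - (δ * lam k) • (Complex.I * q k)‖ ^ 2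
        ≤ 2 * E := by
      refine le_trans ?_ (mul_le_mul_of_nonneg_left hEA (by norm_num))
      rw [Finset.mul_sum]
      refine Finset.sum_le_sum fun k _ => ?_
      have := hl k
      unfold eA
      have : 0 ≤ ε * lam k / 2 * ‖Complex.I * q k + (δ / ε) • sg v k‖ ^ 2 := by positivity
      have : 0 ≤ δ * lam k / 2 * ‖sg v k‖ ^ 2 := by positivity
      linarith
    have h2 : ∑ k ∈ N, ‖sg (HH B) k + (δ * lam k / ε) • (Complex.I * f1 k)‖ ^ 2 ≤
        2 * (√X + δ * A) ^ 2 := by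
      have : ∀ k, ‖sg (HH B) k + (δ * lam k / ε) • (Complex.I * f1 k)‖ ^ 2 ≤
          2 * (W k ^ 2 * sM B k) + 2 * (δ / ε) ^ 2 * (W k ^ 2 * ‖f1 k‖ ^ 2) := by
        intro k
        have n1 := norm_add_le (sg (HH B) k) ((δ * lam k / ε) • (Complex.I * f1 k))
        have n2 : ‖(δ * lam k / ε) • (Complex.I * f1 k)‖ ^ 2 ≤
            (δ / ε) ^ 2 * (W k ^ 2 * ‖f1 k‖ ^ 2) := by
          rw [norm_smul, norm_mul, Complex.norm_I, one_mul, mul_pow, Real.norm_eq_abs, sq_abs]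
          calc _ = (δ / ε) ^ 2 * (lam k ^ 2 * ‖f1 k‖ ^ 2) := by ring
            _ ≤ _ := by gcongr; exact hl k; exact lam_le_W k
        have n3 : ‖sg (HH B) k‖ ^ 2 ≤ W k ^ 2 * sM B k :=
          (sg_HH_sq_le B k).trans (mul_le_mul_of_nonneg_right (lam_sq_le_W_sq k) (sM_nonneg _ _))
        nlinarith [norm_nonneg (sg (HH B) k + (δ * lam k / ε) • (Complex.I * f1 k)),
          sq_nonneg (‖sg (HH B) k‖ - ‖(δ * lam k / ε) • (Complex.I * f1 k)‖)]
      refine (Finset.sum_le_sum fun k _ => this k).trans ?_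
      rw [Finset.sum_add_distrib, ← Finset.mul_sum, ← Finset.mul_sum]
      have e1 : (δ / ε) ^ 2 * (ε * A) ^ 2 = (δ * A) ^ 2 := by field_simp
      have e2 := mul_le_mul_of_nonneg_left hf1 (sq_nonneg (δ / ε))
      rw [e1] at e2
      have e3 := Real.sq_sqrt hX0
      have e4 : 0 ≤ √X * (δ * A) := by positivity
      nlinarith
    have h3 : ∑ k ∈ N, -inner ℝ (sg v k - δ • sg (HH V) k - (δ * lam k) • (Complex.I * q k))
        (sg (HH B) k + (δ * lam k / ε) • (Complex.I * f1 k)) ≤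
        √(2 * E) * √(2 * (√X + δ * A) ^ 2) := by
      refine le_trans ?_ (mul_le_mul (Real.sqrt_le_sqrt h1) (Real.sqrt_le_sqrt h2)
        (Real.sqrt_nonneg _) (Real.sqrt_nonneg _))
      exact sum_le_sqrt_mul_sqrt N (fun k => by positivity) (fun k => by positivity) fun k _ =>
        neg_inner_le_sqrt _ _
    refine h3.trans (le_of_eq ?_)
    rw [Real.sqrt_mul (by norm_num), Real.sqrt_mul (by norm_num), Real.sqrt_sq (by positivity)]
    have : √(2 : ℝ) * √2 = 2 := Real.mul_self_sqrt (by norm_num)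
    linear_combination (√E * (√X + δ * A)) * this
  have t3 : ∑ k ∈ N, lam k * inner ℝ (Complex.I * q k + (δ / ε) • sg v k) (Complex.I * f1 k)
      ≤ E + ε * A ^ 2 := by
    have : ∀ k, lam k * inner ℝ (Complex.I * q k + (δ / ε) • sg v k) (Complex.I * f1 k) ≤
        eA ε δ (lam k) (sg v k) (Complex.I * q k) (sg (HH V) k)
        + ε⁻¹ * (W k ^ 2 * ‖f1 k‖ ^ 2) := by
      intro k
      have n1 := real_inner_le_norm (Complex.I * q k + (δ / ε) • sg v k) (Complex.I * f1 k)
      have n2 : ‖Complex.I * f1 k‖ = ‖f1 k‖ := by rw [norm_mul, Complex.norm_I, one_mul]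
      rw [n2] at n1
      set Y := ‖Complex.I * q k + (δ / ε) • sg v k‖
      have hlk := hl k
      have e1 : ε * lam k / 2 * Y ^ 2 ≤
          eA ε δ (lam k) (sg v k) (Complex.I * q k) (sg (HH V) k) := by
        unfold eA
        have : 0 ≤ δ * lam k / 2 * ‖sg v k‖ ^ 2 := by positivity
        have := sq_nonneg ‖sg v k - δ • sg (HH V) k - (δ * lam k) • (Complex.I * q k)‖
        linarith
      have e2 : Y * ‖f1 k‖ ≤ ε / 2 * Y ^ 2 + ε⁻¹ * ‖f1 k‖ ^ 2 := by
        have : 0 ≤ ε⁻¹ * ((ε * Y - ‖f1 k‖) ^ 2 + ‖f1 k‖ ^ 2) := by positivity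
        have e : ε⁻¹ * ((ε * Y - ‖f1 k‖) ^ 2 + ‖f1 k‖ ^ 2) =
          ε * Y ^ 2 - 2 * (Y * ‖f1 k‖) + 2 * (ε⁻¹ * ‖f1 k‖ ^ 2) := by field_simp; ring
        linarith
      have e3 : lam k ≤ W k ^ 2 := by have := one_le_W k; have := lam_le_W k; nlinarith
      have e4 := mul_le_mul_of_nonneg_left (n1.trans e2) hlk
      have e5 : lam k * (ε⁻¹ * ‖f1 k‖ ^ 2) ≤ W k ^ 2 * (ε⁻¹ * ‖f1 k‖ ^ 2) :=
        mul_le_mul_of_nonneg_right e3 (by positivity)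
      nlinarith
    refine (Finset.sum_le_sum fun k _ => this k).trans ?_
    rw [Finset.sum_add_distrib, ← Finset.mul_sum]
    have e1 := mul_le_mul_of_nonneg_left hf1 (inv_pos.2 hε).le
    have e2 : ε⁻¹ * (ε * A) ^ 2 = ε * A ^ 2 := by field_simp
    linarith
  have split : dEn N ε δ q v V f1 B = -Dn N v - δ * Th N V
      + ∑ k ∈ N, ∑ a, ∑ b, inner ℝ (om v k a b + (2 * δ) • -om (HH V) k a b) (-om (HH B) k a b)
      + ∑ k ∈ N, -inner ℝ (sg v k - δ • sg (HH V) k - (δ * lam k) • (Complex.I * q k))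
        (sg (HH B) k + (δ * lam k / ε) • (Complex.I * f1 k))
      + ∑ k ∈ N, lam k * inner ℝ (Complex.I * q k + (δ / ε) • sg v k) (Complex.I * f1 k) := by
    simp only [dEn, Dn, Th, sM, Finset.mul_sum, mul_add, norm_neg, Finset.sum_add_distrib,
      Finset.sum_sub_distrib, Finset.sum_neg_distrib]
    ring
  rw [split]
  have e : 2 * √E * (√X + δ * A) = 2 * (√E * √X) + 2 * √E * (δ * A) := by ring
  have := mul_nonneg (Real.sqrt_nonneg E) (Real.sqrt_nonneg X)
  linarith

lemma dEn_le_small {f1 : Mode → ℂ} {u : Mode → Fin 3 → ℂ} {f3 : Mode → Fin 3 → Fin 3 → ℂ} {A : ℝ}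
    (hA : 0 ≤ A) (hε : 0 < ε) (hδ : 0 < δ) (hs : ∀ k ∉ N, v k = 0)
    (hu : ∀ F : Finset Mode, ∑ k ∈ F, W k ^ 2 * ‖u k‖ ^ 2 ≤ A ^ 2)
    (hf1 : ∑ k ∈ N, W k ^ 2 * ‖f1 k‖ ^ 2 ≤ (ε * A) ^ 2)
    (hf3 : ∑ k ∈ N, W k ^ 2 * sM f3 k ≤ (δ * A) ^ 2)
    (hsm : √(En N ε δ q v V) * (10000 * Slat) ≤ 1) :
    dEn N ε δ q v V f1 (fun k a b => Bq N u v k a b + f3 k a b) ≤ -(Dn N v) / 2 - δ * Th N V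
      + 10 ^ 7 * Slat ^ 2 * (1 + A) ^ 2 * En N ε δ q v V
      + ‖v 0‖ ^ 2 + 50 * A ^ 2 * δ ^ 2 + ε * A ^ 2 := by
  have h0 := dEn_le (q := q) (v := v) (V := V) (B := fun k a b => Bq N u v k a b + f3 k a b)
    hA hε hδ hf1
  set E := En N ε δ q v V with hE
  have hE0 : 0 ≤ E := En_nonneg hε.le hδ.le
  have hS := one_le_Slat
  set Z := H2n N v with hZ
  have hZ0 : 0 ≤ Z := H2n_nonneg N v
  have hZD : Z ≤ ‖v 0‖ ^ 2 + 4 * Dn N v := H2n_le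
  set X := ∑ k ∈ N, W k ^ 2 * sM (fun k a b => Bq N u v k a b + f3 k a b) k with hX
  have hXle : X ≤ (100 * Slat * (Z + A * √Z) + 2 * (δ * A)) ^ 2 := by
    have h1 := sum_W_sM_add_le N (Bq N u v) f3
    have h2 := sum_W_sM_Bq_le hs hu N
    have hz := Real.sq_sqrt hZ0
    have e1 : 0 ≤ A * √Z := by positivity
    have e2 : 0 ≤ δ * A := by positivity
    have e3 : (A * √Z) ^ 2 = A ^ 2 * Z := by rw [mul_pow, hz]
    have e4 : Slat * (Z ^ 2 + A ^ 2 * Z) ≤ Slat ^ 2 * (Z + A * √Z) ^ 2 := by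
      have : Z ^ 2 + A ^ 2 * Z ≤ (Z + A * √Z) ^ 2 := by
        rw [← e3]; nlinarith [mul_nonneg hZ0 e1]
      calc _ ≤ Slat * (Z + A * √Z) ^ 2 := mul_le_mul_of_nonneg_left this (by linarith)
        _ ≤ _ := mul_le_mul_of_nonneg_right (by nlinarith) (sq_nonneg _)
    have e5 : 0 ≤ (Slat * (Z + A * √Z)) * (δ * A) := by positivity
    have e6 : 0 ≤ Slat ^ 2 * (Z + A * √Z) ^ 2 := by positivity
    have e7 : 0 ≤ (δ * A) ^ 2 := sq_nonneg _
    have e8 : (100 * Slat * (Z + A * √Z) + 2 * (δ * A)) ^ 2 = 10000 * (Slat ^ 2 * (Z + A * √Z) ^ 2)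
      + 400 * ((Slat * (Z + A * √Z)) * (δ * A)) + 4 * (δ * A) ^ 2 := by ring
    rw [e8]
    linarith
  have hsX : √X ≤ 100 * Slat * (Z + A * √Z) + 2 * (δ * A) :=
    (Real.sqrt_le_sqrt hXle).trans_eq (Real.sqrt_sq (by positivity))
  have hsE := Real.sqrt_nonneg E
  have hEs := Real.sq_sqrt hE0
  have hz := Real.sq_sqrt hZ0
  have a1 : 5 * √E * √X ≤ 500 * Slat * √E * Z + 500 * Slat * √E * (A * √Z)
      + 10 * √E * (δ * A) :=
    (mul_le_mul_of_nonneg_left hsX (by positivity)).trans_eq (by ring)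
  have a2 : 500 * Slat * √E * Z ≤ Z / 16 := by
    have := mul_le_mul_of_nonneg_right hsm hZ0
    linarith
  have a3 : 500 * Slat * √E * (A * √Z) ≤ Z / 16 + 4 * (500 * Slat * A) ^ 2 * E := by
    have h := two_mul_le_add_sq (√Z / 4) (2 * (500 * Slat * A) * √E)
    calc 500 * Slat * √E * (A * √Z) = 2 * (√Z / 4) * (2 * (500 * Slat * A) * √E) := by ring
      _ ≤ ((√Z / 4) ^ 2 + (2 * (500 * Slat * A) * √E) ^ 2) := by linarith
      _ = (√Z ^ 2 / 16 + 4 * (500 * Slat * A) ^ 2 * √E ^ 2) := by ring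
      _ ≤ _ := by
        rw [hz, hEs]
  have a4 : 12 * √E * (δ * A) ≤ E + 36 * A ^ 2 * δ ^ 2 := by
    have := sq_nonneg (√E - 6 * (δ * A))
    rw [sub_sq, hEs] at this
    linarith
  have a5 : 4 * (500 * Slat * A) ^ 2 * E + 2 * E ≤ 10 ^ 7 * Slat ^ 2 * (1 + A) ^ 2 * E := by
    refine le_of_eq_of_le (add_mul _ _ _).symm (mul_le_mul_of_nonneg_right ?_ hE0)
    have : 1 ≤ Slat ^ 2 := one_le_pow₀ hS
    have : 0 ≤ Slat ^ 2 * A := by positivity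
    have : 0 ≤ Slat ^ 2 * A ^ 2 := by positivity
    linarith
  have a6 : 0 ≤ A ^ 2 * δ ^ 2 := by positivity
  have a7 := sq_nonneg ‖v 0‖
  linarith

/-- Bounds on the background flow and on the forcing terms. -/
structure Fb (N : Finset Mode) (ε δ T A : ℝ) (u u' : ℝ → Mode → Fin 3 → ℂ) (f1 : ℝ → Mode → ℂ)
    (f2 : ℝ → Mode → Fin 3 → ℂ) (f3 f3' : ℝ → Mode → Fin 3 → Fin 3 → ℂ) : Prop where
  A0 : 0 ≤ A
  hu : ∀ t ∈ Set.Icc 0 T, ∀ F : Finset Mode, ∑ k ∈ F, W k ^ 2 * ‖u t k‖ ^ 2 ≤ A ^ 2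
  hu' : ∀ t ∈ Set.Icc 0 T, ∀ F : Finset Mode, ∑ k ∈ F, W k ^ 2 * ‖u' t k‖ ^ 2 ≤ A ^ 2
  du : ∀ t ∈ Set.Icc 0 T, ∀ k a, HasDerivAt (fun t => u t k a) (u' t k a) t
  hf1 : ∀ t ∈ Set.Icc 0 T, ∑ k ∈ N, W k ^ 2 * ‖f1 t k‖ ^ 2 ≤ (ε * A) ^ 2
  hf2 : ∀ t ∈ Set.Icc 0 T, ∀ k a, f2 t k a = 0
  hf3 : ∀ t ∈ Set.Icc 0 T, ∑ k ∈ N, W k ^ 2 * sM (f3 t) k ≤ (δ * A) ^ 2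
  hf3' : ∀ t ∈ Set.Icc 0 T, ∑ k ∈ N, W k ^ 2 * sM (f3' t) k ≤ (δ * A) ^ 2
  df3 : ∀ t ∈ Set.Icc 0 T, ∀ k a b, HasDerivAt (fun t => f3 t k a b) (f3' t k a b) t

section
variable {N : Finset Mode} {ε δ T A : ℝ} {u u' : ℝ → Mode → Fin 3 → ℂ} {f1 : ℝ → Mode → ℂ}
    {f2 : ℝ → Mode → Fin 3 → ℂ} {f3 f3' : ℝ → Mode → Fin 3 → Fin 3 → ℂ}
    {q : ℝ → Mode → ℂ} {v : ℝ → Mode → Fin 3 → ℂ} {V : ℝ → Mode → Fin 3 → Fin 3 → ℂ}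

lemma HH_zero (V : Mode → Fin 3 → Fin 3 → ℂ) (b : Fin 3) : HH V 0 b = 0 := by
  simp [HH, xi_zero]

lemma sg_zero (v : Mode → Fin 3 → ℂ) : sg v 0 = 0 := by simp [sg, xi_zero]

/-- The mean velocity is conserved. -/
lemma Gal.mean (h : Gal N ε δ T u f1 f2 f3 q v V) (hf : Fb N ε δ T A u u' f1 f2 f3 f3')
    {t : ℝ} (ht : t ∈ Set.Icc 0 T) : v t 0 = v 0 0 := by
  by_cases h0 : (0 : Mode) ∈ N
  · have hd : ∀ t ∈ Set.Icc 0 T, HasDerivAt (fun t => v t 0) 0 t := fun t ht =>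
      hasDerivAt_pi.2 fun a => (h.dv t ht 0 h0 a).congr_deriv (by
        simp [HH_zero, xi_zero, hf.hf2 t ht])
    exact constant_of_has_deriv_right_zero (fun t ht => (hd t ht).continuousAt.continuousWithinAt)
      (fun t ht => (hd t ⟨ht.1, ht.2.le⟩).hasDerivWithinAt) t ht
  · rw [h.sv t 0 h0, h.sv 0 0 h0]

/-- Growth rate of the first energy. -/
def GE (A : ℝ) : ℝ := 10 ^ 7 * Slat ^ 2 * (1 + A) ^ 2

/-- Inhomogeneity in the first energy estimate. -/
def BE (A ε δ m : ℝ) : ℝ := m + 50 * A ^ 2 * δ ^ 2 + ε * A ^ 2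

lemma GE_nonneg (A : ℝ) : 0 ≤ GE A := by unfold GE; positivity

lemma BE_nonneg {A ε δ m : ℝ} (hε : 0 ≤ ε) (hm : 0 ≤ m) : 0 ≤ BE A ε δ m := by
  unfold BE; positivity

lemma Gal.dEn_le (h : Gal N ε δ T u f1 f2 f3 q v V) (hf : Fb N ε δ T A u u' f1 f2 f3 f3')
    (hε : 0 < ε) (hδ : 0 < δ) {t : ℝ} (ht : t ∈ Set.Icc 0 T)
    (hsm : √(En N ε δ (q t) (v t) (V t)) * (10000 * Slat) ≤ 1) :
    dEn N ε δ (q t) (v t) (V t) (f1 t) (Src N u f3 v t) ≤ -(Dn N (v t)) / 2 - δ * Th N (V t)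
      + GE A * En N ε δ (q t) (v t) (V t) + BE A ε δ (‖v 0 0‖ ^ 2) := by
  have := dEn_le_small (q := q t) (v := v t) (V := V t) (f1 := f1 t) (u := u t) (f3 := f3 t) hf.A0
    hε hδ (h.sv t) (hf.hu t ht) (hf.hf1 t ht) (hf.hf3 t ht) hsm
  rw [h.mean hf ht] at this
  unfold GE BE
  refine this.trans (le_of_eq (by ring))

/-- First energy estimate. -/
lemma Gal.En_le (h : Gal N ε δ T u f1 f2 f3 q v V) (hf : Fb N ε δ T A u u' f1 f2 f3 f3')
    (hε : 0 < ε) (hδ : 0 < δ) {M : ℝ}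
    (hM : (En N ε δ (q 0) (v 0) (V 0) + BE A ε δ (‖v 0 0‖ ^ 2) * T) * exp (GE A * T) ≤ M)
    (hsm : √M * (10000 * Slat) < 1) {t : ℝ} (ht : t ∈ Set.Icc 0 T) :
    En N ε δ (q t) (v t) (V t) ≤ M := by
  set e := fun t => En N ε δ (q t) (v t) (V t) with he
  have hS := one_le_Slat
  have hT : 0 ≤ T := ht.1.trans ht.2
  have he0 : 0 ≤ e 0 := En_nonneg hε.le hδ.le
  have hB : 0 ≤ BE A ε δ (‖v 0 0‖ ^ 2) := BE_nonneg hε.le (sq_nonneg _)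
  have hM0 : 0 ≤ M := le_trans (by positivity) hM
  set c := ((10000 * Slat)⁻¹) ^ 2 with hc
  have hMc : M < c := by
    have h1 : √M < (10000 * Slat)⁻¹ := by
      rw [← one_div, lt_div_iff₀ (by positivity)]; exact hsm
    calc M = √M ^ 2 := (Real.sq_sqrt hM0).symm
      _ < _ := pow_lt_pow_left₀ h1 (Real.sqrt_nonneg _) two_ne_zero
  have hd : ∀ t ∈ Set.Icc 0 T, HasDerivAt e
      (dEn N ε δ (q t) (v t) (V t) (f1 t) (Src N u f3 v t)) t := fun t ht =>
    h.hasDerivAt_En hf.hf2 hε.ne' hδ.ne' ht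
  have hcont : ContinuousOn e (Set.Icc 0 T) := fun t ht => (hd t ht).continuousAt.continuousWithinAt
  have step : ∀ s ∈ Set.Icc 0 T, (∀ t ∈ Set.Icc 0 s, e t ≤ c) → e s ≤ M := by
    intro s hs hle
    have hsub : Set.Icc 0 s ⊆ Set.Icc 0 T := Set.Icc_subset_Icc_right hs.2
    refine (gronwall_linear (GE_nonneg A) hB (hcont.mono hsub)
      (fun t ht => hd t (hsub (Set.Ioo_subset_Icc_self ht))) (fun t ht => ?_) le_rfl
      (Set.right_mem_Icc.2 hs.1)).trans (le_trans ?_ hM)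
    · have ht' := Set.Ioo_subset_Icc_self ht
      have h1 := h.dEn_le hf hε hδ (hsub ht') (by
        have := Real.sqrt_le_sqrt (hle t ht')
        rw [hc, Real.sqrt_sq (by positivity)] at this
        calc _ ≤ (10000 * Slat)⁻¹ * (10000 * Slat) :=
              mul_le_mul_of_nonneg_right this (by positivity)
          _ = 1 := inv_mul_cancel₀ (by positivity))
      have := Dn_nonneg N (v t)
      have := mul_nonneg hδ.le (Th_nonneg N (V t))
      linarith
    · rw [sub_zero]
      have hs1 := hs.1
      have hs2 := hs.2
      have := GE_nonneg A
      gcongr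
  refine step t ht fun s hs => (bootstrap hcont ?_ (fun s hs hle => (step s hs hle).trans_lt hMc)
    ⟨hs.1, hs.2.trans ht.2⟩).le
  refine lt_of_le_of_lt (le_trans ?_ hM) hMc
  have h1 : 1 ≤ exp (GE A * T) := Real.one_le_exp (mul_nonneg (GE_nonneg A) hT)
  have h2 : 0 ≤ BE A ε δ (‖v 0 0‖ ^ 2) * T := mul_nonneg hB hT
  calc e 0 ≤ (e 0 + BE A ε δ (‖v 0 0‖ ^ 2) * T) * 1 := by linarith
    _ ≤ _ := mul_le_mul_of_nonneg_left h1 (by positivity)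

end

/-- Leray projection in Fourier variables. -/
def Pr (v : Mode → Fin 3 → ℂ) (k : Mode) (a : Fin 3) : ℂ :=
  v k a - xi k a * (((lam k)⁻¹ : ℝ) * sg v k)

/-- Gradient part in Fourier variables. -/
def Gr (v : Mode → Fin 3 → ℂ) (k : Mode) (a : Fin 3) : ℂ :=
  xi k a * (((lam k)⁻¹ : ℝ) * sg v k)

lemma Pr_add_Gr (v : Mode → Fin 3 → ℂ) (k : Mode) (a : Fin 3) : Pr v k a + Gr v k a = v k a := by
  simp [Pr, Gr]

lemma om_Gr (v : Mode → Fin 3 → ℂ) (k : Mode) (a b : Fin 3) : om (Gr v) k a b = 0 := by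
  simp only [om, Gr]; ring

lemma om_Pr (v : Mode → Fin 3 → ℂ) (k : Mode) (a b : Fin 3) : om (Pr v) k a b = om v k a b := by
  simp only [om, Pr]; ring

lemma sg_Gr (v : Mode → Fin 3 → ℂ) (k : Mode) : sg (Gr v) k = sg v k := by
  by_cases hk : k = 0
  · subst hk; rw [sg_zero, sg_zero]
  · have h : sg (Gr v) k = ((lam k : ℝ) : ℂ) * (((lam k)⁻¹ : ℝ) * sg v k) := by
      simp only [sg, Gr, lam, Fin.sum_univ_three]; push_cast; ring
    rw [h, ← mul_assoc, ← Complex.ofReal_mul, mul_inv_cancel₀ (lam_pos hk).ne', Complex.ofReal_one,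
      one_mul]

lemma sg_Pr (v : Mode → Fin 3 → ℂ) (k : Mode) : sg (Pr v) k = 0 := by
  have h : sg (Pr v) k = sg v k - sg (Gr v) k := by
    simp only [sg, Gr, Pr, Fin.sum_univ_three]; ring
  rw [h, sg_Gr, sub_self]

lemma Gr_zero (v : Mode → Fin 3 → ℂ) : Gr v 0 = 0 := by ext a; simp [Gr, xi_zero]

lemma Pr_zero (v : Mode → Fin 3 → ℂ) : Pr v 0 = v 0 := by ext a; simp [Pr, xi_zero]

lemma lam_sv_Pr (v : Mode → Fin 3 → ℂ) (k : Mode) : lam k * sv (Pr v) k = sM (om v) k / 2 := by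
  rw [← sM_om_add, sg_Pr]; simp [sM, om_Pr]

lemma lam_sv_Gr (v : Mode → Fin 3 → ℂ) (k : Mode) : lam k * sv (Gr v) k = ‖sg v k‖ ^ 2 := by
  rw [← sM_om_add, sg_Gr]; simp [sM, om_Gr]

lemma sv_Pr_le (v : Mode → Fin 3 → ℂ) (k : Mode) : sv (Pr v) k ≤ sv v k := by
  by_cases hk : k = 0
  · subst hk; simp [sv, Pr_zero]
  · refine le_of_mul_le_mul_left ?_ (lam_pos hk)
    rw [lam_sv_Pr, ← sM_om_add]
    linarith [sq_nonneg ‖sg v k‖]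

lemma H2n_Pr_le (N : Finset Mode) (v : Mode → Fin 3 → ℂ) : H2n N (Pr v) ≤ 3 * H2n N v := by
  unfold H2n
  rw [Finset.mul_sum]
  refine Finset.sum_le_sum fun k _ => ?_
  have := ((norm_sq_le_sv (Pr v) k).trans (sv_Pr_le v k)).trans (sv_le_norm_sq v k)
  calc _ ≤ W k ^ 2 * (3 * ‖v k‖ ^ 2) := mul_le_mul_of_nonneg_left this (sq_nonneg _)
    _ = _ := by ring

lemma W_Gr_le (v : Mode → Fin 3 → ℂ) (k : Mode) : W k * ‖Gr v k‖ ^ 2 ≤ 2 * ‖sg v k‖ ^ 2 := by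
  by_cases hk : k = 0
  · subst hk; simp [Gr_zero]
  · have h1 := W_le_two_lam hk
    have h2 := norm_sq_le_sv (Gr v) k
    have h3 := lam_sv_Gr v k
    calc _ ≤ 2 * lam k * sv (Gr v) k := mul_le_mul h1 h2 (sq_nonneg _) (by
          have := lam_nonneg k; linarith)
      _ = _ := by rw [← h3]; ring

lemma W_Pr_le {v : Mode → Fin 3 → ℂ} {k : Mode} (hk : k ≠ 0) :
    W k * ‖Pr v k‖ ^ 2 ≤ sM (om v) k := by
  have h1 := W_le_two_lam hk
  have h2 := norm_sq_le_sv (Pr v) k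
  have h3 := lam_sv_Pr v k
  calc _ ≤ 2 * lam k * sv (Pr v) k := mul_le_mul h1 h2 (sq_nonneg _) (by
        have := lam_nonneg k; linarith)
    _ = 2 * (lam k * sv (Pr v) k) := by ring
    _ = _ := by rw [h3]; ring

lemma Pr_eq_zero {v : Mode → Fin 3 → ℂ} {k : Mode} (h : v k = 0) : Pr v k = 0 := by
  ext a; simp [Pr, sg, h]

lemma Gr_eq_zero {v : Mode → Fin 3 → ℂ} {k : Mode} (h : v k = 0) : Gr v k = 0 := by
  ext a; simp [Gr, sg, h]

lemma sum_supp_le {N : Finset Mode} {g : Mode → ℝ} (hg : ∀ k, 0 ≤ g k) (hs : ∀ k ∉ N, g k = 0)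
    (F : Finset Mode) : ∑ k ∈ F, g k ≤ ∑ k ∈ N, g k := by
  classical
  calc _ ≤ ∑ k ∈ F ∪ N, g k := Finset.sum_le_sum_of_subset_of_nonneg
        Finset.subset_union_left fun k _ _ => hg k
    _ = _ := (Finset.sum_subset Finset.subset_union_right fun k _ hk => hs k hk).symm

lemma sum_W_sM_le_of_norm_le (N : Finset Mode) {S : Mode → Fin 3 → Fin 3 → ℂ} {x : Mode → ℝ}
    (h : ∀ k a b, ‖S k a b‖ ≤ x k) : ∑ k ∈ N, W k * sM S k ≤ 9 * ∑ k ∈ N, W k * x k ^ 2 := by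
  rw [Finset.mul_sum]
  refine Finset.sum_le_sum fun k _ => ?_
  have : sM S k ≤ 9 * x k ^ 2 := by
    calc sM S k ≤ ∑ _a : Fin 3, ∑ _b : Fin 3, x k ^ 2 :=
          Finset.sum_le_sum fun a _ => Finset.sum_le_sum fun b _ =>
            pow_le_pow_left₀ (norm_nonneg _) (h k a b) 2
      _ = _ := by simp; ring
  calc _ ≤ W k * (9 * x k ^ 2) := mul_le_mul_of_nonneg_left this (W_pos k).le
    _ = _ := by ring

lemma sg_HH_sq_inv_le (B : Mode → Fin 3 → Fin 3 → ℂ) (k : Mode) :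
    (lam k)⁻¹ * ‖sg (HH B) k‖ ^ 2 ≤ W k * sM B k := by
  by_cases hk : k = 0
  · subst hk; rw [sg_zero]; simpa using mul_nonneg (W_pos 0).le (sM_nonneg B 0)
  · have := mul_le_mul_of_nonneg_left (sg_HH_sq_le B k) (inv_pos.2 (lam_pos hk)).le
    refine this.trans ?_
    have e : (lam k)⁻¹ * (lam k ^ 2 * sM B k) = lam k * sM B k := by
      have := (lam_pos hk).ne'; field_simp
    rw [e]
    exact mul_le_mul_of_nonneg_right (lam_le_W k) (sM_nonneg _ _)

variable {N : Finset Mode} {u v : Mode → Fin 3 → ℂ} {A : ℝ}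

/-- The part of the interaction containing the gradient component. -/
lemma sum_W_sM_Bq_sub_le (hs : ∀ k ∉ N, v k = 0)
    (hu : ∀ F : Finset Mode, ∑ k ∈ F, W k ^ 2 * ‖u k‖ ^ 2 ≤ A ^ 2) :
    ∑ k ∈ N, W k * sM (fun k a b => Bq N u v k a b - Bq N u (Pr v) k a b) k ≤
      1000 * Slat * (H2n N v + A ^ 2) * ∑ k ∈ N, ‖sg v k‖ ^ 2 := by
  have hS := one_le_Slat
  set g : Mode → ℝ := fun k => ‖Gr v k‖
  set G := ∑ k ∈ N, W k * g k ^ 2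
  have hG0 : 0 ≤ G := Finset.sum_nonneg fun k _ => mul_nonneg (W_pos k).le (sq_nonneg _)
  have hG : G ≤ 2 * ∑ k ∈ N, ‖sg v k‖ ^ 2 := by
    rw [Finset.mul_sum]; exact Finset.sum_le_sum fun k _ => W_Gr_le v k
  have hvs : ∀ F : Finset Mode, ∑ k ∈ F, W k ^ 2 * ‖Pr v k‖ ^ 2 ≤ 3 * H2n N v := fun F =>
    (sum_supp_le (fun k => by positivity) (fun k hk => by simp [Pr_eq_zero (hs k hk)]) F).trans
      (H2n_Pr_le N v)
  have hgs : ∀ F : Finset Mode, ∑ k ∈ F, W k * g k ^ 2 ≤ G := fun F =>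
    sum_supp_le (fun k => mul_nonneg (W_pos k).le (sq_nonneg _))
      (fun k hk => by simp [g, Gr_eq_zero (hs k hk)]) F
  have h1 := cv_h1_right N N (A := g) (b := fun k => ‖v k‖)
    hgs
  have h2 := cv_h1_left N N (A := fun k => ‖Pr v k‖) (b := g)
    hvs
  have h3 := cv_h1_left N N (A := fun k => ‖u k‖) (b := g)
    hu
  have hn : ∀ k a b, ‖Bq N u v k a b - Bq N u (Pr v) k a b‖ ≤ cv N g (fun k => ‖v k‖) k
      + cv N (fun k => ‖Pr v k‖) g k + 2 * cv N (fun k => ‖u k‖) g k := by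
    intro k a b
    have e : Bq N u v k a b - Bq N u (Pr v) k a b =
        cv N (fun k => Gr v k a) (fun k => v k b) k + cv N (fun k => Pr v k a) (fun k => Gr v k b) k
        + (cv N (fun k => u k a) (fun k => Gr v k b) k
          + cv N (fun k => u k b) (fun k => Gr v k a) k) := by
      unfold Bq cv
      simp only [← Finset.sum_add_distrib, ← Finset.sum_sub_distrib]
      refine Finset.sum_congr rfl fun j _ => ?_
      linear_combination (-v j b) * Pr_add_Gr v (k - j) a
        - (Pr v (k - j) a + u (k - j) a) * Pr_add_Gr v j b - u (k - j) b * Pr_add_Gr v j a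
    rw [e]
    have n1 := norm_cv_le N (Gr v) v k a b
    have n2 := norm_cv_le N (Pr v) (Gr v) k a b
    have n3 := norm_cv_le N u (Gr v) k a b
    have n4 := norm_cv_le N u (Gr v) k b a
    refine (norm_add_le _ _).trans ?_
    refine (add_le_add (norm_add_le _ _) (norm_add_le _ _)).trans ?_
    simp only [g]
    linarith
  refine (sum_W_sM_le_of_norm_le N hn).trans ?_
  have h4 : ∑ k ∈ N, W k * (cv N g (fun k => ‖v k‖) k
      + cv N (fun k => ‖Pr v k‖) g k + 2 * cv N (fun k => ‖u k‖) g k) ^ 2 ≤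
      3 * (∑ k ∈ N, W k * cv N g (fun k => ‖v k‖) k ^ 2)
      + 3 * (∑ k ∈ N, W k * cv N (fun k => ‖Pr v k‖) g k ^ 2)
      + 12 * (∑ k ∈ N, W k * cv N (fun k => ‖u k‖) g k ^ 2) := by
    simp only [Finset.mul_sum, ← Finset.sum_add_distrib]
    refine Finset.sum_le_sum fun k _ => ?_
    set x := cv N g (fun k => ‖v k‖) k
    set y := cv N (fun k => ‖Pr v k‖) g k
    set z := cv N (fun k => ‖u k‖) g k
    have : (x + y + 2 * z) ^ 2 ≤ 3 * x ^ 2 + 3 * y ^ 2 + 12 * z ^ 2 := by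
      nlinarith [sq_nonneg (x - y), sq_nonneg (x - 2 * z), sq_nonneg (y - 2 * z)]
    calc _ ≤ W k * (3 * x ^ 2 + 3 * y ^ 2 + 12 * z ^ 2) :=
          mul_le_mul_of_nonneg_left this (W_pos k).le
      _ = _ := by ring
  have hZ := H2n_nonneg N v
  have h1' : ∑ k ∈ N, W k * cv N g (fun k => ‖v k‖) k ^ 2 ≤ 4 * Slat * G * H2n N v := h1
  have h2' : ∑ k ∈ N, W k * cv N (fun k => ‖Pr v k‖) g k ^ 2 ≤ 4 * Slat * (3 * H2n N v) * G := h2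
  have h3' : ∑ k ∈ N, W k * cv N (fun k => ‖u k‖) g k ^ 2 ≤ 4 * Slat * A ^ 2 * G := h3
  have p1 : 0 ≤ Slat * H2n N v * G := by positivity
  have p2 : 0 ≤ Slat * A ^ 2 * G := by positivity
  calc _ ≤ 500 * Slat * (H2n N v + A ^ 2) * G := by nlinarith
    _ ≤ 500 * Slat * (H2n N v + A ^ 2) * (2 * ∑ k ∈ N, ‖sg v k‖ ^ 2) :=
        mul_le_mul_of_nonneg_left hG (by positivity)
    _ = _ := by ring

/-- Derivative of the interaction. -/
def dBq (N : Finset Mode) (u u' w w' : Mode → Fin 3 → ℂ) (k : Mode) (a b : Fin 3) : ℂ :=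
  (cv N (fun k => w' k a) (fun k => w k b) k + cv N (fun k => w k a) (fun k => w' k b) k)
    + (cv N (fun k => u' k a) (fun k => w k b) k + cv N (fun k => u k a) (fun k => w' k b) k)
    + (cv N (fun k => u' k b) (fun k => w k a) k + cv N (fun k => u k b) (fun k => w' k a) k)

lemma hasDerivAt_cv {A b : ℝ → Mode → ℂ} {A' b' : Mode → ℂ} {t : ℝ}
    (hA : ∀ k, HasDerivAt (fun t => A t k) (A' k) t) (hb : ∀ k, HasDerivAt (fun t => b t k) (b' k) t)
    (k : Mode) : HasDerivAt (fun t => cv N (A t) (b t) k) (cv N A' (b t) k + cv N (A t) b' k) t := by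
  unfold cv
  rw [← Finset.sum_add_distrib]
  exact HasDerivAt.fun_sum fun j _ => (hA (k - j)).mul (hb j)

lemma hasDerivAt_Bq {u w : ℝ → Mode → Fin 3 → ℂ} {u' w' : Mode → Fin 3 → ℂ} {t : ℝ}
    (hu : ∀ k a, HasDerivAt (fun t => u t k a) (u' k a) t)
    (hw : ∀ k a, HasDerivAt (fun t => w t k a) (w' k a) t) (k : Mode) (a b : Fin 3) :
    HasDerivAt (fun t => Bq N (u t) (w t) k a b) (dBq N (u t) u' (w t) w' k a b) t :=
  ((hasDerivAt_cv (fun k => hw k a) (fun k => hw k b) k).add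
    (hasDerivAt_cv (fun k => hu k a) (fun k => hw k b) k)).add
    (hasDerivAt_cv (fun k => hu k b) (fun k => hw k a) k)

lemma sum_W_sM_dBq_le {u' w w' : Mode → Fin 3 → ℂ} {P : ℝ} (hs : ∀ k ∉ N, w k = 0)
    (hs' : ∀ k ∉ N, w' k = 0)
    (hu : ∀ F : Finset Mode, ∑ k ∈ F, W k ^ 2 * ‖u k‖ ^ 2 ≤ A ^ 2)
    (hu' : ∀ F : Finset Mode, ∑ k ∈ F, W k ^ 2 * ‖u' k‖ ^ 2 ≤ A ^ 2)
    (hP : ∑ k ∈ N, W k * ‖w' k‖ ^ 2 ≤ P) :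
    ∑ k ∈ N, W k * sM (dBq N u u' w w') k ≤
      288 * Slat * (H2n N w * P + 2 * A ^ 2 * H2n N w + 2 * A ^ 2 * P) := by
  have hS := one_le_Slat
  have hw : ∀ F : Finset Mode, ∑ k ∈ F, W k ^ 2 * ‖w k‖ ^ 2 ≤ H2n N w := fun F =>
    sum_supp_le (fun k => by positivity) (fun k hk => by simp [hs k hk]) F
  have hw' : ∀ F : Finset Mode, ∑ k ∈ F, W k * ‖w' k‖ ^ 2 ≤ P := fun F =>
    (sum_supp_le (fun k => mul_nonneg (W_pos k).le (sq_nonneg _))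
      (fun k hk => by simp [hs' k hk]) F).trans hP
  have h1 := cv_h1_right N N (A := fun k => ‖w' k‖) (b := fun k => ‖w k‖)
    hw'
  have h2 := cv_h1_left N N (A := fun k => ‖w k‖) (b := fun k => ‖w' k‖)
    hw
  have h3 := cv_h1_left N N (A := fun k => ‖u' k‖) (b := fun k => ‖w k‖)
    hu'
  have h4 := cv_h1_left N N (A := fun k => ‖u k‖) (b := fun k => ‖w' k‖)
    hu
  have hn : ∀ k a b, ‖dBq N u u' w w' k a b‖ ≤ cv N (fun k => ‖w' k‖) (fun k => ‖w k‖) k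
      + cv N (fun k => ‖w k‖) (fun k => ‖w' k‖) k + 2 * cv N (fun k => ‖u' k‖) (fun k => ‖w k‖) k
      + 2 * cv N (fun k => ‖u k‖) (fun k => ‖w' k‖) k := by
    intro k a b
    have n1 := norm_cv_le N w' w k a b
    have n2 := norm_cv_le N w w' k a b
    have n3 := norm_cv_le N u' w k a b
    have n4 := norm_cv_le N u w' k a b
    have n5 := norm_cv_le N u' w k b a
    have n6 := norm_cv_le N u w' k b a
    unfold dBq
    refine norm_add₃_le.trans ?_
    refine (add_le_add (add_le_add (norm_add_le _ _) (norm_add_le _ _)) (norm_add_le _ _)).trans ?_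
    linarith
  refine (sum_W_sM_le_of_norm_le N hn).trans ?_
  have hw1 : ∑ k ∈ N, W k * ‖w k‖ ^ 2 ≤ H2n N w := Finset.sum_le_sum fun k _ =>
    mul_le_mul_of_nonneg_right (by have := one_le_W k; nlinarith) (sq_nonneg _)
  have hZ := H2n_nonneg N w
  have hP0 : 0 ≤ P := (Finset.sum_nonneg fun k _ => mul_nonneg (W_pos k).le (sq_nonneg _)).trans hP
  set X1 := cv N (fun k => ‖w' k‖) (fun k => ‖w k‖)
  set X2 := cv N (fun k => ‖w k‖) (fun k => ‖w' k‖)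
  set X3 := cv N (fun k => ‖u' k‖) (fun k => ‖w k‖)
  set X4 := cv N (fun k => ‖u k‖) (fun k => ‖w' k‖)
  have h5 : ∑ k ∈ N, W k * (X1 k + X2 k + 2 * X3 k + 2 * X4 k) ^ 2 ≤
      4 * (∑ k ∈ N, W k * X1 k ^ 2) + 4 * (∑ k ∈ N, W k * X2 k ^ 2)
      + 16 * (∑ k ∈ N, W k * X3 k ^ 2) + 16 * (∑ k ∈ N, W k * X4 k ^ 2) := by
    simp only [Finset.mul_sum, ← Finset.sum_add_distrib]
    refine Finset.sum_le_sum fun k _ => ?_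
    have : (X1 k + X2 k + 2 * X3 k + 2 * X4 k) ^ 2 ≤
        4 * X1 k ^ 2 + 4 * X2 k ^ 2 + 16 * X3 k ^ 2 + 16 * X4 k ^ 2 := by
      nlinarith [sq_nonneg (X1 k - X2 k), sq_nonneg (X1 k - 2 * X3 k), sq_nonneg (X1 k - 2 * X4 k),
        sq_nonneg (X2 k - 2 * X3 k), sq_nonneg (X2 k - 2 * X4 k), sq_nonneg (X3 k - X4 k)]
    calc _ ≤ W k * (4 * X1 k ^ 2 + 4 * X2 k ^ 2 + 16 * X3 k ^ 2 + 16 * X4 k ^ 2) :=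
          mul_le_mul_of_nonneg_left this (W_pos k).le
      _ = _ := by ring
  have h2' : ∑ k ∈ N, W k * X2 k ^ 2 ≤ 4 * Slat * H2n N w * P :=
    h2.trans (mul_le_mul_of_nonneg_left hP (by positivity))
  have h3' : ∑ k ∈ N, W k * X3 k ^ 2 ≤ 4 * Slat * A ^ 2 * H2n N w :=
    h3.trans (mul_le_mul_of_nonneg_left hw1 (by positivity))
  have h4' : ∑ k ∈ N, W k * X4 k ^ 2 ≤ 4 * Slat * A ^ 2 * P :=
    h4.trans (mul_le_mul_of_nonneg_left hP (by positivity))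
  have h1' : ∑ k ∈ N, W k * X1 k ^ 2 ≤ 4 * Slat * P * H2n N w := h1
  linarith

lemma exists_relaxation {g : ℝ → ℂ} {T δ : ℝ} (hT : 0 ≤ T)
    (hg : ContinuousOn g (Set.Icc 0 T)) (L0 : ℂ) :
    ∃ L : ℝ → ℂ, L 0 = L0 ∧ ∀ t ∈ Set.Icc 0 T, HasDerivAt L (δ⁻¹ • (-L t + g t)) t := by
  set G := Set.IccExtend hT (Set.domRestrict (Set.Icc 0 T) g) with hG
  have hGc : Continuous G := (continuousOn_iff_continuous_domRestrict.1 hg).Icc_extend'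
  have hGe : ∀ t ∈ Set.Icc 0 T, G t = g t := fun t ht => by
    rw [hG, Set.IccExtend_of_mem _ _ ht]; rfl
  set I : ℝ → ℂ := fun t => ∫ s in (0:ℝ)..t, (exp (s / δ) : ℂ) * (δ⁻¹ * G s)
  have hc : Continuous fun s : ℝ => (exp (s / δ) : ℂ) * (δ⁻¹ * G s) := by fun_prop
  refine ⟨fun t => (exp (-t / δ) : ℂ) * (L0 + I t), by simp [I], fun t ht => ?_⟩
  have hI : HasDerivAt I ((exp (t / δ) : ℂ) * (δ⁻¹ * G t)) t :=
    intervalIntegral.integral_hasDerivAt_right (hc.intervalIntegrable _ _)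
      (hc.stronglyMeasurableAtFilter _ _) hc.continuousAt
  have he : HasDerivAt (fun t : ℝ => (exp (-t / δ) : ℂ)) ((exp (-t / δ) * (-1 / δ) : ℝ) : ℂ) t :=
    (((hasDerivAt_id t).neg.div_const δ).exp).ofReal_comp
  refine (he.mul (hI.const_add L0)).congr_deriv ?_
  rw [← hGe t ht]
  have hee : (exp (-t / δ) : ℂ) * (exp (t / δ) : ℂ) = 1 := by
    rw [← Complex.ofReal_mul, ← Real.exp_add]; simp [neg_div]
  simp only [Complex.real_smul, Complex.ofReal_mul, Complex.ofReal_div, Complex.ofReal_neg,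
    Complex.ofReal_one, Complex.ofReal_inv]
  linear_combination (δ : ℂ)⁻¹ * G t * hee

section
variable {N : Finset Mode} {ε δ A : ℝ} {q : Mode → ℂ} {u v : Mode → Fin 3 → ℂ}
  {V : Mode → Fin 3 → Fin 3 → ℂ}

lemma sum_sM_om_le_En (hε : 0 ≤ ε) (hδ : 0 ≤ δ) :
    ∑ k ∈ N, (1 + 4 * δ * lam k) * sM (om v) k ≤ 4 * En N ε δ q v V := by
  refine le_trans ?_ (mul_le_mul_of_nonneg_left (sum_eW_le_En hε hδ) (by norm_num))
  simp only [sM, Finset.mul_sum]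
  refine Finset.sum_le_sum fun k _ => Finset.sum_le_sum fun a _ => Finset.sum_le_sum fun b _ => ?_
  rw [eW_sq]
  have := sq_nonneg ‖om v k a b + (2 * δ) • -om (HH V) k a b‖
  linarith

lemma W_sum_Pr_le (hε : 0 ≤ ε) (hδ : 0 ≤ δ) :
    ∑ k ∈ N, W k * ‖Pr v k‖ ^ 2 ≤ ‖v 0‖ ^ 2 + 4 * En N ε δ q v V := by
  classical
  have key : ∀ k, W k * ‖Pr v k‖ ^ 2 ≤
      (if k = 0 then ‖v 0‖ ^ 2 else 0) + (1 + 4 * δ * lam k) * sM (om v) k := by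
    intro k
    have h1 := sM_nonneg (om v) k
    have h2 : 0 ≤ 4 * δ * lam k * sM (om v) k :=
      mul_nonneg (mul_nonneg (by linarith) (lam_nonneg k)) h1
    split_ifs with hk
    · subst hk; rw [Pr_zero]; simp only [W, lam_zero]; linarith
    · have := W_Pr_le (v := v) hk; linarith
  refine (Finset.sum_le_sum fun k _ => key k).trans ?_
  rw [Finset.sum_add_distrib]
  refine add_le_add ?_ (sum_sM_om_le_En hε hδ)
  rw [Finset.sum_ite_eq']
  split_ifs
  · exact le_rfl
  · exact sq_nonneg _

lemma H2n_Pr_le_En (hε : 0 ≤ ε) (hδ : 0 < δ) :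
    H2n N (Pr v) ≤ ‖v 0‖ ^ 2 + 4 * (En N ε δ q v V / δ) := by
  have h1 := H2n_le (N := N) (v := Pr v)
  rw [Pr_zero] at h1
  have h2 : Dn N (Pr v) = ∑ k ∈ N, lam k * sM (om v) k := by
    unfold Dn
    exact Finset.sum_congr rfl fun k _ => by rw [sg_Pr]; simp [sM, om_Pr]
  have h3 : 4 * δ * ∑ k ∈ N, lam k * sM (om v) k ≤ 4 * En N ε δ q v V := by
    refine le_trans ?_ (sum_sM_om_le_En (N := N) (q := q) (v := v) (V := V) hε hδ.le)
    rw [Finset.mul_sum]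
    refine Finset.sum_le_sum fun k _ => ?_
    have := sM_nonneg (om v) k
    linarith
  have h4 : Dn N (Pr v) ≤ En N ε δ q v V / δ := by
    rw [h2, le_div_iff₀ hδ]; linarith
  linarith

lemma sum_W_sM_Bq_Pr_le {f3 : Mode → Fin 3 → Fin 3 → ℂ} {Q r : ℝ} (hQ : 1 ≤ Q) (hr : 0 < r)
    (hr1 : r ≤ 1) (hε : 0 ≤ ε) (hs : ∀ k ∉ N, v k = 0)
    (hu : ∀ F : Finset Mode, ∑ k ∈ F, W k ^ 2 * ‖u k‖ ^ 2 ≤ Q ^ 2)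
    (hf3 : ∑ k ∈ N, W k ^ 2 * sM f3 k ≤ (r ^ 4 * Q) ^ 2)
    (hm : ‖v 0‖ ^ 2 ≤ Q * r ^ 2) (hE : En N ε (r ^ 4) q v V ≤ Q * r ^ 2) :
    ∑ k ∈ N, W k * sM (fun k a b => Bq N u (Pr v) k a b + f3 k a b) k ≤ 6500 * Slat * Q ^ 3 := by
  have hS := one_le_Slat
  set x : Mode → ℝ := cv N (fun k => ‖Pr v k‖) (fun k => ‖Pr v k‖)
  set y : Mode → ℝ := cv N (fun k => ‖u k‖) (fun k => ‖Pr v k‖)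
  have hδ : 0 < r ^ 4 := by positivity
  have hG := (W_sum_Pr_le (N := N) (q := q) (v := v) (V := V) hε hδ.le)
  set G := ∑ k ∈ N, W k * ‖Pr v k‖ ^ 2
  have hG0 : 0 ≤ G := Finset.sum_nonneg fun k _ => mul_nonneg (W_pos k).le (sq_nonneg _)
  have hH := (H2n_Pr_le_En (N := N) (q := q) (v := v) (V := V) hε hδ)
  have hw : ∀ F : Finset Mode, ∑ k ∈ F, W k ^ 2 * ‖Pr v k‖ ^ 2 ≤ H2n N (Pr v) := fun F =>
    sum_supp_le (fun k => by positivity) (fun k hk => by simp [Pr_eq_zero (hs k hk)]) F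
  have h1 : ∑ k ∈ N, W k * x k ^ 2 ≤ 4 * Slat * H2n N (Pr v) * G := cv_h1_left N N hw
  have h2 : ∑ k ∈ N, W k * y k ^ 2 ≤ 4 * Slat * Q ^ 2 * G := cv_h1_left N N hu
  have key : ∀ k, W k * sM (fun k a b => Bq N u (Pr v) k a b + f3 k a b) k ≤
      36 * (W k * x k ^ 2) + 144 * (W k * y k ^ 2) + 2 * (W k ^ 2 * sM f3 k) := by
    intro k
    have h3 : sM (fun k a b => Bq N u (Pr v) k a b + f3 k a b) k ≤
        36 * x k ^ 2 + 144 * y k ^ 2 + 2 * sM f3 k := by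
      have : ∀ a b, ‖Bq N u (Pr v) k a b + f3 k a b‖ ^ 2 ≤
          (4 * x k ^ 2 + 16 * y k ^ 2) + 2 * ‖f3 k a b‖ ^ 2 := by
        intro a b
        have n1 := norm_add_le (Bq N u (Pr v) k a b) (f3 k a b)
        have n2 : ‖Bq N u (Pr v) k a b‖ ≤ x k + 2 * y k := norm_Bq_le N u (Pr v) k a b
        have n3 := pow_le_pow_left₀ (norm_nonneg _) (n1.trans (add_le_add_left n2 _)) 2
        refine n3.trans ?_
        nlinarith [sq_nonneg (x k + 2 * y k - ‖f3 k a b‖), sq_nonneg (x k - 2 * y k)]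
      refine (Finset.sum_le_sum fun a _ => Finset.sum_le_sum fun b _ => this a b).trans
        (le_of_eq ?_)
      simp only [sM, Finset.sum_add_distrib, ← Finset.mul_sum, Finset.sum_const, Finset.card_univ,
        Fintype.card_fin, nsmul_eq_mul]
      push_cast
      ring
    have h4 : W k * sM f3 k ≤ W k ^ 2 * sM f3 k :=
      mul_le_mul_of_nonneg_right (by have := one_le_W k; nlinarith) (sM_nonneg _ _)
    have := mul_le_mul_of_nonneg_left h3 (W_pos k).le
    linarith
  refine (Finset.sum_le_sum fun k _ => key k).trans ?_
  rw [Finset.sum_add_distrib, Finset.sum_add_distrib, ← Finset.mul_sum, ← Finset.mul_sum,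
    ← Finset.mul_sum]
  have hr2 : r ^ 2 ≤ 1 := pow_le_one₀ hr.le hr1
  have hr4 : r ^ 4 ≤ 1 := pow_le_one₀ hr.le hr1
  have g1 : G ≤ 5 * Q * r ^ 2 := by linarith
  have g2 : H2n N (Pr v) * r ^ 2 ≤ 5 * Q := by
    have e1 : En N ε (r ^ 4) q v V / r ^ 4 * r ^ 2 ≤ Q := by
      rw [div_mul_eq_mul_div, div_le_iff₀ hδ]
      calc _ ≤ Q * r ^ 2 * r ^ 2 := mul_le_mul_of_nonneg_right hE (by positivity)
        _ = _ := by ring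
    have e2 : ‖v 0‖ ^ 2 * r ^ 2 ≤ Q := by
      calc _ ≤ Q * r ^ 2 * r ^ 2 := mul_le_mul_of_nonneg_right hm (by positivity)
        _ = Q * r ^ 4 := by ring
        _ ≤ Q * 1 := by gcongr
        _ = Q := mul_one _
    have := mul_le_mul_of_nonneg_right hH (sq_nonneg r)
    linarith
  have g3 : H2n N (Pr v) * G ≤ 25 * Q ^ 2 := by
    calc _ ≤ H2n N (Pr v) * (5 * Q * r ^ 2) := mul_le_mul_of_nonneg_left g1 (H2n_nonneg _ _)
      _ = (H2n N (Pr v) * r ^ 2) * (5 * Q) := by ring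
      _ ≤ 5 * Q * (5 * Q) := mul_le_mul_of_nonneg_right g2 (by positivity)
      _ = _ := by ring
  have g4 : Q ^ 2 * G ≤ 5 * Q ^ 3 := by
    calc _ ≤ Q ^ 2 * (5 * Q * 1) := by gcongr; exact g1.trans (by gcongr)
      _ = _ := by ring
  have g5 : Q ^ 2 ≤ Q ^ 3 := pow_le_pow_right₀ hQ (by norm_num)
  have g6 : (r ^ 4 * Q) ^ 2 ≤ Slat * Q ^ 3 := by
    calc (r ^ 4 * Q) ^ 2 = (r ^ 4) ^ 2 * Q ^ 2 := by ring
      _ ≤ 1 * Q ^ 3 := by gcongr; exact pow_le_one₀ hδ.le hr4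
      _ ≤ _ := by gcongr
  have g7 := mul_le_mul_of_nonneg_left g3 (by linarith : 0 ≤ Slat)
  have g8 := mul_le_mul_of_nonneg_left g4 (by linarith : 0 ≤ Slat)
  have g9 := mul_le_mul_of_nonneg_left g5 (by linarith : 0 ≤ Slat)
  have g10 : 0 ≤ Slat * Q ^ 3 := by positivity
  linarith

lemma sum_W_sM_dBq_small {u' w' : Mode → Fin 3 → ℂ} {f3' : Mode → Fin 3 → Fin 3 → ℂ} {Q r P : ℝ}
    (hQ : 1 ≤ Q) (hr : 0 < r) (hr1 : r ≤ 1) (hs : ∀ k ∉ N, v k = 0) (hs' : ∀ k ∉ N, w' k = 0)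
    (hu : ∀ F : Finset Mode, ∑ k ∈ F, W k ^ 2 * ‖u k‖ ^ 2 ≤ Q ^ 2)
    (hu' : ∀ F : Finset Mode, ∑ k ∈ F, W k ^ 2 * ‖u' k‖ ^ 2 ≤ Q ^ 2)
    (hP : ∑ k ∈ N, W k * ‖w' k‖ ^ 2 ≤ P)
    (hf3 : ∑ k ∈ N, W k ^ 2 * sM f3' k ≤ (r ^ 4 * Q) ^ 2) :
    r * √(∑ k ∈ N, W k * sM (fun k a b => dBq N u u' v w' k a b + f3' k a b) k) ≤
      100 * Slat * Q * (1 + H2n N v / r ^ 2 + r ^ 2 * P) := by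
  have hS := one_le_Slat
  have h1 := sum_W_sM_dBq_le hs hs' hu hu' hP
  have hP0 : 0 ≤ P := (Finset.sum_nonneg fun k _ => mul_nonneg (W_pos k).le (sq_nonneg _)).trans hP
  set X := ∑ k ∈ N, W k * sM (fun k a b => dBq N u u' v w' k a b + f3' k a b) k
  have hZ := H2n_nonneg N v
  have h2 : X ≤ 2 * (∑ k ∈ N, W k * sM (dBq N u u' v w') k) + 2 * ∑ k ∈ N, W k ^ 2 * sM f3' k := by
    rw [Finset.mul_sum, Finset.mul_sum, ← Finset.sum_add_distrib]
    refine Finset.sum_le_sum fun k _ => ?_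
    have h3 : sM (fun k a b => dBq N u u' v w' k a b + f3' k a b) k ≤
        2 * sM (dBq N u u' v w') k + 2 * sM f3' k := by
      unfold sM
      simp_rw [Finset.mul_sum]
      rw [← Finset.sum_add_distrib]
      refine Finset.sum_le_sum fun a _ => ?_
      rw [← Finset.sum_add_distrib]
      refine Finset.sum_le_sum fun b _ => ?_
      have n3 := pow_le_pow_left₀ (norm_nonneg _)
        (norm_add_le (dBq N u u' v w' k a b) (f3' k a b)) 2
      nlinarith [sq_nonneg (‖dBq N u u' v w' k a b‖ - ‖f3' k a b‖)]
    have h4 : W k * sM f3' k ≤ W k ^ 2 * sM f3' k :=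
      mul_le_mul_of_nonneg_right (by have := one_le_W k; nlinarith) (sM_nonneg _ _)
    have := mul_le_mul_of_nonneg_left h3 (W_pos k).le
    linarith
  set Z := H2n N v
  set x := Z / r ^ 2 with hx
  set y := r ^ 2 * P with hy
  have hx0 : 0 ≤ x := by positivity
  have hy0 : 0 ≤ y := by positivity
  have hZx : Z = x * r ^ 2 := by rw [hx]; field_simp
  have hr2 : r ^ 2 ≤ 1 := pow_le_one₀ hr.le hr1
  have hr4 : r ^ 4 ≤ 1 := pow_le_one₀ hr.le hr1
  have hX : (r * √X) ^ 2 ≤ (100 * Slat * Q * (1 + x + y)) ^ 2 := by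
    rw [mul_pow, Real.sq_sqrt (Finset.sum_nonneg fun k _ => mul_nonneg (W_pos k).le (sM_nonneg _ _))]
    have h3 : r ^ 2 * X ≤ r ^ 2 * (576 * Slat * (Z * P + 2 * Q ^ 2 * Z + 2 * Q ^ 2 * P)
        + 2 * (r ^ 4 * Q) ^ 2) := mul_le_mul_of_nonneg_left (by linarith) (sq_nonneg r)
    refine h3.trans ?_
    have e : r ^ 2 * (576 * Slat * (Z * P + 2 * Q ^ 2 * Z + 2 * Q ^ 2 * P) + 2 * (r ^ 4 * Q) ^ 2) =
        576 * Slat * (r ^ 2 * (x * y) + r ^ 4 * (2 * Q ^ 2 * x) + 2 * Q ^ 2 * y)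
        + r ^ 2 * (r ^ 4) ^ 2 * (2 * Q ^ 2) := by rw [hZx, hy]; ring
    rw [e]
    have hQ2 : 1 ≤ Q ^ 2 := one_le_pow₀ hQ
    have hrr : r ^ 2 * (r ^ 4) ^ 2 ≤ 1 := by
      rw [← pow_mul, ← pow_add]; exact pow_le_one₀ hr.le hr1
    have f1 : r ^ 2 * (x * y) ≤ Q ^ 2 * (x * y) :=
      mul_le_mul_of_nonneg_right (hr2.trans hQ2) (by positivity)
    have f2 : r ^ 4 * (2 * Q ^ 2 * x) ≤ 1 * (2 * Q ^ 2 * x) :=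
      mul_le_mul_of_nonneg_right hr4 (by positivity)
    have f3 : r ^ 2 * (r ^ 4) ^ 2 * (2 * Q ^ 2) ≤ 1 * (2 * Q ^ 2) :=
      mul_le_mul_of_nonneg_right hrr (by positivity)
    have hS2 : Slat ≤ Slat ^ 2 := by nlinarith
    calc _ ≤ 576 * Slat * (Q ^ 2 * (x * y) + 1 * (2 * Q ^ 2 * x) + 2 * Q ^ 2 * y) + 1 * (2 * Q ^ 2) := by
          gcongr
      _ = Slat * (576 * (x * y + 2 * x + 2 * y) * Q ^ 2) + 2 * Q ^ 2 := by ring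
      _ ≤ Slat ^ 2 * (576 * (x * y + 2 * x + 2 * y) * Q ^ 2) + Slat ^ 2 * (2 * Q ^ 2) := by
          refine add_le_add (mul_le_mul_of_nonneg_right hS2 (by positivity)) ?_
          have : 1 ≤ Slat ^ 2 := one_le_pow₀ hS
          nlinarith
      _ = Slat ^ 2 * Q ^ 2 * (576 * (x * y + 2 * x + 2 * y) + 2) := by ring
      _ ≤ Slat ^ 2 * Q ^ 2 * (10000 * (1 + x + y) ^ 2) := by
          refine mul_le_mul_of_nonneg_left ?_ (by positivity)
          nlinarith [mul_nonneg hx0 hy0]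
      _ = _ := by ring
  exact le_of_sq_le_sq hX (by positivity)

end

section
variable {K : Finset Mode} {ε δ : ℝ}

/-- Energy of the corrected acoustic variables. -/
def e1 (K : Finset Mode) (ε δ : ℝ) (s G Y : Mode → ℂ) : ℝ :=
  ∑ k ∈ K, (‖s k‖ ^ 2 / 2 + ε * lam k / 2 * ‖Y k‖ ^ 2 + δ * lam k / 2 * ‖G k‖ ^ 2)

lemma e1_hasDerivAt (hK : ∀ k ∈ K, k ≠ 0) (hε : ε ≠ 0) (hδ : δ ≠ 0) {s G Y : ℝ → Mode → ℂ}
    {ba eta Lp : Mode → ℂ} {t : ℝ}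
    (hs : ∀ k ∈ K, HasDerivAt (fun t => s t k) (-(lam k • (G t k + Y t k))) t)
    (hY : ∀ k ∈ K, HasDerivAt (fun t => Y t k) (ε⁻¹ • (s t k + (eta k + ε • Lp k))) t)
    (hG : ∀ k ∈ K, HasDerivAt (fun t => G t k)
      (δ⁻¹ • (-G t k + s t k + (lam k)⁻¹ • ba k)) t) :
    HasDerivAt (fun t => e1 K ε δ (s t) (G t) (Y t)) (∑ k ∈ K, (-(lam k * ‖G t k‖ ^ 2)
      + lam k * inner ℝ (Y t k) (eta k + ε • Lp k) + inner ℝ (G t k) (ba k))) t := by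
  refine HasDerivAt.fun_sum fun k hk => ?_
  have hl := (lam_pos (hK k hk)).ne'
  have := (((hs k hk).norm_sq.div_const 2).add ((hY k hk).norm_sq.const_mul (ε * lam k / 2))).add
    ((hG k hk).norm_sq.const_mul (δ * lam k / 2))
  refine this.congr_deriv ?_
  generalize eta k + ε • Lp k = e
  simp only [inner_smul_right, inner_add_right, inner_neg_right, real_inner_self_eq_norm_sq]
  rw [real_inner_comm (Y t k) (s t k), real_inner_comm (G t k) (s t k)]
  field_simp
  ring

lemma sum_lam_inner_le {Y e : Mode → ℂ} :
    ∑ k ∈ K, lam k * inner ℝ (Y k) (e k) ≤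
      √(∑ k ∈ K, lam k * ‖Y k‖ ^ 2) * √(∑ k ∈ K, lam k * ‖e k‖ ^ 2) := by
  refine sum_le_sqrt_mul_sqrt K (fun k => mul_nonneg (lam_nonneg k) (sq_nonneg _))
    (fun k => mul_nonneg (lam_nonneg k) (sq_nonneg _)) fun k _ => ?_
  rw [Real.sqrt_mul (lam_nonneg k), Real.sqrt_mul (lam_nonneg k)]
  have h1 := mul_le_mul_of_nonneg_left (inner_le_sqrt (Y k) (e k)) (lam_nonneg k)
  refine h1.trans (le_of_eq ?_)
  have := Real.mul_self_sqrt (lam_nonneg k)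
  linear_combination (-(√(‖Y k‖ ^ 2) * √(‖e k‖ ^ 2))) * this

lemma e1_deriv_le (hK : ∀ k ∈ K, k ≠ 0) (hε : 0 < ε) (hδ : 0 < δ) {s G Y ba eta Lp : Mode → ℂ}
    {A R r n : ℝ} (hA : 0 ≤ A) (hR : 0 ≤ R) (hr : 0 < r) (hr1 : r ≤ 1) (hn : 0 ≤ n)
    (hb : ∑ k ∈ K, (lam k)⁻¹ * ‖ba k‖ ^ 2 ≤ R * ∑ k ∈ K, ‖s k‖ ^ 2)
    (heta : ∑ k ∈ K, lam k * ‖eta k‖ ^ 2 ≤ (ε * A) ^ 2)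
    (hL : ∑ k ∈ K, lam k * ‖Lp k‖ ^ 2 ≤ n ^ 2) :
    ∑ k ∈ K, (-(lam k * ‖G k‖ ^ 2) + lam k * inner ℝ (Y k) (eta k + ε • Lp k)
      + inner ℝ (G k) (ba k)) ≤ (R + A + r * n) * (e1 K ε δ s G Y + ε / r ^ 2) := by
  set E := e1 K ε δ s G Y with hE
  have hs2 : ∑ k ∈ K, ‖s k‖ ^ 2 ≤ 2 * E := by
    rw [hE, e1, Finset.mul_sum]
    refine Finset.sum_le_sum fun k _ => ?_
    have h1 : 0 ≤ ε * lam k / 2 * ‖Y k‖ ^ 2 := by have := lam_nonneg k; positivity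
    have h2 : 0 ≤ δ * lam k / 2 * ‖G k‖ ^ 2 := by have := lam_nonneg k; positivity
    linarith
  have hY2 : ε * ∑ k ∈ K, lam k * ‖Y k‖ ^ 2 ≤ 2 * E := by
    rw [hE, e1, Finset.mul_sum, Finset.mul_sum]
    refine Finset.sum_le_sum fun k _ => ?_
    have h2 : 0 ≤ δ * lam k / 2 * ‖G k‖ ^ 2 := by have := lam_nonneg k; positivity
    have := sq_nonneg ‖s k‖
    linarith
  have hE0 : 0 ≤ E := by
    have : 0 ≤ ∑ k ∈ K, ‖s k‖ ^ 2 := Finset.sum_nonneg fun k _ => sq_nonneg _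
    linarith
  set y := ∑ k ∈ K, lam k * ‖Y k‖ ^ 2 with hy
  have hy0 : 0 ≤ y := Finset.sum_nonneg fun k _ => mul_nonneg (lam_nonneg k) (sq_nonneg _)
  have key : ε * √y ≤ r * (E + ε / r ^ 2) := by
    refine le_of_sq_le_sq ?_ (by positivity)
    have e1 : (ε * √y) ^ 2 = ε * (ε * y) := by rw [mul_pow, Real.sq_sqrt hy0]; ring
    rw [e1]
    have e2 : (r * (E + ε / r ^ 2)) ^ 2 = (E * r - ε / r) ^ 2 + 4 * (ε * E) := by
      field_simp; ring
    rw [e2]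
    nlinarith [sq_nonneg (E * r - ε / r), mul_le_mul_of_nonneg_left hY2 hε.le, mul_nonneg hε.le hE0]
  have t1 : ∑ k ∈ K, (-(lam k * ‖G k‖ ^ 2) + inner ℝ (G k) (ba k)) ≤ R * E := by
    have : ∑ k ∈ K, (-(lam k * ‖G k‖ ^ 2) + inner ℝ (G k) (ba k)) ≤
        ∑ k ∈ K, (lam k)⁻¹ * ‖ba k‖ ^ 2 / 2 := by
      refine Finset.sum_le_sum fun k hk => ?_
      have hl := lam_pos (hK k hk)
      have h1 := real_inner_le_norm (G k) (ba k)
      have h2 : ‖G k‖ * ‖ba k‖ ≤ lam k * ‖G k‖ ^ 2 + (lam k)⁻¹ * ‖ba k‖ ^ 2 / 2 := by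
        have h3 : lam k * ‖G k‖ ^ 2 + (lam k)⁻¹ * ‖ba k‖ ^ 2 / 2 - ‖G k‖ * ‖ba k‖ =
            (lam k)⁻¹ * ((lam k * ‖G k‖ - ‖ba k‖ / 2) ^ 2 + ‖ba k‖ ^ 2 / 4) := by
          field_simp; ring
        have h4 : 0 ≤ (lam k)⁻¹ * ((lam k * ‖G k‖ - ‖ba k‖ / 2) ^ 2 + ‖ba k‖ ^ 2 / 4) := by
          positivity
        linarith
      linarith
    refine this.trans ?_
    rw [← Finset.sum_div]
    have := mul_le_mul_of_nonneg_left hs2 hR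
    linarith
  have t2 : ∑ k ∈ K, lam k * inner ℝ (Y k) (eta k) ≤ A * (E + ε / r ^ 2) := by
    refine sum_lam_inner_le.trans ?_
    have : √(∑ k ∈ K, lam k * ‖eta k‖ ^ 2) ≤ ε * A :=
      (Real.sqrt_le_sqrt heta).trans (Real.sqrt_sq (by positivity)).le
    calc √y * √(∑ k ∈ K, lam k * ‖eta k‖ ^ 2) ≤ √y * (ε * A) := by gcongr
      _ = A * (ε * √y) := by ring
      _ ≤ A * (r * (E + ε / r ^ 2)) := by gcongr
      _ ≤ A * (1 * (E + ε / r ^ 2)) := by gcongr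
      _ = _ := by ring
  have t3 : ∑ k ∈ K, lam k * inner ℝ (Y k) (Lp k) ≤ √y * n := by
    refine sum_lam_inner_le.trans ?_
    have : √(∑ k ∈ K, lam k * ‖Lp k‖ ^ 2) ≤ n :=
      (Real.sqrt_le_sqrt hL).trans (Real.sqrt_sq hn).le
    gcongr
  have t3' : ε * ∑ k ∈ K, lam k * inner ℝ (Y k) (Lp k) ≤ r * n * (E + ε / r ^ 2) := by
    calc _ ≤ ε * (√y * n) := by gcongr
      _ = n * (ε * √y) := by ring
      _ ≤ n * (r * (E + ε / r ^ 2)) := by gcongr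
      _ = _ := by ring
  have split : ∑ k ∈ K, (-(lam k * ‖G k‖ ^ 2) + lam k * inner ℝ (Y k) (eta k + ε • Lp k)
      + inner ℝ (G k) (ba k)) = ∑ k ∈ K, (-(lam k * ‖G k‖ ^ 2) + inner ℝ (G k) (ba k))
      + ∑ k ∈ K, lam k * inner ℝ (Y k) (eta k) + ε * ∑ k ∈ K, lam k * inner ℝ (Y k) (Lp k) := by
    rw [Finset.mul_sum, ← Finset.sum_add_distrib, ← Finset.sum_add_distrib]
    refine Finset.sum_congr rfl fun k _ => ?_
    rw [inner_add_right, inner_smul_right]; ring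
  rw [split]
  have : 0 ≤ R * (ε / r ^ 2) := by positivity
  linarith

/-- Smoothed weighted norm. -/
def nL (K : Finset Mode) (Lp : Mode → ℂ) : ℝ := √(∑ k ∈ K, lam k * ‖Lp k‖ ^ 2 + 1)

lemma nL_sq (Lp : Mode → ℂ) : nL K Lp ^ 2 = ∑ k ∈ K, lam k * ‖Lp k‖ ^ 2 + 1 :=
  Real.sq_sqrt (add_nonneg (Finset.sum_nonneg fun k _ =>
    mul_nonneg (lam_nonneg k) (sq_nonneg _)) zero_le_one)

lemma one_le_nL (Lp : Mode → ℂ) : 1 ≤ nL K Lp :=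
  Real.one_le_sqrt.2 (le_add_of_nonneg_left (Finset.sum_nonneg fun k _ =>
    mul_nonneg (lam_nonneg k) (sq_nonneg _)))

lemma nL_hasDerivAt (hK : ∀ k ∈ K, k ≠ 0) (hδ : 0 < δ) {Lp : ℝ → Mode → ℂ} {b : Mode → ℂ} {t : ℝ}
    (h : ∀ k ∈ K, HasDerivAt (fun t => Lp t k) (δ⁻¹ • (-Lp t k + (lam k)⁻¹ • b k)) t) :
    ∃ n', HasDerivAt (fun t => nL K (Lp t)) n' t ∧
      n' ≤ δ⁻¹ * (-nL K (Lp t) + 1 + √(∑ k ∈ K, (lam k)⁻¹ * ‖b k‖ ^ 2)) := by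
  have h1 := (HasDerivAt.fun_sum fun k hk => (h k hk).norm_sq.const_mul (lam k)).add_const 1
  have hn := one_le_nL (K := K) (Lp t)
  have hsq := nL_sq (K := K) (Lp t)
  refine ⟨_, h1.sqrt (by rw [← hsq]; positivity), ?_⟩
  change _ / (2 * nL K (Lp t)) ≤ _
  set n := nL K (Lp t)
  set X := ∑ k ∈ K, (lam k)⁻¹ * ‖b k‖ ^ 2
  have h2 : ∑ k ∈ K, inner ℝ (Lp t k) (b k) ≤ n * √X := by
    have h3 : ∑ k ∈ K, inner ℝ (Lp t k) (b k) ≤ √(∑ k ∈ K, lam k * ‖Lp t k‖ ^ 2) * √X := by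
      refine sum_le_sqrt_mul_sqrt K (fun k => mul_nonneg (lam_nonneg k) (sq_nonneg _))
        (fun k => mul_nonneg (inv_nonneg.2 (lam_nonneg k)) (sq_nonneg _)) fun k hk => ?_
      rw [← Real.sqrt_mul (mul_nonneg (lam_nonneg k) (sq_nonneg _))]
      have : lam k * ‖Lp t k‖ ^ 2 * ((lam k)⁻¹ * ‖b k‖ ^ 2) = ‖Lp t k‖ ^ 2 * ‖b k‖ ^ 2 := by
        have := (lam_pos (hK k hk)).ne'
        field_simp
      rw [this, Real.sqrt_mul (sq_nonneg _)]
      exact inner_le_sqrt _ _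
    refine h3.trans (mul_le_mul_of_nonneg_right ?_ (Real.sqrt_nonneg _))
    exact Real.sqrt_le_sqrt (by linarith)
  have e : ∑ k ∈ K, lam k * (2 * inner ℝ (Lp t k) (δ⁻¹ • (-Lp t k + (lam k)⁻¹ • b k))) =
      2 * δ⁻¹ * (-(n ^ 2 - 1) + ∑ k ∈ K, inner ℝ (Lp t k) (b k)) := by
    rw [hsq, add_sub_cancel_right, ← Finset.sum_neg_distrib, ← Finset.sum_add_distrib,
      Finset.mul_sum]
    refine Finset.sum_congr rfl fun k hk => ?_
    simp only [inner_smul_right, inner_add_right, inner_neg_right, real_inner_self_eq_norm_sq]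
    have := (lam_pos (hK k hk)).ne'
    field_simp
  rw [e, div_le_iff₀ (by positivity)]
  have h4 : -(n ^ 2 - 1) + ∑ k ∈ K, inner ℝ (Lp t k) (b k) ≤ (-n + 1 + √X) * n := by nlinarith
  have := mul_le_mul_of_nonneg_left h4 (by positivity : 0 ≤ 2 * δ⁻¹)
  linarith

end

lemma sg_HH_sub (B B' : Mode → Fin 3 → Fin 3 → ℂ) (k : Mode) :
    sg (HH fun k a b => B k a b - B' k a b) k = sg (HH B) k - sg (HH B') k := by
  simp only [sg, HH, Fin.sum_univ_three]; ring

lemma hasDerivAt_sg_HH {B : ℝ → Mode → Fin 3 → Fin 3 → ℂ} {B' : Mode → Fin 3 → Fin 3 → ℂ} {t : ℝ}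
    {k : Mode} (h : ∀ a b, HasDerivAt (fun t => B t k a b) (B' k a b) t) :
    HasDerivAt (fun t => sg (HH (B t)) k) (sg (HH B') k) t :=
  hasDerivAt_sg (w := fun t => HH (B t)) fun a =>
    HasDerivAt.fun_sum fun j _ => (h a j).const_mul _

lemma HH_eq_zero {V : Mode → Fin 3 → Fin 3 → ℂ} {k : Mode} (h : V k = 0) : HH V k = 0 := by
  ext b; simp [HH, h]

section
variable {N : Finset Mode} {ε δ T A : ℝ} {u u' : ℝ → Mode → Fin 3 → ℂ} {f1 : ℝ → Mode → ℂ}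
    {f2 : ℝ → Mode → Fin 3 → ℂ} {f3 f3' : ℝ → Mode → Fin 3 → Fin 3 → ℂ}
    {q : ℝ → Mode → ℂ} {v : ℝ → Mode → Fin 3 → ℂ} {V : ℝ → Mode → Fin 3 → Fin 3 → ℂ}

lemma Gal.dPr (h : Gal N ε δ T u f1 f2 f3 q v V) (hf2 : ∀ t ∈ Set.Icc 0 T, ∀ k a, f2 t k a = 0)
    {t : ℝ} (ht : t ∈ Set.Icc 0 T) (k : Mode) (a : Fin 3) :
    HasDerivAt (fun t => Pr (v t) k a) (-Pr (HH (V t)) k a) t := by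
  by_cases hk : k ∈ N
  · have h1 := h.dv t ht k hk a
    have h2 := (h.dsg hf2 ht hk).const_mul (((lam k)⁻¹ : ℝ) : ℂ)
    refine (h1.sub (h2.const_mul (xi k a : ℂ))).congr_deriv ?_
    rw [hf2 t ht, Pr]
    by_cases h0 : k = 0
    · subst h0; simp [xi_zero]
    · have : (((lam k)⁻¹ : ℝ) : ℂ) * ((lam k : ℝ) : ℂ) = 1 := by
        rw [← Complex.ofReal_mul, inv_mul_cancel₀ (lam_pos h0).ne', Complex.ofReal_one]
      rw [Complex.real_smul]
      linear_combination (xi k a * (Complex.I * q t k)) * this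
  · have e1 : (fun t => Pr (v t) k a) = fun _ => 0 := by
      ext t; rw [Pr_eq_zero (h.sv t k hk)]; rfl
    rw [e1, Pr_eq_zero (HH_eq_zero (h.sV t k hk)), Pi.zero_apply, neg_zero]
    exact hasDerivAt_const _ _

lemma sum_W_Pr_HH_le (N : Finset Mode) (V : Mode → Fin 3 → Fin 3 → ℂ) :
    ∑ k ∈ N, W k * ‖fun a => -Pr (HH V) k a‖ ^ 2 ≤ Th N V := by
  refine Finset.sum_le_sum fun k _ => ?_
  have : ‖fun a => -Pr (HH V) k a‖ = ‖Pr (HH V) k‖ := norm_neg (Pr (HH V) k)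
  rw [this]
  by_cases hk : k = 0
  · subst hk
    have : HH V 0 = 0 := by ext b; exact HH_zero V b
    rw [Pr_zero, this]; simpa using sM_nonneg _ _
  · exact W_Pr_le hk

/-- Amplification exponent of the divergence estimate. -/
def cE (Q : ℝ) : ℝ := 24 * (100 * Slat * Q) + 8000 * Slat

/-- Growth rate in the divergence estimate. -/
def dE (Q : ℝ) : ℝ := 1 + 100 * Slat * Q * (1 + 3 * Q) + cE Q * (GE Q * Q + Q + 51 * Q ^ 2)
  + 1000 * Slat * (Q + Q ^ 2) + Q

/-- Total exponent in the divergence estimate. -/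
def KE (Q T : ℝ) : ℝ := 20000 * Slat * Q ^ 3 + cE Q * Q + dE Q * T

/-- Rate inequality for the weight of the divergence estimate. -/
lemma weight_rate {Q r ε m2 H D Θ X n e' e n' R : ℝ} (hQ : 1 ≤ Q) (hr : 0 < r) (hr1 : r ≤ 1)
    (hεδ : ε ≤ r ^ 4) (hD : 0 ≤ D) (hΘ : 0 ≤ Θ)
    (hm : m2 ≤ Q * r ^ 2) (hH : H ≤ m2 + 4 * D) (he : e ≤ Q * r ^ 2)
    (he' : e' ≤ -D / 2 - r ^ 4 * Θ + GE Q * e + BE Q ε (r ^ 4) m2)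
    (hn' : n' ≤ (r ^ 4)⁻¹ * (-n + 1 + X))
    (hX : r * X ≤ 100 * Slat * Q * (1 + 3 * H / r ^ 2 + r ^ 2 * Θ))
    (hR : R = 1000 * Slat * (H + Q ^ 2)) :
    r ^ 5 * n' + cE Q * (e' / r ^ 2) - dE Q ≤ -(R + Q + r * n) := by
  have hS := one_le_Slat
  have hr2 : r ^ 2 ≤ 1 := pow_le_one₀ hr.le hr1
  have hc0 : 0 ≤ cE Q := by unfold cE; positivity
  have a1 : r ^ 5 * n' ≤ -(r * n) + r + r * X := by
    have := mul_le_mul_of_nonneg_left hn' (by positivity : 0 ≤ r ^ 5)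
    refine this.trans (le_of_eq ?_)
    field_simp
  set d := D / r ^ 2 with hd
  have hd0 : 0 ≤ d := by positivity
  have hDd : D = d * r ^ 2 := by rw [hd]; field_simp
  have hDd' : D ≤ d := by rw [hDd]; nlinarith
  have a2 : 3 * H / r ^ 2 ≤ 3 * Q + 12 * d := by
    rw [div_le_iff₀ (by positivity)]
    have : (3 * Q + 12 * d) * r ^ 2 = 3 * (Q * r ^ 2) + 12 * D := by rw [hDd]; ring
    linarith
  have a3 : e' / r ^ 2 ≤ -d / 2 - r ^ 2 * Θ + GE Q * Q + Q + 51 * Q ^ 2 := by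
    rw [div_le_iff₀ (by positivity)]
    refine he'.trans ?_
    have g1 : GE Q * e ≤ GE Q * (Q * r ^ 2) := mul_le_mul_of_nonneg_left he (GE_nonneg Q)
    have g2 : BE Q ε (r ^ 4) m2 ≤ Q * r ^ 2 + 51 * Q ^ 2 * r ^ 2 := by
      unfold BE
      have h1 : ε ≤ r ^ 2 := hεδ.trans (pow_le_pow_of_le_one hr.le hr1 (by norm_num))
      have h2 : (r ^ 4) ^ 2 ≤ r ^ 2 := by
        rw [← pow_mul]; exact pow_le_pow_of_le_one hr.le hr1 (by norm_num)
      have h3 := mul_le_mul_of_nonneg_right h1 (sq_nonneg Q)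
      have h4 := mul_le_mul_of_nonneg_left h2 (sq_nonneg Q)
      linarith
    have : (-d / 2 - r ^ 2 * Θ + GE Q * Q + Q + 51 * Q ^ 2) * r ^ 2 =
      -D / 2 - r ^ 4 * Θ + GE Q * (Q * r ^ 2) + Q * r ^ 2 + 51 * Q ^ 2 * r ^ 2 := by rw [hDd]; ring
    linarith
  have a4 : R ≤ 1000 * Slat * (Q + 4 * d + Q ^ 2) := by
    rw [hR]
    have : Q * r ^ 2 ≤ Q := by nlinarith
    have : H ≤ Q + 4 * d := by linarith
    gcongr
  have a5 := mul_le_mul_of_nonneg_left a3 hc0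
  have hSQ : 0 < 100 * Slat * Q := by positivity
  have a6 : r * X ≤ 100 * Slat * Q * (1 + (3 * Q + 12 * d) + r ^ 2 * Θ) :=
    hX.trans (by gcongr)
  have a7 : 100 * Slat * Q * (r ^ 2 * Θ) ≤ cE Q * (r ^ 2 * Θ) := by
    refine mul_le_mul_of_nonneg_right ?_ (by positivity)
    unfold cE; nlinarith
  have a8 : cE Q * d = 24 * (100 * Slat * Q) * d + 8000 * Slat * d := by unfold cE; ring
  unfold dE
  linarith

end

lemma relaxation_sub_identity {l : ℝ} (hl : l ≠ 0) (c : ℝ) (g s b d L : ℂ) :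
    l⁻¹ • (c • (-g + l • s + b)) - c • (-L + l⁻¹ • d) =
      c • (-(l⁻¹ • g - L) + s + l⁻¹ • (b - d)) := by
  have e : ((l : ℝ) : ℂ)⁻¹ * (l : ℂ) = 1 := inv_mul_cancel₀ (Complex.ofReal_ne_zero.2 hl)
  simp only [Complex.real_smul, Complex.ofReal_inv]
  linear_combination ((c : ℂ) * s) * e

lemma acoustic_sub_identity {l : ℝ} (hl : l ≠ 0) (g y L : ℂ) :
    -g - l • y = -(l • (l⁻¹ • g - L + (y + L))) := by
  have e : (l : ℂ) * ((l : ℝ) : ℂ)⁻¹ = 1 := mul_inv_cancel₀ (Complex.ofReal_ne_zero.2 hl)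
  simp only [Complex.real_smul, Complex.ofReal_inv]
  linear_combination g * e

section
variable {N : Finset Mode} {ε T : ℝ} {u u' : ℝ → Mode → Fin 3 → ℂ} {f1 : ℝ → Mode → ℂ}
    {f2 : ℝ → Mode → Fin 3 → ℂ} {f3 f3' : ℝ → Mode → Fin 3 → Fin 3 → ℂ}
    {q : ℝ → Mode → ℂ} {v : ℝ → Mode → Fin 3 → ℂ} {V : ℝ → Mode → Fin 3 → Fin 3 → ℂ} {Q r : ℝ}

lemma sg_HH_Bq_sub (u v w : Mode → Fin 3 → ℂ) (f3 : Mode → Fin 3 → Fin 3 → ℂ) (k : Mode) :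
    sg (HH fun k a b => Bq N u v k a b - Bq N u w k a b) k =
      sg (HH fun k a b => Bq N u v k a b + f3 k a b) k
        - sg (HH fun k a b => Bq N u w k a b + f3 k a b) k := by
  rw [← sg_HH_sub]
  simp only [add_sub_add_right_eq_sub]

set_option maxHeartbeats 1000000 in
/-- Refined bound for the divergence. -/
lemma Gal.div_bound (h : Gal N ε (r ^ 4) T u f1 f2 f3 q v V)
    (hf : Fb N ε (r ^ 4) T Q u u' f1 f2 f3 f3')
    (hQ : 1 ≤ Q) (hr : 0 < r) (hr1 : r ≤ 1) (hε : 0 < ε) (hεδ : ε ≤ r ^ 4)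
    (hm : ‖v 0 0‖ ^ 2 ≤ Q * r ^ 2)
    (hE : ∀ t ∈ Set.Icc 0 T, En N ε (r ^ 4) (q t) (v t) (V t) ≤ Q * r ^ 2)
    (hsm : √(Q * r ^ 2) * (10000 * Slat) ≤ 1)
    (hs0 : ∑ k ∈ N, ‖sg (v 0) k‖ ^ 2 ≤ Q * (ε / r ^ 2))
    (hq0 : ∑ k ∈ N, lam k * ‖q 0 k‖ ^ 2 ≤ Q / r ^ 2)
    (hV0 : ∑ k ∈ N, (lam k)⁻¹ * ‖sg (HH (V 0)) k‖ ^ 2 ≤ Q / r ^ 2) {t : ℝ}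
    (ht : t ∈ Set.Icc 0 T) :
    ∑ k ∈ N, ‖sg (v t) k‖ ^ 2 ≤ 8 * Q * exp (KE Q T) * (ε / r ^ 2) ∧
    ∑ k ∈ N, lam k * ‖q t k‖ ^ 2 ≤
      (16 * Q * exp (KE Q T) + 26000 * Slat * Q ^ 3 + 4 * KE Q T ^ 2) / r ^ 2 := by
  classical
  have hS := one_le_Slat
  have hT : 0 ≤ T := ht.1.trans ht.2
  have h0T : (0 : ℝ) ∈ Set.Icc 0 T := ⟨le_rfl, hT⟩
  have hδ : 0 < r ^ 4 := by positivity
  set K := N.erase 0 with hKdef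
  have hKN : ∀ k ∈ K, k ∈ N := fun k hk => Finset.mem_of_mem_erase hk
  have hK0 : ∀ k ∈ K, k ≠ 0 := fun k hk => Finset.ne_of_mem_erase hk
  have hsub : K ⊆ N := Finset.erase_subset _ _
  have hKsum : ∀ g : Mode → ℝ, g 0 = 0 → ∑ k ∈ K, g k = ∑ k ∈ N, g k := fun g hg =>
    Finset.sum_erase _ hg
  -- symmetric sources
  set Bs : ℝ → Mode → Fin 3 → Fin 3 → ℂ := fun t k a b => Bq N (u t) (Pr (v t)) k a b + f3 t k a b
    with hBs
  set w' : ℝ → Mode → Fin 3 → ℂ := fun t k a => -Pr (HH (V t)) k a with hw'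
  set Bs' : ℝ → Mode → Fin 3 → Fin 3 → ℂ := fun t k a b =>
    dBq N (u t) (u' t) (Pr (v t)) (w' t) k a b + f3' t k a b with hBs'
  have dBs : ∀ t ∈ Set.Icc 0 T, ∀ k, HasDerivAt (fun t => sg (HH (Bs t)) k) (sg (HH (Bs' t)) k) t :=
    fun t ht k => hasDerivAt_sg_HH fun a b =>
      (hasDerivAt_Bq (u := u) (w := fun t => Pr (v t)) (hf.du t ht)
        (h.dPr hf.hf2 ht) k a b).add (hf.df3 t ht k a b)
  have hL := fun k => exists_relaxation (g := fun t => (lam k)⁻¹ • sg (HH (Bs t)) k) (δ := r ^ 4) hT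
    (fun t ht => ((dBs t ht k).const_smul (lam k)⁻¹).continuousAt.continuousWithinAt)
    ((lam k)⁻¹ • sg (HH (V 0)) k)
  choose L L0 dL using hL
  set Lp : ℝ → Mode → ℂ := fun t k => (r ^ 4)⁻¹ • (-L k t + (lam k)⁻¹ • sg (HH (Bs t)) k) with hLp
  have dLp : ∀ t ∈ Set.Icc 0 T, ∀ k, HasDerivAt (fun t => Lp t k)
      ((r ^ 4)⁻¹ • (-Lp t k + (lam k)⁻¹ • sg (HH (Bs' t)) k)) t := fun t ht k =>
    (((dL k t ht).neg.add ((dBs t ht k).const_smul (lam k)⁻¹)).const_smul (r ^ 4)⁻¹)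
  set s : ℝ → Mode → ℂ := fun t => sg (v t) with hsdef
  set G : ℝ → Mode → ℂ := fun t k => (lam k)⁻¹ • sg (HH (V t)) k - L k t with hG
  set Y : ℝ → Mode → ℂ := fun t k => Complex.I * q t k + L k t with hY
  set ba : ℝ → Mode → ℂ := fun t => sg (HH fun k a b => Bq N (u t) (v t) k a b
    - Bq N (u t) (Pr (v t)) k a b) with hba
  have ds : ∀ t ∈ Set.Icc 0 T, ∀ k ∈ K,
      HasDerivAt (fun t => s t k) (-(lam k • (G t k + Y t k))) t := fun t ht k hk => by
    refine (h.dsg hf.hf2 ht (hKN k hk)).congr_deriv ?_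
    exact acoustic_sub_identity (lam_pos (hK0 k hk)).ne' _ _ _
  have dY : ∀ t ∈ Set.Icc 0 T, ∀ k ∈ K, HasDerivAt (fun t => Y t k)
      (ε⁻¹ • (s t k + (Complex.I * f1 t k + ε • Lp t k))) t := fun t ht k hk => by
    refine ((h.dy ht (hKN k hk)).add (dL k t ht)).congr_deriv ?_
    rw [← add_assoc, smul_add _ _ (ε • Lp t k), smul_smul, inv_mul_cancel₀ hε.ne', one_smul]
  have dG : ∀ t ∈ Set.Icc 0 T, ∀ k ∈ K, HasDerivAt (fun t => G t k)
      ((r ^ 4)⁻¹ • (-G t k + s t k + (lam k)⁻¹ • ba t k)) t := fun t ht k hk => by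
    refine (((h.dga ht (hKN k hk)).const_smul (lam k)⁻¹).sub (dL k t ht)).congr_deriv ?_
    have e1 : ba t k = sg (HH (Src N u f3 v t)) k - sg (HH (Bs t)) k :=
      sg_HH_Bq_sub (u t) (v t) (Pr (v t)) (f3 t) k
    rw [e1]
    exact relaxation_sub_identity (lam_pos (hK0 k hk)).ne' _ _ _ _ _ _
  set E1 : ℝ → ℝ := fun t => e1 K ε (r ^ 4) (s t) (G t) (Y t) with hE1
  set n : ℝ → ℝ := fun t => nL K (Lp t) with hn
  set e : ℝ → ℝ := fun t => En N ε (r ^ 4) (q t) (v t) (V t) with he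
  set R : ℝ → ℝ := fun t => 1000 * Slat * (H2n N (v t) + Q ^ 2) with hR
  have hR0 : ∀ t, 0 ≤ R t := fun t => by have := H2n_nonneg N (v t); positivity
  have n1 : ∀ t, 1 ≤ n t := fun t => one_le_nL _
  have he0 : ∀ t, 0 ≤ e t := fun t => En_nonneg hε.le hδ.le
  -- growth of the corrected energy
  have dE1 : ∀ t ∈ Set.Icc 0 T, ∃ d, HasDerivAt E1 d t ∧
      d ≤ (R t + Q + r * n t) * (E1 t + ε / r ^ 2) := fun t ht => by
    refine ⟨_, e1_hasDerivAt hK0 hε.ne' hδ.ne' (ds t ht) (dY t ht) (dG t ht), ?_⟩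
    refine e1_deriv_le hK0 hε hδ (by linarith) (hR0 t) hr hr1 (by linarith [n1 t]) ?_ ?_ ?_
    · have h1 := sum_W_sM_Bq_sub_le (N := N) (h.sv t) (hf.hu t ht)
      rw [hKsum (fun k => ‖s t k‖ ^ 2) (by simp [hsdef, sg_zero])]
      refine le_trans ?_ h1
      exact (Finset.sum_le_sum fun k _ => sg_HH_sq_inv_le _ k).trans
        (Finset.sum_le_sum_of_subset_of_nonneg hsub fun k _ _ =>
          mul_nonneg (W_pos k).le (sM_nonneg _ _))
    · refine le_trans ?_ (hf.hf1 t ht)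
      refine (Finset.sum_le_sum fun k _ => ?_).trans
        (Finset.sum_le_sum_of_subset_of_nonneg hsub fun k _ _ =>
          mul_nonneg (sq_nonneg (W k)) (sq_nonneg _))
      rw [norm_mul, Complex.norm_I, one_mul]
      refine mul_le_mul_of_nonneg_right ?_ (sq_nonneg _)
      have := lam_le_W k; have := one_le_W k; nlinarith
    · have := nL_sq (K := K) (Lp t); simp only [hn]; linarith
  -- weight
  have dn : ∀ t ∈ Set.Icc 0 T, ∃ n', HasDerivAt n n' t ∧
      r ^ 5 * n' + cE Q * (dEn N ε (r ^ 4) (q t) (v t) (V t) (f1 t) (Src N u f3 v t) / r ^ 2)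
        - dE Q ≤ -(R t + Q + r * n t) := fun t ht => by
    obtain ⟨n', hn', hle⟩ := nL_hasDerivAt hK0 hδ (fun k _ => dLp t ht k)
    refine ⟨n', hn', ?_⟩
    have hmt : ‖v t 0‖ ^ 2 ≤ Q * r ^ 2 := by rw [h.mean hf ht]; exact hm
    have hX : √(∑ k ∈ K, (lam k)⁻¹ * ‖sg (HH (Bs' t)) k‖ ^ 2) ≤
        √(∑ k ∈ N, W k * sM (Bs' t) k) := Real.sqrt_le_sqrt
      ((Finset.sum_le_sum fun k _ => sg_HH_sq_inv_le _ k).trans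
        (Finset.sum_le_sum_of_subset_of_nonneg hsub fun k _ _ =>
          mul_nonneg (W_pos k).le (sM_nonneg _ _)))
    have hX2 := sum_W_sM_dBq_small (u := u t) (u' := u' t) (v := Pr (v t)) (w' := w' t)
      (f3' := f3' t) hQ hr hr1 (fun k hk => Pr_eq_zero (h.sv t k hk))
      (fun k hk => by
        ext a; simp only [hw']; rw [Pr_eq_zero (HH_eq_zero (h.sV t k hk))]; simp)
      (hf.hu t ht) (hf.hu' t ht) (sum_W_Pr_HH_le N (V t)) (hf.hf3' t ht)
    refine weight_rate hQ hr hr1 hεδ (Dn_nonneg N (v t)) (Th_nonneg N (V t)) hmt H2n_le (hE t ht)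
      (D := Dn N (v t)) (Θ := Th N (V t)) (m2 := ‖v t 0‖ ^ 2) (H := H2n N (v t))
      ?_ hle ?_ rfl
    · have := h.dEn_le hf hε hδ ht (le_trans (by have := hE t ht; gcongr) hsm)
      rwa [← h.mean hf ht] at this
    · refine (mul_le_mul_of_nonneg_left hX hr.le).trans (hX2.trans ?_)
      have := H2n_Pr_le N (v t)
      have hQ0 : 0 ≤ 100 * Slat * Q := by positivity
      gcongr
  set Λ : ℝ → ℝ := fun t => r ^ 5 * n t + cE Q * (e t / r ^ 2) - dE Q * t with hΛ
  have dΛ : ∀ t ∈ Set.Icc 0 T, ∃ l, HasDerivAt Λ l t ∧ l ≤ -(R t + Q + r * n t) := fun t ht => by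
    obtain ⟨n', hn', hle⟩ := dn t ht
    refine ⟨_, ((hn'.const_mul (r ^ 5)).add (((h.hasDerivAt_En hf.hf2 hε.ne' hδ.ne'
      ht).div_const (r ^ 2)).const_mul (cE Q))).sub ((hasDerivAt_id t).const_mul (dE Q)), ?_⟩
    rw [mul_one]; exact hle
  choose! l hl hl' using dΛ
  choose! d hd hd' using dE1
  have hcΛ : ContinuousOn Λ (Set.Icc 0 T) := fun t ht => (hl t ht).continuousAt.continuousWithinAt
  have hcE : ContinuousOn E1 (Set.Icc 0 T) := fun t ht => (hd t ht).continuousAt.continuousWithinAt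
  have hrate : ∀ t, 0 ≤ R t + Q + r * n t := fun t => by
    have := hR0 t; have := n1 t; positivity
  have hE10 : ∀ t, 0 ≤ E1 t := fun t => Finset.sum_nonneg fun k _ => by
    have := lam_nonneg k; positivity
  have Λle : Λ t ≤ Λ 0 := le_of_hasDerivAt_nonpos hcΛ
    (fun t ht => hl t (Set.Ioo_subset_Icc_self ht)) (fun t ht => by
      have := hl' t (Set.Ioo_subset_Icc_self ht); have := hrate t; linarith) ht
  have Φle : (E1 t + ε / r ^ 2) * exp (Λ t) ≤ (E1 0 + ε / r ^ 2) * exp (Λ 0) := by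
    refine le_of_hasDerivAt_nonpos (f := fun t => (E1 t + ε / r ^ 2) * exp (Λ t))
      ((hcE.add continuousOn_const).mul hcΛ.rexp)
      (fun t ht => ((hd t (Set.Ioo_subset_Icc_self ht)).add_const _).mul
        (hl t (Set.Ioo_subset_Icc_self ht)).exp) (fun t ht => ?_) ht
    have h1 := hd' t (Set.Ioo_subset_Icc_self ht)
    have h2 := hl' t (Set.Ioo_subset_Icc_self ht)
    have h3 : 0 ≤ E1 t + ε / r ^ 2 := by have := hE10 t; positivity
    have h4 := mul_le_mul_of_nonneg_left h2 h3
    have h5 : (d t + (E1 t + ε / r ^ 2) * l t) * exp (Λ t) ≤ 0 :=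
      mul_nonpos_of_nonpos_of_nonneg (by linarith) (exp_pos _).le
    linarith
  -- initial values
  have hL0 : ∀ k, lam k * ‖L k 0‖ ^ 2 = (lam k)⁻¹ * ‖sg (HH (V 0)) k‖ ^ 2 := fun k => by
    rw [L0, norm_smul, mul_pow, Real.norm_eq_abs, sq_abs]
    by_cases hk : lam k = 0
    · simp [hk]
    · field_simp
  have hbs : ∀ t ∈ Set.Icc 0 T, ∑ k ∈ K, (lam k)⁻¹ * ‖sg (HH (Bs t)) k‖ ^ 2 ≤
      6500 * Slat * Q ^ 3 := fun t ht => by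
    refine ((Finset.sum_le_sum fun k _ => sg_HH_sq_inv_le _ k).trans
        (Finset.sum_le_sum_of_subset_of_nonneg hsub fun k _ _ =>
          mul_nonneg (W_pos k).le (sM_nonneg _ _))).trans ?_
    exact sum_W_sM_Bq_Pr_le hQ hr hr1 hε.le (h.sv t) (hf.hu t ht) (hf.hf3 t ht)
      (by rw [h.mean hf ht]; exact hm) (hE t ht)
  have hr2 : r ^ 2 ≤ 1 := pow_le_one₀ hr.le hr1
  have hLs : ∑ k ∈ K, lam k * ‖L k 0‖ ^ 2 ≤ Q / r ^ 2 := by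
    simp_rw [hL0]
    exact (Finset.sum_le_sum_of_subset_of_nonneg hsub fun k _ _ =>
      mul_nonneg (inv_nonneg.2 (lam_nonneg k)) (sq_nonneg _)).trans hV0
  have hqs : ∑ k ∈ K, lam k * ‖q 0 k‖ ^ 2 ≤ Q / r ^ 2 :=
    (Finset.sum_le_sum_of_subset_of_nonneg hsub fun k _ _ =>
      mul_nonneg (lam_nonneg k) (sq_nonneg _)).trans hq0
  have hE1le : E1 0 ≤ 3 * Q * (ε / r ^ 2) := by
    have h1 : E1 0 ≤ (∑ k ∈ K, ‖s 0 k‖ ^ 2) / 2 + ε * (∑ k ∈ K, lam k * ‖q 0 k‖ ^ 2)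
        + ε * ∑ k ∈ K, lam k * ‖L k 0‖ ^ 2 := by
      rw [Finset.mul_sum, Finset.mul_sum, Finset.sum_div, ← Finset.sum_add_distrib,
        ← Finset.sum_add_distrib]
      refine Finset.sum_le_sum fun k _ => ?_
      have g0 : G 0 k = 0 := by simp only [hG, L0, sub_self]
      have y1 : ‖Y 0 k‖ ^ 2 ≤ 2 * ‖q 0 k‖ ^ 2 + 2 * ‖L k 0‖ ^ 2 := by
        have := norm_add_le (Complex.I * q 0 k) (L k 0)
        rw [norm_mul, Complex.norm_I, one_mul] at this
        have := pow_le_pow_left₀ (norm_nonneg _) this 2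
        nlinarith [sq_nonneg (‖q 0 k‖ - ‖L k 0‖)]
      have := mul_le_mul_of_nonneg_left y1
        (mul_nonneg hε.le (lam_nonneg k))
      rw [g0, norm_zero]
      linarith
    have h2 : ∑ k ∈ K, ‖s 0 k‖ ^ 2 ≤ Q * (ε / r ^ 2) :=
      (Finset.sum_le_sum_of_subset_of_nonneg hsub fun k _ _ => sq_nonneg _).trans hs0
    have h3 := mul_le_mul_of_nonneg_left hqs hε.le
    have h4 := mul_le_mul_of_nonneg_left hLs hε.le
    have h5 : ε * (Q / r ^ 2) = Q * (ε / r ^ 2) := by ring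
    have h6 : 0 ≤ Q * (ε / r ^ 2) := by positivity
    linarith
  have hSQ3 : 1 ≤ Slat * Q ^ 3 := one_le_mul_of_one_le_of_one_le hS (one_le_pow₀ hQ)
  have hQ3 : Q ≤ Slat * Q ^ 3 := by
    calc Q = 1 * Q ^ 1 := by ring
      _ ≤ Slat * Q ^ 3 := mul_le_mul hS (pow_le_pow_right₀ hQ (by norm_num)) (by positivity)
        (by positivity)
  have hn0 : r ^ 5 * n 0 ≤ 20000 * Slat * Q ^ 3 := by
    have h1 : (r ^ 5 * n 0) ^ 2 ≤ 20000 * Slat * Q ^ 3 := by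
      have h2 : (r ^ 4) ^ 2 * ∑ k ∈ K, lam k * ‖Lp 0 k‖ ^ 2 ≤
          2 * (∑ k ∈ K, lam k * ‖L k 0‖ ^ 2)
            + 2 * ∑ k ∈ K, (lam k)⁻¹ * ‖sg (HH (Bs 0)) k‖ ^ 2 := by
        rw [Finset.mul_sum, Finset.mul_sum, Finset.mul_sum, ← Finset.sum_add_distrib]
        refine Finset.sum_le_sum fun k hk => ?_
        have hl := lam_pos (hK0 k hk)
        have y1 : (r ^ 4) ^ 2 * ‖Lp 0 k‖ ^ 2 ≤
            2 * ‖L k 0‖ ^ 2 + 2 * ((lam k)⁻¹ ^ 2 * ‖sg (HH (Bs 0)) k‖ ^ 2) := by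
          have h3 := norm_add_le (-L k 0) ((lam k)⁻¹ • sg (HH (Bs 0)) k)
          rw [norm_neg, norm_smul, Real.norm_eq_abs, abs_of_pos (inv_pos.2 hl)] at h3
          have h4 : (r ^ 4) ^ 2 * ‖Lp 0 k‖ ^ 2 = ‖-L k 0 + (lam k)⁻¹ • sg (HH (Bs 0)) k‖ ^ 2 := by
            simp only [hLp]
            rw [norm_smul, Real.norm_eq_abs, abs_of_pos (inv_pos.2 hδ)]
            field_simp
          rw [h4]
          have := pow_le_pow_left₀ (norm_nonneg _) h3 2
          nlinarith [sq_nonneg (‖L k 0‖ - (lam k)⁻¹ * ‖sg (HH (Bs 0)) k‖)]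
        have := mul_le_mul_of_nonneg_left y1 hl.le
        have e : lam k * ((lam k)⁻¹ ^ 2 * ‖sg (HH (Bs 0)) k‖ ^ 2) =
            (lam k)⁻¹ * ‖sg (HH (Bs 0)) k‖ ^ 2 := by field_simp
        linarith
      have h3 := hbs 0 h0T
      have h4 : (r ^ 5 * n 0) ^ 2 = r ^ 2 * ((r ^ 4) ^ 2 * ∑ k ∈ K, lam k * ‖Lp 0 k‖ ^ 2)
          + r ^ 10 := by
        simp only [hn]; rw [mul_pow, nL_sq]; ring
      have h5 : r ^ 10 ≤ 1 := pow_le_one₀ hr.le hr1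
      have h6 : r ^ 2 * (Q / r ^ 2) = Q := by field_simp
      have h7 := mul_le_mul_of_nonneg_left (h2.trans (add_le_add
        (mul_le_mul_of_nonneg_left hLs zero_le_two) (mul_le_mul_of_nonneg_left h3 zero_le_two)))
        (sq_nonneg r)
      have h8 : r ^ 2 * (Slat * Q ^ 3) ≤ Slat * Q ^ 3 := by nlinarith
      rw [h4]; linarith
    refine le_of_sq_le_sq (h1.trans ?_) (by positivity)
    nlinarith
  have hcE0 : 0 ≤ cE Q := by unfold cE; positivity
  have hdE0 : 0 ≤ dE Q := by
    have := GE_nonneg Q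
    unfold dE; positivity
  have hΛ0 : Λ 0 ≤ 20000 * Slat * Q ^ 3 + cE Q * Q := by
    have h1 : e 0 / r ^ 2 ≤ Q := by
      rw [div_le_iff₀ (by positivity)]; exact hE 0 h0T
    have := mul_le_mul_of_nonneg_left h1 hcE0
    simp only [hΛ, mul_zero, sub_zero]; linarith
  have htT : dE Q * t ≤ dE Q * T := mul_le_mul_of_nonneg_left ht.2 hdE0
  have heq : 0 ≤ cE Q * (e t / r ^ 2) := by have := he0 t; positivity
  have hnt : r ^ 5 * n t ≤ KE Q T := by
    have h1 : r ^ 5 * n t + cE Q * (e t / r ^ 2) - dE Q * t ≤ Λ 0 := Λle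
    unfold KE; linarith
  have hnt0 : 0 ≤ r ^ 5 * n t := by have := n1 t; positivity
  have hK1 : 0 ≤ KE Q T := hnt0.trans hnt
  have hΦ : E1 t ≤ 4 * Q * exp (KE Q T) * (ε / r ^ 2) := by
    have h1 : -(dE Q * t) ≤ Λ t := by simp only [hΛ]; linarith
    have h2 : E1 0 + ε / r ^ 2 ≤ 4 * Q * (ε / r ^ 2) := by
      have : 1 * (ε / r ^ 2) ≤ Q * (ε / r ^ 2) := by gcongr
      linarith
    have h3 : E1 t + ε / r ^ 2 = (E1 t + ε / r ^ 2) * exp (Λ t) * exp (-Λ t) := by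
      rw [mul_assoc, ← exp_add, add_neg_cancel, exp_zero, mul_one]
    have h4 : E1 t + ε / r ^ 2 ≤ 4 * Q * exp (KE Q T) * (ε / r ^ 2) := by
      rw [h3]
      calc _ ≤ (E1 0 + ε / r ^ 2) * exp (Λ 0) * exp (-Λ t) :=
            mul_le_mul_of_nonneg_right Φle (exp_pos _).le
        _ = (E1 0 + ε / r ^ 2) * exp (Λ 0 - Λ t) := by rw [mul_assoc, ← exp_add]; rfl
        _ ≤ 4 * Q * (ε / r ^ 2) * exp (KE Q T) := by
            refine mul_le_mul h2 (exp_le_exp.2 ?_) (exp_pos _).le (by positivity)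
            unfold KE; linarith
        _ = _ := by ring
    have : 0 ≤ ε / r ^ 2 := by positivity
    linarith
  constructor
  · have h1 : ∑ k ∈ N, ‖sg (v t) k‖ ^ 2 = ∑ k ∈ K, ‖s t k‖ ^ 2 :=
      (hKsum (fun k => ‖s t k‖ ^ 2) (by simp [hsdef, sg_zero])).symm
    have h2 : ∑ k ∈ K, ‖s t k‖ ^ 2 ≤ 2 * E1 t := by
      simp only [hE1]; unfold e1; rw [Finset.mul_sum]
      refine Finset.sum_le_sum fun k _ => ?_
      have h1 : 0 ≤ ε * lam k / 2 * ‖Y t k‖ ^ 2 := by have := lam_nonneg k; positivity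
      have h2 : 0 ≤ r ^ 4 * lam k / 2 * ‖G t k‖ ^ 2 := by have := lam_nonneg k; positivity
      linarith
    rw [h1]; linarith
  · have h1 : ε * ∑ k ∈ K, lam k * ‖Y t k‖ ^ 2 ≤ 2 * E1 t := by
      simp only [hE1]; unfold e1; rw [Finset.mul_sum, Finset.mul_sum]
      refine Finset.sum_le_sum fun k _ => ?_
      have h2 : 0 ≤ r ^ 4 * lam k / 2 * ‖G t k‖ ^ 2 := by have := lam_nonneg k; positivity
      have := sq_nonneg ‖s t k‖
      linarith
    have h2 : ∑ k ∈ K, lam k * ‖L k t‖ ^ 2 ≤ 13000 * Slat * Q ^ 3 + 2 * (KE Q T ^ 2 / r ^ 2) := by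
      have h3 : ∑ k ∈ K, lam k * ‖L k t‖ ^ 2 ≤
          2 * (∑ k ∈ K, (lam k)⁻¹ * ‖sg (HH (Bs t)) k‖ ^ 2)
            + 2 * ((r ^ 4) ^ 2 * ∑ k ∈ K, lam k * ‖Lp t k‖ ^ 2) := by
        rw [Finset.mul_sum, Finset.mul_sum, Finset.mul_sum, ← Finset.sum_add_distrib]
        refine Finset.sum_le_sum fun k hk => ?_
        have hl := lam_pos (hK0 k hk)
        have y0 : L k t = (lam k)⁻¹ • sg (HH (Bs t)) k - (r ^ 4) • Lp t k := by
          simp only [hLp]; rw [smul_smul, mul_inv_cancel₀ hδ.ne', one_smul]; ring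
        have y1 : ‖L k t‖ ^ 2 ≤ 2 * ((lam k)⁻¹ ^ 2 * ‖sg (HH (Bs t)) k‖ ^ 2)
            + 2 * ((r ^ 4) ^ 2 * ‖Lp t k‖ ^ 2) := by
          have h3 := norm_sub_le ((lam k)⁻¹ • sg (HH (Bs t)) k) ((r ^ 4) • Lp t k)
          rw [← y0, norm_smul, norm_smul, Real.norm_eq_abs, Real.norm_eq_abs,
            abs_of_pos (inv_pos.2 hl), abs_of_pos hδ] at h3
          have := pow_le_pow_left₀ (norm_nonneg _) h3 2
          nlinarith [sq_nonneg ((lam k)⁻¹ * ‖sg (HH (Bs t)) k‖ - r ^ 4 * ‖Lp t k‖)]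
        have := mul_le_mul_of_nonneg_left y1 hl.le
        have e : lam k * ((lam k)⁻¹ ^ 2 * ‖sg (HH (Bs t)) k‖ ^ 2) =
            (lam k)⁻¹ * ‖sg (HH (Bs t)) k‖ ^ 2 := by field_simp
        linarith
      have h4 := hbs t ht
      have h5 : (r ^ 4) ^ 2 * ∑ k ∈ K, lam k * ‖Lp t k‖ ^ 2 ≤ KE Q T ^ 2 / r ^ 2 := by
        rw [le_div_iff₀ (by positivity)]
        have h6 := pow_le_pow_left₀ hnt0 hnt 2
        have h7 : (r ^ 5 * n t) ^ 2 = (r ^ 4) ^ 2 * (∑ k ∈ K, lam k * ‖Lp t k‖ ^ 2) * r ^ 2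
          + r ^ 10 := by
          simp only [hn]; rw [mul_pow, nL_sq]; ring
        have : 0 ≤ r ^ 10 := by positivity
        linarith
      linarith
    have h3 : ∑ k ∈ N, lam k * ‖q t k‖ ^ 2 ≤ 2 * (∑ k ∈ K, lam k * ‖Y t k‖ ^ 2)
        + 2 * ∑ k ∈ K, lam k * ‖L k t‖ ^ 2 := by
      rw [← hKsum (fun k => lam k * ‖q t k‖ ^ 2) (by simp [lam_zero]), Finset.mul_sum,
        Finset.mul_sum, ← Finset.sum_add_distrib]
      refine Finset.sum_le_sum fun k _ => ?_
      have y1 : ‖q t k‖ ^ 2 ≤ 2 * ‖Y t k‖ ^ 2 + 2 * ‖L k t‖ ^ 2 := by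
        have h4 := norm_sub_le (Y t k) (L k t)
        have h5 : Y t k - L k t = Complex.I * q t k := by simp only [hY]; ring
        rw [h5, norm_mul, Complex.norm_I, one_mul] at h4
        have := pow_le_pow_left₀ (norm_nonneg _) h4 2
        nlinarith [sq_nonneg (‖Y t k‖ - ‖L k t‖)]
      have := mul_le_mul_of_nonneg_left y1 (lam_nonneg k)
      linarith
    have h4 : ∑ k ∈ K, lam k * ‖Y t k‖ ^ 2 ≤ 8 * Q * exp (KE Q T) / r ^ 2 := by
      have : ε * ∑ k ∈ K, lam k * ‖Y t k‖ ^ 2 ≤ ε * (8 * Q * exp (KE Q T) / r ^ 2) := by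
        calc _ ≤ 2 * (4 * Q * exp (KE Q T) * (ε / r ^ 2)) := by linarith
          _ = _ := by ring
      exact le_of_mul_le_mul_left this hε
    have h5 : Slat * Q ^ 3 ≤ Slat * Q ^ 3 / r ^ 2 := by
      rw [le_div_iff₀ (by positivity)]; nlinarith
    rw [add_div, add_div]
    have e1 : 16 * Q * exp (KE Q T) / r ^ 2 = 2 * (8 * Q * exp (KE Q T) / r ^ 2) := by ring
    have e2 : 26000 * Slat * Q ^ 3 / r ^ 2 = 26000 * (Slat * Q ^ 3 / r ^ 2) := by ring
    have e3 : 4 * KE Q T ^ 2 / r ^ 2 = 4 * (KE Q T ^ 2 / r ^ 2) := by ring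
    linarith
end

/-- Size of admissible initial perturbations, with `δ = r ^ 4`. -/
structure Ini (N : Finset Mode) (ε r Q : ℝ) (q : Mode → ℂ) (v : Mode → Fin 3 → ℂ)
    (V : Mode → Fin 3 → Fin 3 → ℂ) : Prop where
  m : ‖v 0‖ ^ 2 ≤ Q * r ^ 2
  w : ∑ k ∈ N, (1 + r ^ 4 * lam k) * sM (om v) k ≤ Q * r ^ 2
  s : ∑ k ∈ N, (1 + r ^ 4 * lam k) * ‖sg v k‖ ^ 2 ≤ Q * (ε / r ^ 2)
  H : r ^ 4 * ∑ k ∈ N, lam k * sv (HH V) k ≤ Q / r ^ 2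
  q : ∑ k ∈ N, (lam k + r ^ 4 * lam k ^ 2) * ‖q k‖ ^ 2 ≤ Q / r ^ 2
  V : ∑ k ∈ N, lam k * sM V k ≤ Q / r ^ 2

/-- Size of the perturbations at later times, with `δ = r ^ 4`. -/
structure Fin' (N : Finset Mode) (ε r C : ℝ) (v : Mode → Fin 3 → ℂ) : Prop where
  m : ‖v 0‖ ^ 2 ≤ C * r ^ 2
  w : ∑ k ∈ N, (1 + r ^ 4 * lam k) * sM (om v) k ≤ C * r ^ 2
  s : ∑ k ∈ N, (1 + r ^ 4 * lam k) * ‖sg v k‖ ^ 2 ≤ C * (ε / r ^ 2)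

section
variable {N : Finset Mode} {ε r δ Q : ℝ} {q : Mode → ℂ} {v : Mode → Fin 3 → ℂ}
  {V : Mode → Fin 3 → Fin 3 → ℂ}

lemma eW_le {F : Type*} [NormedAddCommGroup F] [InnerProductSpace ℝ F] {l : ℝ} (w θ : F) :
    eW δ l w θ ≤ (1 + δ * l) * ‖w‖ ^ 2 + 3 / 2 * (δ ^ 2 * ‖θ‖ ^ 2) := by
  have h := real_inner_le_norm w (δ • θ)
  rw [inner_smul_right, norm_smul] at h
  have h2 : ‖w‖ * (‖δ‖ * ‖θ‖) ≤ ‖w‖ ^ 2 / 2 + δ ^ 2 * ‖θ‖ ^ 2 / 2 := by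
    have : δ ^ 2 = ‖δ‖ ^ 2 := by simp
    rw [this]
    nlinarith [sq_nonneg (‖w‖ - ‖δ‖ * ‖θ‖)]
  unfold eW
  linarith

lemma norm_sub_sub_sq_le (a b c : ℂ) :
    ‖a - b - c‖ ^ 2 ≤ 3 * (‖a‖ ^ 2 + ‖b‖ ^ 2 + ‖c‖ ^ 2) := by
  have h1 : ‖a - b - c‖ ≤ ‖a‖ + ‖b‖ + ‖c‖ :=
    (norm_sub_le _ _).trans (by gcongr; exact norm_sub_le _ _)
  have h2 := pow_le_pow_left₀ (norm_nonneg _) h1 2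
  nlinarith [sq_nonneg (‖a‖ - ‖b‖), sq_nonneg (‖a‖ - ‖c‖), sq_nonneg (‖b‖ - ‖c‖)]

lemma norm_add_sq_le (a b : ℂ) : ‖a + b‖ ^ 2 ≤ 2 * (‖a‖ ^ 2 + ‖b‖ ^ 2) := by
  have h2 := pow_le_pow_left₀ (norm_nonneg _) (norm_add_le a b) 2
  nlinarith [sq_nonneg (‖a‖ - ‖b‖)]

lemma Ini.En_le (h : Ini N ε r Q q v V) (hr : 0 < r) (hε : 0 < ε) (hεδ : ε ≤ r ^ 4)
    (hQ : 0 ≤ Q) : En N ε (r ^ 4) q v V ≤ 11 * Q * r ^ 2 := by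
  have r4 : 0 < r ^ 4 := by positivity
  have hterm : En N ε (r ^ 4) q v V ≤ ∑ k ∈ N, ((1 + r ^ 4 * lam k) * sM (om v) k
      + (9 / 2) * ((r ^ 4) ^ 2 * (lam k * sv (HH V) k)) +
      (2 + r ^ 4 / ε) * ((1 + r ^ 4 * lam k) * ‖sg v k‖ ^ 2)
      + 5 / 2 * (r ^ 4 * ((lam k + r ^ 4 * lam k ^ 2) * ‖q k‖ ^ 2))) := by
    unfold En
    refine Finset.sum_le_sum fun k _ => ?_
    have hl := lam_nonneg k
    have h1 : ∑ a, ∑ b, eW (r ^ 4) (lam k) (om v k a b) (-om (HH V) k a b)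
        ≤ (1 + r ^ 4 * lam k) * sM (om v) k + 3 / 2 * ((r ^ 4) ^ 2 * sM (om (HH V)) k) := by
      simp only [sM, Finset.mul_sum, ← Finset.sum_add_distrib]
      refine Finset.sum_le_sum fun a _ => Finset.sum_le_sum fun b _ => ?_
      refine (eW_le _ _).trans ?_
      rw [norm_neg]
    have h2 := sM_om_le (HH V) k
    have h3 := sg_sq_le (HH V) k
    have h4 : eA ε (r ^ 4) (lam k) (sg v k) (Complex.I * q k) (sg (HH V) k) ≤
        3 / 2 * (‖sg v k‖ ^ 2 + (r ^ 4) ^ 2 * ‖sg (HH V) k‖ ^ 2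
          + (r ^ 4 * lam k) ^ 2 * ‖q k‖ ^ 2)
        + ε * lam k * (‖q k‖ ^ 2 + (r ^ 4 / ε) ^ 2 * ‖sg v k‖ ^ 2)
        + r ^ 4 * lam k / 2 * ‖sg v k‖ ^ 2 := by
      have n1 := norm_sub_sub_sq_le (sg v k) ((r ^ 4 : ℝ) • sg (HH V) k)
        ((r ^ 4 * lam k : ℝ) • (Complex.I * q k))
      have n2 := norm_add_sq_le (Complex.I * q k) ((r ^ 4 / ε : ℝ) • sg v k)
      simp only [norm_smul, norm_mul, Complex.norm_I, one_mul, mul_pow, Real.norm_eq_abs, sq_abs]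
        at n1 n2
      have n3 := mul_le_mul_of_nonneg_left n2 (by positivity : 0 ≤ ε * lam k / 2)
      have e : ((r ^ 4) ^ 2 * lam k ^ 2) = (r ^ 4 * lam k) ^ 2 := by ring
      simp only [e] at n1 n3
      unfold eA
      linarith
    have e1 : ε * lam k * ((r ^ 4 / ε) ^ 2 * ‖sg v k‖ ^ 2)
        = r ^ 4 / ε * (r ^ 4 * lam k * ‖sg v k‖ ^ 2) := by field_simp
    have h5 : ε * (lam k * ‖q k‖ ^ 2) ≤ r ^ 4 * (lam k * ‖q k‖ ^ 2) := by gcongr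
    have p1 : 0 ≤ r ^ 4 / ε * ‖sg v k‖ ^ 2 := by positivity
    have p2 : 0 ≤ r ^ 4 * (lam k * ‖q k‖ ^ 2) := by positivity
    have p3 : 0 ≤ (r ^ 4) ^ 2 * lam k ^ 2 * ‖q k‖ ^ 2 := by positivity
    have p4 : 0 ≤ r ^ 4 * lam k * ‖sg v k‖ ^ 2 := by positivity
    have h6 := mul_le_mul_of_nonneg_left h2 (by positivity : 0 ≤ (r ^ 4) ^ 2)
    have h7 := mul_le_mul_of_nonneg_left h3 (by positivity : 0 ≤ (r ^ 4) ^ 2)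
    have p5 := sq_nonneg ‖sg v k‖
    nlinarith
  simp only [Finset.sum_add_distrib, ← Finset.mul_sum] at hterm
  have hH := mul_le_mul_of_nonneg_left h.H r4.le
  have e1 : r ^ 4 * (Q / r ^ 2) = Q * r ^ 2 := by field_simp
  have hq := mul_le_mul_of_nonneg_left h.q r4.le
  have hs := mul_le_mul_of_nonneg_left h.s (by positivity : 0 ≤ 2 + r ^ 4 / ε)
  have e2 : (2 + r ^ 4 / ε) * (Q * (ε / r ^ 2)) = 2 * Q * (ε / r ^ 2) + Q * r ^ 2 := by
    field_simp
  have h8 : ε / r ^ 2 ≤ r ^ 2 := by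
    rw [div_le_iff₀ (by positivity)]; linarith [show r ^ 2 * r ^ 2 = r ^ 4 by ring]
  have h9 := mul_le_mul_of_nonneg_left h8 (by positivity : 0 ≤ 2 * Q)
  have hw := h.w
  rw [e1] at hq hH
  rw [e2] at hs
  have e3 : r ^ 4 * (r ^ 4 * ∑ k ∈ N, lam k * sv (HH V) k)
      = (r ^ 4) ^ 2 * ∑ k ∈ N, lam k * sv (HH V) k := by ring
  rw [e3] at hH
  linarith
end

section
variable {N : Finset Mode} {ε δ T A : ℝ} {u u' : ℝ → Mode → Fin 3 → ℂ} {f1 : ℝ → Mode → ℂ}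
    {f2 : ℝ → Mode → Fin 3 → ℂ} {f3 f3' : ℝ → Mode → Fin 3 → Fin 3 → ℂ}
    {q : ℝ → Mode → ℂ} {v : ℝ → Mode → Fin 3 → ℂ} {V : ℝ → Mode → Fin 3 → Fin 3 → ℂ}

lemma Fb.mono (h : Fb N ε δ T A u u' f1 f2 f3 f3') (hε : 0 ≤ ε) (hδ : 0 ≤ δ) {A' : ℝ}
    (hA : A ≤ A') : Fb N ε δ T A' u u' f1 f2 f3 f3' := by
  have h0 := h.A0
  exact ⟨h0.trans hA, fun t ht F => (h.hu t ht F).trans (by gcongr),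
    fun t ht F => (h.hu' t ht F).trans (by gcongr), h.du,
    fun t ht => (h.hf1 t ht).trans (by gcongr), h.hf2, fun t ht => (h.hf3 t ht).trans (by gcongr),
    fun t ht => (h.hf3' t ht).trans (by gcongr), h.df3⟩

/-- Energy constant. -/
def cM (Q : ℝ) : ℝ := (11 * Q + (Q + 51 * Q ^ 2) * Q) * exp (GE Q * Q)

/-- Pressure constant. -/
def cD (Q T : ℝ) : ℝ := 16 * Q * exp (KE Q T) + 26000 * Slat * Q ^ 3 + 4 * KE Q T ^ 2

/-- Final constant. -/
def cF (Q T : ℝ) : ℝ := 20 * cM Q + 20 * cM Q * exp (KE (cM Q) T) + 2 * cD (cM Q) T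

lemma le_cM {Q : ℝ} (hQ : 0 ≤ Q) : Q ≤ cM Q := by
  unfold cM
  have h := Real.one_le_exp (mul_nonneg (GE_nonneg Q) hQ)
  have h2 : Q ≤ 11 * Q + (Q + 51 * Q ^ 2) * Q := by nlinarith [sq_nonneg Q, pow_nonneg hQ 3]
  exact h2.trans (le_mul_of_one_le_right (hQ.trans h2) h)

lemma Gal.En_le_of_ini {r Q : ℝ}
    (h : Gal N ε (r ^ 4) T u f1 f2 f3 q v V)
    (hf : Fb N ε (r ^ 4) T Q u u' f1 f2 f3 f3') (h0 : Ini N ε r Q (q 0) (v 0) (V 0))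
    (hQ : 1 ≤ Q) (hTQ : T ≤ Q) (hr : 0 < r) (hr1 : r ≤ 1) (hε : 0 < ε) (hεδ : ε ≤ r ^ 4)
    (hsm : √(cM Q * r ^ 2) * (10000 * Slat) < 1) {t : ℝ} (ht : t ∈ Set.Icc 0 T) :
    En N ε (r ^ 4) (q t) (v t) (V t) ≤ cM Q * r ^ 2 := by
  have hQ0 : 0 ≤ Q := by linarith
  have hT : 0 ≤ T := ht.1.trans ht.2
  refine h.En_le hf hε (by positivity) ?_ hsm ht
  have h1 := h0.En_le hr hε hεδ hQ0
  have h2 : BE Q ε (r ^ 4) (‖v 0 0‖ ^ 2) ≤ (Q + 51 * Q ^ 2) * r ^ 2 := by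
    have := h0.m
    have r42 : r ^ 4 ≤ r ^ 2 := pow_le_pow_of_le_one hr.le hr1 (by norm_num)
    have r82 : (r ^ 4) ^ 2 ≤ r ^ 2 := by
      rw [← pow_mul]; exact pow_le_pow_of_le_one hr.le hr1 (by norm_num)
    have := mul_le_mul_of_nonneg_left r82 (sq_nonneg Q)
    have := mul_le_mul_of_nonneg_left (hεδ.trans r42) (sq_nonneg Q)
    unfold BE; linarith
  have hB : 0 ≤ BE Q ε (r ^ 4) (‖v 0 0‖ ^ 2) := BE_nonneg hε.le (sq_nonneg _)
  have hG := GE_nonneg Q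
  calc _ ≤ (11 * Q * r ^ 2 + (Q + 51 * Q ^ 2) * r ^ 2 * Q) * exp (GE Q * Q) := by gcongr
    _ = _ := by unfold cM; ring

lemma Gal.fin {r Q : ℝ} (h : Gal N ε (r ^ 4) T u f1 f2 f3 q v V)
    (hf : Fb N ε (r ^ 4) T Q u u' f1 f2 f3 f3') (h0 : Ini N ε r Q (q 0) (v 0) (V 0))
    (hQ : 1 ≤ Q) (hTQ : T ≤ Q) (hr : 0 < r) (hr1 : r ≤ 1) (hε : 0 < ε) (hεδ : ε ≤ r ^ 4)
    (hsm : √(cM Q * r ^ 2) * (10000 * Slat) < 1) {t : ℝ} (ht : t ∈ Set.Icc 0 T) :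
    Fin' N ε r (cF Q T) (v t) := by
  have hE := fun t (ht : t ∈ Set.Icc 0 T) => h.En_le_of_ini hf h0 hQ hTQ hr hr1 hε hεδ hsm ht
  have hQ0 : 0 ≤ Q := by linarith
  have hQM := le_cM hQ0
  have r4 : 0 < r ^ 4 := by positivity
  have hl0 : ∀ k, 0 ≤ lam k := lam_nonneg
  obtain ⟨b1, b2⟩ := h.div_bound (hf.mono hε.le r4.le hQM) (hQ.trans hQM) hr hr1 hε hεδ
    (h0.m.trans (by gcongr)) hE hsm.le
    (((Finset.sum_le_sum fun k _ => le_mul_of_one_le_left (sq_nonneg _)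
      (by have := mul_nonneg r4.le (hl0 k); linarith)).trans h0.s).trans (by gcongr))
    (((Finset.sum_le_sum fun k _ => mul_le_mul_of_nonneg_right
      (by have := mul_nonneg r4.le (sq_nonneg (lam k)); linarith) (sq_nonneg _)).trans h0.q).trans
        (by gcongr))
    (((Finset.sum_le_sum fun k _ => by
      rcases eq_or_ne k 0 with rfl | hk
      · simp [lam_zero]
      · have hk := lam_pos hk
        rw [inv_mul_le_iff₀ hk, ← mul_assoc, ← pow_two (lam k)]
        exact sg_HH_sq_le _ _).trans h0.V).trans (by gcongr)) ht
  set M := cM Q with hM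
  set X := exp (KE M T) with hX
  change _ ≤ cD M T / r ^ 2 at b2
  have hM0 : 0 ≤ M := hQ0.trans hQM
  have hX0 : 0 ≤ X := (exp_pos _).le
  have hD0 : 0 ≤ cD M T := by
    have := one_le_Slat; unfold cD; positivity
  have hC : cF Q T = 20 * M + 20 * M * X + 2 * cD M T := rfl
  have hEt := hE t ht
  constructor
  · rw [h.mean hf ht]
    refine h0.m.trans (mul_le_mul_of_nonneg_right ?_ (sq_nonneg r))
    have := mul_nonneg hM0 hX0
    linarith
  · have h1 := sum_sM_om_le_En (N := N) (q := q t) (v := v t) (V := V t) hε.le r4.le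
    have h2 : ∑ k ∈ N, (1 + r ^ 4 * lam k) * sM (om (v t)) k
        ≤ ∑ k ∈ N, (1 + 4 * r ^ 4 * lam k) * sM (om (v t)) k := by
      refine Finset.sum_le_sum fun k _ => mul_le_mul_of_nonneg_right ?_ (sM_nonneg _ _)
      have := mul_nonneg r4.le (hl0 k); linarith
    have h3 : 4 * (M * r ^ 2) ≤ cF Q T * r ^ 2 := by
      rw [← mul_assoc]
      refine mul_le_mul_of_nonneg_right ?_ (sq_nonneg r)
      have := mul_nonneg hM0 hX0
      linarith
    linarith
  · have h1 : (r ^ 4) ^ 2 / ε * ∑ k ∈ N, lam k * ‖sg (v t) k‖ ^ 2 ≤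
        4 * En N ε (r ^ 4) (q t) (v t) (V t) + 2 * ε * ∑ k ∈ N, lam k * ‖q t k‖ ^ 2 := by
      refine le_trans ?_ (add_le_add_left (mul_le_mul_of_nonneg_left
        (sum_eA_le_En (q := q t) (v := v t) (V := V t) r4.le) (by norm_num)) _)
      rw [Finset.mul_sum, Finset.mul_sum, Finset.mul_sum, ← Finset.sum_add_distrib]
      refine Finset.sum_le_sum fun k _ => ?_
      have n1 := norm_add_sq_le (Complex.I * q t k + (r ^ 4 / ε : ℝ) • sg (v t) k)
        (-(Complex.I * q t k))
      rw [add_neg_cancel_comm, norm_smul, norm_neg, norm_mul Complex.I, Complex.norm_I, one_mul,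
        mul_pow, Real.norm_eq_abs, sq_abs] at n1
      have n2 := mul_le_mul_of_nonneg_left n1 (mul_nonneg hε.le (hl0 k))
      have e : ε * lam k * ((r ^ 4 / ε) ^ 2 * ‖sg (v t) k‖ ^ 2)
        = (r ^ 4) ^ 2 / ε * (lam k * ‖sg (v t) k‖ ^ 2) := by field_simp
      have p1 := sq_nonneg ‖sg (v t) k - (r ^ 4 : ℝ) • sg (HH (V t)) k
        - (r ^ 4 * lam k) • (Complex.I * q t k)‖
      have p2 : 0 ≤ r ^ 4 * lam k / 2 * ‖sg (v t) k‖ ^ 2 := by have := hl0 k; positivity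
      unfold eA
      linarith
    have h2 : r ^ 4 * ∑ k ∈ N, lam k * ‖sg (v t) k‖ ^ 2 ≤ (4 * M + 2 * cD M T) * (ε / r ^ 2) := by
      have h3 := mul_le_mul_of_nonneg_left b2 (by positivity : 0 ≤ 2 * ε)
      have h4 : ε / r ^ 2 ≤ r ^ 2 := by
        rw [div_le_iff₀ (by positivity)]; linarith [show r ^ 2 * r ^ 2 = r ^ 4 by ring]
      have h5 := mul_le_mul_of_nonneg_left h4 (by positivity : 0 ≤ 2 * cD M T)
      have h6 : (r ^ 4) ^ 2 / ε * ∑ k ∈ N, lam k * ‖sg (v t) k‖ ^ 2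
          ≤ (4 * M + 2 * cD M T) * r ^ 2 := by
        have : 2 * ε * (cD M T / r ^ 2) = 2 * cD M T * (ε / r ^ 2) := by ring
        linarith
      have h7 := mul_le_mul_of_nonneg_left h6 (by positivity : 0 ≤ ε / r ^ 4)
      refine (le_of_eq ?_).trans (h7.trans (le_of_eq ?_)) <;> field_simp
    simp only [add_mul, one_mul, Finset.sum_add_distrib, mul_assoc, ← Finset.mul_sum] at h2 ⊢
    rw [hC]
    have : 0 ≤ ε / r ^ 2 := by positivity
    have p1 := mul_nonneg hM0 this
    have p2 := mul_nonneg (mul_nonneg hM0 hX0) this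
    nlinarith
end

/-- Higher order energy. -/
def SE (m : ℕ) (N : Finset Mode) (ε δ : ℝ) (q : Mode → ℂ) (v : Mode → Fin 3 → ℂ)
    (V : Mode → Fin 3 → Fin 3 → ℂ) : ℝ :=
  ∑ k ∈ N, (W k ^ m) ^ 2 * (ε * ‖q k‖ ^ 2 + sv v k + δ * sM V k)

section
variable {N : Finset Mode} {ε δ T A : ℝ} {u u' : ℝ → Mode → Fin 3 → ℂ} {f1 : ℝ → Mode → ℂ}
    {f2 : ℝ → Mode → Fin 3 → ℂ} {f3 f3' : ℝ → Mode → Fin 3 → Fin 3 → ℂ}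
    {q : ℝ → Mode → ℂ} {v : ℝ → Mode → Fin 3 → ℂ} {V : ℝ → Mode → Fin 3 → Fin 3 → ℂ} {m : ℕ}

lemma SE_nonneg (hε : 0 ≤ ε) (hδ : 0 ≤ δ) {q : Mode → ℂ} {v : Mode → Fin 3 → ℂ}
    {V : Mode → Fin 3 → Fin 3 → ℂ} : 0 ≤ SE m N ε δ q v V :=
  Finset.sum_nonneg fun k _ => by
    have := sv_nonneg v k; have := sM_nonneg V k; positivity

lemma Gal.hasDerivAt_SE (h : Gal N ε δ T u f1 f2 f3 q v V) (hε : ε ≠ 0) (hδ : δ ≠ 0) {t : ℝ}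
    (ht : t ∈ Set.Icc 0 T) : HasDerivAt (fun t => SE m N ε δ (q t) (v t) (V t))
      (∑ k ∈ N, (W k ^ m) ^ 2 * (2 * (inner ℝ (q t k) (f1 t k) + ∑ a, inner ℝ (v t k a) (f2 t k a)
        + ∑ a, ∑ b, inner ℝ (V t k a b) (Bq N (u t) (v t) k a b + f3 t k a b) - sM (V t) k))) t := by
  refine HasDerivAt.fun_sum fun k hk => HasDerivAt.const_mul _ ?_
  have h1 := (h.dq t ht k hk).norm_sq.const_mul ε
  have h2 : HasDerivAt (fun t => NSRelax.sv (v t) k) _ t :=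
    HasDerivAt.fun_sum fun a _ => (h.dv t ht k hk a).norm_sq
  have h3 : HasDerivAt (fun t => sM (V t) k) _ t :=
    HasDerivAt.fun_sum fun a _ => HasDerivAt.fun_sum fun b _ => (h.dV t ht k hk a b).norm_sq
  refine ((h1.add h2).add (h3.const_mul δ)).congr_deriv ?_
  simp only [inner_smul_right, inner_add_right, mul_add, Finset.sum_add_distrib, sM]
  simp only [Fin.sum_univ_three, Complex.inner, HH, sg, norm_sq_reim,
    Complex.add_re, Complex.mul_re, Complex.sub_re, Complex.neg_re, Complex.conj_re,
    Complex.conj_im, Complex.I_re, Complex.I_im, Complex.add_im, Complex.mul_im, Complex.sub_im,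
    Complex.neg_im, Complex.ofReal_re, Complex.ofReal_im]
  field_simp
  ring

lemma two_inner_le (x y : ℂ) : 2 * inner ℝ x y ≤ ‖x‖ ^ 2 + ‖y‖ ^ 2 := by
  have := real_inner_le_norm x y
  nlinarith [sq_nonneg (‖x‖ - ‖y‖)]

lemma sM_Bq_le (u v : Mode → Fin 3 → ℂ) (k : Mode) :
    sM (Bq N u v) k ≤ 18 * cv N (fun k => ‖v k‖) (fun k => ‖v k‖) k ^ 2
      + 72 * cv N (fun k => ‖u k‖) (fun k => ‖v k‖) k ^ 2 := by
  have h : ∀ a b, ‖Bq N u v k a b‖ ^ 2 ≤ 2 * cv N (fun k => ‖v k‖) (fun k => ‖v k‖) k ^ 2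
      + 8 * cv N (fun k => ‖u k‖) (fun k => ‖v k‖) k ^ 2 := fun a b => by
    have h1 := pow_le_pow_left₀ (norm_nonneg _) (norm_Bq_le N u v k a b) 2
    nlinarith [sq_nonneg (cv N (fun k => ‖v k‖) (fun k => ‖v k‖) k
      - 2 * cv N (fun k => ‖u k‖) (fun k => ‖v k‖) k)]
  calc _ ≤ ∑ _a : Fin 3, ∑ _b : Fin 3, _ :=
        Finset.sum_le_sum fun a _ => Finset.sum_le_sum fun b _ => h a b
    _ = _ := by simp; ring

/-- Growth constant of the higher order energy. -/
def KS (ε U : ℝ) (m : ℕ) : ℝ := ε⁻¹ + 1 + 288 * 16 ^ m * Slat * (1 + U)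

lemma sum_sM_Bq_tame (hm : 1 ≤ m) {u v : Mode → Fin 3 → ℂ} {U : ℝ} (hs : ∀ k ∉ N, v k = 0)
    (hu : ∀ F : Finset Mode, ∑ k ∈ F, (W k ^ m * ‖u k‖) ^ 2 ≤ U) :
    ∑ k ∈ N, (W k ^ m) ^ 2 * sM (Bq N u v) k ≤
      288 * 16 ^ m * Slat * (H2n N v + U) * ∑ k ∈ N, (W k ^ m * ‖v k‖) ^ 2 := by
  set Z := ∑ k ∈ N, (W k ^ m * ‖v k‖) ^ 2 with hZ
  have hS := one_le_Slat
  have hZ0 : 0 ≤ Z := Finset.sum_nonneg fun _ _ => sq_nonneg _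
  have hW : ∀ k, W k ^ 2 ≤ (W k ^ m) ^ 2 := fun k => by
    have h1 := one_le_W k
    exact pow_le_pow_left₀ (by positivity) (le_self_pow₀ h1 (by omega)) 2
  have hle : H2n N v ≤ Z := Finset.sum_le_sum fun k _ => by
    rw [mul_pow]; exact mul_le_mul_of_nonneg_right (hW k) (sq_nonneg _)
  have hu2 : ∀ F : Finset Mode, ∑ k ∈ F, W k ^ 2 * ‖u k‖ ^ 2 ≤ U := fun F =>
    (Finset.sum_le_sum fun k _ => by
      rw [mul_pow]; exact mul_le_mul_of_nonneg_right (hW k) (sq_nonneg _)).trans (hu F)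
  have hU : 0 ≤ U := by simpa using hu ∅
  have h1 := cv_tame m N N (A := fun k => ‖v k‖) (b := fun k => ‖v k‖) (P := H2n N v) (Q := Z)
    (fun k => norm_nonneg _) (fun k => norm_nonneg _)
    (sum_supp_le (fun k => by positivity) fun k hk => by simp [hs k hk])
    (sum_supp_le (fun k => by positivity) fun k hk => by simp [hs k hk])
  have h2 := cv_tame m N N (A := fun k => ‖u k‖) (b := fun k => ‖v k‖) (P := U) (Q := U)
    (fun k => norm_nonneg _) (fun k => norm_nonneg _) hu2 hu
  change _ ≤ 2 * 16 ^ m * Slat * (Z * H2n N v + H2n N v * Z) at h1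
  change _ ≤ 2 * 16 ^ m * Slat * (U * H2n N v + U * Z) at h2
  have h3 : ∑ k ∈ N, (W k ^ m) ^ 2 * sM (Bq N u v) k ≤
      18 * ∑ k ∈ N, (W k ^ m * cv N (fun k => ‖v k‖) (fun k => ‖v k‖) k) ^ 2
      + 72 * ∑ k ∈ N, (W k ^ m * cv N (fun k => ‖u k‖) (fun k => ‖v k‖) k) ^ 2 := by
    rw [Finset.mul_sum, Finset.mul_sum, ← Finset.sum_add_distrib]
    refine Finset.sum_le_sum fun k _ => ?_
    have := mul_le_mul_of_nonneg_left (sM_Bq_le (N := N) u v k) (sq_nonneg (W k ^ m))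
    rw [mul_pow, mul_pow]
    linarith
  set c := 16 ^ m * Slat with hc
  have hc0 : 0 ≤ c := by positivity
  have h4 := mul_le_mul_of_nonneg_left hle (mul_nonneg hc0 hU)
  have h5 : 0 ≤ c * H2n N v * Z := mul_nonneg (mul_nonneg hc0 (H2n_nonneg _ _)) hZ0
  have e1 : 2 * 16 ^ m * Slat * (Z * H2n N v + H2n N v * Z) = 4 * (c * H2n N v * Z) := by
    rw [hc]; ring
  have e2 : 2 * 16 ^ m * Slat * (U * H2n N v + U * Z) = 2 * (c * U * H2n N v) + 2 * (c * U * Z) := by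
    rw [hc]; ring
  have e3 : 288 * 16 ^ m * Slat * (H2n N v + U) * Z = 288 * (c * H2n N v * Z) + 288 * (c * U * Z) := by
    rw [hc]; ring
  rw [e3]; rw [e1] at h1; rw [e2] at h2
  linarith

lemma sum_W_norm_le_SE (hε : 0 ≤ ε) (hδ : 0 ≤ δ) {q : Mode → ℂ} {v : Mode → Fin 3 → ℂ}
    {V : Mode → Fin 3 → Fin 3 → ℂ} :
    ∑ k ∈ N, (W k ^ m * ‖v k‖) ^ 2 ≤ SE m N ε δ q v V := by
  refine Finset.sum_le_sum fun k _ => ?_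
  rw [mul_pow]
  refine mul_le_mul_of_nonneg_left ?_ (sq_nonneg _)
  have := norm_sq_le_sv v k; have := sM_nonneg V k
  have : 0 ≤ δ * sM V k := by positivity
  have : 0 ≤ ε * ‖q k‖ ^ 2 := by positivity
  linarith

lemma H2n_le_SE (hε : 0 ≤ ε) (hδ : 0 ≤ δ) {q : Mode → ℂ} {v : Mode → Fin 3 → ℂ}
    {V : Mode → Fin 3 → Fin 3 → ℂ} : H2n N v ≤ SE 1 N ε δ q v V := by
  have := sum_W_norm_le_SE (m := 1) (N := N) hε hδ (q := q) (v := v) (V := V)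
  simpa [H2n, mul_pow] using this

/-- The forcing terms and the background flow are bounded in a strong norm. -/
structure Hb (m : ℕ) (N : Finset Mode) (T U : ℝ) (u : ℝ → Mode → Fin 3 → ℂ) (f1 : ℝ → Mode → ℂ)
    (f2 : ℝ → Mode → Fin 3 → ℂ) (f3 : ℝ → Mode → Fin 3 → Fin 3 → ℂ) : Prop where
  u : ∀ t ∈ Set.Icc 0 T, ∀ F : Finset Mode, ∑ k ∈ F, (W k ^ m * ‖u t k‖) ^ 2 ≤ U
  f : ∀ t ∈ Set.Icc 0 T, ∑ k ∈ N, (W k ^ m) ^ 2 * (‖f1 t k‖ ^ 2 + sv (f2 t) k + sM (f3 t) k) ≤ U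

lemma Gal.dSE_le (h : Gal N ε δ T u f1 f2 f3 q v V) (hε : 0 < ε) (hδ : 0 < δ) (hm : 1 ≤ m) {U : ℝ}
    (hb : Hb m N T U u f1 f2 f3) {t : ℝ} (ht : t ∈ Set.Icc 0 T) :
    (∑ k ∈ N, (W k ^ m) ^ 2 * (2 * (inner ℝ (q t k) (f1 t k) + ∑ a, inner ℝ (v t k a) (f2 t k a)
        + ∑ a, ∑ b, inner ℝ (V t k a b) (Bq N (u t) (v t) k a b + f3 t k a b) - sM (V t) k)))
      ≤ KS ε U m * (1 + H2n N (v t)) * SE m N ε δ (q t) (v t) (V t) + U := by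
  set S := SE m N ε δ (q t) (v t) (V t) with hS
  have h1 := sum_sM_Bq_tame hm (h.sv t) (hb.u t ht)
  have h2 : ∑ k ∈ N, (W k ^ m * ‖v t k‖) ^ 2 ≤ S := sum_W_norm_le_SE hε.le hδ.le
  have hU : 0 ≤ U := by simpa using hb.u t ht ∅
  have hSl := one_le_Slat
  have hH := H2n_nonneg N (v t)
  have hS0 : 0 ≤ S := SE_nonneg hε.le hδ.le
  have h3 : (∑ k ∈ N, (W k ^ m) ^ 2 * (2 * (inner ℝ (q t k) (f1 t k)
      + ∑ a, inner ℝ (v t k a) (f2 t k a)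
      + ∑ a, ∑ b, inner ℝ (V t k a b) (Bq N (u t) (v t) k a b + f3 t k a b) - sM (V t) k))) ≤
      (ε⁻¹ + 1) * S + U + ∑ k ∈ N, (W k ^ m) ^ 2 * sM (Bq N (u t) (v t)) k := by
    refine le_trans ?_ (add_le_add_left (add_le_add_right (hb.f t ht) _) _)
    rw [hS, SE, Finset.mul_sum, ← Finset.sum_add_distrib, ← Finset.sum_add_distrib]
    refine Finset.sum_le_sum fun k _ => ?_
    have i1 := two_inner_le (q t k) (f1 t k)
    have i2 : 2 * ∑ a, inner ℝ (v t k a) (f2 t k a) ≤ NSRelax.sv (v t) k + NSRelax.sv (f2 t) k := by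
      unfold NSRelax.sv
      rw [Finset.mul_sum, ← Finset.sum_add_distrib]
      exact Finset.sum_le_sum fun a _ => two_inner_le _ _
    have i3 : 2 * ∑ a, ∑ b, inner ℝ (V t k a b) (Bq N (u t) (v t) k a b + f3 t k a b) ≤
        2 * sM (V t) k + sM (Bq N (u t) (v t)) k + sM (f3 t) k := by
      unfold sM
      simp only [Finset.mul_sum, ← Finset.sum_add_distrib]
      refine Finset.sum_le_sum fun a _ => Finset.sum_le_sum fun b _ => ?_
      rw [inner_add_right]
      have := two_inner_le (V t k a b) (Bq N (u t) (v t) k a b)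
      have := two_inner_le (V t k a b) (f3 t k a b)
      linarith
    have i4 : ‖q t k‖ ^ 2 + NSRelax.sv (v t) k ≤ (ε⁻¹ + 1) * (ε * ‖q t k‖ ^ 2 + NSRelax.sv (v t) k
        + δ * sM (V t) k) := by
      have p0 := sv_nonneg (v t) k
      have p1 : 0 ≤ δ * sM (V t) k := mul_nonneg hδ.le (sM_nonneg (V t) k)
      have e : ε⁻¹ * (ε * ‖q t k‖ ^ 2) = ‖q t k‖ ^ 2 := by field_simp
      have p2 : 0 ≤ ε * ‖q t k‖ ^ 2 := by positivity
      have p3 : 0 ≤ ε⁻¹ * (NSRelax.sv (v t) k + δ * sM (V t) k) := by positivity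
      linarith
    have i5 := mul_le_mul_of_nonneg_left (add_le_add (add_le_add i1 i2) (add_le_add i3 i4))
      (sq_nonneg (W k ^ m))
    linarith
  have h4 : 288 * 16 ^ m * Slat * (H2n N (v t) + U) * ∑ k ∈ N, (W k ^ m * ‖v t k‖) ^ 2 ≤
      288 * 16 ^ m * Slat * (1 + U) * (1 + H2n N (v t)) * S := by
    rw [mul_assoc (_ * Slat) (1 + U)]
    refine mul_le_mul ?_ h2 (Finset.sum_nonneg fun _ _ => sq_nonneg _) (by positivity)
    refine mul_le_mul_of_nonneg_left ?_ (by positivity)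
    nlinarith [mul_nonneg hU hH]
  have h5 : (ε⁻¹ + 1) * S ≤ (ε⁻¹ + 1) * (1 + H2n N (v t)) * S := by
    refine mul_le_mul_of_nonneg_right ?_ hS0
    exact le_mul_of_one_le_right (by positivity) (by linarith)
  unfold KS
  linarith

lemma KS_nonneg {U : ℝ} (hε : 0 ≤ ε) (hU : 0 ≤ U) : 0 ≤ KS ε U m := by
  have := one_le_Slat; unfold KS; positivity

/-- Propagation of the higher order energy. -/
lemma Gal.SE_le (h : Gal N ε δ T u f1 f2 f3 q v V) (hε : 0 < ε) (hδ : 0 < δ) (hm : 1 ≤ m) {U P : ℝ}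
    (hb : Hb m N T U u f1 f2 f3) (hP : ∀ t ∈ Set.Icc 0 T, H2n N (v t) ≤ P) {t : ℝ}
    (ht : t ∈ Set.Icc 0 T) :
    SE m N ε δ (q t) (v t) (V t) ≤
      (SE m N ε δ (q 0) (v 0) (V 0) + U * T) * exp (KS ε U m * (1 + P) * T) := by
  have hU : 0 ≤ U := by simpa using hb.u t ht ∅
  have hP0 : 0 ≤ P := (H2n_nonneg _ _).trans (hP t ht)
  have hK : 0 ≤ KS ε U m * (1 + P) := mul_nonneg (KS_nonneg hε.le hU) (by linarith)
  have hS : 0 ≤ SE m N ε δ (q 0) (v 0) (V 0) := SE_nonneg hε.le hδ.le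
  have hd := fun t ht => h.hasDerivAt_SE (m := m) hε.ne' hδ.ne' (t := t) ht
  refine (gronwall_linear hK hU (fun t ht => (hd t ht).continuousAt.continuousWithinAt)
    (fun t ht => hd t (Set.Ioo_subset_Icc_self ht)) (fun t ht => ?_) le_rfl ht).trans ?_
  · have ht' := Set.Ioo_subset_Icc_self ht
    refine (h.dSE_le hε hδ hm hb ht').trans ?_
    gcongr
    · exact SE_nonneg hε.le hδ.le
    · exact KS_nonneg hε.le hU
    · exact hP t ht'
  · rw [sub_zero]
    have h1 := ht.2
    have h0 := ht.1
    have hT : 0 ≤ T := h0.trans h1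
    have : 0 ≤ SE m N ε δ (q 0) (v 0) (V 0) + U * T := by positivity
    gcongr

/-- Short time bound, uniform in the truncation. -/
lemma Gal.SE_short (h : Gal N ε δ T u f1 f2 f3 q v V) (hε : 0 < ε) (hδ : 0 < δ) {U R a : ℝ}
    (hb : Hb 1 N T U u f1 f2 f3) (ha : 0 ≤ a) (hR : SE 1 N ε δ (q a) (v a) (V a) ≤ R)
    (hT : (KS ε U 1 * (3 + R) * (2 + R) + U) * (T - a) ≤ 1) {t : ℝ} (ht : t ∈ Set.Icc a T) :
    SE 1 N ε δ (q t) (v t) (V t) ≤ R + 2 := by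
  have h0T : t ∈ Set.Icc 0 T := ⟨ha.trans ht.1, ht.2⟩
  have hU : 0 ≤ U := by simpa using hb.u t h0T ∅
  have hR0 : 0 ≤ R := (SE_nonneg hε.le hδ.le).trans hR
  have hK := KS_nonneg (m := 1) hε.le hU
  have hsub : Set.Icc a T ⊆ Set.Icc 0 T := Set.Icc_subset_Icc_left ha
  have hd := fun t ht => h.hasDerivAt_SE (m := 1) hε.ne' hδ.ne' (t := t) ht
  set L := KS ε U 1 * (3 + R) * (2 + R) + U with hL
  have hL0 : 0 ≤ L := by positivity
  refine (bootstrap (c := R + 2) (e := fun t => SE 1 N ε δ (q t) (v t) (V t))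
    (fun t ht => (hd t (hsub ht)).continuousAt.continuousWithinAt) (by linarith) ?_ ht).le
  intro s hs hle
  have hss : Set.Icc a s ⊆ Set.Icc 0 T := (Set.Icc_subset_Icc_right hs.2).trans hsub
  have := gronwall_linear le_rfl hL0 (fun t ht => (hd t (hss ht)).continuousAt.continuousWithinAt)
    (fun t ht => hd t (hss (Set.Ioo_subset_Icc_self ht))) (fun t ht => ?_) hR
    (Set.right_mem_Icc.2 hs.1)
  · simp only [zero_mul, exp_zero, mul_one] at this
    have h3 := mul_le_mul_of_nonneg_left (sub_le_sub_right hs.2 a) hL0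
    linarith
  · have ht' := Set.Ioo_subset_Icc_self ht
    refine (h.dSE_le hε hδ le_rfl hb (hss ht')).trans ?_
    have h1 := hle t ht'
    have h2 : H2n N (v t) ≤ SE 1 N ε δ (q t) (v t) (V t) := H2n_le_SE hε.le hδ.le
    rw [zero_mul, zero_add, hL]
    have h3 : 1 + H2n N (v t) ≤ 3 + R := by linarith
    have h4 : SE 1 N ε δ (q t) (v t) (V t) ≤ 2 + R := by linarith
    have := SE_nonneg (m := 1) (N := N) hε.le hδ.le (q := q t) (v := v t) (V := V t)
    gcongr

lemma Dn_le_En (hε : 0 ≤ ε) (hδ : 0 < δ) {q : Mode → ℂ} {v : Mode → Fin 3 → ℂ}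
    {V : Mode → Fin 3 → Fin 3 → ℂ} : Dn N v ≤ 2 / δ * En N ε δ q v V := by
  rw [div_mul_eq_mul_div, le_div_iff₀ hδ, Dn, En, Finset.mul_sum, Finset.sum_mul]
  refine Finset.sum_le_sum fun k _ => ?_
  have hl := lam_nonneg k
  have h1 : δ * (lam k * sM (om v) k) ≤ ∑ a, ∑ b, eW δ (lam k) (om v k a b) (-om (HH V) k a b) := by
    simp only [sM, Finset.mul_sum]
    refine Finset.sum_le_sum fun a _ => Finset.sum_le_sum fun b _ => ?_
    rw [eW_sq]
    have := sq_nonneg ‖om v k a b + (2 * δ) • -om (HH V) k a b‖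
    have := sq_nonneg ‖om v k a b‖
    linarith
  have h2 : δ * (lam k * ‖sg v k‖ ^ 2) / 2 ≤ eA ε δ (lam k) (sg v k) (Complex.I * q k) (sg (HH V) k) := by
    unfold eA
    have := sq_nonneg ‖sg v k - δ • sg (HH V) k - (δ * lam k) • (Complex.I * q k)‖
    have : 0 ≤ ε * lam k / 2 * ‖Complex.I * q k + (δ / ε) • sg v k‖ ^ 2 := by positivity
    linarith
  have h3 : 0 ≤ δ * (lam k * sM (om v) k) := by have := sM_nonneg (om v) k; positivity
  linarith

end

/-- Rapid decay of coefficients, uniformly in a parameter and in time. -/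
def RD {ι : Type*} (S : Set ℝ) (c : ι → ℝ → Mode → ℂ) : Prop :=
  ∀ m : ℕ, ∃ C, ∀ i, ∀ t ∈ S, ∀ k, W k ^ m * ‖c i t k‖ ≤ C

/-- Rapidly decaying coefficients with `n` rapidly decaying time derivatives. -/
def Sm {ι : Type*} (S : Set ℝ) : ℕ → (ι → ℝ → Mode → ℂ) → Prop
  | 0, c => RD S c
  | n + 1, c => RD S c ∧ ∃ e : ι → ℝ → Mode → ℂ,
      (∀ i, ∀ t ∈ S, ∀ k, HasDerivAt (fun t => c i t k) (e i t k) t) ∧ Sm S n e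

/-- Convolution over the full lattice. -/
def cvi (A b : Mode → ℂ) (k : Mode) : ℂ := ∑' j, A (k - j) * b j

/-- Multipliers of polynomial growth. -/
def PM {ι : Type*} (M : ι → Mode → ℂ) : Prop := ∃ (C : ℝ) (p : ℕ), ∀ i k, ‖M i k‖ ≤ C * W k ^ p

section
variable {ι : Type*} {S : Set ℝ} {n : ℕ} {c d : ι → ℝ → Mode → ℂ}

lemma RD.exists_nonneg (h : RD S c) (m : ℕ) :
    ∃ C, 0 ≤ C ∧ ∀ i, ∀ t ∈ S, ∀ k, W k ^ m * ‖c i t k‖ ≤ C := by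
  obtain ⟨C, hC⟩ := h m
  exact ⟨max C 0, le_max_right _ _, fun i t ht k => (hC i t ht k).trans (le_max_left _ _)⟩

lemma RD.mono {S' : Set ℝ} (h : RD S c) (hS : S' ⊆ S) : RD S' c := fun m => by
  obtain ⟨C, hC⟩ := h m
  exact ⟨C, fun i t ht k => hC i t (hS ht) k⟩

lemma RD.congr (h : RD S c) (he : ∀ i, ∀ t ∈ S, ∀ k, d i t k = c i t k) : RD S d := fun m => by
  obtain ⟨C, hC⟩ := h m
  exact ⟨C, fun i t ht k => by rw [he i t ht k]; exact hC i t ht k⟩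

lemma RD.add (hc : RD S c) (hd : RD S d) : RD S (fun i t k => c i t k + d i t k) := fun m => by
  obtain ⟨C, hC⟩ := hc m
  obtain ⟨D, hD⟩ := hd m
  refine ⟨C + D, fun i t ht k => ?_⟩
  have := W_pos k
  calc _ ≤ W k ^ m * (‖c i t k‖ + ‖d i t k‖) := by gcongr; exact norm_add_le _ _
    _ ≤ _ := by rw [mul_add]; exact add_le_add (hC i t ht k) (hD i t ht k)

lemma RD.mulm {M : ι → Mode → ℂ} (hM : PM M) (hc : RD S c) :
    RD S (fun i t k => M i k * c i t k) := fun m => by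
  obtain ⟨B, p, hB⟩ := hM
  obtain ⟨C, hC0, hC⟩ := hc.exists_nonneg (m + p)
  refine ⟨max B 0 * C, fun i t ht k => ?_⟩
  have := W_pos k
  rw [norm_mul]
  calc _ ≤ W k ^ m * (max B 0 * W k ^ p * ‖c i t k‖) := by
        gcongr
        exact (hB i k).trans (by gcongr; exact le_max_left _ _)
    _ = max B 0 * (W k ^ (m + p) * ‖c i t k‖) := by ring
    _ ≤ _ := by gcongr; exact hC i t ht k

lemma W_le_mul (k j : Mode) : W k ≤ 4 * (W (k - j) * W j) := by
  have h := W_le_add k j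
  have h1 := one_le_W (k - j); have h2 := one_le_W j
  nlinarith [mul_nonneg (sub_nonneg.2 h1) (sub_nonneg.2 h2)]

lemma norm_cvi_term_le {m : ℕ} {A b : Mode → ℂ} {C D : ℝ} (hA : ∀ k, W k ^ m * ‖A k‖ ≤ C)
    (hb : ∀ k, W k ^ (m + 2) * ‖b k‖ ≤ D) (hC : 0 ≤ C) (k j : Mode) :
    W k ^ m * ‖A (k - j) * b j‖ ≤ 4 ^ m * C * D * (W j ^ 2)⁻¹ := by
  have h0 := W_pos k; have h1 := W_pos (k - j); have h2 := W_pos j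
  rw [norm_mul]
  calc _ ≤ (4 * (W (k - j) * W j)) ^ m * (‖A (k - j)‖ * ‖b j‖) := by gcongr; exact W_le_mul k j
    _ = 4 ^ m * (W (k - j) ^ m * ‖A (k - j)‖) * (W j ^ (m + 2) * ‖b j‖) * (W j ^ 2)⁻¹ := by
        field_simp
        ring
    _ ≤ _ := by gcongr <;> [exact hA _; exact hb _]

lemma cvi_summable {A b : Mode → ℂ} {C D : ℝ} (hA : ∀ k, ‖A k‖ ≤ C)
    (hb : ∀ k, W k ^ 2 * ‖b k‖ ≤ D) (k : Mode) : Summable fun j => ‖A (k - j) * b j‖ := by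
  have hC : 0 ≤ C := (norm_nonneg _).trans (hA 0)
  refine Summable.of_nonneg_of_le (fun _ => norm_nonneg _) (fun j => ?_)
    (summable_W.mul_left (C * D))
  simpa using norm_cvi_term_le (m := 0) (C := C) (by simpa using hA) (by simpa using hb) hC k j

lemma RD.cvi (hc : RD S c) (hd : RD S d) : RD S (fun i t => cvi (c i t) (d i t)) := fun m => by
  obtain ⟨C, hC0, hC⟩ := hc.exists_nonneg m
  obtain ⟨D, hD0, hD⟩ := hd.exists_nonneg (m + 2)
  refine ⟨4 ^ m * C * D * ∑' j : Mode, (W j ^ 2)⁻¹, fun i t ht k => ?_⟩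
  have hW := W_pos k
  have hk := fun j => norm_cvi_term_le (hC i t ht) (hD i t ht) hC0 k j
  have hs : Summable fun j => W k ^ m * ‖c i t (k - j) * d i t j‖ :=
    Summable.of_nonneg_of_le (fun j => by positivity) hk (summable_W.mul_left _)
  have hs' : Summable fun j => ‖c i t (k - j) * d i t j‖ := by
    refine (hs.mul_left (W k ^ m)⁻¹).congr fun j => ?_
    field_simp
  calc _ ≤ W k ^ m * ∑' j, ‖c i t (k - j) * d i t j‖ := by
        gcongr; exact norm_tsum_le_tsum_norm hs'
    _ = ∑' j, W k ^ m * ‖c i t (k - j) * d i t j‖ := tsum_mul_left.symm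
    _ ≤ ∑' j, 4 ^ m * C * D * (W j ^ 2)⁻¹ := hs.tsum_le_tsum hk (summable_W.mul_left _)
    _ = _ := tsum_mul_left

lemma Sm.rd (h : Sm S n c) : RD S c := by
  cases n with
  | zero => exact h
  | succ n => exact h.1

lemma Sm.pred (h : Sm S (n + 1) c) : Sm S n c := by
  induction n generalizing c with
  | zero => exact h.1
  | succ n ih => obtain ⟨h1, c', h2, h3⟩ := h; exact ⟨h1, c', h2, ih h3⟩

lemma Sm.mono {S' : Set ℝ} (h : Sm S n c) (hS : S' ⊆ S) : Sm S' n c := by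
  induction n generalizing c with
  | zero => exact RD.mono h hS
  | succ n ih =>
    obtain ⟨h1, c', h2, h3⟩ := h
    exact ⟨h1.mono hS, c', fun i t ht => h2 i t (hS ht), ih h3⟩

/-- Restriction to a single parameter, or reindexing. -/
lemma Sm.comp {κ : Type*} (h : Sm S n c) (g : κ → ι) : Sm S n (fun i => c (g i)) := by
  induction n generalizing c with
  | zero =>
    intro m
    obtain ⟨C, hC⟩ := h m
    exact ⟨C, fun i => hC (g i)⟩
  | succ n ih =>
    obtain ⟨h1, c', h2, h3⟩ := h
    refine ⟨fun m => ?_, _, fun i => h2 (g i), ih h3⟩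
    obtain ⟨C, hC⟩ := h1 m
    exact ⟨C, fun i => hC (g i)⟩

lemma Sm.add (hc : Sm S n c) (hd : Sm S n d) : Sm S n (fun i t k => c i t k + d i t k) := by
  induction n generalizing c d with
  | zero => exact RD.add hc hd
  | succ n ih =>
    obtain ⟨h1, c', h2, h3⟩ := hc
    obtain ⟨g1, d', g2, g3⟩ := hd
    exact ⟨h1.add g1, _, fun i t ht k => (h2 i t ht k).add (g2 i t ht k), ih h3 g3⟩

lemma Sm.mulm {M : ι → Mode → ℂ} (hM : PM M) (hc : Sm S n c) :
    Sm S n (fun i t k => M i k * c i t k) := by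
  induction n generalizing c with
  | zero => exact RD.mulm hM hc
  | succ n ih =>
    obtain ⟨h1, c', h2, h3⟩ := hc
    exact ⟨h1.mulm hM, _, fun i t ht k => (h2 i t ht k).const_mul _, ih h3⟩

lemma pM_const (a : ℂ) : PM (fun (_ : ι) _ => a) := ⟨‖a‖, 0, by simp⟩

lemma pM_xi (a : Fin 3) : PM (fun (_ : ι) k => (xi k a : ℂ)) := by
  refine ⟨1, 1, fun i k => ?_⟩
  rw [Complex.norm_real, one_mul, pow_one]
  have h1 := xi_sq_le_lam k a
  have h2 := lam_nonneg k
  refine abs_le_of_sq_le_sq ?_ (W_pos k).le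
  unfold W; nlinarith

lemma PM.mul {M M' : ι → Mode → ℂ} (h : PM M) (h' : PM M') : PM (fun i k => M i k * M' i k) := by
  obtain ⟨C, p, hC⟩ := h
  obtain ⟨D, r, hD⟩ := h'
  refine ⟨C * D, p + r, fun i k => ?_⟩
  rw [norm_mul]
  calc _ ≤ (C * W k ^ p) * (D * W k ^ r) :=
        mul_le_mul (hC i k) (hD i k) (norm_nonneg _) ((norm_nonneg _).trans (hC i k))
    _ = _ := by ring

lemma Sm.zero : Sm S n (fun (_ : ι) _ _ => 0) := by
  induction n with
  | zero => exact fun m => ⟨0, by simp⟩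
  | succ n ih => exact ⟨fun m => ⟨0, by simp⟩, _, fun i t _ k => hasDerivAt_const t 0, ih⟩

lemma Sm.sum {α : Type*} (s : Finset α) {c : α → ι → ℝ → Mode → ℂ} (h : ∀ a ∈ s, Sm S n (c a)) :
    Sm S n (fun i t k => ∑ a ∈ s, c a i t k) := by
  classical
  induction s using Finset.induction_on with
  | empty => simpa using Sm.zero
  | insert a s ha ih =>
    simp only [Finset.sum_insert ha]
    exact (h a (by simp)).add (ih fun b hb => h b (by simp [hb]))

lemma hasDerivAt_cvi (hS : IsOpen S) (hS' : IsPreconnected S) {A b A' b' : ι → ℝ → Mode → ℂ}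
    (hA : RD S A) (hb : RD S b) (hA' : RD S A') (hb' : RD S b') (i : ι)
    (dA : ∀ t ∈ S, ∀ k, HasDerivAt (fun t => A i t k) (A' i t k) t)
    (db : ∀ t ∈ S, ∀ k, HasDerivAt (fun t => b i t k) (b' i t k) t) {t : ℝ} (ht : t ∈ S)
    (k : Mode) :
    HasDerivAt (fun t => cvi (A i t) (b i t) k) (cvi (A' i t) (b i t) k + cvi (A i t) (b' i t) k)
      t := by
  obtain ⟨C, hC0, hC⟩ := hA.exists_nonneg 0
  obtain ⟨C', hC0', hC'⟩ := hA'.exists_nonneg 0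
  obtain ⟨D, hD0, hD⟩ := hb.exists_nonneg 2
  obtain ⟨D', hD0', hD'⟩ := hb'.exists_nonneg 2
  simp only [pow_zero, one_mul] at hC hC'
  have e : cvi (A' i t) (b i t) k + cvi (A i t) (b' i t) k =
      ∑' j, (A' i t (k - j) * b i t j + A i t (k - j) * b' i t j) :=
    ((cvi_summable (hC' i t ht) (hD i t ht) k).of_norm.tsum_add
      (cvi_summable (hC i t ht) (hD' i t ht) k).of_norm).symm
  rw [e]
  refine hasDerivAt_tsum_of_isPreconnected (u := fun j => (C' * D + C * D') * (W j ^ 2)⁻¹)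
    (summable_W.mul_left _) hS hS' (fun j s hs => (dA s hs (k - j)).mul (db s hs j))
    (fun j s hs => ?_) ht (cvi_summable (hC i t ht) (hD i t ht) k).of_norm ht
  have h1 := norm_cvi_term_le (m := 0) (by simpa using hC' i s hs) (by simpa using hD i s hs) hC0' k j
  have h2 := norm_cvi_term_le (m := 0) (by simpa using hC i s hs) (by simpa using hD' i s hs) hC0 k j
  refine (norm_add_le _ _).trans ?_
  simp only [pow_zero, one_mul] at h1 h2
  rw [add_mul]
  exact add_le_add h1 h2

lemma Sm.cvi (hS : IsOpen S) (hS' : IsPreconnected S) (hc : Sm S n c) (hd : Sm S n d) :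
    Sm S n (fun i t => cvi (c i t) (d i t)) := by
  induction n generalizing c d with
  | zero => exact RD.cvi hc hd
  | succ n ih =>
    have hc' := hc.pred
    have hd' := hd.pred
    obtain ⟨h1, c', h2, h3⟩ := hc
    obtain ⟨g1, d', g2, g3⟩ := hd
    exact ⟨h1.cvi g1, _, fun i t ht k => hasDerivAt_cvi hS hS' h1 g1 h3.rd g3.rd i (h2 i) (g2 i)
      ht k, (ih h3 hd').add (ih hc' g3)⟩

lemma cv_eq_cvi {N : Finset Mode} {A b : Mode → ℂ} (hb : ∀ k ∉ N, b k = 0) (k : Mode) :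
    cv N A b k = NSRelax.cvi A b k :=
  (tsum_eq_sum fun j hj => by rw [hb j hj, mul_zero]).symm

open Filter Topology in
lemma tendsto_cvi {l : Filter ℕ} [l.NeBot] {A b : ℕ → Mode → ℂ} {A0 b0 : Mode → ℂ} {C D : ℝ}
    (hA : ∀ i k, ‖A i k‖ ≤ C) (hb : ∀ i k, W k ^ 2 * ‖b i k‖ ≤ D)
    (tA : ∀ k, Tendsto (fun i => A i k) l (𝓝 (A0 k)))
    (tb : ∀ k, Tendsto (fun i => b i k) l (𝓝 (b0 k))) (k : Mode) :
    Tendsto (fun i => NSRelax.cvi (A i) (b i) k) l (𝓝 (NSRelax.cvi A0 b0 k)) := by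
  have hC : 0 ≤ C := (norm_nonneg _).trans (hA 0 0)
  refine tendsto_tsum_of_dominated_convergence (bound := fun j => C * D * (W j ^ 2)⁻¹)
    (summable_W.mul_left _) (fun j => (tA _).mul (tb j)) (Eventually.of_forall fun i j => ?_)
  simpa using norm_cvi_term_le (m := 0) (C := C) (by simpa using hA i) (by simpa using hb i) hC k j

end

/-- Coefficients of one mode of a state. -/
abbrev Zt := ℂ × (Fin 3 → ℂ) × (Fin 3 → Fin 3 → ℂ)

/-- Extension by zero of a truncated state. -/
def ext0 {N : Finset Mode} (z : N → Zt) : Mode → Zt := Function.extend Subtype.val z 0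

/-- Right-hand side of the truncated system. -/
def rhs (N : Finset Mode) (ε δ : ℝ) (u : ℝ → Mode → Fin 3 → ℂ) (f1 : ℝ → Mode → ℂ)
    (f2 : ℝ → Mode → Fin 3 → ℂ) (f3 : ℝ → Mode → Fin 3 → Fin 3 → ℂ) (t : ℝ) (z : N → Zt) (k : N) :
    Zt :=
  (ε⁻¹ • (-(Complex.I * sg (fun k => (ext0 z k).2.1) k) + f1 t k),
    fun a => -HH (fun k => (ext0 z k).2.2) k a - xi k a * (Complex.I * (ext0 z k).1) + f2 t k a,
    fun a b => δ⁻¹ • (-(ext0 z k).2.2 a b - Complex.I * xi k b * (ext0 z k).2.1 a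
      + (Bq N (u t) (fun k => (ext0 z k).2.1) k a b + f3 t k a b)))

section
variable {N : Finset Mode} {ε δ T : ℝ} {u : ℝ → Mode → Fin 3 → ℂ} {f1 : ℝ → Mode → ℂ}
    {f2 : ℝ → Mode → Fin 3 → ℂ} {f3 : ℝ → Mode → Fin 3 → Fin 3 → ℂ}
    {q q' : ℝ → Mode → ℂ} {v v' : ℝ → Mode → Fin 3 → ℂ} {V V' : ℝ → Mode → Fin 3 → Fin 3 → ℂ}

lemma ext0_mem (z : N → Zt) {k : Mode} (hk : k ∈ N) : ext0 z k = z ⟨k, hk⟩ :=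
  Subtype.val_injective.extend_apply z 0 ⟨k, hk⟩

lemma ext0_not_mem (z : N → Zt) {k : Mode} (hk : k ∉ N) : ext0 z k = 0 :=
  Function.extend_apply' _ _ _ (by rintro ⟨⟨j, hj⟩, rfl⟩; exact hk hj)

lemma contDiff_ext0 (k : Mode) : ContDiff ℝ 1 fun p : ℝ × (N → Zt) => ext0 p.2 k := by
  by_cases hk : k ∈ N
  · simp only [ext0_mem _ hk]
    exact (contDiff_apply ℝ Zt (⟨k, hk⟩ : N)).comp contDiff_snd
  · simp only [ext0_not_mem _ hk]
    exact contDiff_const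

lemma contDiff_rhs (hu : ∀ k a, ContDiff ℝ 1 fun t => u t k a) (h1 : ∀ k, ContDiff ℝ 1 fun t => f1 t k)
    (h2 : ∀ k a, ContDiff ℝ 1 fun t => f2 t k a) (h3 : ∀ k a b, ContDiff ℝ 1 fun t => f3 t k a b) :
    ContDiff ℝ 1 (Function.uncurry (rhs N ε δ u f1 f2 f3)) := by
  have eq : ∀ k, ContDiff ℝ 1 fun p : ℝ × (N → Zt) => (ext0 p.2 k).1 := fun k =>
    (contDiff_ext0 k).fst
  have ev : ∀ k a, ContDiff ℝ 1 fun p : ℝ × (N → Zt) => (ext0 p.2 k).2.1 a := fun k a =>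
    contDiff_pi.1 ((contDiff_ext0 k).snd.fst) a
  have eV : ∀ k a b, ContDiff ℝ 1 fun p : ℝ × (N → Zt) => (ext0 p.2 k).2.2 a b := fun k a b =>
    contDiff_pi.1 (contDiff_pi.1 ((contDiff_ext0 k).snd.snd) a) b
  have hu' : ∀ k a, ContDiff ℝ 1 fun p : ℝ × (N → Zt) => u p.1 k a := fun k a =>
    (hu k a).comp contDiff_fst
  have h1' : ∀ k, ContDiff ℝ 1 fun p : ℝ × (N → Zt) => f1 p.1 k := fun k =>
    (h1 k).comp contDiff_fst
  have h2' : ∀ k a, ContDiff ℝ 1 fun p : ℝ × (N → Zt) => f2 p.1 k a := fun k a =>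
    (h2 k a).comp contDiff_fst
  have h3' : ∀ k a b, ContDiff ℝ 1 fun p : ℝ × (N → Zt) => f3 p.1 k a b := fun k a b =>
    (h3 k a b).comp contDiff_fst
  refine contDiff_pi.2 fun k => ContDiff.prodMk ?_ (ContDiff.prodMk ?_ ?_)
  · simp only [sg]
    refine ContDiff.const_smul _ (ContDiff.add (ContDiff.neg (contDiff_const.mul ?_)) (h1' k))
    exact ContDiff.sum fun a _ => contDiff_const.mul (ev k a)
  · refine contDiff_pi.2 fun a => ?_
    simp only [HH]
    refine ((ContDiff.neg (ContDiff.sum fun j _ => contDiff_const.mul (eV k a j))).sub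
      (contDiff_const.mul (contDiff_const.mul (eq k)))).add (h2' k a)
  · refine contDiff_pi.2 fun a => contDiff_pi.2 fun b => ?_
    simp only [Bq, cv]
    refine ContDiff.const_smul _ (((eV k a b).neg.sub (contDiff_const.mul (ev k a))).add
      (ContDiff.add (ContDiff.add (ContDiff.add ?_ ?_) ?_) (h3' k a b)))
    · exact ContDiff.sum fun j _ => (ev _ a).mul (ev j b)
    · exact ContDiff.sum fun j _ => (hu' _ a).mul (ev j b)
    · exact ContDiff.sum fun j _ => (hu' _ b).mul (ev j a)

lemma gal_of_ode {z : ℝ → N → Zt}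
    (hz : ∀ t ∈ Set.Icc 0 T, HasDerivAt z (rhs N ε δ u f1 f2 f3 t (z t)) t) :
    Gal N ε δ T u f1 f2 f3 (fun t k => (ext0 (z t) k).1) (fun t k => (ext0 (z t) k).2.1)
      (fun t k => (ext0 (z t) k).2.2) := by
  have hk : ∀ t ∈ Set.Icc 0 T, ∀ k : N, HasDerivAt (fun t => ext0 (z t) k)
      (rhs N ε δ u f1 f2 f3 t (z t) k) t := fun t ht k => by
    simp only [ext0_mem _ k.2]
    exact hasDerivAt_pi.1 (hz t ht) k
  refine ⟨fun t k hk => ?_, fun t k hk => ?_, fun t k hk => ?_, fun t ht k hkN => ?_,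
    fun t ht k hkN a => ?_, fun t ht k hkN a b => ?_⟩
  · simp [ext0_not_mem _ hk]
  · simp [ext0_not_mem _ hk]
  · simp [ext0_not_mem _ hk]
  · exact (hk t ht ⟨k, hkN⟩).hasFDerivAt.fst.hasDerivAt.congr_deriv (by simp [rhs])
  · exact (hasDerivAt_pi.1 (hk t ht ⟨k, hkN⟩).hasFDerivAt.snd.fst.hasDerivAt a).congr_deriv
      (by simp [rhs])
  · exact (hasDerivAt_pi.1 (hasDerivAt_pi.1
      (hk t ht ⟨k, hkN⟩).hasFDerivAt.snd.snd.hasDerivAt a) b).congr_deriv (by simp [rhs])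

lemma Gal.ext0_eq (h : Gal N ε δ T u f1 f2 f3 q v V) (t : ℝ) (k : Mode) :
    ext0 (fun k : N => ((q t k, v t k, V t k) : Zt)) k = (q t k, v t k, V t k) := by
  by_cases hk : k ∈ N
  · rw [ext0_mem _ hk]
  · rw [ext0_not_mem _ hk, h.sq t k hk, h.sv t k hk, h.sV t k hk]; rfl

lemma Gal.ode (h : Gal N ε δ T u f1 f2 f3 q v V) : ∀ t ∈ Set.Icc 0 T,
    HasDerivAt (fun t (k : N) => ((q t k, v t k, V t k) : Zt))
      (rhs N ε δ u f1 f2 f3 t (fun k : N => (q t k, v t k, V t k))) t := by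
  intro t ht
  refine hasDerivAt_pi.2 fun k => ?_
  simp only [rhs, h.ext0_eq]
  exact (h.dq t ht k k.2).prodMk ((hasDerivAt_pi.2 fun a => h.dv t ht k k.2 a).prodMk
    (hasDerivAt_pi.2 fun a => hasDerivAt_pi.2 fun b => h.dV t ht k k.2 a b))

lemma Gal.unique (hu : ∀ k a, ContDiff ℝ 1 fun t => u t k a) (h1 : ∀ k, ContDiff ℝ 1 fun t => f1 t k)
    (h2 : ∀ k a, ContDiff ℝ 1 fun t => f2 t k a) (h3 : ∀ k a b, ContDiff ℝ 1 fun t => f3 t k a b)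
    (h : Gal N ε δ T u f1 f2 f3 q v V) (h' : Gal N ε δ T u f1 f2 f3 q' v' V')
    (h0 : q 0 = q' 0 ∧ v 0 = v' 0 ∧ V 0 = V' 0) {t : ℝ} (ht : t ∈ Set.Icc 0 T) :
    q t = q' t ∧ v t = v' t ∧ V t = V' t := by
  have e := ode_unique (contDiff_rhs (N := N) (ε := ε) (δ := δ) hu h1 h2 h3)
    (by simp only [h0.1, h0.2.1, h0.2.2]) h.ode h'.ode ht
  have key : ∀ k, (q t k, v t k, V t k) = (q' t k, v' t k, V' t k) := fun k => by
    rw [← h.ext0_eq, ← h'.ext0_eq]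
    exact congrArg (fun z => ext0 z k) e
  simp only [Prod.mk.injEq] at key
  exact ⟨funext fun k => (key k).1, funext fun k => (key k).2.1, funext fun k => (key k).2.2⟩

lemma norm_lt_of_SE_le (hε : 0 < ε) (hδ : 0 < δ) {z : N → Zt} {R : ℝ} (hR : 0 ≤ R)
    (h : SE 1 N ε δ (fun k => (ext0 z k).1) (fun k => (ext0 z k).2.1) (fun k => (ext0 z k).2.2) ≤ R) :
    ‖z‖ < √((ε⁻¹ + 1 + δ⁻¹) * R) + 1 := by
  refine lt_of_le_of_lt ((pi_norm_le_iff_of_nonneg (Real.sqrt_nonneg _)).2 fun k => ?_)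
    (lt_add_one _)
  have hk := (Finset.single_le_sum (f := fun k => (W k ^ 1) ^ 2 * (ε * ‖(ext0 z k).1‖ ^ 2
    + sv (fun k => (ext0 z k).2.1) k + δ * sM (fun k => (ext0 z k).2.2) k)) (fun k _ => by
    have := sv_nonneg (fun k => (ext0 z k).2.1) k
    have := sM_nonneg (fun k => (ext0 z k).2.2) k; positivity) k.2).trans h
  have a1 := sv_nonneg (fun k => (ext0 z k).2.1) k
  have a2 := sM_nonneg (fun k => (ext0 z k).2.2) k
  have hW : 1 ≤ (W k ^ 1) ^ 2 := by rw [pow_one]; exact one_le_pow₀ (one_le_W _)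
  have hk' : ε * ‖(ext0 z k).1‖ ^ 2 + sv (fun k => (ext0 z k).2.1) k
      + δ * sM (fun k => (ext0 z k).2.2) k ≤ R :=
    (le_mul_of_one_le_left (by positivity) hW).trans hk
  have e1 : ε * (ε⁻¹ * R) = R := by field_simp
  have e3 : δ * (δ⁻¹ * R) = R := by field_simp
  have p1 : 0 ≤ ε⁻¹ * R := by positivity
  have p3 : 0 ≤ δ⁻¹ * R := by positivity
  have q1 : 0 ≤ ε * ‖(ext0 z k).1‖ ^ 2 := by positivity
  have q3 : 0 ≤ δ * sM (fun k => (ext0 z k).2.2) k := by positivity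
  have b1 : ‖(ext0 z k).1‖ ^ 2 ≤ ε⁻¹ * R := le_of_mul_le_mul_left (by linarith) hε
  have b3 : sM (fun k => (ext0 z k).2.2) k ≤ δ⁻¹ * R := le_of_mul_le_mul_left (by linarith) hδ
  rw [ext0_mem _ k.2] at b1
  refine norm_prod_le_iff.2 ⟨Real.le_sqrt_of_sq_le (by linarith), norm_prod_le_iff.2
    ⟨Real.le_sqrt_of_sq_le ?_, ?_⟩⟩
  · have := norm_sq_le_sv (fun k => (ext0 z k).2.1) k
    rw [ext0_mem _ k.2] at this
    linarith
  · refine (pi_norm_le_iff_of_nonneg (Real.sqrt_nonneg _)).2 fun a =>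
      (pi_norm_le_iff_of_nonneg (Real.sqrt_nonneg _)).2 fun b => Real.le_sqrt_of_sq_le ?_
    have c1 : ‖(z k).2.2 a b‖ ^ 2 ≤ sM (fun k => (ext0 z k).2.2) k := by
      simp only [sM, ext0_mem _ k.2]
      exact (Finset.single_le_sum (f := fun b => ‖(z k).2.2 a b‖ ^ 2) (fun _ _ => sq_nonneg _)
        (Finset.mem_univ b)).trans (Finset.single_le_sum (f := fun a => ∑ b, ‖(z k).2.2 a b‖ ^ 2)
          (fun _ _ => Finset.sum_nonneg fun _ _ => sq_nonneg _) (Finset.mem_univ a))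
    linarith

/-- Existence for the truncated system from an a priori bound. -/
lemma exists_gal (hu : ∀ k a, ContDiff ℝ 1 fun t => u t k a) (h1 : ∀ k, ContDiff ℝ 1 fun t => f1 t k)
    (h2 : ∀ k a, ContDiff ℝ 1 fun t => f2 t k a) (h3 : ∀ k a b, ContDiff ℝ 1 fun t => f3 t k a b)
    (hε : 0 < ε) (hδ : 0 < δ) (hT : 0 ≤ T) {R : ℝ} (q0 : Mode → ℂ) (v0 : Mode → Fin 3 → ℂ)
    (V0 : Mode → Fin 3 → Fin 3 → ℂ) (s1 : ∀ k ∉ N, q0 k = 0) (s2 : ∀ k ∉ N, v0 k = 0)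
    (s3 : ∀ k ∉ N, V0 k = 0)
    (hap : ∀ t₁ ∈ Set.Icc 0 T, ∀ q v V, Gal N ε δ t₁ u f1 f2 f3 q v V →
      q 0 = q0 → v 0 = v0 → V 0 = V0 → SE 1 N ε δ (q t₁) (v t₁) (V t₁) ≤ R)
    (h0 : SE 1 N ε δ q0 v0 V0 ≤ R) :
    ∃ q v V, Gal N ε δ T u f1 f2 f3 q v V ∧ q 0 = q0 ∧ v 0 = v0 ∧ V 0 = V0 := by
  have hR : 0 ≤ R := (SE_nonneg hε.le hδ.le).trans h0
  have e0 : ∀ z : N → Zt, z = (fun k : N => ((q0 k, v0 k, V0 k) : Zt)) →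
      (fun k => (ext0 z k).1) = q0 ∧ (fun k => (ext0 z k).2.1) = v0 ∧
        (fun k => (ext0 z k).2.2) = V0 := fun z hz => by
    have : ∀ k, ext0 z k = (q0 k, v0 k, V0 k) := fun k => by
      by_cases hk : k ∈ N
      · rw [ext0_mem _ hk, hz]
      · rw [ext0_not_mem _ hk, s1 k hk, s2 k hk, s3 k hk]; rfl
    simp [this]
  have hlt : ‖(fun k : N => ((q0 k, v0 k, V0 k) : Zt))‖ < √((ε⁻¹ + 1 + δ⁻¹) * R) + 1 := by
    refine norm_lt_of_SE_le hε hδ hR ?_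
    rw [(e0 _ rfl).1, (e0 _ rfl).2.1, (e0 _ rfl).2.2]
    exact h0
  have hz : ∃ z : ℝ → N → Zt, z 0 = (fun k : N => ((q0 k, v0 k, V0 k) : Zt)) ∧
      ∀ t ∈ Set.Icc 0 T, HasDerivAt z (rhs N ε δ u f1 f2 f3 t (z t)) t := by
    refine ode_global (contDiff_rhs (N := N) (ε := ε) (δ := δ) hu h1 h2 h3) hT _ hlt ?_
    intro t₁ ht₁ z hz hd
    have hd' := gal_of_ode hd
    have hS := hap t₁ ht₁ _ _ _ hd' (e0 _ hz).1 (e0 _ hz).2.1 (e0 _ hz).2.2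
    exact norm_lt_of_SE_le hε hδ hR hS
  obtain ⟨z, hz, hd⟩ := hz
  have hg := gal_of_ode hd
  exact ⟨_, _, _, hg, (e0 _ hz).1, (e0 _ hz).2.1, (e0 _ hz).2.2⟩

open ComplexConjugate in
/-- The truncated system respects real-valuedness. -/
lemma Gal.reflect (hN : ∀ k ∈ N, -k ∈ N) (ru : ∀ t k a, u t (-k) a = conj (u t k a))
    (r1 : ∀ t k, f1 t (-k) = conj (f1 t k)) (r2 : ∀ t k a, f2 t (-k) a = conj (f2 t k a))
    (r3 : ∀ t k a b, f3 t (-k) a b = conj (f3 t k a b)) (h : Gal N ε δ T u f1 f2 f3 q v V) :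
    Gal N ε δ T u f1 f2 f3 (fun t k => conj (q t (-k))) (fun t k a => conj (v t (-k) a))
      (fun t k a b => conj (V t (-k) a b)) := by
  have hN' : ∀ k ∉ N, -k ∉ N := fun k hk h => hk (by simpa using hN _ h)
  have cvr : ∀ (A b : Mode → ℂ) k, conj (cv N A b (-k)) =
      cv N (fun k => conj (A (-k))) (fun k => conj (b (-k))) k := fun A b k => by
    simp only [cv, map_sum, map_mul]
    refine Finset.sum_nbij' (fun j => -j) (fun j => -j) hN hN (by simp) (by simp) fun j _ => ?_
    congr 2 <;> congr 1
    · abel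
    · simp
  refine ⟨fun t k hk => ?_, fun t k hk => ?_, fun t k hk => ?_, fun t ht k hkN => ?_,
    fun t ht k hkN a => ?_, fun t ht k hkN a b => ?_⟩
  · simp [h.sq t _ (hN' k hk)]
  · ext a; simp [h.sv t _ (hN' k hk)]
  · ext a b; simp [h.sV t _ (hN' k hk)]
  · refine ((h.dq t ht (-k) (hN k hkN)).star).congr_deriv ?_
    simp [sg, xi_neg, r1, Complex.real_smul, Complex.conj_ofReal]
  · refine ((h.dv t ht (-k) (hN k hkN) a).star).congr_deriv ?_
    simp [HH, xi_neg, r2]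
    ring
  · refine ((h.dV t ht (-k) (hN k hkN) a b).star).congr_deriv ?_
    have e : conj (Bq N (u t) (v t) (-k) a b) = Bq N (u t) (fun k a => conj (v t (-k) a)) k a b := by
      have hu : ∀ k a, conj (u t (-k) a) = u t k a := fun k a => by rw [ru]; simp
      simp only [Bq, map_add, cvr, hu]
    simp [xi_neg, r3, ← e, Complex.real_smul, Complex.conj_ofReal]
    ring

end

/-- Truncation of coefficients to a finite set of modes. -/
def trn (N : Finset Mode) {E : Type*} [Zero E] (f : Mode → E) : Mode → E :=
  fun k => if k ∈ N then f k else 0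

section
variable {N : Finset Mode} {ε δ T T' A : ℝ} {u u' : ℝ → Mode → Fin 3 → ℂ} {f1 : ℝ → Mode → ℂ}
    {f2 : ℝ → Mode → Fin 3 → ℂ} {f3 f3' : ℝ → Mode → Fin 3 → Fin 3 → ℂ}
    {q : ℝ → Mode → ℂ} {v : ℝ → Mode → Fin 3 → ℂ} {V : ℝ → Mode → Fin 3 → Fin 3 → ℂ}

lemma trn_mem {E : Type*} [Zero E] (f : Mode → E) {k : Mode} (hk : k ∈ N) : trn N f k = f k :=
  if_pos hk

lemma trn_not_mem {E : Type*} [Zero E] (f : Mode → E) {k : Mode} (hk : k ∉ N) : trn N f k = 0 :=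
  if_neg hk

lemma Gal.restrict (h : Gal N ε δ T u f1 f2 f3 q v V) (hT : T' ≤ T) :
    Gal N ε δ T' u f1 f2 f3 q v V :=
  have hs : Set.Icc 0 T' ⊆ Set.Icc 0 T := Set.Icc_subset_Icc_right hT
  ⟨h.sq, h.sv, h.sV, fun t ht => h.dq t (hs ht), fun t ht => h.dv t (hs ht),
    fun t ht => h.dV t (hs ht)⟩

lemma Fb.restrict (h : Fb N ε δ T A u u' f1 f2 f3 f3') (hT : T' ≤ T) :
    Fb N ε δ T' A u u' f1 f2 f3 f3' :=
  have hs : Set.Icc 0 T' ⊆ Set.Icc 0 T := Set.Icc_subset_Icc_right hT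
  ⟨h.A0, fun t ht => h.hu t (hs ht), fun t ht => h.hu' t (hs ht), fun t ht => h.du t (hs ht),
    fun t ht => h.hf1 t (hs ht), fun t ht => h.hf2 t (hs ht), fun t ht => h.hf3 t (hs ht),
    fun t ht => h.hf3' t (hs ht), fun t ht => h.df3 t (hs ht)⟩

lemma Hb.restrict {m : ℕ} {U : ℝ} (h : Hb m N T U u f1 f2 f3) (hT : T' ≤ T) :
    Hb m N T' U u f1 f2 f3 :=
  have hs : Set.Icc 0 T' ⊆ Set.Icc 0 T := Set.Icc_subset_Icc_right hT
  ⟨fun t ht => h.u t (hs ht), fun t ht => h.f t (hs ht)⟩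

lemma SE_trn (m : ℕ) (q : Mode → ℂ) (v : Mode → Fin 3 → ℂ) (V : Mode → Fin 3 → Fin 3 → ℂ) :
    SE m N ε δ (trn N q) (trn N v) (trn N V) = SE m N ε δ q v V :=
  Finset.sum_congr rfl fun k hk => by simp only [sv, sM, trn_mem _ hk]

lemma Ini.trn {r Q : ℝ} {q : Mode → ℂ} {v : Mode → Fin 3 → ℂ} {V : Mode → Fin 3 → Fin 3 → ℂ}
    (h : Ini N ε r Q q v V) (hQ : 0 ≤ Q) :
    Ini N ε r Q (NSRelax.trn N q) (NSRelax.trn N v) (NSRelax.trn N V) := by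
  refine ⟨?_, h.w.trans_eq' (Finset.sum_congr rfl fun k hk => ?_),
    h.s.trans_eq' (Finset.sum_congr rfl fun k hk => ?_),
    h.H.trans_eq' (congrArg _ (Finset.sum_congr rfl fun k hk => ?_)),
    h.q.trans_eq' (Finset.sum_congr rfl fun k hk => ?_),
    h.V.trans_eq' (Finset.sum_congr rfl fun k hk => ?_)⟩
  · by_cases h0 : (0 : Mode) ∈ N
    · rw [trn_mem _ h0]; exact h.m
    · rw [trn_not_mem _ h0]; simp; positivity
  · simp only [sM, om, trn_mem _ hk]
  · simp only [sg, trn_mem _ hk]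
  · simp only [sv, HH, trn_mem _ hk]
  · simp only [trn_mem _ hk]
  · simp only [sM, trn_mem _ hk]

/-- Bounded truncated approximations past time `T`. -/
lemma exists_gal_bdd {r Q U S0 : ℝ} (hu : ∀ k a, ContDiff ℝ 1 fun t => u t k a)
    (h1 : ∀ k, ContDiff ℝ 1 fun t => f1 t k) (h2 : ∀ k a, ContDiff ℝ 1 fun t => f2 t k a)
    (h3 : ∀ k a b, ContDiff ℝ 1 fun t => f3 t k a b) {q0 : Mode → ℂ} {v0 : Mode → Fin 3 → ℂ}
    {V0 : Mode → Fin 3 → Fin 3 → ℂ} (hf : ∀ N, Fb N ε (r ^ 4) T Q u u' f1 f2 f3 f3')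
    (hb : ∀ N, Hb 1 N (T + 1) U u f1 f2 f3) (h0 : ∀ N, Ini N ε r Q q0 v0 V0)
    (hS : ∀ N, SE 1 N ε (r ^ 4) q0 v0 V0 ≤ S0) (hT : 0 ≤ T)
    (hQ : 1 ≤ Q) (hTQ : T ≤ Q) (hr : 0 < r) (hr1 : r ≤ 1) (hε : 0 < ε) (hεδ : ε ≤ r ^ 4)
    (hsm : √(cM Q * r ^ 2) * (10000 * Slat) < 1) :
    ∃ τ > 0, τ ≤ 1 ∧ ∃ R, ∀ N, ∃ q v V, Gal N ε (r ^ 4) (T + τ) u f1 f2 f3 q v V ∧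
      q 0 = trn N q0 ∧ v 0 = trn N v0 ∧ V 0 = trn N V0 ∧
      ∀ t ∈ Set.Icc 0 (T + τ), SE 1 N ε (r ^ 4) (q t) (v t) (V t) ≤ R := by
  have hδ : 0 < r ^ 4 := by positivity
  have hQ0 : 0 ≤ Q := by linarith
  have hU : 0 ≤ U := by simpa using (hb ∅).u 0 ⟨le_rfl, by linarith⟩ ∅
  have hS0 : 0 ≤ S0 := (SE_nonneg hε.le hδ.le).trans (hS ∅)
  set P0 := Q * r ^ 2 + 4 * (2 / r ^ 4 * (cM Q * r ^ 2)) with hP0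
  have hcM : 0 ≤ cM Q := hQ0.trans (le_cM hQ0)
  have hP00 : 0 ≤ P0 := by positivity
  have hKS := KS_nonneg (m := 1) hε.le hU
  set R1 := (S0 + U * T) * exp (KS ε U 1 * (1 + P0) * T) with hR1
  have hR10 : 0 ≤ R1 := by positivity
  have hSR : S0 ≤ R1 := by
    have : 1 ≤ exp (KS ε U 1 * (1 + P0) * T) := Real.one_le_exp (by positivity)
    have : S0 ≤ S0 + U * T := by have := mul_nonneg hU hT; linarith
    nlinarith
  set L := KS ε U 1 * (3 + R1) * (2 + R1) + U with hL
  have hL0 : 0 ≤ L := by positivity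
  set τ := (L + 1)⁻¹ with hτ
  have hτ0 : 0 < τ := by positivity
  have hτ1 : τ ≤ 1 := inv_le_one_of_one_le₀ (by linarith)
  have hLτ : L * τ ≤ 1 := by
    rw [hτ, mul_inv_le_iff₀ (by positivity)]; linarith
  have key : ∀ N, ∀ t₁ ∈ Set.Icc 0 (T + τ), ∀ q v V, Gal N ε (r ^ 4) t₁ u f1 f2 f3 q v V →
      q 0 = trn N q0 → v 0 = trn N v0 → V 0 = trn N V0 →
      SE 1 N ε (r ^ 4) (q t₁) (v t₁) (V t₁) ≤ R1 + 2 := by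
    intro N t₁ ht₁ q v V h e1 e2 e3
    have hini : Ini N ε r Q (q 0) (v 0) (V 0) := by rw [e1, e2, e3]; exact (h0 N).trn hQ0
    have hSE0 : SE 1 N ε (r ^ 4) (q 0) (v 0) (V 0) ≤ S0 := by
      rw [e1, e2, e3, SE_trn]; exact hS N
    have low : ∀ t ∈ Set.Icc 0 (min t₁ T), SE 1 N ε (r ^ 4) (q t) (v t) (V t) ≤ R1 := by
      intro t ht
      have hg := h.restrict (min_le_left t₁ T)
      have hf' := (hf N).restrict (min_le_right t₁ T)
      have hm1 := min_le_right t₁ T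
      have hb' := (hb N).restrict (show min t₁ T ≤ T + 1 by linarith)
      have hmin0 : 0 ≤ min t₁ T := le_min ht₁.1 hT
      refine (hg.SE_le hε hδ le_rfl hb' (P := P0) (fun s hs => ?_) ht).trans ?_
      · refine H2n_le.trans ?_
        rw [hP0]
        refine add_le_add ?_ (mul_le_mul_of_nonneg_left ((Dn_le_En hε.le hδ).trans
          (mul_le_mul_of_nonneg_left (hg.En_le_of_ini hf' hini hQ (hm1.trans hTQ) hr hr1 hε hεδ
            hsm hs) (by positivity))) (by norm_num))
        rw [hg.mean hf' hs]; exact hini.m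
      · rw [hR1]; gcongr
    rcases le_or_gt t₁ T with hle | hlt
    · have := low t₁ ⟨ht₁.1, by rw [min_eq_left hle]⟩
      linarith
    · refine h.SE_short hε hδ ((hb N).restrict (by linarith [ht₁.2])) hT
        (low T ⟨hT, by rw [min_eq_right hlt.le]⟩) ?_ ⟨hlt.le, le_rfl⟩
      refine le_trans ?_ hLτ
      have : t₁ - T ≤ τ := by linarith [ht₁.2]
      gcongr
  refine ⟨τ, hτ0, hτ1, R1 + 2, fun N => ?_⟩
  obtain ⟨q, v, V, hg, e1, e2, e3⟩ := exists_gal (T := T + τ) (R := R1 + 2) (N := N) hu h1 h2 h3 hε hδ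
    (by positivity) (trn N q0) (trn N v0) (trn N V0) (fun k hk => trn_not_mem _ hk)
    (fun k hk => trn_not_mem _ hk) (fun k hk => trn_not_mem _ hk) (key N)
    (by rw [SE_trn]; linarith [hS N])
  exact ⟨q, v, V, hg, e1, e2, e3, fun t ht => key N t ht q v V (hg.restrict ht.2) e1 e2 e3⟩

/-- Coefficients of smooth functions of time and space. -/
def SmA (c : ℝ → Mode → ℂ) : Prop := ∀ T n, Sm (Set.Ioo (-T) T) n (fun _ : Unit => c)

/-- Rapidly decaying coefficients. -/
def Rd (c : Mode → ℂ) : Prop := ∀ m : ℕ, ∃ C, ∀ k, W k ^ m * ‖c k‖ ≤ C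

/-- Smooth real background flow and forcing. -/
structure Frc (u : ℝ → Mode → Fin 3 → ℂ) (f1 : ℝ → Mode → ℂ)
    (f2 : ℝ → Mode → Fin 3 → ℂ) (f3 : ℝ → Mode → Fin 3 → Fin 3 → ℂ) : Prop where
  su : ∀ a, SmA fun t k => u t k a
  s1 : SmA f1
  s2 : ∀ a, SmA fun t k => f2 t k a
  s3 : ∀ a b, SmA fun t k => f3 t k a b
  ru : ∀ t k a, u t (-k) a = starRingEnd ℂ (u t k a)
  r1 : ∀ t k, f1 t (-k) = starRingEnd ℂ (f1 t k)
  r2 : ∀ t k a, f2 t (-k) a = starRingEnd ℂ (f2 t k a)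
  r3 : ∀ t k a b, f3 t (-k) a b = starRingEnd ℂ (f3 t k a b)

lemma SmA.exists_deriv {c : ℝ → Mode → ℂ} (h : SmA c) (T : ℝ) (n : ℕ) : ∃ c' : ℝ → Mode → ℂ,
    (∀ t ∈ Set.Ioo (-T) T, ∀ k, HasDerivAt (fun t => c t k) (c' t k) t) ∧
      Sm (Set.Ioo (-T) T) n fun _ : Unit => c' := by
  obtain ⟨-, c', hd, hc'⟩ := h T (n + 1)
  exact ⟨c' (), hd (), hc'.comp fun _ => ()⟩

lemma SmA.contDiff {c : ℝ → Mode → ℂ} (h : SmA c) (k : Mode) : ContDiff ℝ 1 fun t => c t k := by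
  have hd : ∀ t, ContDiffAt ℝ 1 (fun t => c t k) t := fun t => by
    obtain ⟨c', h1, h2⟩ := h.exists_deriv (|t| + 1) 1
    obtain ⟨-, c'', h3, -⟩ := h2
    have hmem : ∀ s ∈ Set.Ioo (-(|t| + 1)) (|t| + 1), Set.Ioo (-(|t| + 1)) (|t| + 1) ∈ nhds s :=
      fun s hs => isOpen_Ioo.mem_nhds hs
    have ht : t ∈ Set.Ioo (-(|t| + 1)) (|t| + 1) :=
      ⟨by linarith [neg_abs_le t], by linarith [le_abs_self t]⟩
    refine contDiffAt_one_iff.2 ⟨fun s => ContinuousLinearMap.toSpanSingleton ℝ (c' s k), _,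
      hmem t ht, fun s hs => ?_, fun s hs => (h1 s hs k).hasFDerivAt⟩
    have : ContinuousAt (fun s => c' s k) s := (h3 () s hs k).continuousAt
    exact ((ContinuousLinearMap.toSpanSingletonCLE (𝕜 := ℝ) (E := ℂ)).continuous.continuousAt.comp
      this).continuousWithinAt
  exact contDiff_iff_contDiffAt.2 hd

lemma SmA.rd {c : ℝ → Mode → ℂ} (h : SmA c) (T : ℝ) : RD (Set.Icc 0 T) fun _ : Unit => c :=
  RD.mono (h (|T| + 1) 0) fun t ht =>
    ⟨by linarith [abs_nonneg T, ht.1], by linarith [ht.2, le_abs_self T]⟩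

lemma RD.sum_le {ι : Type*} {S : Set ℝ} {c : ι → ℝ → Mode → ℂ} (h : RD S c) (m : ℕ) :
    ∃ C, 0 ≤ C ∧ ∀ i, ∀ t ∈ S, ∀ F : Finset Mode, ∑ k ∈ F, (W k ^ m) ^ 2 * ‖c i t k‖ ^ 2 ≤ C := by
  obtain ⟨C, hC0, hC⟩ := h.exists_nonneg (m + 1)
  refine ⟨C ^ 2 * Slat, by have := one_le_Slat; positivity, fun i t ht F => ?_⟩
  calc _ ≤ ∑ k ∈ F, C ^ 2 * (W k ^ 2)⁻¹ := Finset.sum_le_sum fun k _ => by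
        have hW := W_pos k
        have := pow_le_pow_left₀ (by positivity) (hC i t ht k) 2
        rw [← div_eq_mul_inv, le_div_iff₀ (by positivity)]
        calc _ = (W k ^ (m + 1) * ‖c i t k‖) ^ 2 := by ring
          _ ≤ _ := this
    _ ≤ _ := by rw [← Finset.mul_sum]; gcongr; exact sum_W_le F

lemma Frc.hb (h : Frc u f1 f2 f3) (m : ℕ) (T : ℝ) : ∃ U, ∀ N, Hb m N T U u f1 f2 f3 := by
  choose Cu hu0 hu using fun a => ((h.su a).rd T).sum_le m
  obtain ⟨C1, h10, h1⟩ := (h.s1.rd T).sum_le m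
  choose C2 h20 h2 using fun a => ((h.s2 a).rd T).sum_le m
  choose C3 h30 h3 using fun a b => ((h.s3 a b).rd T).sum_le m
  refine ⟨∑ a, Cu a + (C1 + ∑ a, C2 a + ∑ a, ∑ b, C3 a b), fun N => ⟨fun t ht F => ?_,
    fun t ht => ?_⟩⟩
  · have : ∑ k ∈ F, (W k ^ m * ‖u t k‖) ^ 2 ≤ ∑ a, Cu a := by
      calc _ ≤ ∑ k ∈ F, ∑ a, (W k ^ m) ^ 2 * ‖u t k a‖ ^ 2 := Finset.sum_le_sum fun k _ => by
            rw [mul_pow, ← Finset.mul_sum]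
            gcongr
            exact norm_sq_le_sv (u t) k
        _ = ∑ a, ∑ k ∈ F, (W k ^ m) ^ 2 * ‖u t k a‖ ^ 2 := Finset.sum_comm
        _ ≤ _ := Finset.sum_le_sum fun a _ => hu a () t ht F
    have := Finset.sum_nonneg fun a (_ : a ∈ Finset.univ) => h20 a
    have := Finset.sum_nonneg fun a (_ : a ∈ Finset.univ) =>
      Finset.sum_nonneg fun b (_ : b ∈ Finset.univ) => h30 a b
    linarith
  · have hsu := Finset.sum_nonneg fun a (_ : a ∈ Finset.univ) => hu0 a
    have e1 := h1 () t ht N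
    have e2 : ∑ k ∈ N, (W k ^ m) ^ 2 * sv (f2 t) k ≤ ∑ a, C2 a := by
      simp only [sv, Finset.mul_sum]
      rw [Finset.sum_comm]
      exact Finset.sum_le_sum fun a _ => h2 a () t ht N
    have e3 : ∑ k ∈ N, (W k ^ m) ^ 2 * sM (f3 t) k ≤ ∑ a, ∑ b, C3 a b := by
      simp only [sM, Finset.mul_sum]
      rw [Finset.sum_comm]
      refine Finset.sum_le_sum fun a _ => ?_
      rw [Finset.sum_comm]
      exact Finset.sum_le_sum fun b _ => h3 a b () t ht N
    simp only [mul_add, Finset.sum_add_distrib]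
    linarith

lemma exists_SE_le {q0 : Mode → ℂ} {v0 : Mode → Fin 3 → ℂ} {V0 : Mode → Fin 3 → Fin 3 → ℂ}
    (hε : 0 ≤ ε) (hδ : 0 ≤ δ) (h1 : Rd q0) (h2 : ∀ a, Rd fun k => v0 k a)
    (h3 : ∀ a b, Rd fun k => V0 k a b) (m : ℕ) : ∃ S, ∀ N, SE m N ε δ q0 v0 V0 ≤ S := by
  have cv : ∀ c, Rd c → RD (Set.univ) fun (_ : Unit) _ => c := fun c h m => by
    obtain ⟨C, hC⟩ := h m
    exact ⟨C, fun _ _ _ => hC⟩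
  obtain ⟨C1, h10, h1⟩ := (cv _ h1).sum_le m
  choose C2 h20 h2 using fun a => (cv _ (h2 a)).sum_le m
  choose C3 h30 h3 using fun a b => (cv _ (h3 a b)).sum_le m
  refine ⟨ε * C1 + ∑ a, C2 a + δ * ∑ a, ∑ b, C3 a b, fun N => ?_⟩
  have e1 := h1 () 0 trivial N
  have e2 : ∑ k ∈ N, (W k ^ m) ^ 2 * sv v0 k ≤ ∑ a, C2 a := by
    simp only [sv, Finset.mul_sum]
    rw [Finset.sum_comm]
    exact Finset.sum_le_sum fun a _ => h2 a () 0 trivial N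
  have e3 : ∑ k ∈ N, (W k ^ m) ^ 2 * sM V0 k ≤ ∑ a, ∑ b, C3 a b := by
    simp only [sM, Finset.mul_sum]
    rw [Finset.sum_comm]
    refine Finset.sum_le_sum fun a _ => ?_
    rw [Finset.sum_comm]
    exact Finset.sum_le_sum fun b _ => h3 a b () 0 trivial N
  calc SE m N ε δ q0 v0 V0 = ε * ∑ k ∈ N, (W k ^ m) ^ 2 * ‖q0 k‖ ^ 2
        + ∑ k ∈ N, (W k ^ m) ^ 2 * sv v0 k + δ * ∑ k ∈ N, (W k ^ m) ^ 2 * sM V0 k := by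
        rw [SE, Finset.mul_sum, Finset.mul_sum, ← Finset.sum_add_distrib, ← Finset.sum_add_distrib]
        exact Finset.sum_congr rfl fun k _ => by ring
    _ ≤ _ := by gcongr

end

/-- Quadratic source over the full lattice. -/
def Bi (u v : Mode → Fin 3 → ℂ) (k : Mode) (a b : Fin 3) : ℂ :=
  cvi (fun k => v k a) (fun k => v k b) k + cvi (fun k => u k a) (fun k => v k b) k
    + cvi (fun k => u k b) (fun k => v k a) k

/-- The system for the coefficients, filtered by the multipliers `χ`. -/
structure Spe {ι : Type*} (S : Set ℝ) (χ : ι → Mode → ℂ) (ε δ : ℝ) (u : ℝ → Mode → Fin 3 → ℂ)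
    (f1 : ℝ → Mode → ℂ) (f2 : ℝ → Mode → Fin 3 → ℂ) (f3 : ℝ → Mode → Fin 3 → Fin 3 → ℂ)
    (q : ι → ℝ → Mode → ℂ) (v : ι → ℝ → Mode → Fin 3 → ℂ)
    (V : ι → ℝ → Mode → Fin 3 → Fin 3 → ℂ) : Prop where
  dq : ∀ i, ∀ t ∈ S, ∀ k, HasDerivAt (fun t => q i t k)
    (χ i k * (ε⁻¹ * (-(Complex.I * sg (v i t) k) + f1 t k))) t
  dv : ∀ i, ∀ t ∈ S, ∀ k a, HasDerivAt (fun t => v i t k a)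
    (χ i k * (-HH (V i t) k a - xi k a * (Complex.I * q i t k) + f2 t k a)) t
  dV : ∀ i, ∀ t ∈ S, ∀ k a b, HasDerivAt (fun t => V i t k a b)
    (χ i k * (δ⁻¹ * (-V i t k a b - Complex.I * xi k b * v i t k a
      + (Bi (u t) (v i t) k a b + f3 t k a b)))) t

section
variable {ι : Type*} {S : Set ℝ} {n : ℕ} {N : Finset Mode} {ε δ T : ℝ}
    {u u' : ℝ → Mode → Fin 3 → ℂ} {f1 : ℝ → Mode → ℂ}
    {f2 : ℝ → Mode → Fin 3 → ℂ} {f3 f3' : ℝ → Mode → Fin 3 → Fin 3 → ℂ}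

lemma Sm.rd_deriv {c c' : ι → ℝ → Mode → ℂ} (h : Sm S n c') (hc : RD S c)
    (hd : ∀ i, ∀ t ∈ S, ∀ k, HasDerivAt (fun t => c i t k) (c' i t k) t) : Sm S (n + 1) c :=
  ⟨hc, c', hd, h⟩

lemma sm_Rq {χ : ι → Mode → ℂ} (hχ : PM χ) (s1 : Sm S n fun _ : ι => f1)
    {v : ι → ℝ → Mode → Fin 3 → ℂ} (hv : ∀ a, Sm S n fun i t k => v i t k a) :
    Sm S n fun i t k => χ i k * (ε⁻¹ * (-(Complex.I * sg (v i t) k) + f1 t k)) := by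
  have h := (((Sm.sum Finset.univ fun a _ => (hv a).mulm
    ((pM_const (-Complex.I)).mul (pM_xi a))).add s1).mulm (pM_const ((ε : ℂ)⁻¹))).mulm hχ
  convert h using 4
  simp only [sg, Finset.mul_sum, neg_mul, Finset.sum_neg_distrib, Complex.ofReal_inv, mul_assoc]

lemma sm_Rv {χ : ι → Mode → ℂ} (hχ : PM χ) (s2 : ∀ a, Sm S n fun (_ : ι) t k => f2 t k a)
    {q : ι → ℝ → Mode → ℂ} {V : ι → ℝ → Mode → Fin 3 → Fin 3 → ℂ} (hq : Sm S n q)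
    (hV : ∀ a b, Sm S n fun i t k => V i t k a b) (a : Fin 3) :
    Sm S n fun i t k => χ i k * (-HH (V i t) k a - xi k a * (Complex.I * q i t k) + f2 t k a) := by
  have h := (((Sm.sum Finset.univ fun b _ => (hV a b).mulm
    ((pM_const (-Complex.I)).mul (pM_xi b))).add (hq.mulm ((pM_const (-Complex.I)).mul
      (pM_xi a)))).add (s2 a)).mulm hχ
  convert h using 4
  simp only [HH, neg_mul, Finset.sum_neg_distrib, mul_assoc]
  ring

lemma sm_Bi (hS : IsOpen S) (hS' : IsPreconnected S)
    (su : ∀ a, Sm S n fun (_ : ι) t k => u t k a) {v : ι → ℝ → Mode → Fin 3 → ℂ}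
    (hv : ∀ a, Sm S n fun i t k => v i t k a) (a b : Fin 3) :
    Sm S n fun i t k => Bi (u t) (v i t) k a b :=
  (((hv a).cvi hS hS' (hv b)).add ((su a).cvi hS hS' (hv b))).add ((su b).cvi hS hS' (hv a))

lemma rd_Bi (su : ∀ a, RD S fun (_ : ι) t k => u t k a) {v : ι → ℝ → Mode → Fin 3 → ℂ}
    (hv : ∀ a, RD S fun i t k => v i t k a) (a b : Fin 3) :
    RD S fun i t k => Bi (u t) (v i t) k a b :=
  (((hv a).cvi (hv b)).add ((su a).cvi (hv b))).add ((su b).cvi (hv a))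

lemma sm_RV {χ : ι → Mode → ℂ} (hχ : PM χ)
    (s3 : ∀ a b, Sm S n fun (_ : ι) t k => f3 t k a b)
    {v : ι → ℝ → Mode → Fin 3 → ℂ} {V : ι → ℝ → Mode → Fin 3 → Fin 3 → ℂ}
    (hv : ∀ a, Sm S n fun i t k => v i t k a)
    (hV : ∀ a b, Sm S n fun i t k => V i t k a b)
    (hB : ∀ a b, Sm S n fun i t k => Bi (u t) (v i t) k a b) (a b : Fin 3) :
    Sm S n fun i t k => χ i k * (δ⁻¹ * (-V i t k a b - Complex.I * xi k b * v i t k a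
      + (Bi (u t) (v i t) k a b + f3 t k a b))) := by
  have h := (((((hV a b).mulm (pM_const (-1))).add ((hv a).mulm ((pM_const (-Complex.I)).mul
    (pM_xi b)))).add ((hB a b).add (s3 a b))).mulm (pM_const ((δ : ℂ)⁻¹))).mulm hχ
  convert h using 4
  simp only [Complex.ofReal_inv]
  ring

/-- Smoothing in time from the equations. -/
lemma Spe.sm {χ : ι → Mode → ℂ} {q : ι → ℝ → Mode → ℂ} {v : ι → ℝ → Mode → Fin 3 → ℂ}
    {V : ι → ℝ → Mode → Fin 3 → Fin 3 → ℂ} (h : Spe S χ ε δ u f1 f2 f3 q v V) (hχ : PM χ)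
    (hS : IsOpen S) (hS' : IsPreconnected S) (hST : S ⊆ Set.Ioo (-T) T) (hF : Frc u f1 f2 f3)
    (rq : RD S q) (rv : ∀ a, RD S fun i t k => v i t k a)
    (rV : ∀ a b, RD S fun i t k => V i t k a b) (n : ℕ) :
    Sm S n q ∧ (∀ a, Sm S n fun i t k => v i t k a) ∧ ∀ a b, Sm S n fun i t k => V i t k a b := by
  have gen : ∀ c n, SmA c → Sm S n fun _ : ι => c := fun c n h => ((h T n).comp fun _ => ()).mono hST
  induction n with
  | zero => exact ⟨rq, rv, rV⟩
  | succ n ih =>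
    obtain ⟨i1, i2, i3⟩ := ih
    exact ⟨(sm_Rq hχ (gen _ n hF.s1) i2).rd_deriv rq h.dq,
      fun a => (sm_Rv hχ (fun a => gen _ n (hF.s2 a)) i1 i3 a).rd_deriv (rv a)
        fun i t ht k => h.dv i t ht k a,
      fun a b => (sm_RV hχ (fun a b => gen _ n (hF.s3 a b)) i2 i3
        (sm_Bi hS hS' (fun a => gen _ n (hF.su a)) i2) a b).rd_deriv (rV a b) fun i t ht k => h.dV i t ht k a b⟩

lemma Gal.spe {c : ι → Finset Mode} {q : ι → ℝ → Mode → ℂ} {v : ι → ℝ → Mode → Fin 3 → ℂ}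
    {V : ι → ℝ → Mode → Fin 3 → Fin 3 → ℂ}
    (h : ∀ i, Gal (c i) ε δ T u f1 f2 f3 (q i) (v i) (V i)) :
    Spe (Set.Icc 0 T) (fun i k => if k ∈ c i then 1 else 0) ε δ u f1 f2 f3 q v V := by
  refine ⟨fun i t ht k => ?_, fun i t ht k a => ?_, fun i t ht k a b => ?_⟩
  · by_cases hk : k ∈ c i
    · refine ((h i).dq t ht k hk).congr_deriv ?_
      simp [hk]; ring
    · simpa [hk, (h i).sq _ k hk] using hasDerivAt_const t (0 : ℂ)
  · by_cases hk : k ∈ c i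
    · simpa [hk] using (h i).dv t ht k hk a
    · simpa [hk, (h i).sv _ k hk] using hasDerivAt_const t (0 : ℂ)
  · by_cases hk : k ∈ c i
    · have e : Bi (u t) (v i t) k a b = Bq (c i) (u t) (v i t) k a b := by
        have hs : ∀ a, ∀ k ∉ c i, v i t k a = 0 := fun a k hk => by simp [(h i).sv t k hk]
        simp only [Bi, Bq, cv_eq_cvi (hs _)]
      refine ((h i).dV t ht k hk a b).congr_deriv ?_
      simp [hk, e]; ring
    · simpa [hk, (h i).sV _ k hk] using hasDerivAt_const t (0 : ℂ)

lemma pM_ind (c : ι → Finset Mode) : PM (fun i k => if k ∈ c i then (1 : ℂ) else 0) :=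
  ⟨1, 0, fun i k => by dsimp only; split_ifs <;> simp⟩

/-- Bounds for the truncated solutions give rapidly decaying coefficients. -/
lemma rd_of_SE (hε : 0 < ε) (hδ : 0 < δ) {c : ι → Finset Mode} {q : ι → ℝ → Mode → ℂ}
    {v : ι → ℝ → Mode → Fin 3 → ℂ} {V : ι → ℝ → Mode → Fin 3 → Fin 3 → ℂ}
    (h : ∀ i, Gal (c i) ε δ T u f1 f2 f3 (q i) (v i) (V i))
    (hb : ∀ m : ℕ, ∃ K, ∀ i, ∀ t ∈ S, SE (m + 1) (c i) ε δ (q i t) (v i t) (V i t) ≤ K) :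
    RD S q ∧ (∀ a, RD S fun i t k => v i t k a) ∧ ∀ a b, RD S fun i t k => V i t k a b := by
  have key : ∀ m, ∃ K, 0 ≤ K ∧ ∀ i, ∀ t ∈ S, ∀ k, (W k ^ m) ^ 2 *
      (ε * ‖q i t k‖ ^ 2 + sv (v i t) k + δ * sM (V i t) k) ≤ K := fun m => by
    obtain ⟨K, hK⟩ := hb m
    refine ⟨max K 0, le_max_right _ _, fun i t ht k => ?_⟩
    by_cases hk : k ∈ c i
    · refine le_trans ?_ ((hK i t ht).trans (le_max_left _ _))
      have pos : ∀ k, 0 ≤ ε * ‖q i t k‖ ^ 2 + sv (v i t) k + δ * sM (V i t) k := fun k => by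
        have := sv_nonneg (v i t) k; have := sM_nonneg (V i t) k; positivity
      refine le_trans ?_ (Finset.single_le_sum (f := fun k => (W k ^ (m + 1)) ^ 2 *
        (ε * ‖q i t k‖ ^ 2 + sv (v i t) k + δ * sM (V i t) k))
        (fun k _ => mul_nonneg (by positivity) (pos k)) hk)
      have hW := one_le_W k
      exact mul_le_mul_of_nonneg_right (pow_le_pow_left₀ (by positivity)
        (pow_le_pow_right₀ hW (by omega)) 2) (pos k)
    · simp [sv, sM, (h i).sq t k hk, (h i).sv t k hk, (h i).sV t k hk]
  have fin : ∀ (x : ι → ℝ → Mode → ℂ) (s : ℝ), 0 ≤ s → (∀ i t k, ‖x i t k‖ ^ 2 ≤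
      s * (ε * ‖q i t k‖ ^ 2 + sv (v i t) k + δ * sM (V i t) k)) → RD S x := fun x s hs hx m => by
    obtain ⟨K, hK0, hK⟩ := key m
    refine ⟨√(s * K), fun i t ht k => Real.le_sqrt_of_sq_le ?_⟩
    have hW := W_pos k
    calc (W k ^ m * ‖x i t k‖) ^ 2 = (W k ^ m) ^ 2 * ‖x i t k‖ ^ 2 := by ring
      _ ≤ (W k ^ m) ^ 2 * (s * (ε * ‖q i t k‖ ^ 2 + sv (v i t) k + δ * sM (V i t) k)) := by
          gcongr; exact hx i t k
      _ = s * ((W k ^ m) ^ 2 * (ε * ‖q i t k‖ ^ 2 + sv (v i t) k + δ * sM (V i t) k)) := by ring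
      _ ≤ _ := by gcongr; exact hK i t ht k
  refine ⟨fin q ε⁻¹ (by positivity) fun i t k => ?_, fun a => fin _ 1 zero_le_one fun i t k => ?_,
    fun a b => fin _ δ⁻¹ (by positivity) fun i t k => ?_⟩
  all_goals have s1 := sv_nonneg (v i t) k; have s2 := sM_nonneg (V i t) k
  · rw [inv_mul_eq_div, le_div_iff₀ hε]
    nlinarith [mul_nonneg hδ.le s2]
  · have : ‖v i t k a‖ ^ 2 ≤ sv (v i t) k :=
      Finset.single_le_sum (f := fun a => ‖v i t k a‖ ^ 2) (fun _ _ => sq_nonneg _)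
        (Finset.mem_univ a)
    nlinarith [mul_nonneg hδ.le s2, mul_nonneg hε.le (sq_nonneg ‖q i t k‖)]
  · have : ‖V i t k a b‖ ^ 2 ≤ sM (V i t) k :=
      (Finset.single_le_sum (f := fun b => ‖V i t k a b‖ ^ 2) (fun _ _ => sq_nonneg _)
        (Finset.mem_univ b)).trans (Finset.single_le_sum (f := fun a => ∑ b, ‖V i t k a b‖ ^ 2)
          (fun _ _ => Finset.sum_nonneg fun _ _ => sq_nonneg _) (Finset.mem_univ a))
    rw [inv_mul_eq_div, le_div_iff₀ hδ]
    nlinarith [mul_le_mul_of_nonneg_left this hδ.le, mul_nonneg hε.le (sq_nonneg ‖q i t k‖)]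

open Filter Topology in
/-- Ultrafilter limits of rapidly decaying families. -/
lemma RD.exists_lim {c : ℕ → ℝ → Mode → ℂ} (h : RD S c) : ∃ d : ℝ → Mode → ℂ,
    (∀ t ∈ S, ∀ k, Tendsto (fun n => c n t k) (hyperfilter ℕ) (𝓝 (d t k))) ∧
      RD S fun _ : Unit => d := by
  have key : ∀ t ∈ S, ∀ k, ∃ z, Tendsto (fun n => c n t k) (hyperfilter ℕ) (𝓝 z) := by
    intro t ht k
    obtain ⟨C, hC⟩ := h 0
    obtain ⟨z, -, hz⟩ := (isCompact_closedBall (0 : ℂ) C).ultrafilter_le_nhds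
      ((hyperfilter ℕ).map fun n => c n t k) (by
        rw [Filter.le_principal_iff]
        exact Filter.mem_map.2 (Filter.univ_mem' fun n => by simpa using hC n t ht k))
    exact ⟨z, hz⟩
  choose! d hd using key
  refine ⟨d, hd, fun m => ?_⟩
  obtain ⟨C, hC⟩ := h m
  exact ⟨C, fun _ t ht k => le_of_tendsto ((hd t ht k).norm.const_mul _)
    (Eventually.of_forall fun n => hC n t ht k)⟩

open Filter Topology in
/-- Derivatives pass to the limit. -/
lemma Sm.hasDerivAt_lim {c c' : ℕ → ℝ → Mode → ℂ} (hS : IsOpen S) (hc' : Convex ℝ S)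
    (hd : ∀ i, ∀ t ∈ S, ∀ k, HasDerivAt (fun t => c i t k) (c' i t k) t) (h : Sm S 1 c')
    {d : ℝ → Mode → ℂ} {l : Filter ℕ} [l.NeBot]
    (ht : ∀ t ∈ S, ∀ k, Tendsto (fun n => c n t k) l (𝓝 (d t k)))
    {t : ℝ} (hts : t ∈ S) (k : Mode) {z : ℂ} (hz : Tendsto (fun n => c' n t k) l (𝓝 z)) :
    HasDerivAt (fun t => d t k) z t := by
  obtain ⟨-, c'', hd', hb⟩ := h
  obtain ⟨L, hL0, hL⟩ := RD.exists_nonneg hb 0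
  have lip : ∀ i, ∀ s ∈ S, ‖c' i s k - c' i t k‖ ≤ L * ‖s - t‖ := fun i s hs =>
    hc'.norm_image_sub_le_of_norm_hasDerivWithin_le (fun s hs => (hd' i s hs k).hasDerivWithinAt)
      (fun s hs => by simpa using hL i s hs k) hts hs
  have est : ∀ s ∈ S, ‖d s k - d t k - (s - t : ℝ) • z‖ ≤ L * ‖s - t‖ * ‖s - t‖ := by
    intro s hs
    refine le_of_tendsto (((ht s hs k).sub (ht t hts k)).sub (hz.const_smul (s - t))).norm
      (Eventually.of_forall fun i => ?_)
    have hseg : segment ℝ t s ⊆ S := hc'.segment_subset hts hs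
    have := (convex_segment t s).norm_image_sub_le_of_norm_hasDerivWithin_le
      (f := fun r => c i r k - (r - t) • c' i t k) (f' := fun r => c' i r k - c' i t k)
      (C := L * ‖s - t‖) (fun r hr => ?_) (fun r hr => (lip i r (hseg hr)).trans ?_)
      (left_mem_segment ℝ t s) (right_mem_segment ℝ t s)
    · simpa [sub_right_comm] using this
    · have h1 := (hd i r (hseg hr) k).sub (((hasDerivAt_id r).sub_const t).smul_const (c' i t k))
      refine HasDerivAt.hasDerivWithinAt (HasDerivAt.congr_deriv h1 ?_)
      simp
    · have hr' : ‖r - t‖ ≤ ‖s - t‖ := by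
        rw [segment_eq_uIcc] at hr
        have := Set.abs_sub_left_of_mem_uIcc hr
        simpa [Real.norm_eq_abs] using this
      gcongr
  rw [hasDerivAt_iff_isLittleO]
  have hO : (fun s => d s k - d t k - (s - t) • z) =O[𝓝 t] fun s => (s - t) * (s - t) := by
    refine Asymptotics.IsBigO.of_bound L (Filter.mem_of_superset (hS.mem_nhds hts) fun s hs => ?_)
    have := est s hs
    show ‖d s k - d t k - (s - t) • z‖ ≤ L * ‖(s - t) * (s - t)‖
    rw [norm_mul]; simpa [mul_assoc] using this
  refine hO.trans_isLittleO ?_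
  have h0 : Tendsto (fun s => s - t) (𝓝 t) (𝓝 0) := by
    have : ContinuousAt (fun s : ℝ => s - t) t := by fun_prop
    simpa [ContinuousAt] using this
  have h1 := ((Asymptotics.isLittleO_one_iff ℝ).2 h0).mul_isBigO
    (Asymptotics.isBigO_refl (fun s => s - t) (𝓝 t))
  simpa using h1

open Filter Topology in
/-- Lipschitz bounds pass to the limit. -/
lemma continuousOn_lim {c c' : ℕ → ℝ → Mode → ℂ} (hc' : Convex ℝ S)
    (hd : ∀ i, ∀ t ∈ S, ∀ k, HasDerivAt (fun t => c i t k) (c' i t k) t) (h : RD S c')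
    {d : ℝ → Mode → ℂ} {l : Filter ℕ} [l.NeBot]
    (ht : ∀ t ∈ S, ∀ k, Tendsto (fun n => c n t k) l (𝓝 (d t k))) (k : Mode) :
    ContinuousOn (fun t => d t k) S := by
  obtain ⟨L, hL0, hL⟩ := RD.exists_nonneg h 0
  have : LipschitzOnWith ⟨L, hL0⟩ (fun t => d t k) S := LipschitzOnWith.of_dist_le_mul
    fun s hs t hts => by
      rw [dist_eq_norm, dist_eq_norm]
      exact le_of_tendsto (((ht s hs k).sub (ht t hts k)).norm) (Eventually.of_forall fun i =>
        hc'.norm_image_sub_le_of_norm_hasDerivWithin_le (fun s hs => (hd i s hs k).hasDerivWithinAt)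
          (fun s hs => show ‖c' i s k‖ ≤ L by simpa using hL i s hs k) hts hs)
  exact this.continuousOn

end

/-- The symmetric box of modes of size `n`. -/
def bx (n : ℕ) : Finset Mode := Fintype.piFinset fun _ => Finset.Icc (-(n : ℤ)) n

lemma mem_bx {n : ℕ} {k : Mode} : k ∈ bx n ↔ ∀ a, |k a| ≤ n := by
  simp [bx, Fintype.mem_piFinset, abs_le]

lemma neg_mem_bx {n : ℕ} {k : Mode} (h : k ∈ bx n) : -k ∈ bx n := by
  simpa [mem_bx] using h

lemma eventually_subset_bx (F : Finset Mode) : ∀ᶠ n in Filter.atTop, F ⊆ bx n := by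
  filter_upwards [Filter.eventually_ge_atTop (F.sup fun k => Finset.univ.sup fun a => (k a).natAbs)]
    with n hn k hk
  refine mem_bx.2 fun a => ?_
  have h1 : (k a).natAbs ≤ Finset.univ.sup fun a => (k a).natAbs :=
    Finset.le_sup (f := fun a => (k a).natAbs) (Finset.mem_univ a)
  have h2 := Finset.le_sup (f := fun k : Mode => Finset.univ.sup fun a => (k a).natAbs) hk
  have h3 : (k a).natAbs ≤ n := h1.trans (h2.trans hn)
  rw [Int.abs_eq_natAbs]
  exact_mod_cast h3

/-- A smooth real solution of the coefficient system on `[0, T₁]`, close to zero on `[0, T₀]`. -/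
structure Slv (T0 T1 ε r C : ℝ) (u : ℝ → Mode → Fin 3 → ℂ)
    (f1 : ℝ → Mode → ℂ) (f2 : ℝ → Mode → Fin 3 → ℂ) (f3 : ℝ → Mode → Fin 3 → Fin 3 → ℂ)
    (q0 : Mode → ℂ) (v0 : Mode → Fin 3 → ℂ) (V0 : Mode → Fin 3 → Fin 3 → ℂ)
    (q : ℝ → Mode → ℂ) (v : ℝ → Mode → Fin 3 → ℂ) (V : ℝ → Mode → Fin 3 → Fin 3 → ℂ) : Prop where
  rq : RD (Set.Icc 0 T1) fun _ : Unit => q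
  rv : ∀ a, RD (Set.Icc 0 T1) fun (_ : Unit) t k => v t k a
  rV : ∀ a b, RD (Set.Icc 0 T1) fun (_ : Unit) t k => V t k a b
  cq : ∀ k, ContinuousOn (fun t => q t k) (Set.Icc 0 T1)
  cv : ∀ k a, ContinuousOn (fun t => v t k a) (Set.Icc 0 T1)
  cV : ∀ k a b, ContinuousOn (fun t => V t k a b) (Set.Icc 0 T1)
  spe : Spe (Set.Ioo 0 T1) (fun (_ : Unit) _ => 1) ε (r ^ 4) u f1 f2 f3 (fun _ => q) (fun _ => v)
    fun _ => V
  sq : ∀ n, Sm (Set.Ioo 0 T1) n fun _ : Unit => q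
  sv : ∀ n a, Sm (Set.Ioo 0 T1) n fun (_ : Unit) t k => v t k a
  sV : ∀ n a b, Sm (Set.Ioo 0 T1) n fun (_ : Unit) t k => V t k a b
  q0 : q 0 = q0
  v0 : v 0 = v0
  V0 : V 0 = V0
  cjq : ∀ t ∈ Set.Icc 0 T1, ∀ k, q t (-k) = starRingEnd ℂ (q t k)
  cjv : ∀ t ∈ Set.Icc 0 T1, ∀ k a, v t (-k) a = starRingEnd ℂ (v t k a)
  cjV : ∀ t ∈ Set.Icc 0 T1, ∀ k a b, V t (-k) a b = starRingEnd ℂ (V t k a b)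
  fin : ∀ t ∈ Set.Icc 0 T0, ∀ N, Fin' N ε r C (v t)

open Filter Topology in
lemma Fin'.of_tendsto {ε r C : ℝ} {l : Filter ℕ} [l.NeBot] {B : ℕ → Finset Mode}
    {v : ℕ → Mode → Fin 3 → ℂ} {w : Mode → Fin 3 → ℂ} {N : Finset Mode}
    (h : ∀ n, Fin' (B n) ε r C (v n)) (hN : ∀ᶠ n in l, N ⊆ B n)
    (hv : ∀ k a, Tendsto (fun n => v n k a) l (𝓝 (w k a))) : Fin' N ε r C w := by
  have hw : ∀ k, 0 ≤ 1 + r ^ 4 * lam k := fun k => by have := lam_nonneg k; positivity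
  have t1 : Tendsto (fun n => ‖v n 0‖ ^ 2) l (𝓝 (‖w 0‖ ^ 2)) :=
    (tendsto_pi_nhds.2 fun a => hv 0 a).norm.pow 2
  have t2 : Tendsto (fun n => ∑ k ∈ N, (1 + r ^ 4 * lam k) * sM (om (v n)) k) l
      (𝓝 (∑ k ∈ N, (1 + r ^ 4 * lam k) * sM (om w) k)) := by
    refine tendsto_finsetSum N fun k _ => Tendsto.const_mul _ ?_
    refine tendsto_finsetSum _ fun a _ => tendsto_finsetSum _ fun b _ => ?_
    exact (((hv k b).const_mul _).sub ((hv k a).const_mul _)).norm.pow 2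
  have t3 : Tendsto (fun n => ∑ k ∈ N, (1 + r ^ 4 * lam k) * ‖sg (v n) k‖ ^ 2) l
      (𝓝 (∑ k ∈ N, (1 + r ^ 4 * lam k) * ‖sg w k‖ ^ 2)) := by
    refine tendsto_finsetSum N fun k _ => Tendsto.const_mul _ (Tendsto.pow (Tendsto.norm ?_) 2)
    exact tendsto_finsetSum _ fun a _ => (hv k a).const_mul _
  refine ⟨le_of_tendsto t1 (Eventually.of_forall fun n => (h n).m),
    le_of_tendsto t2 (hN.mono fun n hn => ?_), le_of_tendsto t3 (hN.mono fun n hn => ?_)⟩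
  · exact (Finset.sum_le_sum_of_subset_of_nonneg hn fun k _ _ =>
      mul_nonneg (hw k) (sM_nonneg _ k)).trans (h n).w
  · exact (Finset.sum_le_sum_of_subset_of_nonneg hn fun k _ _ =>
      mul_nonneg (hw k) (sq_nonneg _)).trans (h n).s

section
variable {ε T : ℝ} {u u' : ℝ → Mode → Fin 3 → ℂ} {f1 : ℝ → Mode → ℂ}
    {f2 : ℝ → Mode → Fin 3 → ℂ} {f3 f3' : ℝ → Mode → Fin 3 → Fin 3 → ℂ}

open Filter Topology in
lemma exists_slv {r Q : ℝ} (hF : Frc u f1 f2 f3) {q0 : Mode → ℂ} {v0 : Mode → Fin 3 → ℂ}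
    {V0 : Mode → Fin 3 → Fin 3 → ℂ} (hf : ∀ N, Fb N ε (r ^ 4) T Q u u' f1 f2 f3 f3')
    (h0 : ∀ N, Ini N ε r Q q0 v0 V0) (hq0 : Rd q0) (hv0 : ∀ a, Rd fun k => v0 k a)
    (hV0 : ∀ a b, Rd fun k => V0 k a b) (rq : ∀ k, q0 (-k) = starRingEnd ℂ (q0 k))
    (rv : ∀ k a, v0 (-k) a = starRingEnd ℂ (v0 k a))
    (rV : ∀ k a b, V0 (-k) a b = starRingEnd ℂ (V0 k a b)) (hT : 0 ≤ T)
    (hQ : 1 ≤ Q) (hTQ : T ≤ Q) (hr : 0 < r) (hr1 : r ≤ 1) (hε : 0 < ε) (hεδ : ε ≤ r ^ 4)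
    (hsm : √(cM Q * r ^ 2) * (10000 * Slat) < 1) :
    ∃ T1 > T, ∃ q v V, Slv T T1 ε r (cF Q T) u f1 f2 f3 q0 v0 V0 q v V := by
  have hδ : 0 < r ^ 4 := by positivity
  have cu := fun k a => (hF.su a).contDiff k
  have c1 := fun k => hF.s1.contDiff k
  have c2 := fun k a => (hF.s2 a).contDiff k
  have c3 := fun k a b => (hF.s3 a b).contDiff k
  obtain ⟨U, hU⟩ := hF.hb 1 (T + 1)
  obtain ⟨S0, hS0⟩ := exists_SE_le hε.le hδ.le hq0 hv0 hV0 1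
  obtain ⟨τ, hτ, -, R, hex⟩ := exists_gal_bdd cu c1 c2 c3 hf hU h0 hS0 hT hQ hTQ hr hr1 hε hεδ hsm
  choose q v V hG iq iv iV hR using fun n => hex (bx n)
  set T1 := T + τ with hT1
  have hTT : T ≤ T1 := by linarith
  have h0T : (0 : ℝ) ∈ Set.Icc 0 T1 := ⟨le_rfl, by linarith⟩
  have hIo : Set.Ioo 0 T1 ⊆ Set.Icc 0 T1 := Set.Ioo_subset_Icc_self
  have hIo' : Set.Ioo 0 T1 ⊆ Set.Ioo (-T1) T1 := Set.Ioo_subset_Ioo_left (by linarith)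
  -- uniform bounds
  obtain ⟨bq, bv, bV⟩ := rd_of_SE (S := Set.Icc 0 T1) hε hδ hG fun m => by
    obtain ⟨Um, hUm⟩ := hF.hb (m + 1) T1
    obtain ⟨S, hS⟩ := exists_SE_le hε.le hδ.le hq0 hv0 hV0 (m + 1)
    have hU0 : 0 ≤ Um := by simpa using (hUm ∅).u 0 h0T ∅
    have hR0 : 0 ≤ R := (SE_nonneg hε.le hδ.le).trans (hR 0 0 h0T)
    refine ⟨(S + Um * T1) * exp (KS ε Um (m + 1) * (1 + R) * T1), fun n t ht => ?_⟩
    refine ((hG n).SE_le hε hδ (by omega) (hUm _) (P := R)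
      (fun t ht => (H2n_le_SE hε.le hδ.le).trans (hR n t ht)) ht).trans ?_
    rw [iq, iv, iV, SE_trn]
    gcongr
    exact hS _
  have spI : Spe (Set.Icc 0 T1) (fun (n : ℕ) k => if k ∈ bx n then (1 : ℂ) else 0) ε (r ^ 4) u f1 f2 f3 q v V :=
    Gal.spe hG
  have spn : Spe (Set.Ioo 0 T1) (fun (n : ℕ) k => if k ∈ bx n then (1 : ℂ) else 0) ε (r ^ 4) u f1 f2 f3 q v V :=
    ⟨fun i t ht => spI.dq i t (hIo ht), fun i t ht => spI.dv i t (hIo ht),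
      fun i t ht => spI.dV i t (hIo ht)⟩
  have pm : PM fun (n : ℕ) k => if k ∈ bx n then (1 : ℂ) else 0 := pM_ind bx
  have cI : Convex ℝ (Set.Ioo 0 T1) := convex_Ioo _ _
  -- limits
  obtain ⟨x, lq, xq⟩ := bq.exists_lim
  choose y lv xv using fun a => (bv a).exists_lim
  choose z lV xV using fun a b => (bV a b).exists_lim
  have hl : ((hyperfilter ℕ : Ultrafilter ℕ) : Filter ℕ) ≤ atTop := Nat.hyperfilter_le_atTop
  have lχ : ∀ k, Tendsto (fun n : ℕ => if k ∈ bx n then (1 : ℂ) else 0) (hyperfilter ℕ) (𝓝 1) :=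
    fun k => (tendsto_const_nhds.congr' ((eventually_subset_bx {k}).mono fun n hn => by
      rw [if_pos (by simpa using hn)])).mono_left hl
  have lsg : ∀ t ∈ Set.Icc 0 T1, ∀ k, Tendsto (fun n => sg (v n t) k) (hyperfilter ℕ)
      (𝓝 (sg (fun k a => y a t k) k)) := fun t ht k =>
    tendsto_finsetSum _ fun a _ => (lv a t ht k).const_mul _
  have lHH : ∀ t ∈ Set.Icc 0 T1, ∀ k a, Tendsto (fun n => HH (V n t) k a) (hyperfilter ℕ)
      (𝓝 (HH (fun k a b => z a b t k) k a)) := fun t ht k a =>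
    tendsto_finsetSum _ fun b _ => (lV a b t ht k).const_mul _
  have lB : ∀ t ∈ Set.Icc 0 T1, ∀ k a b, Tendsto (fun n => Bi (u t) (v n t) k a b) (hyperfilter ℕ)
      (𝓝 (Bi (u t) (fun k a => y a t k) k a b)) := fun t ht k a b => by
    have vb : ∀ a, ∃ D, ∀ n k, W k ^ 2 * ‖v n t k a‖ ≤ D := fun a => by
      obtain ⟨D, hD⟩ := bv a 2
      exact ⟨D, fun n k => hD n t ht k⟩
    have vb0 : ∀ a, ∃ D, ∀ n k, ‖v n t k a‖ ≤ D := fun a => by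
      obtain ⟨D, hD⟩ := bv a 0
      exact ⟨D, fun n k => by simpa using hD n t ht k⟩
    have ub0 : ∀ a, ∃ D, ∀ k, ‖u t k a‖ ≤ D := fun a => by
      obtain ⟨D, hD⟩ := (hF.su a).rd T1 0
      exact ⟨D, fun k => by simpa using hD () t ht k⟩
    choose D hD using vb
    choose D0 hD0 using vb0
    choose E0 hE0 using ub0
    exact ((tendsto_cvi (hD0 a) (hD b) (lv a t ht) (lv b t ht) k).add
      (tendsto_cvi (fun _ : ℕ => hE0 a) (hD b) (fun k => tendsto_const_nhds) (lv b t ht) k)).add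
      (tendsto_cvi (fun _ : ℕ => hE0 b) (hD a) (fun k => tendsto_const_nhds) (lv a t ht) k)
  obtain ⟨m1, m2, m3⟩ := spn.sm (T := T1) pm isOpen_Ioo isPreconnected_Ioo hIo' hF (bq.mono hIo)
    (fun a => (bv a).mono hIo) (fun a b => (bV a b).mono hIo) 1
  have gen : ∀ c n, SmA c → Sm (Set.Ioo 0 T1) n fun _ : ℕ => c :=
    fun c n h => ((h T1 n).comp fun _ => ()).mono hIo'
  have gen' : ∀ c, SmA c → RD (Set.Icc 0 T1) fun _ : ℕ => c := fun c h m => by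
    obtain ⟨C, hC⟩ := h.rd T1 m
    exact ⟨C, fun _ => hC ()⟩
  have spe : Spe (Set.Ioo 0 T1) (fun (_ : Unit) _ => 1) ε (r ^ 4) u f1 f2 f3 (fun _ => x)
      (fun _ t k a => y a t k) fun _ t k a b => z a b t k := by
    refine ⟨fun _ t ht k => ?_, fun _ t ht k a => ?_, fun _ t ht k a b => ?_⟩
    · exact Sm.hasDerivAt_lim isOpen_Ioo cI spn.dq (sm_Rq pm (gen _ _ hF.s1) m2)
        (fun t ht => lq t (hIo ht)) ht k
        ((lχ k).mul (((lsg t (hIo ht) k).const_mul _).neg.add tendsto_const_nhds |>.const_mul _))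
    · exact Sm.hasDerivAt_lim isOpen_Ioo cI (c := fun n t k => v n t k a)
        (fun i t ht k => spn.dv i t ht k a) (sm_Rv pm (fun a => gen _ _ (hF.s2 a)) m1 m3 a)
        (fun t ht => lv a t (hIo ht)) ht k
        ((lχ k).mul (((lHH t (hIo ht) k a).neg.sub (((lq t (hIo ht) k).const_mul _).const_mul _)).add
          tendsto_const_nhds))
    · exact Sm.hasDerivAt_lim isOpen_Ioo cI (c := fun n t k => V n t k a b)
        (fun i t ht k => spn.dV i t ht k a b) (sm_RV pm (fun a b => gen _ _ (hF.s3 a b)) m2 m3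
          (sm_Bi isOpen_Ioo isPreconnected_Ioo (fun a => gen _ _ (hF.su a)) m2) a b)
        (fun t ht => lV a b t (hIo ht)) ht k
        ((lχ k).mul ((((lV a b t (hIo ht) k).neg.sub ((lv a t (hIo ht) k).const_mul _)).add
          ((lB t (hIo ht) k a b).add tendsto_const_nhds)).const_mul _))
  have sm := fun n => spe.sm (T := T1) ⟨1, 0, by simp⟩ isOpen_Ioo isPreconnected_Ioo hIo' hF
    (xq.mono hIo) (fun a => (xv a).mono hIo) (fun a b => (xV a b).mono hIo) n
  have trl : ∀ {k : Mode} {w0 : ℂ} {w : ℕ → ℂ}, (∀ n, k ∈ bx n → w n = w0) →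
      Tendsto w (hyperfilter ℕ) (𝓝 w0) := fun {k w0 w} h =>
    (tendsto_const_nhds.congr' ((eventually_subset_bx {k}).mono fun n hn =>
      (h n (by simpa using hn)).symm)).mono_left hl
  have refl : ∀ n, ∀ t ∈ Set.Icc 0 T1, (fun k => starRingEnd ℂ (q n t (-k))) = q n t ∧
      (fun k a => starRingEnd ℂ (v n t (-k) a)) = v n t ∧
      (fun k a b => starRingEnd ℂ (V n t (-k) a b)) = V n t := fun n t ht => by
    refine Gal.unique cu c1 c2 c3 ((hG n).reflect (fun k => neg_mem_bx) hF.ru hF.r1 hF.r2 hF.r3)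
      (hG n) ⟨?_, ?_, ?_⟩ ht
    · funext k
      rw [iq n]
      by_cases hk : k ∈ bx n
      · simp [trn, hk, neg_mem_bx hk, rq]
      · simp [trn, hk, mt neg_mem_bx (a := -k ∈ bx n) (by simpa using hk)]
    · funext k a
      rw [iv n]
      by_cases hk : k ∈ bx n
      · simp [trn, hk, neg_mem_bx hk, rv]
      · simp [trn, hk, mt neg_mem_bx (a := -k ∈ bx n) (by simpa using hk)]
    · funext k a b
      rw [iV n]
      by_cases hk : k ∈ bx n
      · simp [trn, hk, neg_mem_bx hk, rV]
      · simp [trn, hk, mt neg_mem_bx (a := -k ∈ bx n) (by simpa using hk)]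
  have cj : ∀ {z : ℂ} {w : ℕ → ℂ}, Tendsto w (hyperfilter ℕ) (𝓝 z) →
      Tendsto (fun n => starRingEnd ℂ (w n)) (hyperfilter ℕ) (𝓝 (starRingEnd ℂ z)) :=
    fun h => (Complex.continuous_conj.tendsto _).comp h
  refine ⟨T1, by linarith, x, fun t k a => y a t k, fun t k a b => z a b t k, xq, xv, xV,
    fun k => ?_, fun k a => ?_, fun k a b => ?_, spe, fun n => (sm n).1, fun n => (sm n).2.1,
    fun n => (sm n).2.2, ?_, ?_, ?_, fun t ht k => ?_, fun t ht k a => ?_, fun t ht k a b => ?_,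
    fun t ht N => ?_⟩
  · exact continuousOn_lim (convex_Icc _ _) spI.dq
      (sm_Rq (n := 0) pm (gen' _ hF.s1) bv) lq k
  · exact continuousOn_lim (convex_Icc _ _) (c := fun n t k => v n t k a)
      (fun i t ht k => spI.dv i t ht k a)
      (sm_Rv (n := 0) pm (fun a => gen' _ (hF.s2 a)) bq bV a) (lv a) k
  · exact continuousOn_lim (convex_Icc _ _) (c := fun n t k => V n t k a b)
      (fun i t ht k => spI.dV i t ht k a b) (sm_RV (n := 0) pm (fun a b => gen' _ (hF.s3 a b)) bv bV
        (rd_Bi (fun a => gen' _ (hF.su a)) bv) a b) (lV a b) k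
  · funext k
    exact tendsto_nhds_unique (lq 0 h0T k) (trl (k := k) fun n hn => by rw [iq, trn_mem _ hn])
  · funext k a
    exact tendsto_nhds_unique (lv a 0 h0T k) (trl (k := k) fun n hn => by rw [iv, trn_mem _ hn])
  · funext k a b
    exact tendsto_nhds_unique (lV a b 0 h0T k) (trl (k := k) fun n hn => by rw [iV, trn_mem _ hn])
  · refine tendsto_nhds_unique (lq t ht (-k)) ((cj (lq t ht k)).congr fun n => ?_)
    rw [← congrFun (refl n t ht).1 k]
    simp
  · refine tendsto_nhds_unique (lv a t ht (-k)) ((cj (lv a t ht k)).congr fun n => ?_)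
    rw [← congrFun (congrFun (refl n t ht).2.1 k) a]
    simp
  · refine tendsto_nhds_unique (lV a b t ht (-k)) ((cj (lV a b t ht k)).congr fun n => ?_)
    rw [← congrFun (congrFun (congrFun (refl n t ht).2.2 k) a) b]
    simp
  · have ht1 : t ∈ Set.Icc 0 T1 := ⟨ht.1, ht.2.trans hTT⟩
    have hfin : ∀ n, Fin' (bx n) ε r (cF Q T) (v n t) := fun n =>
      ((hG n).restrict hTT).fin (hf _) (by rw [iq, iv, iV]; exact (h0 _).trn (by linarith)) hQ hTQ hr
        hr1 hε hεδ hsm ht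
    have hev : ∀ᶠ n in (hyperfilter ℕ : Filter ℕ), N ⊆ bx n := (eventually_subset_bx N).filter_mono hl
    exact Fin'.of_tendsto hfin hev fun k a => lv a t ht1 k

end

/-- Characters of the torus. -/
def ex (k : Mode) (x : Spc 3) : ℂ := Complex.exp (Complex.I * ∑ a, ((xi k a : ℝ) : ℂ) * (x a : ℂ))

/-- Fourier coefficients over the unit cell. -/
def fc (f : Spc 3 → ℝ) (k : Mode) : ℂ := ∫ x in cube 3, (f x : ℂ) * ex (-k) x

lemma ex_zero (x : Spc 3) : ex 0 x = 1 := by simp [ex, xi_zero]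

lemma ex_add (j k : Mode) (x : Spc 3) : ex (j + k) x = ex j x * ex k x := by
  simp only [ex, ← Complex.exp_add, xi_add, Complex.ofReal_add, add_mul, Finset.sum_add_distrib,
    mul_add]

lemma ex_neg (k : Mode) (x : Spc 3) : ex (-k) x = starRingEnd ℂ (ex k x) := by
  simp only [ex, ← Complex.exp_conj, map_mul, map_sum, Complex.conj_I, Complex.conj_ofReal, xi_neg]
  congr 1; push_cast; simp only [neg_mul, Finset.sum_neg_distrib]; ring

lemma norm_ex (k : Mode) (x : Spc 3) : ‖ex k x‖ = 1 := by
  have : (∑ a, ((xi k a : ℝ) : ℂ) * (x a : ℂ)) = ((∑ a, xi k a * x a : ℝ) : ℂ) := by push_cast; rfl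
  rw [ex, this, mul_comm, Complex.norm_exp_ofReal_mul_I]

lemma ex_per (k : Mode) : Per (ex k) := by
  intro x m
  have : (Complex.I * ∑ a, ((xi k a : ℝ) : ℂ) * ((x a + (m a : ℝ) : ℝ) : ℂ))
      = (Complex.I * ∑ a, ((xi k a : ℝ) : ℂ) * (x a : ℂ))
        + ((∑ a, k a * m a : ℤ) : ℂ) * (2 * π * Complex.I) := by
    simp only [xi]; push_cast
    simp only [Fin.sum_univ_three]; ring
  simp only [ex]
  rw [this, Complex.exp_add, Complex.exp_int_mul_two_pi_mul_I, mul_one]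

lemma contDiff_ex (k : Mode) {n : WithTop ℕ∞} : ContDiff ℝ n (ex k) := by
  unfold ex
  refine ContDiff.cexp (contDiff_const.mul (ContDiff.sum fun a _ => contDiff_const.mul ?_))
  exact Complex.ofRealCLM.contDiff.comp (contDiff_apply ℝ ℝ a)

lemma continuous_ex (k : Mode) : Continuous (ex k) := (contDiff_ex k (n := 0)).continuous

/-- The derivative of a character. -/
def exD (k : Mode) (x : Spc 3) : Spc 3 →L[ℝ] ℂ :=
  ∑ a, (ContinuousLinearMap.proj a : Spc 3 →L[ℝ] ℝ).smulRight (Complex.I * ((xi k a : ℝ) : ℂ) * ex k x)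

lemma hasFDerivAt_ex (k : Mode) (x : Spc 3) : HasFDerivAt (ex k) (exD k x) x := by
  have h : HasFDerivAt (fun x : Spc 3 => Complex.I * ∑ a, ((xi k a : ℝ) : ℂ) * (x a : ℂ))
      (∑ a, (ContinuousLinearMap.proj a : Spc 3 →L[ℝ] ℝ).smulRight
        (Complex.I * ((xi k a : ℝ) : ℂ))) x := by
    simp only [Finset.mul_sum]
    refine HasFDerivAt.fun_sum fun a _ => ?_
    have := (Complex.ofRealCLM.hasFDerivAt (x := x a)).comp x
      (ContinuousLinearMap.proj (R := ℝ) (φ := fun _ : Fin 3 => ℝ) a).hasFDerivAt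
    refine ((this.const_mul ((xi k a : ℝ) : ℂ)).const_mul Complex.I).congr_fderiv ?_
    ext v; simp; ring
  refine h.cexp.congr_fderiv ?_
  ext v
  simp only [exD, ex, smul_apply, sum_apply,
    ContinuousLinearMap.smulRight_apply, smul_eq_mul, Finset.mul_sum]
  refine Finset.sum_congr rfl fun a _ => ?_
  simp only [Complex.real_smul]; ring

lemma exD_single (k : Mode) (x : Spc 3) (i : Fin 3) :
    exD k x (Pi.single i 1) = Complex.I * ((xi k i : ℝ) : ℂ) * ex k x := by
  simp only [exD, sum_apply, ContinuousLinearMap.smulRight_apply,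
    ContinuousLinearMap.proj_apply]
  rw [Finset.sum_eq_single i]
  · simp
  · intro b _ hb; simp [hb]
  · simp

lemma cube_eq (d : ℕ) : cube d = Set.Icc (0 : Spc d) 1 := by
  rw [cube, ← Set.pi_univ_Icc]; rfl

lemma isCompact_cube (d : ℕ) : IsCompact (cube d) := by rw [cube_eq]; exact isCompact_Icc

lemma measurableSet_cube (d : ℕ) : MeasurableSet (cube d) := (isCompact_cube d).measurableSet

lemma volume_cube (d : ℕ) : volume.real (cube d) = 1 := by
  rw [cube_eq, measureReal_def, Real.volume_Icc_pi]; simp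

lemma integrableOn_cube {d : ℕ} {E : Type*} [NormedAddCommGroup E] {f : Spc d → E}
    (hf : Continuous f) : IntegrableOn f (cube d) :=
  hf.continuousOn.integrableOn_compact (isCompact_cube d)

lemma integral_fderiv_per {E : Type*} [NormedAddCommGroup E] [NormedSpace ℝ E] [CompleteSpace E]
    {F : Spc 3 → E} (hF : ContDiff ℝ 1 F) (hp : Per F) (i : Fin 3) :
    ∫ x in cube 3, fderiv ℝ F x (Pi.single i 1) = 0 := by
  have hd := hF.differentiable one_ne_zero
  have hc : Continuous fun x => fderiv ℝ F x (Pi.single i 1) :=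
    (hF.continuous_fderiv one_ne_zero).clm_apply continuous_const
  have key := integral_divergence_of_hasFDerivAt_off_countable' (n := 2) (E := E)
    (0 : Fin 3 → ℝ) 1 (fun i => zero_le_one)
    (fun j x => if j = i then F x else 0)
    (fun j x => if j = i then fderiv ℝ F x else 0) ∅ Set.countable_empty
    (fun j => by
      by_cases h : j = i
      · simpa [h] using hF.continuous.continuousOn
      · simpa [h] using continuousOn_const)
    (fun x _ j => by
      by_cases h : j = i
      · simpa [h] using (hd x).hasFDerivAt
      · simpa [h] using hasFDerivAt_const (0 : E) x)
    (by
      rw [← cube_eq]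
      refine (integrableOn_cube hc).congr (ae_of_all _ fun x => ?_)
      dsimp only
      rw [Finset.sum_eq_single i (by intro b _ hb; simp [hb]) (by simp)]; simp)
  rw [← cube_eq] at key
  have e1 : ∀ x : Spc 3, (∑ j : Fin 3, (if j = i then fderiv ℝ F x else 0) (Pi.single j 1))
      = fderiv ℝ F x (Pi.single i 1) := fun x => by
    rw [Finset.sum_eq_single i (by intro b _ hb; simp [hb]) (by simp)]; simp
  have e2 : (∫ x in cube 3, ∑ j : Fin 3, (if j = i then fderiv ℝ F x else 0) (Pi.single j 1))
      = ∫ x in cube 3, fderiv ℝ F x (Pi.single i 1) := by simp only [e1]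
  rw [← e2]
  refine key.trans (Finset.sum_eq_zero fun j _ => ?_)
  rw [sub_eq_zero]
  refine integral_congr_ae (ae_of_all _ fun y => ?_)
  by_cases h : j = i
  · subst h
    simp only [if_true]
    rw [← hp (j.insertNth ((0 : Fin 3 → ℝ) j) y) (Pi.single j 1)]
    congr 1; funext l
    refine Fin.succAboveCases j ?_ (fun m => ?_) l
    · simp
    · simp
  · simp [h]

lemma integral_ex {k : Mode} (hk : k ≠ 0) : ∫ x in cube 3, ex k x = 0 := by
  obtain ⟨i, hi⟩ : ∃ i, k i ≠ 0 := by
    by_contra! h; exact hk (funext h)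
  have h := integral_fderiv_per (contDiff_ex k) (ex_per k) i
  simp only [(hasFDerivAt_ex k _).fderiv, exD_single] at h
  rw [integral_const_mul] at h
  refine (mul_eq_zero.1 h).resolve_left ?_
  simp only [xi, mul_eq_zero, Complex.I_ne_zero, false_or, Complex.ofReal_eq_zero]
  have := Real.pi_ne_zero
  have : (k i : ℝ) ≠ 0 := by exact_mod_cast hi
  simp [*]

lemma integral_ex_zero : ∫ x in cube 3, ex 0 x = 1 := by
  simp [ex_zero, volume_cube]

section
variable {f g : Spc 3 → ℝ}

lemma integrable_fc (hf : Continuous f) (k : Mode) :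
    IntegrableOn (fun x => (f x : ℂ) * ex (-k) x) (cube 3) :=
  integrableOn_cube ((Complex.continuous_ofReal.comp hf).mul (continuous_ex _))

lemma fc_add (hf : Continuous f) (hg : Continuous g) (k : Mode) :
    fc (fun x => f x + g x) k = fc f k + fc g k := by
  simp only [fc]
  rw [← integral_add (integrable_fc hf k) (integrable_fc hg k)]
  simp only [Complex.ofReal_add, add_mul]

lemma fc_smul (c : ℝ) (k : Mode) : fc (fun x => c * f x) k = c * fc f k := by
  simp only [fc]
  rw [← integral_const_mul]
  simp only [Complex.ofReal_mul, mul_assoc]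

lemma fc_neg (k : Mode) : fc (fun x => - f x) k = - fc f k := by
  have := fc_smul (f := f) (-1) k
  simpa using this

lemma fc_sub (hf : Continuous f) (hg : Continuous g) (k : Mode) :
    fc (fun x => f x - g x) k = fc f k - fc g k := by
  simp only [sub_eq_add_neg]
  rw [← fc_neg k]; exact fc_add hf hg.neg k

lemma fc_sum {ι : Type*} (s : Finset ι) {F : ι → Spc 3 → ℝ} (hF : ∀ i, Continuous (F i))
    (k : Mode) : fc (fun x => ∑ i ∈ s, F i x) k = ∑ i ∈ s, fc (F i) k := by
  simp only [fc]
  rw [← integral_finsetSum _ fun i _ => integrable_fc (hF i) k]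
  simp only [Complex.ofReal_sum, Finset.sum_mul]

lemma fc_conj (k : Mode) : fc f (-k) = starRingEnd ℂ (fc f k) := by
  simp only [fc]
  rw [← integral_conj]
  refine integral_congr_ae (ae_of_all _ fun x => ?_)
  simp only [map_mul, Complex.conj_ofReal]
  rw [ex_neg (-k)]

lemma norm_fc_le {C : ℝ} (h : ∀ x ∈ cube 3, |f x| ≤ C) (k : Mode) : ‖fc f k‖ ≤ C := by
  have := norm_setIntegral_le_of_norm_le_const (μ := volume) (s := cube 3)
    (f := fun x => (f x : ℂ) * ex (-k) x) (C := C) (isCompact_cube 3).measure_lt_top (by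
      intro x hx
      rw [norm_mul, norm_ex, mul_one, Complex.norm_real]; exact h x hx)
  rwa [volume_cube, mul_one] at this

lemma fc_pd (hf : ContDiff ℝ 1 f) (hp : Per f) (i : Fin 3) (k : Mode) :
    fc (pd i f) k = Complex.I * ((xi k i : ℝ) : ℂ) * fc f k := by
  have hF : ContDiff ℝ 1 fun x => (f x : ℂ) * ex (-k) x :=
    (Complex.ofRealCLM.contDiff.comp hf).mul (contDiff_ex _)
  have h := integral_fderiv_per hF (fun x m => by
    change ((f _ : ℝ) : ℂ) * ex (-k) _ = _; rw [hp x m, ex_per (-k) x m]) i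
  have e : ∀ x, fderiv ℝ (fun x => (f x : ℂ) * ex (-k) x) x (Pi.single i 1)
      = (pd i f x : ℂ) * ex (-k) x - Complex.I * ((xi k i : ℝ) : ℂ) * ((f x : ℂ) * ex (-k) x) := by
    intro x
    have h1 : HasFDerivAt (fun x => (f x : ℂ)) (Complex.ofRealCLM.comp (fderiv ℝ f x)) x :=
      (Complex.ofRealCLM.hasFDerivAt).comp x (hf.differentiable one_ne_zero x).hasFDerivAt
    have h2 : HasFDerivAt (fun x => (f x : ℂ) * ex (-k) x) _ x := h1.mul (hasFDerivAt_ex (-k) x)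
    rw [h2.fderiv]
    simp only [add_apply, smul_apply, exD_single, xi_neg,
      ContinuousLinearMap.comp_apply, smul_eq_mul, pd, Complex.ofRealCLM_apply]
    push_cast; ring
  simp only [e] at h
  rw [integral_sub, integral_const_mul, sub_eq_zero] at h
  · exact h
  · exact integrable_fc ((hf.continuous_fderiv one_ne_zero).clm_apply continuous_const) k
  · exact (integrable_fc hf.continuous k).const_mul _

end

/-- Fourier inversion for continuous periodic functions with summable coefficients. -/
lemma hasSum_fc {f : Spc 3 → ℝ} (hf : Continuous f) (hp : Per f) (hs : Summable (fc f))
    (x : Spc 3) : HasSum (fun k => fc f k * ex k x) (f x) := by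
  have hq : IsOpenQuotientMap
      (Pi.map (fun (_ : Fin 3) (y : ℝ) => (y : UnitAddCircle))) :=
    IsOpenQuotientMap.piMap fun _ => QuotientAddGroup.isOpenQuotientMap_mk
  let P : C(Spc 3, UnitAddTorus (Fin 3)) := ⟨_, hq.continuous⟩
  have hP : Topology.IsQuotientMap P := hq.isQuotientMap
  let F : C(UnitAddTorus (Fin 3), ℂ) := hP.lift
    ⟨fun x => (f x : ℂ), Complex.continuous_ofReal.comp hf⟩ (by
      intro x y hxy
      change ((f x : ℝ) : ℂ) = f y
      have : ∀ i, ∃ n : ℤ, y i = x i + n := fun i => by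
        have h := congrFun hxy i
        change ((x i : ℝ) : UnitAddCircle) = (y i : ℝ) at h
        rw [QuotientAddGroup.eq, AddSubgroup.mem_zmultiples_iff] at h
        obtain ⟨n, hn⟩ := h
        refine ⟨n, ?_⟩
        simp only [zsmul_eq_mul, mul_one] at hn
        rw [hn]; ring
      choose n hn using this
      have : y = fun i => x i + (n i : ℝ) := funext hn
      rw [this, hp x n])
  have hF : ∀ x : Spc 3, F (fun i => (x i : UnitAddCircle)) = f x := fun x => by
    have h : F.comp P = ⟨fun x => (f x : ℂ), Complex.continuous_ofReal.comp hf⟩ := hP.lift_comp _ _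
    exact DFunLike.congr_fun h x
  have hex : ∀ (n : Mode) (x : Spc 3),
      UnitAddTorus.mFourier n (fun i => (x i : UnitAddCircle)) = ex n x := fun n x => by
    simp only [UnitAddTorus.mFourier, ContinuousMap.coe_mk, fourier_coe_apply, ex, ← Complex.exp_sum,
      xi, Finset.mul_sum]
    congr 1
    refine Finset.sum_congr rfl fun i _ => ?_
    push_cast; ring
  have hc : UnitAddTorus.mFourierCoeff F = fc f := by
    funext n
    rw [UnitAddTorus.mFourierCoeff_eq_integral F n 0]
    have hs : {x : Fin 3 → ℝ | ∀ i, x i ∈ Set.Ioc ((0 : Fin 3 → ℝ) i) ((0 : Fin 3 → ℝ) i + 1)}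
        = Set.pi Set.univ fun i => Set.Ioc ((0 : Fin 3 → ℝ) i) ((1 : Fin 3 → ℝ) i) := by
      ext x; simp [Set.mem_pi]
    rw [hs, fc, cube_eq]
    have := (Measure.univ_pi_Ioc_ae_eq_Icc (μ := fun _ : Fin 3 => (volume : Measure ℝ))
      (f := (0 : Fin 3 → ℝ)) (g := 1))
    rw [volume_pi, setIntegral_congr_set this]
    refine integral_congr_ae (ae_of_all _ fun x => ?_)
    simp only [hF, hex, smul_eq_mul]; ring
  have := UnitAddTorus.hasSum_mFourier_series_apply_of_summable (f := F) (by rwa [hc])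
    (fun i => (x i : UnitAddCircle))
  simpa only [hc, hF, hex, smul_eq_mul] using this

/-- Differentiation under the integral over the unit cell. -/
lemma hasDerivAt_integral_cube {E : Type*} [NormedAddCommGroup E] [NormedSpace ℝ E]
    {G G' : ℝ → Spc 3 → E} {J : Set ℝ} (hJ : IsOpen J)
    (hG : ∀ t ∈ J, Continuous (G t))
    (hG' : ContinuousOn (fun q : ℝ × Spc 3 => G' q.1 q.2) (J ×ˢ Set.univ))
    (hd : ∀ t ∈ J, ∀ x, HasDerivAt (fun s => G s x) (G' t x) t) {t : ℝ} (ht : t ∈ J) :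
    HasDerivAt (fun s => ∫ x in cube 3, G s x) (∫ x in cube 3, G' t x) t := by
  obtain ⟨r, hr, hrJ⟩ := Metric.nhds_basis_closedBall.mem_iff.1 (hJ.mem_nhds ht)
  obtain ⟨C, hC⟩ := ((isCompact_closedBall t r).prod (isCompact_cube 3)).exists_bound_of_continuousOn
    (hG'.mono (Set.prod_mono hrJ (Set.subset_univ _)))
  have c' : Continuous (G' t) := by
    have : Continuous fun x : Spc 3 => (t, x) := by fun_prop
    exact hG'.comp_continuous this fun x => ⟨ht, trivial⟩
  refine (hasDerivAt_integral_of_dominated_loc_of_deriv_le (F := G) (F' := G')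
    (bound := fun _ => C) (Metric.closedBall_mem_nhds t hr) ?_ (integrableOn_cube (hG t ht))
    (integrableOn_cube c').aestronglyMeasurable ?_ ?_ ?_).2
  · filter_upwards [hJ.mem_nhds ht] with s hs using (integrableOn_cube (hG s hs)).aestronglyMeasurable
  · filter_upwards [ae_restrict_mem (measurableSet_cube 3)] with x hx s hs using hC (s, x) ⟨hs, hx⟩
  · exact integrableOn_cube continuous_const
  · exact ae_of_all _ fun x s hs => hd s (hrJ hs) x

/-- Smooth spatially periodic scalar fields. -/
def SP (f : ℝ → Spc 3 → ℝ) : Prop := SmoothS f ∧ ∀ t, Per (f t)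

/-- Smooth periodic functions of space. -/
def SX (f : Spc 3 → ℝ) : Prop := ContDiff ℝ (⊤ : ℕ∞) f ∧ Per f

lemma SX.sp {f : Spc 3 → ℝ} (h : SX f) : SP fun _ => f := ⟨h.1.comp contDiff_snd, fun _ => h.2⟩

section
variable {f g : ℝ → Spc 3 → ℝ}

lemma SP.sx (h : SP f) (t : ℝ) : SX (f t) :=
  ⟨h.1.comp (contDiff_const.prodMk contDiff_id), h.2 t⟩

lemma SP.add (hf : SP f) (hg : SP g) : SP fun t x => f t x + g t x :=
  ⟨hf.1.add hg.1, fun t x k => by simp only [hf.2 t x k, hg.2 t x k]⟩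

lemma SP.mul (hf : SP f) (hg : SP g) : SP fun t x => f t x * g t x :=
  ⟨hf.1.mul hg.1, fun t x k => by simp only [hf.2 t x k, hg.2 t x k]⟩

lemma SP.const (c : ℝ) : SP fun _ _ => c := ⟨contDiff_const, fun _ _ _ => rfl⟩

lemma SP.neg (hf : SP f) : SP fun t x => -f t x :=
  ⟨hf.1.neg, fun t x k => by simp only [hf.2 t x k]⟩

lemma SP.sub (hf : SP f) (hg : SP g) : SP fun t x => f t x - g t x :=
  ⟨hf.1.sub hg.1, fun t x k => by simp only [hf.2 t x k, hg.2 t x k]⟩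

lemma SP.sum {ι : Type*} (s : Finset ι) {F : ι → ℝ → Spc 3 → ℝ} (h : ∀ i, SP (F i)) :
    SP fun t x => ∑ i ∈ s, F i t x :=
  ⟨ContDiff.sum fun i _ => (h i).1, fun t x k => by simp only [(h _).2 t x k]⟩

lemma per_pd {f : Spc 3 → ℝ} (h : Per f) (i : Fin 3) : Per (pd i f) := by
  intro x k
  have e : (fun y : Spc 3 => f (y + fun i => (k i : ℝ))) = f := funext fun y => h y k
  have := fderiv_comp_add_right (𝕜 := ℝ) (f := f) (x := x) (fun i => (k i : ℝ))
  rw [e] at this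
  change fderiv ℝ f (x + fun i => (k i : ℝ)) _ = _
  rw [← this]; rfl

lemma SP.hasFDerivAt (h : SP f) (q : ℝ × Spc 3) :
    HasFDerivAt (fun q : ℝ × Spc 3 => f q.1 q.2) (fderiv ℝ (fun q : ℝ × Spc 3 => f q.1 q.2) q) q :=
  (h.1.differentiable (by simp) q).hasFDerivAt

lemma hasFDerivAt_slice {E : Type*} [NormedAddCommGroup E] [NormedSpace ℝ E] {F : ℝ → Spc 3 → E}
    {L : ℝ × Spc 3 →L[ℝ] E} {t : ℝ} {x : Spc 3}
    (h : HasFDerivAt (fun q : ℝ × Spc 3 => F q.1 q.2) L (t, x)) :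
    HasFDerivAt (F t) (L.comp (ContinuousLinearMap.inr ℝ ℝ (Spc 3))) x :=
  h.comp x (hasFDerivAt_prodMk_right t x)

lemma hasDerivAt_slice {E : Type*} [NormedAddCommGroup E] [NormedSpace ℝ E] {F : ℝ → Spc 3 → E}
    {L : ℝ × Spc 3 →L[ℝ] E} {t : ℝ} {x : Spc 3}
    (h : HasFDerivAt (fun q : ℝ × Spc 3 => F q.1 q.2) L (t, x)) :
    HasDerivAt (fun s => F s x) (L (1, 0)) t := by
  have h2 : HasFDerivAt (fun s => F s x) (L.comp (ContinuousLinearMap.inl ℝ ℝ (Spc 3))) t :=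
    HasFDerivAt.comp (f := fun s => (s, x)) (g := fun q : ℝ × Spc 3 => F q.1 q.2) t h
      (hasFDerivAt_prodMk_left t x)
  simpa using h2.hasDerivAt

lemma SP.pd_eq (h : SP f) (i : Fin 3) (t : ℝ) (x : Spc 3) : pd i (f t) x
    = fderiv ℝ (fun q : ℝ × Spc 3 => f q.1 q.2) (t, x) (0, Pi.single i 1) := by
  rw [pd, (hasFDerivAt_slice (h.hasFDerivAt (t, x))).fderiv]; simp

lemma SP.hasDerivAt (h : SP f) (t : ℝ) (x : Spc 3) :
    HasDerivAt (fun s => f s x) (dtS f t x) t := by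
  rw [dtS]; exact (hasDerivAt_slice (h.hasFDerivAt (t, x))).differentiableAt.hasDerivAt

lemma SP.dtS_eq (h : SP f) (t : ℝ) (x : Spc 3) : dtS f t x
    = fderiv ℝ (fun q : ℝ × Spc 3 => f q.1 q.2) (t, x) (1, 0) :=
  (hasDerivAt_slice (h.hasFDerivAt (t, x))).deriv

lemma SP.fderiv_apply (h : SP f) (v : ℝ × Spc 3) : SmoothS fun t x =>
    fderiv ℝ (fun q : ℝ × Spc 3 => f q.1 q.2) (t, x) v :=
  (h.1.fderiv_right (m := (⊤ : ℕ∞)) (by simp)).clm_apply contDiff_const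

lemma SP.pd (h : SP f) (i : Fin 3) : SP fun t => pd i (f t) := by
  refine ⟨?_, fun t => per_pd (h.2 t) i⟩
  have e : (fun t => NSRelax.pd i (f t)) = fun t x => _ := funext fun t => funext fun x => h.pd_eq i t x
  rw [e]; exact h.fderiv_apply _

lemma SP.dtS (h : SP f) : SP (dtS f) := by
  refine ⟨?_, fun t x k => ?_⟩
  · have e : NSRelax.dtS f = fun t x => _ := funext fun t => funext fun x => h.dtS_eq t x
    rw [e]; exact h.fderiv_apply _
  · simp only [NSRelax.dtS]
    congr 1; funext s; exact h.2 s x k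

lemma SP.continuous (h : SP f) : Continuous fun q : ℝ × Spc 3 => f q.1 q.2 := ContDiff.continuous h.1

lemma SX.pd {f : Spc 3 → ℝ} (h : SX f) (i : Fin 3) : SX (pd i f) := (h.sp.pd i).sx 0

lemma SX.cd {f : Spc 3 → ℝ} (h : SX f) : ContDiff ℝ 1 f := h.1.of_le (by simp)

lemma SX.cont {f : Spc 3 → ℝ} (h : SX f) : Continuous f := h.1.continuous

lemma SX.fc_pd {f : Spc 3 → ℝ} (h : SX f) (i : Fin 3) (k : Mode) :
    fc (NSRelax.pd i f) k = Complex.I * ((xi k i : ℝ) : ℂ) * fc f k := NSRelax.fc_pd h.cd h.2 i k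

lemma SP.bdd (h : SP f) (a b : ℝ) : ∃ C, ∀ t ∈ Set.Icc a b, ∀ k, ‖fc (f t) k‖ ≤ C := by
  obtain ⟨C, hC⟩ := (isCompact_Icc.prod (isCompact_cube 3)).exists_bound_of_continuousOn
    h.continuous.continuousOn (s := Set.Icc a b ×ˢ cube 3)
  exact ⟨C, fun t ht k => norm_fc_le (fun x hx => hC (t, x) ⟨ht, hx⟩) k⟩

lemma SP.decay (m : ℕ) : ∀ {f : ℝ → Spc 3 → ℝ}, SP f → ∀ a b : ℝ,
    ∃ C, ∀ t ∈ Set.Icc a b, ∀ k, W k ^ m * ‖fc (f t) k‖ ≤ C := by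
  induction m with
  | zero => intro f h a b; simpa using h.bdd a b
  | succ m ih =>
    intro f h a b
    obtain ⟨C, hC⟩ := ih (h.sub (SP.sum Finset.univ fun i => (h.pd i).pd i)) a b
    refine ⟨C, fun t ht k => ?_⟩
    have h2 := hC t ht k
    rw [fc_sub (h.sx t).cont (continuous_finsetSum _ fun i _ => (((h.sx t).pd i).pd i).cont),
      fc_sum _ fun i => (((h.sx t).pd i).pd i).cont] at h2
    have e : fc (f t) k - ∑ i, fc (NSRelax.pd i (NSRelax.pd i (f t))) k = (W k : ℂ) * fc (f t) k := by
      simp only [((h.sx t).pd _).fc_pd, (h.sx t).fc_pd, W, lam]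
      push_cast
      rw [add_mul, one_mul, Finset.sum_mul, sub_eq_add_neg, ← Finset.sum_neg_distrib]
      congr 1
      refine Finset.sum_congr rfl fun i _ => ?_
      linear_combination (-((xi k i : ℝ) : ℂ) ^ 2 * fc (f t) k) * Complex.I_sq
    rw [e, norm_mul, Complex.norm_real, Real.norm_of_nonneg (W_pos k).le] at h2
    rw [pow_succ, mul_assoc]; exact h2

lemma SP.hasDerivAt_fc (h : SP f) (t : ℝ) (k : Mode) :
    HasDerivAt (fun t => fc (f t) k) (fc (NSRelax.dtS f t) k) t := by
  refine hasDerivAt_integral_cube (G := fun t x => (f t x : ℂ) * ex (-k) x)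
    (G' := fun t x => (NSRelax.dtS f t x : ℂ) * ex (-k) x) (J := Set.univ) isOpen_univ
    (fun t _ => ?_) ?_ (fun t _ x => ?_) trivial
  · exact (Complex.continuous_ofReal.comp (h.sx t).cont).mul (continuous_ex _)
  · exact ((Complex.continuous_ofReal.comp h.dtS.continuous).mul
      ((continuous_ex _).comp continuous_snd)).continuousOn
  · exact (h.hasDerivAt t x).ofReal_comp.mul_const _

lemma SP.sm (n : ℕ) : ∀ {f : ℝ → Spc 3 → ℝ}, SP f → ∀ a b : ℝ,
    Sm (Set.Ioo a b) n fun (_ : Unit) t k => fc (f t) k := by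
  have hr : ∀ {f : ℝ → Spc 3 → ℝ}, SP f → ∀ a b : ℝ,
      RD (Set.Ioo a b) fun (_ : Unit) t k => fc (f t) k := fun h a b m => by
    obtain ⟨C, hC⟩ := h.decay m a b
    exact ⟨C, fun _ t ht k => hC t (Set.Ioo_subset_Icc_self ht) k⟩
  induction n with
  | zero => intro f h a b; exact hr h a b
  | succ n ih =>
    intro f h a b
    exact ⟨hr h a b, fun _ t k => fc (NSRelax.dtS f t) k,
      fun _ t _ k => h.hasDerivAt_fc t k, ih h.dtS a b⟩

lemma SP.smA (h : SP f) : SmA fun t k => fc (f t) k := fun T n => h.sm n (-T) T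

lemma SX.rd {f : Spc 3 → ℝ} (h : SX f) : Rd (fc f) := fun m => by
  obtain ⟨C, hC⟩ := h.sp.decay m 0 0
  exact ⟨C, fun k => hC 0 (by simp) k⟩

end

section
variable {A b : Mode → ℂ}

lemma Rd.norm_le (h : Rd A) : ∃ C, 0 ≤ C ∧ ∀ k, ‖A k‖ ≤ C * (W k ^ 2)⁻¹ := by
  obtain ⟨C, hC⟩ := h 2
  refine ⟨C, (by have := W_pos 0; positivity : 0 ≤ W 0 ^ 2 * ‖A 0‖).trans (hC 0), fun k => ?_⟩
  have := W_pos k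
  rw [← div_eq_mul_inv, le_div_iff₀ (by positivity), mul_comm]; exact hC k

lemma Rd.summable (h : Rd A) : Summable fun k => ‖A k‖ := by
  obtain ⟨C, _, hC⟩ := h.norm_le
  exact Summable.of_nonneg_of_le (fun _ => norm_nonneg _) hC (summable_W.mul_left C)

lemma RD.rd {ι : Type*} {S : Set ℝ} {c : ι → ℝ → Mode → ℂ} (h : RD S c) (i : ι) {t : ℝ}
    (ht : t ∈ S) : Rd (c i t) := fun m => by
  obtain ⟨C, hC⟩ := h m; exact ⟨C, hC i t ht⟩

lemma Rd.rD (h : Rd A) : RD Set.univ fun (_ : Unit) (_ : ℝ) => A := fun m => by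
  obtain ⟨C, hC⟩ := h m; exact ⟨C, fun _ _ _ => hC⟩

lemma Rd.add (h : Rd A) (h' : Rd b) : Rd fun k => A k + b k := (h.rD.add h'.rD).rd () (t := 0) trivial

lemma Rd.mulm {M : Unit → Mode → ℂ} (hM : PM M) (h : Rd A) : Rd fun k => M () k * A k :=
  (h.rD.mulm hM).rd () (t := 0) trivial

/-- Fourier synthesis. -/
def syn (c : Mode → ℂ) (x : Spc 3) : ℂ := ∑' k, c k * ex k x

/-- Real Fourier synthesis. -/
def rs (c : Mode → ℂ) (x : Spc 3) : ℝ := (syn c x).re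

lemma Rd.hasSum (h : Rd A) (x : Spc 3) : HasSum (fun k => A k * ex k x) (syn A x) :=
  (Summable.of_norm (by simpa [norm_ex] using h.summable)).hasSum

lemma syn_add (hA : Rd A) (hb : Rd b) (x : Spc 3) :
    syn (fun k => A k + b k) x = syn A x + syn b x := by
  refine HasSum.tsum_eq ?_
  simpa only [add_mul] using (hA.hasSum x).add (hb.hasSum x)

lemma syn_smul (c : ℂ) (hA : Rd A) (x : Spc 3) : syn (fun k => c * A k) x = c * syn A x := by
  refine HasSum.tsum_eq ?_
  simpa only [mul_assoc] using (hA.hasSum x).mul_left c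

lemma SX.syn_fc {f : Spc 3 → ℝ} (h : SX f) (x : Spc 3) : syn (fc f) x = f x :=
  (hasSum_fc h.cont h.2 h.rd.summable.of_norm x).tsum_eq

lemma syn_per (A : Mode → ℂ) : Per (syn A) := fun x k => by
  simp only [syn]; congr 1; funext j; rw [ex_per j x k]

lemma syn_real (h : ∀ k, A (-k) = starRingEnd ℂ (A k)) (x : Spc 3) : syn A x = (rs A x : ℂ) := by
  symm
  rw [rs, ← Complex.conj_eq_iff_re]
  simp only [syn]
  rw [Complex.conj_tsum, ← (Equiv.neg Mode).tsum_eq fun k => A k * ex k x]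
  refine tsum_congr fun k => ?_
  simp only [Equiv.neg_apply, map_mul, h, ex_neg]

lemma Rd.continuous (h : Rd A) : Continuous (syn A) := by
  obtain ⟨C, _, hC⟩ := h.norm_le
  exact continuous_tsum (fun k => continuous_const.mul (continuous_ex k)) (summable_W.mul_left C)
    fun k x => by rw [norm_mul, norm_ex, mul_one]; exact hC k

lemma syn_cvi (hA : Rd A) (hb : Rd b) (x : Spc 3) : syn (cvi A b) x = syn A x * syn b x := by
  have sA : Summable fun k => ‖A k * ex k x‖ := by simpa [norm_ex] using hA.summable
  have sb : Summable fun k => ‖b k * ex k x‖ := by simpa [norm_ex] using hb.summable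
  rw [syn, syn, syn, tsum_mul_tsum_of_summable_norm sA sb]
  have sAb := summable_mul_of_summable_norm sA sb
  let e : Mode × Mode ≃ Mode × Mode :=
    ⟨fun z => (z.1 - z.2, z.2), fun z => (z.1 + z.2, z.2), fun z => by simp, fun z => by simp⟩
  rw [← e.tsum_eq]
  have s2 := (e.summable_iff).2 sAb
  rw [Summable.tsum_prod (f := fun z => (A (e z).1 * ex (e z).1 x) * (b (e z).2 * ex (e z).2 x)) s2]
  refine tsum_congr fun k => ?_
  rw [cvi, ← tsum_mul_right]
  refine tsum_congr fun j => ?_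
  change _ = A (k - j) * ex (k - j) x * (b j * ex j x)
  have : ex k x = ex (k - j) x * ex j x := by rw [← ex_add, sub_add_cancel]
  rw [this]; ring

lemma hasSum_integral_syn (h : Rd A) {g : Spc 3 → ℂ} (hg : Continuous g) :
    HasSum (fun k => A k * ∫ x in cube 3, ex k x * g x) (∫ x in cube 3, syn A x * g x) := by
  obtain ⟨B, hB⟩ := (isCompact_cube 3).exists_bound_of_continuousOn hg.continuousOn
  have h1 : ∀ k, Integrable (fun x => A k * ex k x * g x) (volume.restrict (cube 3)) := fun k =>
    integrableOn_cube ((continuous_const.mul (continuous_ex k)).mul hg)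
  have h2 : Summable fun k => ∫ x in cube 3, ‖A k * ex k x * g x‖ := by
    refine Summable.of_nonneg_of_le (fun k => by positivity) (fun k => ?_) (h.summable.mul_right B)
    have : ∫ x in cube 3, ‖A k * ex k x * g x‖ ≤ ∫ x in cube 3, ‖A k‖ * B := by
      refine setIntegral_mono_on (h1 k).norm (integrableOn_cube continuous_const)
        (measurableSet_cube 3) fun x hx => ?_
      rw [norm_mul, norm_mul, norm_ex, mul_one]
      exact mul_le_mul_of_nonneg_left (hB x hx) (norm_nonneg _)
    simpa [volume_cube] using this
  have h3 := hasSum_integral_of_summable_integral_norm h1 h2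
  have e : (fun x => syn A x * g x) = fun x => ∑' k, A k * ex k x * g x := funext fun x => by
    rw [syn, tsum_mul_right]
  rw [e]
  simpa only [mul_assoc, integral_const_mul] using h3

lemma fc_rs (h : Rd A) (hr : ∀ k, A (-k) = starRingEnd ℂ (A k)) (k : Mode) : fc (rs A) k = A k := by
  simp only [fc, ← syn_real hr]
  rw [← (hasSum_integral_syn h (continuous_ex (-k))).tsum_eq, tsum_eq_single k]
  · simp only [← ex_add, add_neg_cancel, integral_ex_zero, mul_one]
  · intro j hj
    simp only [← ex_add]
    rw [integral_ex (by rwa [← sub_eq_add_neg, sub_ne_zero]), mul_zero]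

/-- Parseval's identity. -/
lemma SX.parseval {f : Spc 3 → ℝ} (h : SX f) :
    HasSum (fun k => ‖fc f k‖ ^ 2) (∫ x in cube 3, f x ^ 2) := by
  have h1 := hasSum_integral_syn h.rd (Complex.continuous_ofReal.comp h.cont)
  rw [← Complex.hasSum_ofReal]
  convert! h1 using 1
  · funext k
    have : (∫ x in cube 3, ex k x * (Complex.ofReal ∘ f) x) = fc f (-k) := by
      rw [fc, neg_neg]; simp only [Function.comp, mul_comm]
    rw [this, fc_conj, Complex.mul_conj, Complex.normSq_eq_norm_sq]
  · rw [← integral_complex_ofReal]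
    refine integral_congr_ae (ae_of_all _ fun x => ?_)
    simp only [h.syn_fc, Function.comp]; push_cast; ring

end

/-- The derivative in `(t, x)` with time component `A` and spatial components `B`. -/
def jet (A : ℂ) (B : Fin 3 → ℂ) : ℝ × Spc 3 →L[ℝ] ℂ :=
  ContinuousLinearMap.smulRightL ℝ (ℝ × Spc 3) ℂ (ContinuousLinearMap.fst ℝ ℝ (Spc 3)) A
    + ∑ a, ContinuousLinearMap.smulRightL ℝ (ℝ × Spc 3) ℂ
      ((ContinuousLinearMap.proj a : Spc 3 →L[ℝ] ℝ).comp (ContinuousLinearMap.snd ℝ ℝ (Spc 3))) (B a)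

lemma jet_apply (A : ℂ) (B : Fin 3 → ℂ) (v : ℝ × Spc 3) :
    jet A B v = (v.1 : ℂ) * A + ∑ a, (v.2 a : ℂ) * B a := by
  simp [jet]

lemma norm_jet_le (A : ℂ) (B : Fin 3 → ℂ) : ‖jet A B‖ ≤ ‖A‖ + ∑ a, ‖B a‖ := by
  refine ContinuousLinearMap.opNorm_le_bound _ (by positivity) fun v => ?_
  rw [jet_apply, add_mul, Finset.sum_mul]
  refine (norm_add_le _ _).trans (add_le_add ?_ ((norm_sum_le _ _).trans
    (Finset.sum_le_sum fun a _ => ?_)))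
  · rw [norm_mul, Complex.norm_real, mul_comm]
    exact mul_le_mul_of_nonneg_left (norm_fst_le v) (norm_nonneg _)
  · rw [norm_mul, Complex.norm_real, mul_comm]
    exact mul_le_mul_of_nonneg_left ((norm_le_pi_norm v.2 a).trans (norm_snd_le v)) (norm_nonneg _)

lemma hasSum_jet {A : Mode → ℂ} {B : Mode → Fin 3 → ℂ} {A0 : ℂ} {B0 : Fin 3 → ℂ}
    (hA : HasSum A A0) (hB : ∀ a, HasSum (fun k => B k a) (B0 a)) :
    HasSum (fun k => jet (A k) (B k)) (jet A0 B0) := by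
  unfold jet
  exact (ContinuousLinearMap.hasSum _ hA).add
    (hasSum_sum fun a _ => ContinuousLinearMap.hasSum _ (hB a))

lemma contDiffOn_jet {n : WithTop ℕ∞} {s : Set (ℝ × Spc 3)} {A : ℝ × Spc 3 → ℂ}
    {B : ℝ × Spc 3 → Fin 3 → ℂ} (hA : ContDiffOn ℝ n A s) (hB : ∀ a, ContDiffOn ℝ n (fun q => B q a) s) :
    ContDiffOn ℝ n (fun q => jet (A q) (B q)) s := by
  unfold jet
  exact ((ContinuousLinearMap.contDiff _).comp_contDiffOn hA).add
    (ContDiffOn.sum fun a _ => (ContinuousLinearMap.contDiff _).comp_contDiffOn (hB a))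

lemma rd_Ixi {ι : Type*} {S : Set ℝ} {c : ι → ℝ → Mode → ℂ} (h : RD S c) (a : Fin 3) :
    RD S fun i t k => Complex.I * ((xi k a : ℝ) : ℂ) * c i t k :=
  h.mulm ((pM_const Complex.I).mul (pM_xi a))

lemma Rd.Ixi {A : Mode → ℂ} (h : Rd A) (a : Fin 3) :
    Rd fun k => Complex.I * ((xi k a : ℝ) : ℂ) * A k :=
  (rd_Ixi h.rD a).rd () (t := 0) trivial

section
variable {a b : ℝ} {c c' : ℝ → Mode → ℂ}

lemma hasFDerivAt_syn (h : RD (Set.Ioo a b) fun _ : Unit => c)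
    (h' : RD (Set.Ioo a b) fun _ : Unit => c')
    (hd : ∀ t ∈ Set.Ioo a b, ∀ k, HasDerivAt (fun t => c t k) (c' t k) t) {t : ℝ}
    (ht : t ∈ Set.Ioo a b) (x : Spc 3) :
    HasFDerivAt (fun q : ℝ × Spc 3 => syn (c q.1) q.2)
      (jet (syn (c' t) x) fun i => syn (fun k => Complex.I * ((xi k i : ℝ) : ℂ) * c t k) x) (t, x) := by
  have hI := fun i => rd_Ixi h i
  obtain ⟨C, hC⟩ := h' 2
  choose D hD using fun i => hI i 2
  have hb : ∀ {z : ℂ} {E : ℝ} (k : Mode), W k ^ 2 * ‖z‖ ≤ E → ‖z‖ ≤ E * (W k ^ 2)⁻¹ := by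
    intro z E k hz
    have := W_pos k
    rwa [← div_eq_mul_inv, le_div_iff₀ (by positivity), mul_comm]
  have key := hasFDerivAt_tsum_of_isPreconnected
    (f := fun k (q : ℝ × Spc 3) => c q.1 k * ex k q.2)
    (f' := fun k q => jet (c' q.1 k * ex k q.2)
      fun i => Complex.I * ((xi k i : ℝ) : ℂ) * c q.1 k * ex k q.2)
    (u := fun k => (C + ∑ i, D i) * (W k ^ 2)⁻¹) (s := Set.Ioo a b ×ˢ Set.univ) (x₀ := (t, x))
    (x := (t, x)) (summable_W.mul_left _) (isOpen_Ioo.prod isOpen_univ)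
    (isPreconnected_Ioo.prod isPreconnected_univ) ?_ ?_ ⟨ht, trivial⟩
    ((h.rd () ht).hasSum x).summable ⟨ht, trivial⟩
  · refine key.congr_fderiv (HasSum.tsum_eq ?_)
    exact hasSum_jet ((h'.rd () ht).hasSum x) fun i => ((hI i).rd () ht).hasSum x
  · rintro k ⟨s, y⟩ ⟨hs, -⟩
    have h1 : HasFDerivAt (fun q : ℝ × Spc 3 => c q.1 k) _ (s, y) :=
      HasFDerivAt.comp (f := Prod.fst) (g := fun t => c t k) (s, y) (hd s hs k).hasFDerivAt
        hasFDerivAt_fst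
    have h2 : HasFDerivAt (fun q : ℝ × Spc 3 => ex k q.2) _ (s, y) :=
      HasFDerivAt.comp (f := Prod.snd) (g := ex k) (s, y) (hasFDerivAt_ex k y) hasFDerivAt_snd
    have h3 : HasFDerivAt (fun q : ℝ × Spc 3 => c q.1 k * ex k q.2) _ (s, y) := h1.mul h2
    refine h3.congr_fderiv (ContinuousLinearMap.ext fun v => ?_)
    rw [jet_apply]
    simp only [add_apply, smul_apply, ContinuousLinearMap.comp_apply, smul_eq_mul,
      ContinuousLinearMap.coe_fst', ContinuousLinearMap.coe_snd', exD, sum_apply,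
      ContinuousLinearMap.smulRight_apply, ContinuousLinearMap.proj_apply,
      ContinuousLinearMap.toSpanSingleton_apply, Complex.real_smul, Finset.mul_sum]
    rw [add_comm]
    refine congrArg₂ _ (by ring) (Finset.sum_congr rfl fun i _ => by ring)
  · rintro k ⟨s, y⟩ ⟨hs, -⟩
    refine (norm_jet_le _ _).trans ?_
    rw [add_mul, Finset.sum_mul]
    refine add_le_add ?_ (Finset.sum_le_sum fun i _ => ?_)
    · rw [norm_mul, norm_ex, mul_one]; exact hb k (hC () s hs k)
    · rw [norm_mul _ (ex k y), norm_ex, mul_one]; exact hb k (hD i () s hs k)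

lemma contDiffOn_syn (n : ℕ) : ∀ {c : ℝ → Mode → ℂ}, (Sm (Set.Ioo a b) (n + 1) fun _ : Unit => c) →
    ContDiffOn ℝ n (fun q : ℝ × Spc 3 => syn (c q.1) q.2) (Set.Ioo a b ×ˢ Set.univ) := by
  have dif : ∀ {n : ℕ} {c : ℝ → Mode → ℂ}, (Sm (Set.Ioo a b) (n + 1) fun _ : Unit => c) →
      DifferentiableOn ℝ (fun q : ℝ × Spc 3 => syn (c q.1) q.2) (Set.Ioo a b ×ˢ Set.univ) := by
    rintro n c ⟨h, c', hd, h'⟩ ⟨t, x⟩ ⟨ht, -⟩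
    exact (hasFDerivAt_syn h (h'.rd.mono subset_rfl) (hd ()) ht x).differentiableAt.differentiableWithinAt
  induction n with
  | zero => intro c h; exact contDiffOn_zero.2 (dif h).continuousOn
  | succ n ih =>
    intro c h
    have h0 := h
    obtain ⟨hr, c', hd, h'⟩ := h
    push_cast
    rw [contDiffOn_succ_iff_fderiv_of_isOpen (isOpen_Ioo.prod isOpen_univ)]
    refine ⟨dif h0, fun hn => absurd hn (by exact_mod_cast WithTop.coe_ne_top), ?_⟩
    have hI : ∀ i, Sm (Set.Ioo a b) (n + 1) fun (_ : Unit) t k => Complex.I * ((xi k i : ℝ) : ℂ) * c t k :=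
      fun i => h0.pred.mulm ((pM_const Complex.I).mul (pM_xi i))
    refine (contDiffOn_jet (ih (c := c' ()) h') fun i => ih (hI i)).congr ?_
    rintro ⟨t, x⟩ ⟨ht, -⟩
    exact (hasFDerivAt_syn hr h'.rd (hd ()) ht x).fderiv

lemma contDiffOn_rs (h : ∀ n, Sm (Set.Ioo a b) n fun _ : Unit => c) :
    ContDiffOn ℝ (⊤ : ℕ∞) (fun q : ℝ × Spc 3 => rs (c q.1) q.2) (Set.Ioo a b ×ˢ Set.univ) :=
  Complex.reCLM.contDiff.comp_contDiffOn (contDiffOn_infty.2 fun n => contDiffOn_syn n (h (n + 1)))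

lemma continuousOn_rs (h : RD (Set.Icc a b) fun _ : Unit => c)
    (hc : ∀ k, ContinuousOn (fun t => c t k) (Set.Icc a b)) :
    ContinuousOn (fun q : ℝ × Spc 3 => rs (c q.1) q.2) (Set.Icc a b ×ˢ Set.univ) := by
  obtain ⟨C, hC⟩ := h 2
  refine Complex.continuous_re.comp_continuousOn (continuousOn_tsum (fun k => ?_)
    (summable_W.mul_left C) ?_)
  · exact ((hc k).comp continuousOn_fst fun q hq => hq.1).mul
      ((continuous_ex k).comp continuous_snd).continuousOn
  · rintro k ⟨t, x⟩ ⟨ht, -⟩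
    have := W_pos k
    rw [norm_mul, norm_ex, mul_one, ← div_eq_mul_inv, le_div_iff₀ (by positivity), mul_comm]
    exact hC () t ht k

lemma hasDerivAt_rs (h : ∀ n, Sm (Set.Ioo a b) n fun _ : Unit => c)
    (hd : ∀ t ∈ Set.Ioo a b, ∀ k, HasDerivAt (fun t => c t k) (c' t k) t) {t : ℝ}
    (ht : t ∈ Set.Ioo a b) (x : Spc 3) :
    HasDerivAt (fun s => rs (c s) x) (rs (c' t) x) t := by
  obtain ⟨hr, e, he, hs⟩ := h 1
  have e1 : ∀ t ∈ Set.Ioo a b, e () t = c' t := fun t ht => funext fun k =>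
    (he () t ht k).unique (hd t ht k)
  have h1 := hasDerivAt_slice (F := fun t => syn (c t)) (hasFDerivAt_syn hr hs.rd (he ()) ht x)
  rw [e1 t ht, jet_apply] at h1
  simp only [Complex.ofReal_one, one_mul, Pi.zero_apply, Complex.ofReal_zero, zero_mul,
    Finset.sum_const_zero, add_zero] at h1
  exact (Complex.reCLM.hasFDerivAt.comp_hasDerivAt t h1)

lemma hasFDerivAt_rs {A : Mode → ℂ} (h : Rd A) (x : Spc 3) :
    DifferentiableAt ℝ (rs A) x ∧
      ∀ i, pd i (rs A) x = rs (fun k => Complex.I * ((xi k i : ℝ) : ℂ) * A k) x := by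
  have h1 := hasFDerivAt_slice (F := fun _ : ℝ => syn A) (hasFDerivAt_syn (a := -1) (b := 1) (c := fun _ => A)
    (c' := fun _ _ => 0) (h.rD.mono (Set.subset_univ _)) (fun m => ⟨0, by simp⟩)
    (fun t _ k => hasDerivAt_const t _) (t := 0) (by simp) x)
  have h2 : HasFDerivAt (rs A) _ x := Complex.reCLM.hasFDerivAt.comp x h1
  refine ⟨h2.differentiableAt, fun i => ?_⟩
  rw [pd, h2.fderiv]
  simp only [ContinuousLinearMap.comp_apply, ContinuousLinearMap.inr_apply, jet_apply]
  rw [Finset.sum_eq_single i (by intro b _ hb; simp [hb]) (by simp)]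
  simp [rs]

end

section
variable {A B : Mode → ℂ}

lemma rs_add (hA : Rd A) (hB : Rd B) (x : Spc 3) : rs (fun k => A k + B k) x = rs A x + rs B x := by
  simp only [rs, syn_add hA hB, Complex.add_re]

lemma rs_smul (c : ℝ) (hA : Rd A) (x : Spc 3) : rs (fun k => (c : ℂ) * A k) x = c * rs A x := by
  simp only [rs, syn_smul (c : ℂ) hA, Complex.re_ofReal_mul]

lemma Rd.smul (c : ℂ) (hA : Rd A) : Rd fun k => c * A k := hA.mulm (pM_const c)

lemma Rd.zero : Rd fun _ => 0 := fun _ => ⟨0, by simp⟩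

lemma Rd.sum {ι : Type*} (s : Finset ι) {A : ι → Mode → ℂ} (h : ∀ i, Rd (A i)) :
    Rd fun k => ∑ i ∈ s, A i k := by
  classical
  induction s using Finset.induction_on with
  | empty => simpa using Rd.zero
  | insert i s hi ih => simp only [Finset.sum_insert hi]; exact (h i).add ih

lemma rs_sum {A : Fin 3 → Mode → ℂ} (h : ∀ i, Rd (A i)) (x : Spc 3) :
    rs (fun k => ∑ i, A i k) x = ∑ i, rs (A i) x := by
  simp only [Fin.sum_univ_three]
  rw [rs_add ((h 0).add (h 1)) (h 2), rs_add (h 0) (h 1)]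

lemma rs_mul (hA : Rd A) (hB : Rd B) (rA : ∀ k, A (-k) = starRingEnd ℂ (A k))
    (rB : ∀ k, B (-k) = starRingEnd ℂ (B k)) (x : Spc 3) : rs (cvi A B) x = rs A x * rs B x := by
  rw [rs, syn_cvi hA hB, syn_real rA, syn_real rB, ← Complex.ofReal_mul, Complex.ofReal_re]

lemma SX.rs_fc {f : Spc 3 → ℝ} (h : SX f) (x : Spc 3) : rs (fc f) x = f x := by
  rw [rs, h.syn_fc, Complex.ofReal_re]

lemma rs_per (A : Mode → ℂ) : Per (rs A) := fun x k => by simp only [rs]; rw [syn_per A x k]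

lemma pd_add_rs {f : Spc 3 → ℝ} (hf : SX f) (hA : Rd A) (i : Fin 3) (x : Spc 3) :
    pd i (fun y => f y + rs A y) x
      = pd i f x + rs (fun k => Complex.I * ((xi k i : ℝ) : ℂ) * A k) x := by
  obtain ⟨h1, h2⟩ := hasFDerivAt_rs hA x
  rw [← h2 i, pd, fderiv_fun_add (hf.1.differentiable (by simp) x) h1]; rfl

lemma Rd.cvi (hA : Rd A) (hB : Rd B) : Rd (NSRelax.cvi A B) :=
  (hA.rD.cvi hB.rD).rd () (t := 0) trivial

end

section
variable {p : ℝ → Spc 3 → ℝ} {u : ℝ → Spc 3 → Vec 3} {ε δ : ℝ}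

lemma SP.stress (hu : ∀ a, SP fun t x => u t x a) (a b : Fin 3) :
    SP fun t x => NSRelax.stress u t x a b := ((hu a).mul (hu b)).sub ((hu a).pd b)

/-- Residual of the mass balance. -/
def res1 (ε : ℝ) (p : ℝ → Spc 3 → ℝ) (u : ℝ → Spc 3 → Vec 3) (t : ℝ) (x : Spc 3) : ℝ :=
  -(ε * dtS p t x + divv (u t) x)

/-- Residual of the momentum balance. -/
def res2 (p : ℝ → Spc 3 → ℝ) (u : ℝ → Spc 3 → Vec 3) (a : Fin 3) (t : ℝ) (x : Spc 3) : ℝ :=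
  -(dtV u t x a + divM (stress u t) x a + pd a (p t) x)

/-- Residual of the stress relation. -/
def res3 (δ : ℝ) (u : ℝ → Spc 3 → Vec 3) (a b : Fin 3) (t : ℝ) (x : Spc 3) : ℝ :=
  -δ * dtM (stress u) t x a b

lemma sp_res1 (hp : SP p) (hu : ∀ a, SP fun t x => u t x a) : SP (res1 ε p u) :=
  (((SP.const ε).mul hp.dtS).add (SP.sum Finset.univ fun i => (hu i).pd i)).neg

lemma sp_res2 (hp : SP p) (hu : ∀ a, SP fun t x => u t x a) (a : Fin 3) : SP (res2 p u a) :=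
  (((hu a).dtS.add (SP.sum Finset.univ fun j => (SP.stress hu a j).pd j)).add (hp.pd a)).neg

lemma sp_res3 (hu : ∀ a, SP fun t x => u t x a) (a b : Fin 3) : SP (res3 δ u a b) :=
  (SP.const (-δ)).mul (SP.stress hu a b).dtS

lemma mem_Itv {T t : ℝ} (hT : 0 < T) : t ∈ Itv (ENNReal.ofReal T) ↔ 0 ≤ t ∧ t < T := by
  simp only [Itv, Set.mem_ofPred_eq, ENNReal.ofReal_lt_ofReal_iff hT]

lemma isRelax_of_slv {T0 T1 r C : ℝ} (hp : SP p) (hu : ∀ a, SP fun t x => u t x a)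
    {P : Spc 3 → ℝ} {Y : Fin 3 → Spc 3 → ℝ} {Z : Fin 3 → Fin 3 → Spc 3 → ℝ} (hP : SX P)
    (hY : ∀ a, SX (Y a)) (hZ : ∀ a b, SX (Z a b))
    {q : ℝ → Mode → ℂ} {v : ℝ → Mode → Fin 3 → ℂ} {V : ℝ → Mode → Fin 3 → Fin 3 → ℂ}
    (hT1 : 0 < T1) (hε : 0 < ε) (hr : 0 < r)
    (S : Slv T0 T1 ε r C (fun t k a => fc (fun x => u t x a) k) (fun t => fc (res1 ε p u t))
      (fun t k a => fc (res2 p u a t) k) (fun t k a b => fc (res3 (r ^ 4) u a b t) k)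
      (fc P) (fun k a => fc (Y a) k) (fun k a b => fc (Z a b) k) q v V) :
    IsRelax 3 ε (r ^ 4) (ENNReal.ofReal T1) (fun t x => p t x + rs (q t) x)
      (fun t x a => u t x a + rs (fun k => v t k a) x)
      (fun t x a b => stress u t x a b + rs (fun k => V t k a b) x) := by
  have hI : ∀ t, t ∈ Itv (ENNReal.ofReal T1) ↔ 0 ≤ t ∧ t < T1 := fun t => mem_Itv hT1
  have hII : ∀ t ∈ Itv (ENNReal.ofReal T1), t ∈ Set.Icc 0 T1 := fun t ht =>
    ⟨((hI t).1 ht).1, ((hI t).1 ht).2.le⟩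
  have hIo : ∀ t ∈ Itv (ENNReal.ofReal T1), 0 < t → t ∈ Set.Ioo 0 T1 := fun t ht h =>
    ⟨h, ((hI t).1 ht).2⟩
  have hu' := hu
  have hS := SP.stress hu
  have Rq : ∀ t ∈ Set.Icc 0 T1, Rd (q t) := fun t ht => S.rq.rd () ht
  have Rv : ∀ t ∈ Set.Icc 0 T1, ∀ a, Rd (fun k => v t k a) := fun t ht a => (S.rv a).rd () ht
  have RV : ∀ t ∈ Set.Icc 0 T1, ∀ a b, Rd (fun k => V t k a b) := fun t ht a b => (S.rV a b).rd () ht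
  have hδ : (0 : ℝ) < r ^ 4 := by positivity
  have sub : Itv (ENNReal.ofReal T1) ×ˢ (Set.univ : Set (Spc 3)) ⊆ Set.Icc 0 T1 ×ˢ Set.univ :=
    Set.prod_mono hII subset_rfl
  refine ⟨ENNReal.ofReal_pos.2 hT1, ?_, ?_, ?_, ?_, ?_, ?_, ?_, ?_, ?_⟩
  · simp only [S.q0, S.v0, S.V0, hP.rs_fc, (hY _).rs_fc, (hZ _ _).rs_fc]
    refine ((hp.sx 0).1.add hP.1).prodMk (ContDiff.prodMk ?_ ?_)
    · exact contDiff_pi.2 fun a => ((hu a).sx 0).1.add (hY a).1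
    · exact contDiff_pi.2 fun a => contDiff_pi.2 fun b => ((hS a b).sx 0).1.add (hZ a b).1
  · intro t _ x k
    simp only [hp.2 t x k, rs_per (q t) x k]
  · intro t _ x k
    funext a
    simp only [rs_per _ x k]
    exact congrArg (· + _) ((hu a).2 t x k)
  · intro t _ x k
    funext a b
    simp only [rs_per _ x k]
    exact congrArg (· + _) ((hS a b).2 t x k)
  · refine ContinuousOn.prodMk ?_ (ContinuousOn.prodMk (continuousOn_pi.2 fun a => ?_)
      (continuousOn_pi.2 fun a => continuousOn_pi.2 fun b => ?_))
    · exact hp.continuous.continuousOn.add ((continuousOn_rs S.rq S.cq).mono sub)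
    · exact (hu a).continuous.continuousOn.add
        ((continuousOn_rs (c := fun t k => v t k a) (S.rv a) fun k => S.cv k a).mono sub)
    · exact (hS a b).continuous.continuousOn.add
        ((continuousOn_rs (c := fun t k => V t k a b) (S.rV a b) fun k => S.cV k a b).mono sub)
  · intro t ht h0 x
    have hm : Set.Ioo 0 T1 ×ˢ (Set.univ : Set (Spc 3)) ∈ nhds (t, x) :=
      (isOpen_Ioo.prod isOpen_univ).mem_nhds ⟨hIo t ht h0, trivial⟩
    refine ContDiffAt.prodMk ?_ (ContDiffAt.prodMk (contDiffAt_pi.2 fun a => ?_)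
      (contDiffAt_pi.2 fun a => contDiffAt_pi.2 fun b => ?_))
    · exact (ContDiff.contDiffAt hp.1).add ((contDiffOn_rs S.sq).contDiffAt hm)
    · exact (ContDiff.contDiffAt (hu a).1).add
        ((contDiffOn_rs (c := fun t k => v t k a) fun n => S.sv n a).contDiffAt hm)
    · exact (ContDiff.contDiffAt (hS a b).1).add
        ((contDiffOn_rs (c := fun t k => V t k a b) fun n => S.sV n a b).contDiffAt hm)
  · intro t ht h0 x
    have hto := hIo t ht h0
    have hti := hII t ht
    have d1 := (hp.hasDerivAt t x).add (hasDerivAt_rs S.sq (S.spe.dq ()) hto x)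
    have hF := (sp_res1 (ε := ε) hp hu).sx t
    have e : (fun k => (1 : ℂ) * (((ε⁻¹ : ℝ) : ℂ) * (-(Complex.I * sg (v t) k) + fc (res1 ε p u t) k)))
        = fun k => ((ε⁻¹ : ℝ) : ℂ) * (((-1 : ℝ) : ℂ) *
          (∑ a, Complex.I * ((xi k a : ℝ) : ℂ) * v t k a) + fc (res1 ε p u t) k) := by
      funext k
      have h1 : ∑ a, Complex.I * ((xi k a : ℝ) : ℂ) * v t k a = Complex.I * sg (v t) k := by
        simp only [sg, Finset.mul_sum, mul_assoc]
      rw [h1]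
      push_cast; ring
    have hs := Rd.sum Finset.univ fun a => (Rv t hti a).Ixi a
    rw [e, rs_smul _ ((hs.smul _).add hF.rd), rs_add (hs.smul _) hF.rd, rs_smul _ hs,
      rs_sum fun a => (Rv t hti a).Ixi a, hF.rs_fc] at d1
    have e1 : dtS (fun t x => p t x + rs (q t) x) t x = _ := d1.deriv
    rw [e1]
    simp only [divv, pd_add_rs ((hu _).sx t) (Rv t hti _), Finset.sum_add_distrib, res1]
    field_simp
    ring
  · intro t ht h0 x a
    have hto := hIo t ht h0
    have hti := hII t ht
    have d1 := ((hu a).hasDerivAt t x).add (hasDerivAt_rs (c := fun t k => v t k a)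
      (fun n => S.sv n a) (fun t ht k => S.spe.dv () t ht k a) hto x)
    have hF := (sp_res2 hp hu a).sx t
    have e : (fun k => (1 : ℂ) * (-HH (V t) k a - ((xi k a : ℝ) : ℂ) * (Complex.I * q t k)
          + fc (res2 p u a t) k))
        = fun k => ((-1 : ℝ) : ℂ) * ((∑ j, Complex.I * ((xi k j : ℝ) : ℂ) * V t k a j)
          + Complex.I * ((xi k a : ℝ) : ℂ) * q t k) + fc (res2 p u a t) k := by
      funext k
      simp only [HH]
      push_cast; ring
    have hs := Rd.sum Finset.univ fun j => (RV t hti a j).Ixi j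
    have hq := (Rq t hti).Ixi a
    rw [e, rs_add ((hs.add hq).smul _) hF.rd, rs_smul _ (hs.add hq), rs_add hs hq,
      rs_sum fun j => (RV t hti a j).Ixi j, hF.rs_fc] at d1
    have e1 : dtV (fun t x a => u t x a + rs (fun k => v t k a) x) t x a = _ := d1.deriv
    rw [e1]
    simp only [divM]
    rw [pd_add_rs (hp.sx t) (Rq t hti)]
    have e3 : ∀ j, pd j (fun y => stress u t y a j + rs (fun k => V t k a j) y) x = _ := fun j =>
      pd_add_rs ((hS a j).sx t) (RV t hti a j) j x
    simp only [e3, Finset.sum_add_distrib, res2, divM]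
    change dtV u t x a + _ + _ + _ = _
    ring
  · intro t ht h0 x a b
    have hto := hIo t ht h0
    have hti := hII t ht
    have d1 := ((hS a b).hasDerivAt t x).add (hasDerivAt_rs (c := fun t k => V t k a b)
      (fun n => S.sV n a b) (fun t ht k => S.spe.dV () t ht k a b) hto x)
    have hF := (sp_res3 (δ := r ^ 4) hu a b).sx t
    have e : (fun k => (1 : ℂ) * (((((r ^ 4)⁻¹ : ℝ)) : ℂ) * (-V t k a b
          - Complex.I * ((xi k b : ℝ) : ℂ) * v t k a
          + (Bi (fun k a => fc (fun x => u t x a) k) (v t) k a b + fc (res3 (r ^ 4) u a b t) k))))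
        = fun k => ((((r ^ 4)⁻¹ : ℝ)) : ℂ) * (((-1 : ℝ) : ℂ) * (V t k a b
          + Complex.I * ((xi k b : ℝ) : ℂ) * v t k a)
          + (Bi (fun k a => fc (fun x => u t x a) k) (v t) k a b + fc (res3 (r ^ 4) u a b t) k)) := by
      funext k
      push_cast; ring
    have hv := Rv t hti
    have hru := fun a => ((hu a).sx t).rd
    have hx := (hv a).Ixi b
    have c1 := (hv a).cvi (hv b)
    have c2 := (hru a).cvi (hv b)
    have c3 := (hru b).cvi (hv a)
    have hB : Rd fun k => Bi (fun k a => fc (fun x => u t x a) k) (v t) k a b := (c1.add c2).add c3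
    have eB : rs (fun k => Bi (fun k a => fc (fun x => u t x a) k) (v t) k a b) x
        = rs (fun k => v t k a) x * rs (fun k => v t k b) x + u t x a * rs (fun k => v t k b) x
          + u t x b * rs (fun k => v t k a) x := by
      have hvr := fun a k => S.cjv t hti k a
      rw [← ((hu a).sx t).rs_fc x, ← ((hu b).sx t).rs_fc x, ← rs_mul (hv a) (hv b) (hvr a) (hvr b),
        ← rs_mul (hru a) (hv b) fc_conj (hvr b), ← rs_mul (hru b) (hv a) fc_conj (hvr a),
        ← rs_add c1 c2, ← rs_add (c1.add c2) c3]
      rfl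
    have hV := RV t hti a b
    have hin := (hV.add hx).smul ((-1 : ℝ) : ℂ)
    rw [e, rs_smul _ (hin.add (hB.add hF.rd)), rs_add hin (hB.add hF.rd),
      rs_smul _ (hV.add hx), rs_add hV hx, rs_add hB hF.rd, hF.rs_fc, eB] at d1
    have e1 : dtM (fun t x a b => stress u t x a b + rs (fun k => V t k a b) x) t x a b = _ := d1.deriv
    rw [e1]
    rw [pd_add_rs ((hu a).sx t) (hv a)]
    simp only [res3]
    have e4 : dtS (fun t x => stress u t x a b) t x = dtM (stress u) t x a b := rfl
    rw [e4]
    simp only [stress]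
    field_simp
    ring

end

/-- Periodic scalar fields, continuous on `[0,T]` and smooth on `(0,T)`. -/
structure SJ (T : ℝ) (f : ℝ → Spc 3 → ℝ) : Prop where
  c : ContinuousOn (fun q : ℝ × Spc 3 => f q.1 q.2) (Set.Icc 0 T ×ˢ Set.univ)
  s : ContDiffOn ℝ (⊤ : ℕ∞) (fun q : ℝ × Spc 3 => f q.1 q.2) (Set.Ioo 0 T ×ˢ Set.univ)
  p : ∀ t ∈ Set.Icc 0 T, Per (f t)

section
variable {T : ℝ} {f g : ℝ → Spc 3 → ℝ}

lemma SJ.add (hf : SJ T f) (hg : SJ T g) : SJ T fun t x => f t x + g t x :=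
  ⟨hf.c.add hg.c, hf.s.add hg.s, fun t ht x k => congrArg₂ (· + ·) (hf.p t ht x k) (hg.p t ht x k)⟩

lemma SJ.mul (hf : SJ T f) (hg : SJ T g) : SJ T fun t x => f t x * g t x :=
  ⟨hf.c.mul hg.c, hf.s.mul hg.s, fun t ht x k => congrArg₂ (· * ·) (hf.p t ht x k) (hg.p t ht x k)⟩

lemma SJ.sub (hf : SJ T f) (hg : SJ T g) : SJ T fun t x => f t x - g t x :=
  ⟨hf.c.sub hg.c, hf.s.sub hg.s, fun t ht x k => congrArg₂ (· - ·) (hf.p t ht x k) (hg.p t ht x k)⟩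

lemma SJ.const (c : ℝ) : SJ T fun _ _ => c :=
  ⟨continuousOn_const, contDiffOn_const, fun _ _ _ _ => rfl⟩

lemma SJ.sum {ι : Type*} {f : ι → ℝ → Spc 3 → ℝ} (s : Finset ι) (h : ∀ i, SJ T (f i)) :
    SJ T fun t x => ∑ i ∈ s, f i t x :=
  ⟨continuousOn_finsetSum s fun i _ => (h i).c, ContDiffOn.sum fun i _ => (h i).s,
    fun t ht x k => Finset.sum_congr rfl fun i _ => (h i).p t ht x k⟩

lemma SJ.slice_cont (hf : SJ T f) {t : ℝ} (ht : t ∈ Set.Icc 0 T) : Continuous (f t) :=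
  continuousOn_univ.1 (hf.c.comp (f := fun x : Spc 3 => (t, x)) (by fun_prop) fun _ _ => ⟨ht, trivial⟩)

lemma SJ.slice (hf : SJ T f) {t : ℝ} (ht : t ∈ Set.Ioo 0 T) : SX (f t) :=
  ⟨contDiffOn_univ.1 (hf.s.comp (f := fun x : Spc 3 => (t, x)) (by fun_prop) fun _ _ => ⟨ht, trivial⟩),
    hf.p t ⟨ht.1.le, ht.2.le⟩⟩

lemma SJ.hasFDerivAt (hf : SJ T f) {t : ℝ} (ht : t ∈ Set.Ioo 0 T) (x : Spc 3) :
    HasFDerivAt (fun q : ℝ × Spc 3 => f q.1 q.2)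
      (fderiv ℝ (fun q : ℝ × Spc 3 => f q.1 q.2) (t, x)) (t, x) :=
  ((hf.s.contDiffAt ((isOpen_Ioo.prod isOpen_univ).mem_nhds ⟨ht, trivial⟩)).differentiableAt
    (by simp)).hasFDerivAt

lemma SJ.hasDerivAt (hf : SJ T f) {t : ℝ} (ht : t ∈ Set.Ioo 0 T) (x : Spc 3) :
    HasDerivAt (fun s => f s x) (dtS f t x) t := by
  rw [dtS]; exact (hasDerivAt_slice (hf.hasFDerivAt ht x)).differentiableAt.hasDerivAt

lemma SJ.dtS_eq (hf : SJ T f) {t : ℝ} (ht : t ∈ Set.Ioo 0 T) (x : Spc 3) : dtS f t x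
    = fderiv ℝ (fun q : ℝ × Spc 3 => f q.1 q.2) (t, x) (1, 0) :=
  (hasDerivAt_slice (hf.hasFDerivAt ht x)).deriv

lemma SJ.dtS_cont (hf : SJ T f) :
    ContinuousOn (fun q : ℝ × Spc 3 => dtS f q.1 q.2) (Set.Ioo 0 T ×ˢ Set.univ) := by
  have h : ContinuousOn (fun q : ℝ × Spc 3 => fderiv ℝ (fun q : ℝ × Spc 3 => f q.1 q.2) q (1, 0))
      (Set.Ioo 0 T ×ˢ Set.univ) :=
    (hf.s.continuousOn_fderiv_of_isOpen (isOpen_Ioo.prod isOpen_univ) (by simp)).clm_apply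
      continuousOn_const
  exact h.congr fun q hq => hf.dtS_eq hq.1 q.2

lemma SJ.bound (hf : SJ T f) : ∃ M, ∀ t ∈ Set.Icc 0 T, ∀ x ∈ cube 3, |f t x| ≤ M := by
  obtain ⟨M, hM⟩ := (isCompact_Icc.prod (isCompact_cube 3)).exists_bound_of_continuousOn
    (hf.c.mono (Set.prod_mono subset_rfl (Set.subset_univ _)))
  exact ⟨M, fun t ht x hx => hM (t, x) ⟨ht, hx⟩⟩

lemma SJ.integral_cont (hf : SJ T f) :
    ContinuousOn (fun t => ∫ x in cube 3, f t x) (Set.Icc 0 T) := by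
  rw [continuousOn_iff_continuous_domRestrict]
  refine continuous_parametric_integral_of_continuous
    (f := fun (t : Set.Icc 0 T) (x : Spc 3) => f t x) ?_ (isCompact_cube 3)
  exact hf.c.comp_continuous (f := fun q : Set.Icc 0 T × Spc 3 => ((q.1 : ℝ), q.2)) (by fun_prop)
    fun q => ⟨q.1.2, trivial⟩

lemma SJ.integral_deriv (hf : SJ T f) {t : ℝ} (ht : t ∈ Set.Ioo 0 T) :
    HasDerivAt (fun t => ∫ x in cube 3, f t x) (∫ x in cube 3, dtS f t x) t :=
  hasDerivAt_integral_cube isOpen_Ioo (fun _ ht => (hf.slice ht).cont) hf.dtS_cont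
    (fun _ ht x => hf.hasDerivAt ht x) ht

lemma SJ.dtS_sub (hf : SJ T f) (hg : SJ T g) {t : ℝ} (ht : t ∈ Set.Ioo 0 T) (x : Spc 3) :
    dtS (fun t x => f t x - g t x) t x = dtS f t x - dtS g t x :=
  ((hf.hasDerivAt ht x).sub (hg.hasDerivAt ht x)).deriv

lemma SX.pd_sub {f g : Spc 3 → ℝ} (hf : SX f) (hg : SX g) (i : Fin 3) (x : Spc 3) :
    NSRelax.pd i (fun y => f y - g y) x = NSRelax.pd i f x - NSRelax.pd i g x := by
  simp only [NSRelax.pd]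
  rw [fderiv_fun_sub (hf.1.differentiable (by simp) x) (hg.1.differentiable (by simp) x)]; rfl

lemma SX.pd_mul {f g : Spc 3 → ℝ} (hf : SX f) (hg : SX g) (i : Fin 3) (x : Spc 3) :
    NSRelax.pd i (fun y => f y * g y) x = f x * NSRelax.pd i g x + NSRelax.pd i f x * g x := by
  simp only [NSRelax.pd]
  rw [fderiv_fun_mul (hf.1.differentiable (by simp) x) (hg.1.differentiable (by simp) x)]
  simp [mul_comm]

lemma SX.mul {f g : Spc 3 → ℝ} (hf : SX f) (hg : SX g) : SX fun x => f x * g x :=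
  ⟨hf.1.mul hg.1, fun x k => congrArg₂ (· * ·) (hf.2 x k) (hg.2 x k)⟩

lemma SX.integral_pd {f : Spc 3 → ℝ} (hf : SX f) (i : Fin 3) :
    ∫ x in cube 3, NSRelax.pd i f x = 0 :=
  integral_fderiv_per (hf.1.of_le (by simp)) hf.2 i

/-- A continuous periodic function whose square has zero mean vanishes. -/
lemma eq_zero_of_integral_sq {f : Spc 3 → ℝ} (hf : Continuous f) (hp : Per f)
    (h : ∫ x in cube 3, f x ^ 2 ≤ 0) (x : Spc 3) : f x = 0 := by
  have hi : Set.EqOn (fun x => f x ^ 2) 0 (interior (cube 3)) := by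
    have h0 : ∫ x in cube 3, f x ^ 2 = 0 := h.antisymm (integral_nonneg fun x => sq_nonneg _)
    have h1 := (integral_eq_zero_iff_of_nonneg (fun x => sq_nonneg (f x))
      (integrableOn_cube (hf.pow 2))).1 h0
    refine Measure.eqOn_open_of_ae_eq (μ := volume) ?_ isOpen_interior (hf.pow 2).continuousOn
      continuousOn_const
    exact ae_restrict_of_ae_restrict_of_subset interior_subset h1
  have hc : Set.EqOn (fun x => f x ^ 2) 0 (cube 3) := by
    have hcl : closure (interior (cube 3)) = cube 3 := by
      rw [cube, interior_pi_set Set.finite_univ]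
      simp [closure_pi_set]
    rw [← hcl]
    exact hi.closure (hf.pow 2) continuous_const
  have hx := hp x fun i => -⌊x i⌋
  have hm : (fun i => x i + ((-⌊x i⌋ : ℤ) : ℝ)) ∈ cube 3 := fun i _ => by
    have a1 := Int.floor_le (x i)
    have a2 := Int.lt_floor_add_one (x i)
    push_cast
    exact ⟨by linarith, by linarith⟩
  have := hc hm
  rw [← hx]
  simpa using this

end

section
variable {ε δ T : ℝ} {Tl : ℝ≥0∞} {p : ℝ → Spc 3 → ℝ} {u : ℝ → Spc 3 → Vec 3}
  {U : ℝ → Spc 3 → Fin 3 → Fin 3 → ℝ}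

lemma Icc_subset_Itv (hT : ENNReal.ofReal T < Tl) : Set.Icc 0 T ⊆ Itv Tl := fun _ ht =>
  ⟨ht.1, (ENNReal.ofReal_le_ofReal ht.2).trans_lt hT⟩

lemma IsRelax.sj (h : IsRelax 3 ε δ Tl p u U) (hT : ENNReal.ofReal T < Tl) :
    SJ T p ∧ (∀ a, SJ T fun t x => u t x a) ∧ ∀ a b, SJ T fun t x => U t x a b := by
  have hI := Icc_subset_Itv hT
  have hc := h.cont.mono (Set.prod_mono hI (subset_refl (Set.univ : Set (Spc 3))))
  have hs : ContDiffOn ℝ (⊤ : ℕ∞) (fun q : ℝ × Spc 3 => (p q.1 q.2, u q.1 q.2, U q.1 q.2))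
      (Set.Ioo 0 T ×ˢ Set.univ) := fun q hq =>
    (h.smooth q.1 (hI ⟨hq.1.1.le, hq.1.2.le⟩) hq.1.1 q.2).contDiffWithinAt
  refine ⟨⟨hc.fst, hs.fst, fun t ht => h.per_p t (hI ht)⟩, fun a => ⟨continuousOn_pi.1 hc.snd.fst a,
    contDiffOn_pi.1 hs.snd.fst a, fun t ht x k => congrFun (h.per_u t (hI ht) x k) a⟩,
    fun a b => ⟨continuousOn_pi.1 (continuousOn_pi.1 hc.snd.snd a) b,
    contDiffOn_pi.1 (contDiffOn_pi.1 hs.snd.snd a) b,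
    fun t ht x k => congrFun (congrFun (h.per_U t (hI ht) x k) a) b⟩⟩

end

lemma nonlinear_energy_le {M : ℝ} {D u1 u2 : Fin 3 → ℝ} {E : Fin 3 → Fin 3 → ℝ}
    (h1 : ∀ a, |u1 a| ≤ M) (h2 : ∀ a, |u2 a| ≤ M) :
    2 * ∑ a, ∑ b, E a b * (u1 a * D b + D a * u2 b - E a b) ≤ 6 * M ^ 2 * ∑ a, D a ^ 2 := by
  have k1 : ∀ a, u1 a ^ 2 ≤ M ^ 2 := fun a => sq_le_sq' (neg_le_of_abs_le (h1 a)) (le_of_abs_le (h1 a))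
  have k2 : ∀ a, u2 a ^ 2 ≤ M ^ 2 := fun a => sq_le_sq' (neg_le_of_abs_le (h2 a)) (le_of_abs_le (h2 a))
  have key : ∀ a b, 2 * (E a b * (u1 a * D b + D a * u2 b - E a b))
      ≤ M ^ 2 * D b ^ 2 + M ^ 2 * D a ^ 2 := fun a b => by
    have := mul_le_mul_of_nonneg_right (k1 a) (sq_nonneg (D b))
    have := mul_le_mul_of_nonneg_right (k2 b) (sq_nonneg (D a))
    nlinarith [sq_nonneg (2 * E a b - (u1 a * D b + D a * u2 b)), sq_nonneg (u1 a * D b - D a * u2 b)]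
  calc _ = ∑ a, ∑ b, 2 * (E a b * (u1 a * D b + D a * u2 b - E a b)) := by
        simp only [Finset.mul_sum]
    _ ≤ ∑ a, ∑ b, (M ^ 2 * D b ^ 2 + M ^ 2 * D a ^ 2) :=
        Finset.sum_le_sum fun a _ => Finset.sum_le_sum fun b _ => key a b
    _ = _ := by simp only [Fin.sum_univ_three]; ring

/-- Two solutions of the relaxation system with the same data have the same velocity. -/
lemma relax_unique {ε δ T : ℝ} {Tl1 Tl2 : ℝ≥0∞} {p1 p2 : ℝ → Spc 3 → ℝ} {u1 u2 : ℝ → Spc 3 → Vec 3}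
    {U1 U2 : ℝ → Spc 3 → Fin 3 → Fin 3 → ℝ} (h1 : IsRelax 3 ε δ Tl1 p1 u1 U1)
    (h2 : IsRelax 3 ε δ Tl2 p2 u2 U2) (hε : 0 < ε) (hδ : 0 < δ) (hT1 : ENNReal.ofReal T < Tl1)
    (hT2 : ENNReal.ofReal T < Tl2) (ep : p1 0 = p2 0) (eu : u1 0 = u2 0) (eU : U1 0 = U2 0) :
    ∀ t ∈ Set.Icc 0 T, u1 t = u2 t := by
  intro t ht
  obtain ⟨P1, V1, W1⟩ := h1.sj hT1
  obtain ⟨P2, V2, W2⟩ := h2.sj hT2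
  set P : ℝ → Spc 3 → ℝ := fun t x => p1 t x - p2 t x with hPd
  set D : Fin 3 → ℝ → Spc 3 → ℝ := fun a t x => u1 t x a - u2 t x a with hDd
  set E : Fin 3 → Fin 3 → ℝ → Spc 3 → ℝ := fun a b t x => U1 t x a b - U2 t x a b with hEd
  have hP : SJ T P := P1.sub P2
  have hD : ∀ a, SJ T (D a) := fun a => (V1 a).sub (V2 a)
  have hE : ∀ a b, SJ T (E a b) := fun a b => (W1 a b).sub (W2 a b)
  set G : ℝ → Spc 3 → ℝ := fun t x => ε * (P t x * P t x) + ∑ a, D a t x * D a t x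
    + δ * ∑ a, ∑ b, E a b t x * E a b t x with hGd
  have hG : SJ T G := (((SJ.const ε).mul (hP.mul hP)).add (SJ.sum _ fun a => (hD a).mul (hD a))).add
    ((SJ.const δ).mul (SJ.sum _ fun a => SJ.sum _ fun b => (hE a b).mul (hE a b)))
  have hGD : ∀ t x, ∑ a, D a t x ^ 2 ≤ G t x := fun t x => by
    have e1 : 0 ≤ ε * (P t x * P t x) := mul_nonneg hε.le (mul_self_nonneg _)
    have e2 : 0 ≤ δ * ∑ a, ∑ b, E a b t x * E a b t x := mul_nonneg hδ.le
      (Finset.sum_nonneg fun a _ => Finset.sum_nonneg fun b _ => mul_self_nonneg _)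
    simp only [hGd, sq]; linarith
  choose M1 hM1 using fun a => (V1 a).bound
  choose M2 hM2 using fun a => (V2 a).bound
  set M := ∑ a, (|M1 a| + |M2 a|) with hM
  have hMa : ∀ a, |M1 a| + |M2 a| ≤ M := fun a => Finset.single_le_sum
    (f := fun a => |M1 a| + |M2 a|) (fun a _ => by positivity) (Finset.mem_univ a)
  have b1 : ∀ t ∈ Set.Icc 0 T, ∀ x ∈ cube 3, ∀ a, |u1 t x a| ≤ M := fun t ht x hx a => by
    linarith [hM1 a t ht x hx, hMa a, le_abs_self (M1 a), abs_nonneg (M2 a)]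
  have b2 : ∀ t ∈ Set.Icc 0 T, ∀ x ∈ cube 3, ∀ a, |u2 t x a| ≤ M := fun t ht x hx a => by
    linarith [hM2 a t ht x hx, hMa a, le_abs_self (M2 a), abs_nonneg (M1 a)]
  have hd : ∀ t ∈ Set.Ioo 0 T, ∫ x in cube 3, dtS G t x ≤ 6 * M ^ 2 * ∫ x in cube 3, G t x := by
    intro t ht
    have hti : t ∈ Set.Icc 0 T := ⟨ht.1.le, ht.2.le⟩
    have hI1 := Icc_subset_Itv hT1 hti
    have hI2 := Icc_subset_Itv hT2 hti
    have hPD := fun a => (hP.slice ht).mul ((hD a).slice ht)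
    have hDE := fun a b => ((hD a).slice ht).mul ((hE a b).slice ht)
    have pw : ∀ x ∈ cube 3, dtS G t x ≤ -2 * (∑ a, pd a (fun y => P t y * D a t y) x
        + ∑ a, ∑ b, pd b (fun y => D a t y * E a b t y) x) + 6 * M ^ 2 * G t x := by
      intro x hx
      have dP : ε * dtS P t x = -∑ a, pd a (D a t) x := by
        have m1 := h1.mass t hI1 ht.1 x
        have m2 := h2.mass t hI2 ht.1 x
        simp only [divv] at m1 m2
        rw [show dtS P t x = _ from P1.dtS_sub P2 ht x]
        have : ∀ a, pd a (D a t) x = _ := fun a => ((V1 a).slice ht).pd_sub ((V2 a).slice ht) a x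
        simp only [this, Finset.sum_sub_distrib]
        linarith
      have dD : ∀ a, dtS (D a) t x = -(∑ b, pd b (E a b t) x) - pd a (P t) x := fun a => by
        have m1 := h1.momentum t hI1 ht.1 x a
        have m2 := h2.momentum t hI2 ht.1 x a
        simp only [divM] at m1 m2
        rw [show dtS (D a) t x = dtV u1 t x a - dtV u2 t x a from (V1 a).dtS_sub (V2 a) ht x]
        have : ∀ b, pd b (E a b t) x = _ := fun b =>
          ((W1 a b).slice ht).pd_sub ((W2 a b).slice ht) b x
        have e2 : pd a (P t) x = _ := (P1.slice ht).pd_sub (P2.slice ht) a x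
        simp only [this, e2, Finset.sum_sub_distrib]
        linarith
      have dE : ∀ a b, δ * dtS (E a b) t x = u1 t x a * D b t x + D a t x * u2 t x b - E a b t x
          - pd b (D a t) x := fun a b => by
        have m1 := h1.stress_eq t hI1 ht.1 x a b
        have m2 := h2.stress_eq t hI2 ht.1 x a b
        rw [show dtS (E a b) t x = dtM U1 t x a b - dtM U2 t x a b from
          (W1 a b).dtS_sub (W2 a b) ht x]
        have e2 : pd b (D a t) x = _ := ((V1 a).slice ht).pd_sub ((V2 a).slice ht) b x
        rw [e2]
        simp only [hDd, hEd]
        linarith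
      have dG : dtS G t x = 2 * (P t x * (ε * dtS P t x)) + ∑ a, 2 * (D a t x * dtS (D a) t x)
          + ∑ a, ∑ b, 2 * (E a b t x * (δ * dtS (E a b) t x)) := by
        have d1 := ((hP.hasDerivAt ht x).mul (hP.hasDerivAt ht x)).const_mul ε
        have d2 := HasDerivAt.fun_sum (u := Finset.univ) fun a _ =>
          ((hD a).hasDerivAt ht x).mul ((hD a).hasDerivAt ht x)
        have d3 := (HasDerivAt.fun_sum (u := Finset.univ) fun a _ =>
          HasDerivAt.fun_sum (u := Finset.univ) fun b _ =>
          ((hE a b).hasDerivAt ht x).mul ((hE a b).hasDerivAt ht x)).const_mul δ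
        have d4 : dtS G t x = _ := ((d1.add d2).add d3).deriv
        rw [d4]
        simp only [Finset.mul_sum]
        congr 1
        · congr 1
          · ring
          · exact Finset.sum_congr rfl fun a _ => by ring
        · exact Finset.sum_congr rfl fun a _ => Finset.sum_congr rfl fun b _ => by ring
      have q1 : ∀ a, pd a (fun y => P t y * D a t y) x = _ := fun a =>
        (hP.slice ht).pd_mul ((hD a).slice ht) a x
      have q2 : ∀ a b, pd b (fun y => D a t y * E a b t y) x = _ := fun a b =>
        ((hD a).slice ht).pd_mul ((hE a b).slice ht) b x
      have nl := nonlinear_energy_le (E := fun a b => E a b t x) (D := fun a => D a t x)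
        (b1 t hti x hx) (b2 t hti x hx)
      have hg := mul_le_mul_of_nonneg_left (hGD t x) (by positivity : 0 ≤ 6 * M ^ 2)
      rw [dG, dP]
      simp only [dD, dE, q1, q2]
      simp only [Fin.sum_univ_three] at nl hg ⊢
      linarith
    have i1 : ∀ a, IntegrableOn (fun x => pd a (fun y => P t y * D a t y) x) (cube 3) := fun a =>
      integrableOn_cube ((hPD a).pd a).cont
    have i2 : ∀ a b, IntegrableOn (fun x => pd b (fun y => D a t y * E a b t y) x) (cube 3) :=
      fun a b => integrableOn_cube ((hDE a b).pd b).cont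
    have i3 := integrableOn_cube (hG.slice ht).cont
    have i1' := integrable_finsetSum Finset.univ fun a _ => i1 a
    have i2' := integrable_finsetSum Finset.univ fun a _ =>
      integrable_finsetSum Finset.univ fun b _ => i2 a b
    have i4 : IntegrableOn (fun x => dtS G t x) (cube 3) := by
      have hc : Continuous fun x : Spc 3 => dtS G t x := continuousOn_univ.1
        (hG.dtS_cont.comp (f := fun x : Spc 3 => (t, x)) (by fun_prop) fun _ _ => ⟨ht, trivial⟩)
      exact integrableOn_cube hc
    have := setIntegral_mono_on i4 (((i1'.add i2').const_mul (-2)).add (i3.const_mul (6 * M ^ 2)))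
      (measurableSet_cube 3) pw
    refine this.trans (le_of_eq ?_)
    have z1 := fun a => (hPD a).integral_pd a
    have z2 := fun a b => (hDE a b).integral_pd b
    rw [integral_add' ((i1'.add i2').const_mul (-2)) (i3.const_mul (6 * M ^ 2))]
    rw [integral_const_mul, integral_const_mul, integral_add' i1' i2',
      integral_finsetSum _ fun a _ => i1 a,
      integral_finsetSum _ fun a _ => integrable_finsetSum Finset.univ fun b _ => i2 a b]
    simp only [integral_finsetSum _ fun b _ => i2 _ b, z1, z2]
    simp
  have h0 : ∫ x in cube 3, G 0 x ≤ 0 := by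
    simp [hGd, hPd, hDd, hEd, ep, eu, eU]
  have fin := gronwall_linear (A := 6 * M ^ 2) (B := 0) (by positivity) le_rfl hG.integral_cont
    (fun t ht => hG.integral_deriv ht) (fun t ht => by simpa using hd t ht) h0 ht
  simp only [zero_mul, add_zero] at fin
  funext x a
  refine sub_eq_zero.1 (eq_zero_of_integral_sq ((hD a).slice_cont ht) ((hD a).p t ht) ?_ x)
  refine le_trans (setIntegral_mono_on (integrableOn_cube (((hD a).slice_cont ht).pow 2))
    (integrableOn_cube (hG.slice_cont ht)) (measurableSet_cube 3) fun x _ => ?_) fin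
  exact (Finset.single_le_sum (f := fun a => D a t x ^ 2) (fun a _ => sq_nonneg _)
    (Finset.mem_univ a)).trans (hGD t x)

lemma SX.add {f g : Spc 3 → ℝ} (hf : SX f) (hg : SX g) : SX fun x => f x + g x :=
  (hf.sp.add hg.sp).sx 0

lemma SX.sub {f g : Spc 3 → ℝ} (hf : SX f) (hg : SX g) : SX fun x => f x - g x :=
  (hf.sp.sub hg.sp).sx 0

lemma SX.sum {ι : Type*} (s : Finset ι) {f : ι → Spc 3 → ℝ} (h : ∀ i, SX (f i)) :
    SX fun x => ∑ i ∈ s, f i x := (SP.sum s fun i => (h i).sp).sx 0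

section
variable {ι : Type*} [Fintype ι] {f : Spc 3 → ι → ℝ}

lemma hasSum_integral_sq {κ : Type*} (s : Finset κ) {g : κ → Spc 3 → ℝ} (hg : ∀ i, SX (g i)) :
    HasSum (fun k => ∑ i ∈ s, ‖fc (g i) k‖ ^ 2) (∫ x in cube 3, ∑ i ∈ s, g i x ^ 2) := by
  rw [integral_finsetSum (f := fun i x => g i x ^ 2) _ fun i _ => integrableOn_cube ((hg i).cont.pow 2)]
  exact hasSum_sum fun i _ => (hg i).parseval

lemma hasSum_L2sq (hf : ∀ a, SX fun x => f x a) :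
    HasSum (fun k => ∑ a, ‖fc (fun x => f x a) k‖ ^ 2) (L2sq f) :=
  hasSum_integral_sq Finset.univ hf

lemma SX.norm_fc_pd {g : Spc 3 → ℝ} (h : SX g) (i : Fin 3) (k : Mode) :
    ‖fc (NSRelax.pd i g) k‖ ^ 2 = xi k i ^ 2 * ‖fc g k‖ ^ 2 := by
  rw [h.fc_pd, norm_mul, norm_mul, Complex.norm_I, Complex.norm_real, one_mul, mul_pow,
    Real.norm_eq_abs, sq_abs]

lemma SX.sum_norm_fc_pd {g : Spc 3 → ℝ} (h : SX g) (k : Mode) :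
    ∑ i, ‖fc (NSRelax.pd i g) k‖ ^ 2 = lam k * ‖fc g k‖ ^ 2 := by
  simp only [h.norm_fc_pd, lam, Finset.sum_mul]

lemma hasSum_D1L2sq (hf : ∀ a, SX fun x => f x a) :
    HasSum (fun k => lam k * ∑ a, ‖fc (fun x => f x a) k‖ ^ 2) (D1L2sq f) := by
  have h := hasSum_integral_sq (Finset.univ ×ˢ Finset.univ)
    (g := fun i : ι × Fin 3 => pd i.2 fun x => f x i.1) fun i => (hf i.1).pd i.2
  simp only [Finset.sum_product] at h
  convert! h using 1
  funext k
  simp only [(hf _).sum_norm_fc_pd, Finset.mul_sum]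

lemma hasSum_D2L2sq (hf : ∀ a, SX fun x => f x a) :
    HasSum (fun k => lam k ^ 2 * ∑ a, ‖fc (fun x => f x a) k‖ ^ 2) (D2L2sq f) := by
  have h := hasSum_integral_sq (Finset.univ ×ˢ (Finset.univ ×ˢ Finset.univ))
    (g := fun i : ι × Fin 3 × Fin 3 => pd i.2.1 (pd i.2.2 fun x => f x i.1))
    fun i => ((hf i.1).pd i.2.2).pd i.2.1
  simp only [Finset.sum_product] at h
  convert! h using 1
  funext k
  rw [Finset.mul_sum]
  refine Finset.sum_congr rfl fun a _ => ?_
  rw [Finset.sum_comm]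
  simp only [((hf a).pd _).sum_norm_fc_pd, ← Finset.mul_sum, (hf a).sum_norm_fc_pd]
  ring

lemma L2sq_nonneg (f : Spc 3 → ι → ℝ) : 0 ≤ L2sq f :=
  integral_nonneg fun _ => Finset.sum_nonneg fun _ _ => sq_nonneg _

lemma D1L2sq_nonneg (f : Spc 3 → ι → ℝ) : 0 ≤ D1L2sq f :=
  integral_nonneg fun _ => Finset.sum_nonneg fun _ _ => Finset.sum_nonneg fun _ _ => sq_nonneg _

lemma D2L2sq_nonneg (f : Spc 3 → ι → ℝ) : 0 ≤ D2L2sq f :=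
  integral_nonneg fun _ => Finset.sum_nonneg fun _ _ => Finset.sum_nonneg fun _ _ =>
    Finset.sum_nonneg fun _ _ => sq_nonneg _

/-- The weighted norm `‖f‖² + δ ‖f‖²_{H¹}` on the Fourier side. -/
lemma hasSum_weighted (hf : ∀ a, SX fun x => f x a) (δ : ℝ) :
    HasSum (fun k => (1 + δ + δ * lam k) * ∑ a, ‖fc (fun x => f x a) k‖ ^ 2)
      (L2sq f + δ * H1sq f) := by
  have h := (hasSum_L2sq hf).add (((hasSum_L2sq hf).add (hasSum_D1L2sq hf)).mul_left δ)
  convert! h using 1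
  funext k; ring

end

section
variable {Y : Spc 3 → Vec 3} {Z : Spc 3 → Fin 3 → Fin 3 → ℝ}

lemma sx_divv (hY : ∀ a, SX fun x => Y x a) : SX (divv Y) := SX.sum Finset.univ fun i => (hY i).pd i

lemma sx_divM (hZ : ∀ a b, SX fun x => Z x a b) (a : Fin 3) : SX fun x => divM Z x a :=
  SX.sum Finset.univ fun i => (hZ a i).pd i

lemma sx_curl (hY : ∀ a, SX fun x => Y x a) (a : Fin 3) : SX fun x => curl3 Y x a := by
  fin_cases a
  · exact ((hY 2).pd 1).sub ((hY 1).pd 2)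
  · exact ((hY 0).pd 2).sub ((hY 2).pd 0)
  · exact ((hY 1).pd 0).sub ((hY 0).pd 1)

lemma fc_divv (hY : ∀ a, SX fun x => Y x a) (k : Mode) :
    fc (divv Y) k = Complex.I * sg (fun k a => fc (fun x => Y x a) k) k := by
  have h := fc_sum Finset.univ (F := fun i => pd i fun y => Y y i) (fun i => ((hY i).pd i).cont) k
  rw [show fc (divv Y) k = _ from h]
  simp only [(hY _).fc_pd, sg, Finset.mul_sum, mul_assoc]

lemma norm_fc_divv (hY : ∀ a, SX fun x => Y x a) (k : Mode) :
    ‖fc (divv Y) k‖ ^ 2 = ‖sg (fun k a => fc (fun x => Y x a) k) k‖ ^ 2 := by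
  rw [fc_divv hY, norm_mul, Complex.norm_I, one_mul]

lemma fc_divM (hZ : ∀ a b, SX fun x => Z x a b) (k : Mode) (a : Fin 3) :
    fc (fun x => divM Z x a) k = HH (fun k a b => fc (fun x => Z x a b) k) k a := by
  have h := fc_sum Finset.univ (F := fun i => pd i fun y => Z y a i)
    (fun i => ((hZ a i).pd i).cont) k
  rw [show fc (fun x => divM Z x a) k = _ from h]
  simp only [(hZ _ _).fc_pd, HH]

lemma norm_fc_curl (hY : ∀ a, SX fun x => Y x a) (k : Mode) :
    ∑ a, ‖fc (fun x => curl3 Y x a) k‖ ^ 2 = sM (om fun k a => fc (fun x => Y x a) k) k / 2 := by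
  have key : ∀ i j, ‖fc (fun x => pd i (fun y => Y y j) x - pd j (fun y => Y y i) x) k‖ ^ 2
      = ‖om (fun k a => fc (fun x => Y x a) k) k i j‖ ^ 2 := fun i j => by
    rw [fc_sub ((hY j).pd i).cont ((hY i).pd j).cont]
    have e1 : fc (fun x => pd i (fun y => Y y j) x) k = _ := (hY j).fc_pd i k
    have e2 : fc (fun x => pd j (fun y => Y y i) x) k = _ := (hY i).fc_pd j k
    rw [e1, e2, om, mul_assoc, mul_assoc, ← mul_sub, norm_mul, Complex.norm_I, one_mul]
  have k12 := key 1 2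
  have k20 := key 2 0
  have k01 := key 0 1
  have anti : ∀ i j, ‖om (fun k a => fc (fun x => Y x a) k) k i j‖
      = ‖om (fun k a => fc (fun x => Y x a) k) k j i‖ := fun i j => by
    rw [← norm_neg]; simp only [om]; ring_nf
  have diag : ∀ i, ‖om (fun k a => fc (fun x => Y x a) k) k i i‖ = 0 := fun i => by simp [om]
  simp only [sM, Fin.sum_univ_three, diag, anti 1 0, anti 2 1, anti 0 2]
  change ‖fc (fun x => pd 1 (fun y => Y y 2) x - pd 2 (fun y => Y y 1) x) k‖ ^ 2
    + ‖fc (fun x => pd 2 (fun y => Y y 0) x - pd 0 (fun y => Y y 2) x) k‖ ^ 2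
    + ‖fc (fun x => pd 0 (fun y => Y y 1) x - pd 1 (fun y => Y y 0) x) k‖ ^ 2 = _
  rw [k12, k20, k01]
  ring

end

/-- The bounds of `Fin'` over all finite sets give the bounds in physical space. -/
lemma bounds_of_fin {Y : Spc 3 → Vec 3} (hY : ∀ a, SX fun x => Y x a) {ε r C : ℝ} (hε : 0 < ε)
    (hr : 0 < r) (hr1 : r ≤ 1) (hεr : ε ≤ r ^ 4)
    (h : ∀ N, Fin' N ε r C fun k a => fc (fun x => Y x a) k) :
    L2sq Y ≤ 5 * |C| * r ^ 2 ∧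
      L2sq (curl3 Y) + r ^ 4 * H1sq (curl3 Y) ≤ 5 * |C| * r ^ 2 ∧
      L2sq (sc (divv Y)) + r ^ 4 * H1sq (sc (divv Y)) ≤ 5 * |C| * (ε / r ^ 2) := by
  set v : Mode → Fin 3 → ℂ := fun k a => fc (fun x => Y x a) k with hv
  have hr4 : r ^ 4 ≤ 1 := pow_le_one₀ hr.le hr1
  have hr4' : 0 < r ^ 4 := by positivity
  have hw : ∀ k, 0 ≤ r ^ 4 * lam k := fun k => mul_nonneg hr4'.le (lam_nonneg k)
  have hC := le_abs_self C
  have hC0 := abs_nonneg C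
  have he : ε / r ^ 2 ≤ r ^ 2 := by
    rw [div_le_iff₀ (by positivity)]; calc ε ≤ r ^ 4 := hεr
      _ = _ := by ring
  have he0 : 0 ≤ ε / r ^ 2 := by positivity
  have hr2 : 0 ≤ r ^ 2 := by positivity
  have c1 := mul_le_mul_of_nonneg_right hC hr2
  have c2 := mul_le_mul_of_nonneg_right hC he0
  have c3 := mul_le_mul_of_nonneg_left he hC0
  have c4 := mul_nonneg hC0 hr2
  have c5 := mul_nonneg hC0 he0
  refine ⟨hasSum_le_of_sum_le (hasSum_L2sq hY) fun N => ?_,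
    hasSum_le_of_sum_le (hasSum_weighted (sx_curl hY) _) fun N => ?_,
    hasSum_le_of_sum_le (hasSum_weighted (f := sc (divv Y)) (fun _ => sx_divv hY) _) fun N => ?_⟩
  · obtain ⟨hm, hw', hs⟩ := h N
    have key : ∀ k, ∑ a, ‖fc (fun x => Y x a) k‖ ^ 2 ≤ (if k = 0 then 3 * ‖v 0‖ ^ 2 else 0)
        + ((1 + r ^ 4 * lam k) * sM (om v) k + (1 + r ^ 4 * lam k) * ‖sg v k‖ ^ 2) := fun k => by
      change sv v k ≤ _
      have n1 := sM_nonneg (om v) k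
      have n2 := sq_nonneg ‖sg v k‖
      have m1 := mul_nonneg (hw k) n1
      have m2 := mul_nonneg (hw k) n2
      split_ifs with h0
      · subst h0
        have := sv_le_norm_sq v 0
        linarith
      · have h1 := sM_om_add v k
        have := mul_le_mul_of_nonneg_right (one_le_lam h0) (sv_nonneg v k)
        linarith
    refine (Finset.sum_le_sum fun k _ => key k).trans ?_
    rw [Finset.sum_add_distrib, Finset.sum_add_distrib]
    have : ∑ k ∈ N, (if k = 0 then 3 * ‖v 0‖ ^ 2 else 0) ≤ 3 * ‖v 0‖ ^ 2 := by
      rw [Finset.sum_ite_eq' N 0 fun _ => 3 * ‖v 0‖ ^ 2]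
      split_ifs
      · exact le_rfl
      · positivity
    linarith
  · obtain ⟨hm, hw', hs⟩ := h N
    refine (Finset.sum_le_sum fun k _ => ?_).trans (hw'.trans (by linarith))
    have e1 : ∑ a, ‖fc (fun x => curl3 Y x a) k‖ ^ 2 = _ := norm_fc_curl hY k
    rw [e1]
    have n1 := sM_nonneg (om v) k
    have m1 := mul_nonneg (hw k) n1
    have m2 := mul_le_mul_of_nonneg_right hr4 n1
    linarith
  · obtain ⟨hm, hw', hs⟩ := h N
    have hs2 : ∑ k ∈ N, 2 * ((1 + r ^ 4 * lam k) * ‖sg v k‖ ^ 2) ≤ 2 * (C * (ε / r ^ 2)) := by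
      rw [← Finset.mul_sum]; linarith
    refine (Finset.sum_le_sum fun k _ => ?_).trans (hs2.trans (by linarith))
    simp only [sc, Finset.univ_unique, Finset.sum_const, Finset.card_singleton, one_smul]
    have e1 : ‖fc (fun x => divv Y x) k‖ ^ 2 = _ := norm_fc_divv hY k
    rw [e1]
    have n1 := sq_nonneg ‖sg v k‖
    have m1 := mul_nonneg (hw k) n1
    have m2 := mul_le_mul_of_nonneg_right hr4 n1
    change _ * ‖sg v k‖ ^ 2 ≤ _
    linarith

lemma norm_sub_sq_le {E : Type*} [SeminormedAddCommGroup E] (a b : E) :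
    ‖a - b‖ ^ 2 ≤ 2 * ‖a‖ ^ 2 + 2 * ‖b‖ ^ 2 := by
  have h := pow_le_pow_left₀ (norm_nonneg _) (norm_sub_le a b) 2
  nlinarith [sq_nonneg (‖a‖ - ‖b‖)]

/-- The physical initial bounds give the bounds on the Fourier coefficients. -/
lemma ini_of_norms {P0 P1 : Spc 3 → ℝ} {Y : Spc 3 → Vec 3} {Z0 Z1 : Spc 3 → Fin 3 → Fin 3 → ℝ}
    (hP0 : SX P0) (hP1 : SX P1) (hY : ∀ a, SX fun x => Y x a) (hZ0 : ∀ a b, SX fun x => Z0 x a b)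
    (hZ1 : ∀ a b, SX fun x => Z1 x a b) {ε r C0 Q : ℝ} (hr : 0 < r)
    (hr1 : r ≤ 1)
    (iu : L2sq Y ≤ C0 * r ^ 2)
    (ic : L2sq (curl3 Y) + r ^ 4 * H1sq (curl3 Y) ≤ C0 * r ^ 2)
    (id : L2sq (sc (divv Y)) + r ^ 4 * H1sq (sc (divv Y)) ≤ C0 * (ε / r ^ 2))
    (ip : H1sq (sc P1) + r ^ 4 * H2sq (sc P1) ≤ C0 / r ^ 2)
    (iU : H1sq (mtx Z1) + r ^ 4 * H1sq (divM Z1) ≤ C0 / r ^ 2) (hε : 0 < ε) (hC0 : 0 < C0)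
    (hQ : 2 * C0 + 2 * (D1L2sq (sc P0) + D2L2sq (sc P0)) + 2 * D1L2sq (mtx Z0)
      + 2 * D1L2sq (divM Z0) ≤ Q) (N : Finset Mode) :
    Ini N ε r Q (fc fun x => P1 x - P0 x) (fun k a => fc (fun x => Y x a) k)
      (fun k a b => fc (fun x => Z1 x a b - Z0 x a b) k) := by
  set v : Mode → Fin 3 → ℂ := fun k a => fc (fun x => Y x a) k with hv
  have hr4 : r ^ 4 ≤ 1 := pow_le_one₀ hr.le hr1
  have hr4' : 0 < r ^ 4 := by positivity
  have hr2 : 0 < r ^ 2 := by positivity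
  have hr2' : r ^ 2 ≤ 1 := pow_le_one₀ hr.le hr1
  have hw : ∀ k, 0 ≤ r ^ 4 * lam k := fun k => mul_nonneg hr4'.le (lam_nonneg k)
  have n1 := D1L2sq_nonneg (sc P0)
  have n2 := D2L2sq_nonneg (sc P0)
  have n3 := D1L2sq_nonneg (mtx Z0)
  have n4 := D1L2sq_nonneg (divM Z0)
  have hQ2 : 2 * C0 ≤ Q := by linarith
  have hd : ∀ c, 0 ≤ c → c ≤ c / r ^ 2 := fun c hc => by
    rw [le_div_iff₀ hr2]; nlinarith
  have scale : ∀ {a c : ℝ}, a ≤ 2 * (C0 / r ^ 2) + 2 * c → 0 ≤ c → 2 * C0 + 2 * c ≤ Q → a ≤ Q / r ^ 2 := by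
    intro a c h1 h2 h3
    have h4 : (2 * C0 + 2 * c) / r ^ 2 ≤ Q / r ^ 2 := div_le_div_of_nonneg_right h3 hr2.le
    have h5 : (2 * C0 + 2 * c) / r ^ 2 = 2 * (C0 / r ^ 2) + 2 * (c / r ^ 2) := by ring
    linarith [hd c h2]
  refine ⟨?_, ?_, ?_, ?_, ?_, ?_⟩
  · have h := sum_le_hasSum {0} (fun k _ => Finset.sum_nonneg fun a _ => sq_nonneg _) (hasSum_L2sq hY)
    rw [Finset.sum_singleton] at h
    have h2 : ‖v 0‖ ^ 2 ≤ _ := norm_sq_le_sv v 0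
    simp only [sv, hv] at h2
    nlinarith
  · have h := sum_le_hasSum N (fun k _ => ?_) (hasSum_weighted (sx_curl hY) (r ^ 4))
    · have h2 : ∑ k ∈ N, (1 + r ^ 4 * lam k) * sM (om v) k ≤ 2 * (C0 * r ^ 2) := by
        have h3 := mul_le_mul_of_nonneg_left (h.trans ic) zero_le_two
        refine le_trans ?_ h3
        rw [Finset.mul_sum]
        refine Finset.sum_le_sum fun k _ => ?_
        have e1 : ∑ a, ‖fc (fun x => curl3 Y x a) k‖ ^ 2 = _ := norm_fc_curl hY k
        rw [e1]
        have := mul_nonneg hr4'.le (sM_nonneg (om v) k)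
        linarith
      nlinarith
    · have := hw k
      exact mul_nonneg (by linarith) (Finset.sum_nonneg fun a _ => sq_nonneg _)
  · have h := sum_le_hasSum N (fun k _ => ?_)
      (hasSum_weighted (f := sc (divv Y)) (fun _ => sx_divv hY) (r ^ 4))
    · have he : 0 ≤ ε / r ^ 2 := by positivity
      have h2 : ∑ k ∈ N, (1 + r ^ 4 * lam k) * ‖sg v k‖ ^ 2 ≤ C0 * (ε / r ^ 2) := by
        refine le_trans ?_ (h.trans id)
        refine Finset.sum_le_sum fun k _ => ?_
        simp only [sc, Finset.univ_unique, Finset.sum_const, Finset.card_singleton, one_smul]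
        have e1 : ‖fc (fun x => divv Y x) k‖ ^ 2 = _ := norm_fc_divv hY k
        rw [e1]
        have := mul_nonneg hr4'.le (sq_nonneg ‖sg v k‖)
        change _ ≤ _ * ‖sg v k‖ ^ 2
        linarith
      nlinarith
    · have := hw k
      exact mul_nonneg (by linarith) (Finset.sum_nonneg fun a _ => sq_nonneg _)
  · have s1 := sum_le_hasSum N (fun k _ => mul_nonneg (lam_nonneg k)
      (Finset.sum_nonneg fun a _ => sq_nonneg _)) (hasSum_D1L2sq (sx_divM hZ1))
    have s0 := sum_le_hasSum N (fun k _ => mul_nonneg (lam_nonneg k)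
      (Finset.sum_nonneg fun a _ => sq_nonneg _)) (hasSum_D1L2sq (sx_divM hZ0))
    have hs : ∑ k ∈ N, lam k * sv (HH fun k a b => fc (fun x => Z1 x a b - Z0 x a b) k) k
        ≤ 2 * D1L2sq (divM Z1) + 2 * D1L2sq (divM Z0) := by
      refine le_trans ?_ (add_le_add (mul_le_mul_of_nonneg_left s1 zero_le_two)
        (mul_le_mul_of_nonneg_left s0 zero_le_two))
      rw [Finset.mul_sum, Finset.mul_sum, ← Finset.sum_add_distrib]
      refine Finset.sum_le_sum fun k _ => ?_
      have e : sv (HH fun k a b => fc (fun x => Z1 x a b - Z0 x a b) k) k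
          ≤ 2 * (∑ a, ‖fc (fun x => divM Z1 x a) k‖ ^ 2) + 2 * ∑ a, ‖fc (fun x => divM Z0 x a) k‖ ^ 2 := by
        rw [sv, Finset.mul_sum, Finset.mul_sum, ← Finset.sum_add_distrib]
        refine Finset.sum_le_sum fun a _ => ?_
        have e1 : HH (fun k a b => fc (fun x => Z1 x a b - Z0 x a b) k) k a
            = fc (fun x => divM Z1 x a) k - fc (fun x => divM Z0 x a) k := by
          rw [fc_divM hZ1, fc_divM hZ0]
          simp only [HH, fc_sub (hZ1 _ _).cont (hZ0 _ _).cont, mul_sub, Finset.sum_sub_distrib]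
        rw [e1]
        exact norm_sub_sq_le _ _
      have := mul_le_mul_of_nonneg_left e (lam_nonneg k)
      linarith
    refine scale (c := D1L2sq (divM Z0)) ?_ n4 (by linarith)
    have m1 := mul_le_mul_of_nonneg_left hs hr4'.le
    have m2 : 0 ≤ H1sq (mtx Z1) := add_nonneg (L2sq_nonneg _) (D1L2sq_nonneg _)
    have m3 : 0 ≤ r ^ 4 * L2sq (divM Z1) := mul_nonneg hr4'.le (L2sq_nonneg _)
    have m4 : r ^ 4 * D1L2sq (divM Z0) ≤ D1L2sq (divM Z0) := mul_le_of_le_one_left n4 hr4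
    have m5 : H1sq (divM Z1) = L2sq (divM Z1) + D1L2sq (divM Z1) := rfl
    rw [m5] at iU
    linarith
  · have a1 := sum_le_hasSum N (fun k _ => mul_nonneg (lam_nonneg k)
      (Finset.sum_nonneg fun a _ => sq_nonneg _)) (hasSum_D1L2sq (f := sc P1) fun _ => hP1)
    have a0 := sum_le_hasSum N (fun k _ => mul_nonneg (lam_nonneg k)
      (Finset.sum_nonneg fun a _ => sq_nonneg _)) (hasSum_D1L2sq (f := sc P0) fun _ => hP0)
    have b1 := sum_le_hasSum N (fun k _ => mul_nonneg (sq_nonneg (lam k))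
      (Finset.sum_nonneg fun a _ => sq_nonneg _)) (hasSum_D2L2sq (f := sc P1) fun _ => hP1)
    have b0 := sum_le_hasSum N (fun k _ => mul_nonneg (sq_nonneg (lam k))
      (Finset.sum_nonneg fun a _ => sq_nonneg _)) (hasSum_D2L2sq (f := sc P0) fun _ => hP0)
    simp only [sc, Finset.univ_unique, Finset.sum_const, Finset.card_singleton, one_smul] at a1 a0 b1 b0
    change _ ≤ D1L2sq (sc P1) at a1
    change _ ≤ D1L2sq (sc P0) at a0
    change _ ≤ D2L2sq (sc P1) at b1
    change _ ≤ D2L2sq (sc P0) at b0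
    have hs : ∑ k ∈ N, (lam k + r ^ 4 * lam k ^ 2) * ‖fc (fun x => P1 x - P0 x) k‖ ^ 2
        ≤ 2 * (D1L2sq (sc P1) + r ^ 4 * D2L2sq (sc P1))
          + 2 * (D1L2sq (sc P0) + r ^ 4 * D2L2sq (sc P0)) := by
      refine le_trans ?_ (add_le_add
        (mul_le_mul_of_nonneg_left (add_le_add a1 (mul_le_mul_of_nonneg_left b1 hr4'.le)) zero_le_two)
        (mul_le_mul_of_nonneg_left (add_le_add a0 (mul_le_mul_of_nonneg_left b0 hr4'.le)) zero_le_two))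
      simp only [Finset.mul_sum, ← Finset.sum_add_distrib]
      refine Finset.sum_le_sum fun k _ => ?_
      rw [fc_sub hP1.cont hP0.cont]
      have h0 : 0 ≤ lam k + r ^ 4 * lam k ^ 2 := by have := lam_nonneg k; positivity
      have := mul_le_mul_of_nonneg_left (norm_sub_sq_le (fc P1 k) (fc P0 k)) h0
      refine this.trans (le_of_eq ?_)
      ring
    refine scale (c := D1L2sq (sc P0) + D2L2sq (sc P0)) ?_ (add_nonneg n1 n2) (by linarith)
    have m1 := L2sq_nonneg (sc P1)
    have m2 := mul_nonneg hr4'.le (add_nonneg m1 (D1L2sq_nonneg (sc P1)))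
    have m4 : r ^ 4 * D2L2sq (sc P0) ≤ D2L2sq (sc P0) := mul_le_of_le_one_left n2 hr4
    simp only [H1sq, H2sq] at ip
    linarith
  · have s1 := sum_le_hasSum N (fun k _ => mul_nonneg (lam_nonneg k)
      (Finset.sum_nonneg fun a _ => sq_nonneg _))
      (hasSum_D1L2sq (f := mtx Z1) fun ab => hZ1 ab.1 ab.2)
    have s0 := sum_le_hasSum N (fun k _ => mul_nonneg (lam_nonneg k)
      (Finset.sum_nonneg fun a _ => sq_nonneg _))
      (hasSum_D1L2sq (f := mtx Z0) fun ab => hZ0 ab.1 ab.2)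
    have hs : ∑ k ∈ N, lam k * sM (fun k a b => fc (fun x => Z1 x a b - Z0 x a b) k) k
        ≤ 2 * D1L2sq (mtx Z1) + 2 * D1L2sq (mtx Z0) := by
      refine le_trans ?_ (add_le_add (mul_le_mul_of_nonneg_left s1 zero_le_two)
        (mul_le_mul_of_nonneg_left s0 zero_le_two))
      rw [Finset.mul_sum, Finset.mul_sum, ← Finset.sum_add_distrib]
      refine Finset.sum_le_sum fun k _ => ?_
      have e : sM (fun k a b => fc (fun x => Z1 x a b - Z0 x a b) k) k
          ≤ 2 * (∑ a, ‖fc (fun x => mtx Z1 x a) k‖ ^ 2) + 2 * ∑ a, ‖fc (fun x => mtx Z0 x a) k‖ ^ 2 := by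
        rw [sM, Finset.mul_sum, Finset.mul_sum, ← Finset.sum_add_distrib, Fintype.sum_prod_type]
        refine Finset.sum_le_sum fun a _ => Finset.sum_le_sum fun b _ => ?_
        rw [fc_sub (hZ1 a b).cont (hZ0 a b).cont]
        exact norm_sub_sq_le _ _
      have := mul_le_mul_of_nonneg_left e (lam_nonneg k)
      linarith
    refine scale (c := D1L2sq (mtx Z0)) ?_ n3 (by linarith)
    have m2 := L2sq_nonneg (mtx Z1)
    have m3 : 0 ≤ r ^ 4 * H1sq (divM Z1) :=
      mul_nonneg hr4'.le (add_nonneg (L2sq_nonneg _) (D1L2sq_nonneg _))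
    simp only [H1sq] at iU m3
    linarith

lemma SP.sum_le {f : ℝ → Spc 3 → ℝ} (h : SP f) (T : ℝ) :
    ∃ C, 0 ≤ C ∧ ∀ t ∈ Set.Icc 0 T, ∀ F : Finset Mode, ∑ k ∈ F, W k ^ 2 * ‖fc (f t) k‖ ^ 2 ≤ C := by
  have hR : RD (Set.Icc 0 T) fun (_ : Unit) t => fc (f t) := fun m => by
    obtain ⟨C, hC⟩ := h.decay m 0 T
    exact ⟨C, fun _ t ht k => hC t ht k⟩
  obtain ⟨C, h0, hC⟩ := hR.sum_le 1
  exact ⟨C, h0, fun t ht F => by simpa using hC () t ht F⟩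

lemma sum_W_sq_le {ι : Type*} (s : Finset ι) {c : ι → Mode → ℂ} {C : ι → ℝ} {F : Finset Mode}
    (h : ∀ i, ∑ k ∈ F, W k ^ 2 * ‖c i k‖ ^ 2 ≤ C i) :
    ∑ k ∈ F, W k ^ 2 * ∑ i ∈ s, ‖c i k‖ ^ 2 ≤ ∑ i ∈ s, C i := by
  simp only [Finset.mul_sum]
  rw [Finset.sum_comm]
  exact Finset.sum_le_sum fun i _ => h i

lemma sum_W_norm_sq_le {c : Mode → Fin 3 → ℂ} {C : Fin 3 → ℝ} {F : Finset Mode}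
    (h : ∀ a, ∑ k ∈ F, W k ^ 2 * ‖c k a‖ ^ 2 ≤ C a) :
    ∑ k ∈ F, W k ^ 2 * ‖c k‖ ^ 2 ≤ ∑ a, C a :=
  (Finset.sum_le_sum fun k _ => mul_le_mul_of_nonneg_left (norm_sq_le_sv c k)
    (sq_nonneg (W k))).trans (sum_W_sq_le Finset.univ (c := fun a k => c k a) h)

section
variable {T0 : ℝ} {p : ℝ → Spc 3 → ℝ} {u : ℝ → Spc 3 → Vec 3}

lemma IsNS.sp_p (h : IsNS 3 (Set.Icc 0 T0) p u) : SP p := ⟨h.smooth_p, h.per_p⟩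

lemma IsNS.sp_u (h : IsNS 3 (Set.Icc 0 T0) p u) (a : Fin 3) : SP fun t x => u t x a :=
  ⟨contDiff_pi.1 h.smooth_u a, fun t x k => congrFun (h.per_u t x k) a⟩

lemma IsNS.res2_eq (h : IsNS 3 (Set.Icc 0 T0) p u) {t : ℝ} (ht : t ∈ Set.Icc 0 T0) (a : Fin 3)
    (x : Spc 3) : res2 p u a t x = 0 := by
  have hm := h.momentum t ht x a
  have hu := fun a => (h.sp_u a).sx t
  have e : ∀ j, pd j (fun y => stress u t y a j) x = _ := fun j =>
    ((hu a).mul (hu j)).pd_sub ((hu a).pd j) j x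
  simp only [divM, tens, lapV, lapS] at hm
  simp only [res2, divM, e, Finset.sum_sub_distrib]
  linarith

/-- Uniform bounds on the background flow and on the residuals. -/
lemma IsNS.exists_fb (h : IsNS 3 (Set.Icc 0 T0) p u) : ∃ A0, 0 ≤ A0 ∧ ∀ A, A0 ≤ A →
    ∀ ε δ : ℝ, ∀ N : Finset Mode,
    Fb N ε δ T0 A (fun t k a => fc (fun x => u t x a) k)
      (fun t k a => fc (dtS (fun t x => u t x a) t) k) (fun t => fc (res1 ε p u t))
      (fun t k a => fc (res2 p u a t) k) (fun t k a b => fc (res3 δ u a b t) k)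
      (fun t k a b => ((-δ : ℝ) : ℂ) * fc (dtS (dtS fun t x => stress u t x a b) t) k) := by
  have hp := h.sp_p
  have hu := h.sp_u
  have hS := SP.stress hu
  choose C1 p1 h1 using fun a => (hu a).sum_le T0
  choose C2 p2 h2 using fun a => (hu a).dtS.sum_le T0
  obtain ⟨C3, p3, h3⟩ := hp.dtS.sum_le T0
  choose C4 p4 h4 using fun a b => (hS a b).dtS.sum_le T0
  choose C5 p5 h5 using fun a b => (hS a b).dtS.dtS.sum_le T0
  have s1 : 0 ≤ ∑ a, C1 a := Finset.sum_nonneg fun a _ => p1 a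
  have s2 : 0 ≤ ∑ a, C2 a := Finset.sum_nonneg fun a _ => p2 a
  have s4 : 0 ≤ ∑ ab : Fin 3 × Fin 3, C4 ab.1 ab.2 := Finset.sum_nonneg fun a _ => p4 _ _
  have s5 : 0 ≤ ∑ ab : Fin 3 × Fin 3, C5 ab.1 ab.2 := Finset.sum_nonneg fun a _ => p5 _ _
  refine ⟨1 + ∑ a, C1 a + ∑ a, C2 a + C3 + ∑ ab : Fin 3 × Fin 3, C4 ab.1 ab.2
    + ∑ ab : Fin 3 × Fin 3, C5 ab.1 ab.2, by positivity, fun A hA ε δ N => ?_⟩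
  have hA1 : 1 ≤ A := by linarith
  have hAA : A ≤ A ^ 2 := by nlinarith
  have f3e : ∀ t k a b, fc (res3 δ u a b t) k
      = ((-δ : ℝ) : ℂ) * fc (dtS (fun t x => stress u t x a b) t) k := fun t k a b =>
    fc_smul (f := dtS (fun t x => stress u t x a b) t) (-δ) k
  have sMδ : ∀ (c : Mode → Fin 3 → Fin 3 → ℂ) (C : Fin 3 → Fin 3 → ℝ),
      (∀ a b, ∑ k ∈ N, W k ^ 2 * ‖c k a b‖ ^ 2 ≤ C a b) →
      ∑ ab : Fin 3 × Fin 3, C ab.1 ab.2 ≤ A →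
      ∑ k ∈ N, W k ^ 2 * sM (fun k a b => ((-δ : ℝ) : ℂ) * c k a b) k ≤ (δ * A) ^ 2 := by
    intro c C hc hC
    have hs := (sum_W_sq_le (Finset.univ) (c := fun (ab : Fin 3 × Fin 3) k => c k ab.1 ab.2)
      (C := fun ab => C ab.1 ab.2) fun ab => hc ab.1 ab.2).trans (hC.trans hAA)
    rw [mul_pow]
    refine le_trans (le_of_eq ?_) (mul_le_mul_of_nonneg_left hs (sq_nonneg δ))
    rw [Finset.mul_sum]
    refine Finset.sum_congr rfl fun k _ => ?_
    simp only [sM, norm_mul, mul_pow, Complex.norm_real, Real.norm_eq_abs, sq_abs, neg_sq,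
      ← Finset.mul_sum, Fintype.sum_prod_type]
    ring
  refine ⟨by linarith, fun t ht F => ?_, fun t ht F => ?_, fun t _ k a => (hu a).hasDerivAt_fc t k,
    fun t ht => ?_, fun t ht k a => ?_, fun t ht => ?_, fun t ht => ?_, fun t ht k a b => ?_⟩
  · have := sum_W_norm_sq_le (c := fun k a => fc (fun x => u t x a) k) (C := C1)
      fun a => h1 a t ht F
    linarith
  · have := sum_W_norm_sq_le (c := fun k a => fc (dtS (fun t x => u t x a) t) k) (C := C2)
      fun a => h2 a t ht F
    linarith
  · have e : res1 ε p u t = fun x => (-ε) * dtS p t x := by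
      funext x; simp only [res1, h.div_free t ht x]; ring
    rw [mul_pow]
    refine le_trans (le_of_eq ?_) (mul_le_mul_of_nonneg_left
      ((h3 t ht N).trans (show C3 ≤ A ^ 2 by linarith)) (sq_nonneg ε))
    rw [Finset.mul_sum]
    refine Finset.sum_congr rfl fun k _ => ?_
    rw [e, fc_smul, norm_mul, mul_pow, Complex.norm_real, Real.norm_eq_abs, sq_abs, neg_sq]
    ring
  · have e : res2 p u a t = fun _ => 0 := funext fun x => h.res2_eq ht a x
    simp [e, fc]
  · simp only [f3e]
    exact sMδ _ C4 (fun a b => h4 a b t ht N) (by linarith)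
  · exact sMδ _ C5 (fun a b => h5 a b t ht N) (by linarith)
  · simp only [f3e]
    exact ((hS a b).dtS.hasDerivAt_fc t k).const_mul _

lemma IsNS.frc (h : IsNS 3 (Set.Icc 0 T0) p u) (ε δ : ℝ) :
    Frc (fun t k a => fc (fun x => u t x a) k) (fun t => fc (res1 ε p u t))
      (fun t k a => fc (res2 p u a t) k) (fun t k a b => fc (res3 δ u a b t) k) :=
  ⟨fun a => (h.sp_u a).smA, (sp_res1 h.sp_p h.sp_u).smA, fun a => (sp_res2 h.sp_p h.sp_u a).smA,
    fun a b => (sp_res3 h.sp_u a b).smA, fun _ k _ => fc_conj k, fun _ k => fc_conj k,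
    fun _ k _ => fc_conj k, fun _ k _ _ => fc_conj k⟩

/-- The main estimate with `δ = r ^ 4`. -/
lemma relaxation_bounds (h : IsNS 3 (Set.Icc 0 T0) p u) (hT0 : 0 < T0) {ε r C0 Q : ℝ} {Tl : ℝ≥0∞}
    {pe : ℝ → Spc 3 → ℝ} {ue : ℝ → Spc 3 → Vec 3} {Ue : ℝ → Spc 3 → Fin 3 → Fin 3 → ℝ}
    (hR : IsMaxRelax 3 ε (r ^ 4) Tl pe ue Ue) (hε : 0 < ε) (hr : 0 < r) (hr1 : r ≤ 1)
    (hεr : ε ≤ r ^ 4) (hC0 : 0 < C0)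
    (iu : L2sq (fun x (b : Fin 3) => ue 0 x b - u 0 x b) ≤ C0 * r ^ 2)
    (ic : L2sq (curl3 fun x (b : Fin 3) => ue 0 x b - u 0 x b)
      + r ^ 4 * H1sq (curl3 fun x (b : Fin 3) => ue 0 x b - u 0 x b) ≤ C0 * r ^ 2)
    (id : L2sq (sc (divv (ue 0))) + r ^ 4 * H1sq (sc (divv (ue 0))) ≤ C0 * (ε / r ^ 2))
    (ip : H1sq (sc (pe 0)) + r ^ 4 * H2sq (sc (pe 0)) ≤ C0 / r ^ 2)
    (iU : H1sq (mtx (Ue 0)) + r ^ 4 * H1sq (divM (Ue 0)) ≤ C0 / r ^ 2)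
    (hQ1 : 1 ≤ Q) (hTQ : T0 ≤ Q)
    (hQ : 2 * C0 + 2 * (D1L2sq (sc (p 0)) + D2L2sq (sc (p 0))) + 2 * D1L2sq (mtx (stress u 0))
      + 2 * D1L2sq (divM (stress u 0)) ≤ Q)
    (hfb : ∀ N : Finset Mode, Fb N ε (r ^ 4) T0 Q (fun t k a => fc (fun x => u t x a) k)
      (fun t k a => fc (dtS (fun t x => u t x a) t) k) (fun t => fc (res1 ε p u t))
      (fun t k a => fc (res2 p u a t) k) (fun t k a b => fc (res3 (r ^ 4) u a b t) k)
      (fun t k a b => ((-r ^ 4 : ℝ) : ℂ) * fc (dtS (dtS fun t x => stress u t x a b) t) k))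
    (hsm : √(cM Q * r ^ 2) * (10000 * Slat) < 1) :
    ENNReal.ofReal T0 < Tl ∧ ∀ t ∈ Set.Icc (0 : ℝ) T0,
      L2sq (fun x (b : Fin 3) => ue t x b - u t x b) ≤ 5 * |cF Q T0| * r ^ 2 ∧
      L2sq (curl3 fun x (b : Fin 3) => ue t x b - u t x b)
        + r ^ 4 * H1sq (curl3 fun x (b : Fin 3) => ue t x b - u t x b) ≤ 5 * |cF Q T0| * r ^ 2 ∧
      L2sq (sc (divv (ue t))) + r ^ 4 * H1sq (sc (divv (ue t))) ≤ 5 * |cF Q T0| * (ε / r ^ 2) := by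
  obtain ⟨hR, hmax⟩ := hR
  have hp := h.sp_p
  have hu := h.sp_u
  have hS := SP.stress hu
  have h0 : (0 : ℝ) ∈ Itv Tl := ⟨le_rfl, by simpa using hR.pos⟩
  have hi := hR.init_smooth
  have hP1 : SX (pe 0) := ⟨hi.fst, hR.per_p 0 h0⟩
  have hY1 : ∀ a, SX fun x => ue 0 x a := fun a =>
    ⟨contDiff_pi.1 hi.snd.fst a, fun x k => congrFun (hR.per_u 0 h0 x k) a⟩
  have hZ1 : ∀ a b, SX fun x => Ue 0 x a b := fun a b =>
    ⟨contDiff_pi.1 (contDiff_pi.1 hi.snd.snd a) b,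
      fun x k => congrFun (congrFun (hR.per_U 0 h0 x k) a) b⟩
  have hP : SX fun x => pe 0 x - p 0 x := hP1.sub (hp.sx 0)
  have hY : ∀ a, SX fun x => ue 0 x a - u 0 x a := fun a => (hY1 a).sub ((hu a).sx 0)
  have hZ : ∀ a b, SX fun x => Ue 0 x a b - stress u 0 x a b := fun a b =>
    (hZ1 a b).sub ((hS a b).sx 0)
  have hdiv : ∀ t ∈ Set.Icc 0 T0, (∀ a, SX fun x => ue t x a) →
      divv (fun x (b : Fin 3) => ue t x b - u t x b) = divv (ue t) := by
    intro t ht hX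
    funext x
    have e : ∀ i, pd i (fun y => ue t y i - u t y i) x = _ := fun i =>
      (hX i).pd_sub ((hu i).sx t) i x
    have e0 := h.div_free t ht x
    simp only [divv] at e0
    simp only [divv, e, Finset.sum_sub_distrib, e0, sub_zero]
  have hIni := ini_of_norms (ε := ε) (Y := fun x b => ue 0 x b - u 0 x b) (hp.sx 0) hP1 hY
    (fun a b => (hS a b).sx 0) hZ1 hr hr1 iu ic
    (by rw [hdiv 0 ⟨le_rfl, hT0.le⟩ hY1]; exact id) ip iU hε hC0 hQ
  obtain ⟨T1, hT1, q, v, V, S⟩ := exists_slv (h.frc ε (r ^ 4)) hfb hIni hP.rd (fun a => (hY a).rd)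
    (fun a b => (hZ a b).rd) fc_conj (fun k _ => fc_conj k) (fun k _ _ => fc_conj k) hT0.le hQ1 hTQ
    hr hr1 hε hεr hsm
  have hT1' : 0 < T1 := hT0.trans hT1
  have hr4 : 0 < r ^ 4 := by positivity
  have hN := isRelax_of_slv hp hu hP hY hZ hT1' hε hr S
  have e1 : (fun x => p 0 x + rs (q 0) x) = pe 0 := by
    funext x; rw [S.q0, hP.rs_fc]; ring
  have e2 : (fun x a => u 0 x a + rs (fun k => v 0 k a) x) = ue 0 := by
    funext x a; simp only [S.v0, (hY a).rs_fc]; ring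
  have e3 : (fun x a b => stress u 0 x a b + rs (fun k => V 0 k a b) x) = Ue 0 := by
    funext x a b; simp only [S.V0, (hZ a b).rs_fc]; ring
  have hlt := (ENNReal.ofReal_lt_ofReal_iff hT1').2 hT1
  have hTl : ENNReal.ofReal T0 < Tl := hlt.trans_le (hmax _ _ _ _ hN e1 e2 e3)
  refine ⟨hTl, fun t ht => ?_⟩
  have huniq : ue t = fun x a => u t x a + rs (fun k => v t k a) x :=
    relax_unique hR hN hε hr4 hTl hlt e1.symm e2.symm e3.symm t ht
  have hX : ∀ a, SX fun x => ue t x a := by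
    rcases ht.1.eq_or_lt with rfl | hpos
    · exact hY1
    · intro a
      have hmid : ENNReal.ofReal ((T0 + T1) / 2) < ENNReal.ofReal T1 :=
        (ENNReal.ofReal_lt_ofReal_iff hT1').2 (by linarith)
      have := ((hN.sj hmid).2.1 a).slice (t := t) ⟨hpos, by linarith [ht.2]⟩
      rw [huniq]
      exact this
  have ht1 : t ∈ Set.Icc 0 T1 := ⟨ht.1, ht.2.trans hT1.le⟩
  have hfc : (fun k a => fc (fun x => ue t x a - u t x a) k) = v t := by
    funext k a
    have : (fun x => ue t x a - u t x a) = rs fun k => v t k a := by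
      funext x; rw [huniq]; ring
    rw [this]
    exact fc_rs ((S.rv a).rd () ht1) (fun k => S.cjv t ht1 k a) k
  have hb := bounds_of_fin (Y := fun x b => ue t x b - u t x b) (C := cF Q T0)
    (fun a => (hX a).sub ((hu a).sx t)) hε hr hr1 hεr (fun N => by rw [hfc]; exact S.fin t ht N)
  rw [hdiv t ht hX] at hb
  exact hb

end

/-- Theorem `thm:critical_3d_inhomo` of the paper: global-in-time
velocity convergence on `𝕋³` for order-one initial perturbations, in the regime
`ε ≤ μ⋆ δ`. -/
theorem relaxation_critical_3d_inhomo
    (T0 : ℝ) (hT0 : 0 < T0)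
    (p : ℝ → Spc 3 → ℝ) (u : ℝ → Spc 3 → Vec 3)
    (hNS : IsNS 3 (Set.Icc 0 T0) p u)
    (pe : ℝ → ℝ → ℝ → Spc 3 → ℝ) (ue : ℝ → ℝ → ℝ → Spc 3 → Vec 3)
    (Ue : ℝ → ℝ → ℝ → Spc 3 → Fin 3 → Fin 3 → ℝ) (Tl : ℝ → ℝ → ℝ≥0∞)
    (hRel : ∀ ε δ : ℝ, 0 < ε → 0 < δ →
      IsMaxRelax 3 ε δ (Tl ε δ) (pe ε δ) (ue ε δ) (Ue ε δ))
    (C0 : ℝ) (hC0 : 0 < C0)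
    (hinit_u : ∀ ε δ : ℝ, 0 < ε → 0 < δ →
      L2sq (fun x (b : Fin 3) => ue ε δ 0 x b - u 0 x b) ≤ C0 * δ ^ ((1:ℝ)/2))
    (hinit_curl : ∀ ε δ : ℝ, 0 < ε → 0 < δ →
      L2sq (fun x => curl3 (fun y (b : Fin 3) => ue ε δ 0 y b - u 0 y b) x)
        + δ * H1sq (fun x => curl3 (fun y (b : Fin 3) => ue ε δ 0 y b - u 0 y b) x)
        ≤ C0 * δ ^ ((1:ℝ)/2))
    (hinit_div : ∀ ε δ : ℝ, 0 < ε → 0 < δ →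
      L2sq (sc fun x => divv (ue ε δ 0) x) + δ * H1sq (sc fun x => divv (ue ε δ 0) x)
        ≤ C0 * δ ^ (-(1:ℝ)/2) * ε)
    (hinit_p : ∀ ε δ : ℝ, 0 < ε → 0 < δ →
      H1sq (sc (pe ε δ 0)) + δ * H2sq (sc (pe ε δ 0)) ≤ C0 * δ ^ (-(1:ℝ)/2))
    (hinit_U : ∀ ε δ : ℝ, 0 < ε → 0 < δ →
      H1sq (mtx (Ue ε δ 0)) + δ * H1sq (fun x => divM (Ue ε δ 0) x)
        ≤ C0 * δ ^ (-(1:ℝ)/2)) :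
    ∃ μs > (0:ℝ), ∃ C > (0:ℝ), ∃ η > (0:ℝ),
      ∀ ε δ : ℝ, 0 < ε → 0 < δ → ε + δ < η → ε ≤ μs * δ →
        -- the solution exists on `[0,T0]` …
        ENNReal.ofReal T0 < Tl ε δ ∧
        -- … and the bounds hold on `[0,T0]`
        ∀ t ∈ Set.Icc (0:ℝ) T0,
          L2sq (fun x (b : Fin 3) => ue ε δ t x b - u t x b) ≤ C * δ ^ ((1:ℝ)/2) ∧
          L2sq (fun x => curl3 (fun y (b : Fin 3) => ue ε δ t y b - u t y b) x)
            + δ * H1sq (fun x => curl3 (fun y (b : Fin 3) => ue ε δ t y b - u t y b) x)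
            ≤ C * δ ^ ((1:ℝ)/2) ∧
          L2sq (sc fun x => divv (ue ε δ t) x)
            + δ * H1sq (sc fun x => divv (ue ε δ t) x)
            ≤ C * δ ^ (-(1:ℝ)/2) * ε := by
  obtain ⟨A0, hA0, hfb⟩ := hNS.exists_fb
  have n1 := D1L2sq_nonneg (sc (p 0))
  have n2 := D2L2sq_nonneg (sc (p 0))
  have n3 := D1L2sq_nonneg (mtx (stress u 0))
  have n4 := D1L2sq_nonneg (divM (stress u 0))
  obtain ⟨Q, hQdef⟩ : ∃ Q, Q = A0 + 1 + T0 + (2 * C0 + 2 * (D1L2sq (sc (p 0)) + D2L2sq (sc (p 0)))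
    + 2 * D1L2sq (mtx (stress u 0)) + 2 * D1L2sq (divM (stress u 0))) := ⟨_, rfl⟩
  have hQ1 : 1 ≤ Q := by linarith
  have hK : 0 < cM Q := lt_of_lt_of_le (by linarith) (le_cM (by linarith))
  have hL : 0 < 10000 * Slat := by linarith [one_le_Slat]
  have hF := abs_nonneg (cF Q T0)
  have hB : 0 < 1 / (cM Q * (10000 * Slat) ^ 2) := by positivity
  refine ⟨1, one_pos, 5 * |cF Q T0| + 1, by positivity,
    min 1 ((1 / (cM Q * (10000 * Slat) ^ 2)) ^ 2), lt_min one_pos (by positivity),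
    fun ε δ hε hδ hη hεδ => ?_⟩
  obtain ⟨r, hr, rfl⟩ : ∃ r > 0, δ = r ^ 4 :=
    ⟨√√δ, Real.sqrt_pos.2 (Real.sqrt_pos.2 hδ), by
      rw [show √√δ ^ 4 = (√√δ ^ 2) ^ 2 by ring, Real.sq_sqrt (Real.sqrt_nonneg _),
        Real.sq_sqrt hδ.le]⟩
  have hr2 : 0 < r ^ 2 := by positivity
  have hδη : r ^ 4 < min 1 ((1 / (cM Q * (10000 * Slat) ^ 2)) ^ 2) := by linarith
  have hr1 : r ≤ 1 := by
    by_contra! hlt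
    have := one_le_pow₀ hlt.le (n := 4)
    linarith [hδη.trans_le (min_le_left _ _)]
  have hrB : r ^ 2 < 1 / (cM Q * (10000 * Slat) ^ 2) := by
    refine lt_of_pow_lt_pow_left₀ 2 hB.le ?_
    rw [← pow_mul]
    exact hδη.trans_le (min_le_right _ _)
  have hsm : √(cM Q * r ^ 2) * (10000 * Slat) < 1 := by
    rw [lt_div_iff₀ (by positivity)] at hrB
    rw [← lt_div_iff₀ hL]
    refine (Real.sqrt_lt' (by positivity)).2 ?_
    rw [div_pow, one_pow, lt_div_iff₀ (by positivity)]
    linarith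
  have ep : (r ^ 4) ^ ((1 : ℝ) / 2) = r ^ 2 := by
    rw [← Real.sqrt_eq_rpow, show r ^ 4 = (r ^ 2) ^ 2 by ring, Real.sqrt_sq hr2.le]
  have em : (r ^ 4) ^ (-(1 : ℝ) / 2) = (r ^ 2)⁻¹ := by
    rw [neg_div, Real.rpow_neg hδ.le, ep]
  have iu := hinit_u ε _ hε hδ
  have ic := hinit_curl ε _ hε hδ
  have id := hinit_div ε _ hε hδ
  have ip := hinit_p ε _ hε hδ
  have iU := hinit_U ε _ hε hδ
  rw [ep] at iu ic
  rw [em] at id ip iU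
  obtain ⟨hT, hb⟩ := relaxation_bounds hNS hT0 (hRel ε _ hε hδ) hε hr hr1 (by linarith) hC0 iu ic
    (id.trans (le_of_eq (by ring))) ip iU hQ1 (by linarith) (by linarith)
    (hfb Q (by linarith) ε (r ^ 4)) hsm
  refine ⟨hT, fun t ht => ?_⟩
  obtain ⟨b1, b2, b3⟩ := hb t ht
  rw [ep, em]
  refine ⟨b1.trans ?_, b2.trans ?_, b3.trans ?_⟩
  · gcongr; linarith
  · gcongr; linarith
  · rw [show (5 * |cF Q T0| + 1) * (r ^ 2)⁻¹ * ε = (5 * |cF Q T0| + 1) * (ε / r ^ 2) by ring]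
    gcongr; linarith

end NSRelax
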